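/- For every parameter α ≥ 1.9, Wright's equation x'(t) = -α(e^{x(t-1)} - 1) has a slowly oscillating periodic solution, and this SOPS is unique up to time translation. -/

import Mathlib

open Real Set Filter

noncomputable section

/-- `x` solves Wright's equation `x'(t) = -α (e^{x(t-1)} - 1)` on all of `ℝ`. -/
def WrightSol (α : ℝ) (x : ℝ → ℝ) : Prop :=
  ∀ t : ℝ, HasDerivAt x (-α * (Real.exp (x (t - 1)) - 1)) t

/-- The space 𝒳: C¹ functions with `x 0 = 0`, `x' 0 > 0` and `x < 0` on `(-1,0)`. -/
def InX (x : ℝ → ℝ) : Prop :=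
  ContDiff ℝ 1 x ∧ x 0 = 0 ∧ 0 < deriv x 0 ∧ ∀ t ∈ Set.Ioo (-1 : ℝ) 0, x t < 0

/-- A slowly oscillating periodic solution in 𝒳, with first zero `q` and data `qbar`:
positive on `(0,q)`, negative on `(q, q+qbar)`, periodic with minimal period `q+qbar`. -/
def SOPSX (α q qbar : ℝ) (x : ℝ → ℝ) : Prop :=
  InX x ∧ WrightSol α x ∧ 1 < q ∧ 1 < qbar ∧
  (∀ t ∈ Set.Ioo 0 q, 0 < x t) ∧
  (∀ t ∈ Set.Ioo q (q + qbar), x t < 0) ∧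
  Function.Periodic x (q + qbar) ∧
  (∀ T : ℝ, 0 < T → Function.Periodic x T → q + qbar ≤ T)

/-- A slowly oscillating periodic solution (up to time translation). -/
def SOPS (α : ℝ) (x : ℝ → ℝ) : Prop :=
  WrightSol α x ∧
  ∃ q qbar : ℝ, 1 < q ∧ 1 < qbar ∧
    (∃ τ : ℝ, (∀ t ∈ Set.Ioo 0 q, 0 < x (t + τ)) ∧
      (∀ t ∈ Set.Ioo q (q + qbar), x (t + τ) < 0)) ∧
    Function.Periodic x (q + qbar) ∧
    (∀ T : ℝ, 0 < T → Function.Periodic x T → q + qbar ≤ T)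

/-- `w` is differentiable past `a+1` with derivative of sign opposite to `w (u-1)`. -/
structure Osc (w w' : ℝ → ℝ) (a : ℝ) : Prop where
  cont : Continuous w
  der : ∀ u, a + 1 < u → HasDerivAt w (w' u) u
  s1 : ∀ u, a + 1 < u → w (u-1) ≤ 0 → 0 ≤ w' u
  s2 : ∀ u, a + 1 < u → 0 ≤ w (u-1) → w' u ≤ 0

theorem Osc.neg {w w' : ℝ → ℝ} {a : ℝ} (h : Osc w w' a) :
    Osc (fun u => - w u) (fun u => - w' u) a where
  cont := h.cont.neg
  der := fun u hu => (h.der u hu).neg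
  s1 := fun u hu h0 => by have := h.s2 u hu (by linarith); linarith
  s2 := fun u hu h0 => by have := h.s1 u hu (by linarith); linarith

theorem Osc.mono {w w' : ℝ → ℝ} {a a' : ℝ} (h : Osc w w' a) (ha : a ≤ a') : Osc w w' a' where
  cont := h.cont
  der := fun u hu => h.der u (by linarith)
  s1 := fun u hu => h.s1 u (by linarith)
  s2 := fun u hu => h.s2 u (by linarith)

theorem monoOn_of_hasDeriv {w w' : ℝ → ℝ} {p r : ℝ} (hc : ContinuousOn w (Icc p r))
    (hd : ∀ u, p < u → u < r → HasDerivAt w (w' u) u)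
    (hs : ∀ u, p < u → u < r → 0 ≤ w' u) : MonotoneOn w (Icc p r) := by
  apply monotoneOn_of_deriv_nonneg (convex_Icc p r) hc
  · intro u hu
    rw [interior_Icc] at hu
    exact (hd u hu.1 hu.2).differentiableAt.differentiableWithinAt
  · intro u hu
    rw [interior_Icc] at hu
    rw [(hd u hu.1 hu.2).deriv]
    exact hs u hu.1 hu.2

theorem antiOn_of_hasDeriv {w w' : ℝ → ℝ} {p r : ℝ} (hc : ContinuousOn w (Icc p r))
    (hd : ∀ u, p < u → u < r → HasDerivAt w (w' u) u)
    (hs : ∀ u, p < u → u < r → w' u ≤ 0) : AntitoneOn w (Icc p r) := by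
  apply antitoneOn_of_deriv_nonpos (convex_Icc p r) hc
  · intro u hu
    rw [interior_Icc] at hu
    exact (hd u hu.1 hu.2).differentiableAt.differentiableWithinAt
  · intro u hu
    rw [interior_Icc] at hu
    rw [(hd u hu.1 hu.2).deriv]
    exact hs u hu.1 hu.2

/-- first time of positivity -/
theorem first_pos {w : ℝ → ℝ} (hc : Continuous w) {a p : ℝ} (hap : a ≤ p) (hp : 0 < w p)
    (ha : w a ≤ 0) : ∃ z, a ≤ z ∧ z < p ∧ w z = 0 ∧ (∀ u, a ≤ u → u ≤ z → w u ≤ 0) ∧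
      ∀ e, 0 < e → ∃ r, z < r ∧ r < z + e ∧ r ≤ p ∧ 0 < w r := by
  set P := {u | a ≤ u ∧ u ≤ p ∧ 0 < w u} with hP
  have hne : P.Nonempty := ⟨p, hap, le_refl _, hp⟩
  have hbd : BddBelow P := ⟨a, fun u hu => hu.1⟩
  set z := sInf P with hz
  have haz : a ≤ z := le_csInf hne (fun u hu => hu.1)
  have hzp : z ≤ p := csInf_le hbd ⟨hap, le_refl _, hp⟩
  have hlt : ∀ u, a ≤ u → u < z → w u ≤ 0 := by
    intro u hu huz
    by_contra hcon
    push Not at hcon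
    have : z ≤ u := csInf_le hbd ⟨hu, by linarith, hcon⟩
    linarith
  have hwz : w z ≤ 0 := by
    by_contra hcon
    push Not at hcon
    have haz' : a < z := lt_of_le_of_ne haz (fun h => by rw [← h] at hcon; linarith)
    have hev : ∀ᶠ u in nhds z, 0 < w u := (hc.tendsto z).eventually (lt_mem_nhds hcon)
    rw [Metric.eventually_nhds_iff] at hev
    obtain ⟨e, he, hev⟩ := hev
    have h1 := hlt (max a (z - e/2)) (le_max_left _ _) (max_lt haz' (by linarith))
    have h2 := hev (y := max a (z - e/2)) (by
      rw [Real.dist_eq, abs_lt]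
      have := le_max_right a (z - e/2)
      have := max_lt haz' (show z - e/2 < z by linarith)
      constructor <;> linarith)
    linarith
  have hnear : ∀ e, 0 < e → ∃ r, z < r ∧ r < z + e ∧ r ≤ p ∧ 0 < w r := by
    intro e he
    obtain ⟨r, hr, hre⟩ := exists_lt_of_csInf_lt hne (show sInf P < z + e by linarith)
    refine ⟨r, ?_, hre, hr.2.1, hr.2.2⟩
    have h1 : z ≤ r := csInf_le hbd hr
    exact lt_of_le_of_ne h1 (fun h => by have := hr.2.2; rw [← h] at this; linarith)
  have hwz0 : w z = 0 := by
    apply le_antisymm hwz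
    by_contra hcon
    push Not at hcon
    have hev : ∀ᶠ u in nhds z, w u < 0 := (hc.tendsto z).eventually (gt_mem_nhds hcon)
    rw [Metric.eventually_nhds_iff] at hev
    obtain ⟨e, he, hev⟩ := hev
    obtain ⟨r, hr1, hr2, hr3, hr4⟩ := hnear e he
    have := hev (y := r) (by rw [Real.dist_eq, abs_lt]; constructor <;> linarith)
    linarith
  refine ⟨z, haz, ?_, hwz0, ?_, hnear⟩
  · exact lt_of_le_of_ne hzp (fun h => by rw [h] at hwz0; linarith)
  · intro u hu huz
    rcases lt_or_eq_of_le huz with h | h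
    · exact hlt u hu h
    · rw [h]; exact hwz

theorem Osc.adv {w w' : ℝ → ℝ} {a b : ℝ} (h : Osc w w' a)
    (hw : ∀ u, a ≤ u → u ≤ a + 1 → w u ≤ 0) (hb : a + 1 ≤ b) (hwb : w b = 0) :
    (∀ u, a ≤ u → u ≤ b → w u ≤ 0) ∨ ∃ z, a + 1 ≤ z ∧ z + 1 < b ∧ (∀ u, a ≤ u → u ≤ z → w u ≤ 0) ∧
      w z = 0 ∧ (∀ u, z ≤ u → u ≤ z + 1 → 0 ≤ w u) ∧ 0 < w (z+1) := by
  by_cases hall : ∀ u, a ≤ u → u ≤ b → w u ≤ 0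
  · exact Or.inl hall
  right
  push Not at hall
  obtain ⟨p, hp1, hp2, hp3⟩ := hall
  have hap : a + 1 < p := by
    by_contra hcon
    push Not at hcon
    linarith [hw p hp1 hcon]
  obtain ⟨z, hz1, hz2, hz3, hz4, hz5⟩ := first_pos h.cont hap.le hp3 (hw (a+1) (by linarith) le_rfl)
  have hneg : ∀ u, a ≤ u → u ≤ z → w u ≤ 0 := by
    intro u hu huz
    rcases le_total u (a+1) with h1 | h1
    · exact hw u hu h1
    · exact hz4 u h1 huz
  have hmono : MonotoneOn w (Icc z (z+1)) :=
    monoOn_of_hasDeriv h.cont.continuousOn (fun u hu _ => h.der u (by linarith))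
      (fun u hu hu2 => h.s1 u (by linarith) (hneg _ (by linarith) (by linarith)))
  obtain ⟨r, hr1, hr2, hr3, hr4⟩ := hz5 1 one_pos
  refine ⟨z, hz1, ?_, hneg, hz3, ?_, ?_⟩
  · by_contra hcon
    push Not at hcon
    have := hmono (show r ∈ Icc z (z+1) from ⟨hr1.le, hr2.le⟩) (show b ∈ Icc z (z+1) from ⟨by linarith, hcon⟩)
      (by linarith)
    linarith
  · intro u hu1 hu2
    have := hmono (show z ∈ Icc z (z+1) from ⟨le_rfl, by linarith⟩) (show u ∈ Icc z (z+1) from ⟨hu1, hu2⟩) hu1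
    linarith
  · have := hmono (show r ∈ Icc z (z+1) from ⟨hr1.le, hr2.le⟩) (show z+1 ∈ Icc z (z+1) from ⟨by linarith, le_rfl⟩)
      hr2.le
    linarith

theorem Osc.adv' {w w' : ℝ → ℝ} {a b : ℝ} (h : Osc w w' a)
    (hw : ∀ u, a ≤ u → u ≤ a + 1 → 0 ≤ w u) (hb : a + 1 ≤ b) (hwb : w b = 0) :
    (∀ u, a ≤ u → u ≤ b → 0 ≤ w u) ∨ ∃ z, a + 1 ≤ z ∧ z + 1 < b ∧ (∀ u, a ≤ u → u ≤ z → 0 ≤ w u) ∧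
      w z = 0 ∧ (∀ u, z ≤ u → u ≤ z + 1 → w u ≤ 0) ∧ w (z+1) < 0 := by
  rcases h.neg.adv (b := b) (fun u h1 h2 => by have := hw u h1 h2; linarith) hb (by linarith) with h1 | h1
  · exact Or.inl (fun u hu hu2 => by have := h1 u hu hu2; linarith)
  · obtain ⟨z, h1, h2, h3, h4, h5, h6⟩ := h1
    exact Or.inr ⟨z, h1, h2, fun u hu hu2 => by have := h3 u hu hu2; linarith, by linarith,
      fun u hu hu2 => by have := h5 u hu hu2; linarith, by linarith⟩

/-- the window `[z-1,z]` before a zero has constant weak sign -/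
theorem Osc.constSign {w w' : ℝ → ℝ} {a b : ℝ} (h : Osc w w' a)
    (hw : (∀ u, a ≤ u → u ≤ a + 1 → w u ≤ 0) ∨ (∀ u, a ≤ u → u ≤ a + 1 → 0 ≤ w u))
    (hb : a + 1 ≤ b) (hwb : w b = 0) :
    (∀ u, b - 1 ≤ u → u ≤ b → w u ≤ 0) ∨ (∀ u, b - 1 ≤ u → u ≤ b → 0 ≤ w u) := by
  obtain ⟨N, hN⟩ := exists_nat_gt (b - a)
  induction N generalizing a with
  | zero => simp at hN; linarith
  | succ N ih =>
    push_cast at hN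
    rcases hw with hw | hw
    · rcases h.adv hw hb hwb with h1 | ⟨z, h1, h2, h3, h4, h5, h6⟩
      · exact Or.inl (fun u hu hu2 => h1 u (by linarith) hu2)
      · exact ih (h.mono (show a ≤ z by linarith)) (Or.inr h5) (by linarith) (by linarith)
    · rcases h.adv' hw hb hwb with h1 | ⟨z, h1, h2, h3, h4, h5, h6⟩
      · exact Or.inr (fun u hu hu2 => h1 u (by linarith) hu2)
      · exact ih (h.mono (show a ≤ z by linarith)) (Or.inl h5) (by linarith) (by linarith)

/-- Lemma R: after a strictly negative time `us`, if the kernel mass (encoded by `B`) on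
`[us+1, b]` is less than one, the sign near the zero `b` is `≤ 0`. -/
theorem Osc.lemR {w w' B B' : ℝ → ℝ} {a b us : ℝ} (h : Osc w w' a)
    (hw : (∀ u, a ≤ u → u ≤ a + 1 → w u ≤ 0) ∨ (∀ u, a ≤ u → u ≤ a + 1 → 0 ≤ w u))
    (hus : a ≤ us) (hub : us ≤ b) (hwu : w us < 0) (hwb : w b = 0) (hab : a + 1 ≤ b)
    (hBc : Continuous B)
    (hB : ∀ u, us + 1 < u → HasDerivAt B (B' u) u) (hB0 : ∀ u, us + 1 < u → 0 ≤ B' u)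
    (hw' : ∀ u W, us + 1 < u → 0 ≤ W → w (u-1) ≤ W → - (W * B' u) ≤ w' u)
    (hBb : ∀ v1 v2, us + 1 ≤ v1 → v1 ≤ v2 → v2 ≤ b → B v2 - B v1 < 1) :
    ∀ u, b - 1 ≤ u → u ≤ b → w u ≤ 0 := by
  by_cases hall : ∀ u, us ≤ u → u ≤ b → w u ≤ 0
  · rcases h.constSign hw hab hwb with h1 | h1
    · exact h1
    · intro u hu hu2
      rcases le_total us u with h2 | h2
      · exact hall u h2 hu2
      · exfalso
        have := h1 us (by linarith) hub
        linarith
  exfalso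
  push Not at hall
  obtain ⟨p, hp1, hp2, hp3⟩ := hall
  obtain ⟨z, hz1, hz2, hz3, hz4, hz5⟩ := first_pos h.cont hp1 hp3 hwu.le
  have husz : us < z := lt_of_le_of_ne hz1 (fun h => by rw [← h] at hz3; linarith)
  -- window before z is nonpositive
  have hwin : ∀ u, z - 1 ≤ u → a ≤ u → u ≤ z → w u ≤ 0 := by
    intro u hu hau huz
    rcases le_total us u with h2 | h2
    · exact hz4 u h2 huz
    · rcases le_total (a+1) z with h3 | h3
      · rcases h.constSign hw h3 hz3 with h1 | h1
        · exact h1 u hu huz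
        · have := h1 us (by linarith) husz.le
          linarith
      · rcases hw with h1 | h1
        · exact h1 u hau (by linarith)
        · have := h1 us hus (by linarith)
          linarith
  have haz : a + 1 ≤ z := by
    by_contra hcon
    push Not at hcon
    rcases hw with h1 | h1
    · obtain ⟨r, hr1, hr2, hr3, hr4⟩ := hz5 (a + 1 - z) (by linarith)
      have := h1 r (by linarith) (by linarith)
      linarith
    · have := h1 us hus (by linarith)
      linarith
  have hmono : MonotoneOn w (Icc z (z+1)) :=
    monoOn_of_hasDeriv h.cont.continuousOn (fun u hu _ => h.der u (by linarith))
      (fun u hu hu2 => h.s1 u (by linarith) (hwin _ (by linarith) (by linarith) (by linarith)))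
  obtain ⟨r, hr1, hr2, hr3, hr4⟩ := hz5 1 one_pos
  have hW : 0 < w (z+1) := by
    have := hmono (show r ∈ Icc z (z+1) from ⟨hr1.le, hr2.le⟩) (show z+1 ∈ Icc z (z+1) from ⟨by linarith, le_rfl⟩)
      hr2.le
    linarith
  have hzb : z + 1 < b := by
    by_contra hcon
    push Not at hcon
    have := hmono (show r ∈ Icc z (z+1) from ⟨hr1.le, hr2.le⟩) (show b ∈ Icc z (z+1) from ⟨by linarith, hcon⟩)
      (by linarith)
    linarith
  -- first nonpositive time after z+1
  set W := w (z+1) with hWdef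
  have hpos : ∀ u, z + 1 ≤ u → u ≤ b → 0 < w u ∧ w u ≤ W := by
    intro u hu hub
    by_contra hcon
    -- first time where the positivity fails
    set P := {v | z + 1 ≤ v ∧ v ≤ b ∧ w v ≤ 0} with hP
    have hcl : IsClosed P := by
      have : P = Icc (z+1) b ∩ w ⁻¹' (Iic 0) := by
        ext v; simp [hP, and_assoc]
      rw [this]
      exact isClosed_Icc.inter (isClosed_Iic.preimage h.cont)
    have hne : P.Nonempty := ⟨b, hzb.le, le_rfl, hwb.le⟩
    have hbd : BddBelow P := ⟨z+1, fun v hv => hv.1⟩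
    have hmem := hcl.csInf_mem hne hbd
    set b' := sInf P with hb'
    have hb'1 : z + 1 < b' := lt_of_le_of_ne hmem.1 (fun h => by
      have := hmem.2.2; rw [← h] at this; linarith)
    have hposb : ∀ v, z + 1 ≤ v → v < b' → 0 < w v := by
      intro v hv hvb
      by_contra hc
      push Not at hc
      have : b' ≤ v := csInf_le hbd ⟨hv, by linarith [hmem.2.1], hc⟩
      linarith
    have hnn : ∀ v, z ≤ v → v < b' → 0 ≤ w v := by
      intro v hv hvb
      rcases le_total (z+1) v with h1 | h1
      · exact (hposb v h1 hvb).le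
      · have := hmono (show z ∈ Icc z (z+1) from ⟨le_rfl, by linarith⟩) (show v ∈ Icc z (z+1) from ⟨hv, h1⟩) hv
        linarith
    have hanti : AntitoneOn w (Icc (z+1) b') :=
      antiOn_of_hasDeriv h.cont.continuousOn (fun u hu _ => h.der u (by linarith))
        (fun u hu hu2 => h.s2 u (by linarith) (hnn _ (by linarith) (by linarith)))
    have hle : ∀ v, z ≤ v → v ≤ b' → w v ≤ W := by
      intro v hv hvb
      rcases le_total (z+1) v with h1 | h1
      · exact hanti (show z+1 ∈ Icc (z+1) b' from ⟨le_rfl, hb'1.le⟩) ⟨h1, hvb⟩ h1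
      · exact hmono ⟨hv, h1⟩ (show z+1 ∈ Icc z (z+1) from ⟨by linarith, le_rfl⟩) h1
    have hmono2 : MonotoneOn (fun u => w u + W * B u) (Icc (z+1) b') := by
      apply monoOn_of_hasDeriv (w' := fun u => w' u + W * B' u)
        (h.cont.add (continuous_const.mul hBc)).continuousOn
      · intro u hu hu2
        exact (h.der u (by linarith)).add ((hB u (by linarith)).const_mul W)
      · intro u hu hu2
        have := hw' u W (by linarith) hW.le (hle _ (by linarith) (by linarith))
        linarith
    have h1 := hmono2 (show z+1 ∈ Icc (z+1) b' from ⟨le_rfl, hb'1.le⟩) (show b' ∈ Icc (z+1) b' from ⟨hb'1.le, le_rfl⟩) hb'1.le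
    have h2 := hBb (z+1) b' (by linarith) hb'1.le hmem.2.1
    have h3 := hmem.2.2
    simp only at h1
    rw [← hWdef] at h1
    nlinarith
  have := (hpos b hzb.le le_rfl).1
  linarith

theorem sub_le_sub_of_deriv {w w' g g' : ℝ → ℝ} {p r : ℝ} (hpr : p ≤ r)
    (hwc : ContinuousOn w (Icc p r)) (hgc : ContinuousOn g (Icc p r))
    (hw : ∀ u, p < u → u < r → HasDerivAt w (w' u) u)
    (hg : ∀ u, p < u → u < r → HasDerivAt g (g' u) u)
    (h : ∀ u, p < u → u < r → w' u ≤ g' u) : w r - w p ≤ g r - g p := by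
  have := monoOn_of_hasDeriv (w := fun u => g u - w u) (w' := fun u => g' u - w' u) (p := p) (r := r)
    (hgc.sub hwc) (fun u h1 h2 => (hg u h1 h2).sub (hw u h1 h2))
    (fun u h1 h2 => by have := h u h1 h2; linarith)
  have := this (left_mem_Icc.2 hpr) (right_mem_Icc.2 hpr) hpr
  simp only at this
  linarith

theorem sub_le_of_deriv {w w' : ℝ → ℝ} {p r C : ℝ} (hpr : p ≤ r)
    (hwc : ContinuousOn w (Icc p r))
    (hw : ∀ u, p < u → u < r → HasDerivAt w (w' u) u)
    (h : ∀ u, p < u → u < r → w' u ≤ C) : w r - w p ≤ C * (r - p) := by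
  have := sub_le_sub_of_deriv (g := fun u => C * u) (g' := fun _ => C) hpr hwc
    (by fun_prop) hw (fun u _ _ => by simpa using (hasDerivAt_id u).const_mul C) h
  linarith

theorem le_sub_of_deriv {w w' : ℝ → ℝ} {p r C : ℝ} (hpr : p ≤ r)
    (hwc : ContinuousOn w (Icc p r))
    (hw : ∀ u, p < u → u < r → HasDerivAt w (w' u) u)
    (h : ∀ u, p < u → u < r → C ≤ w' u) : C * (r - p) ≤ w r - w p := by
  have := sub_le_sub_of_deriv (w := fun u => C * u) (w' := fun _ => C) hpr
    (by fun_prop) hwc (fun u _ _ => by simpa using (hasDerivAt_id u).const_mul C) hw h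
  linarith

structure Traj (α : ℝ) (x : ℝ → ℝ) : Prop where
  cont : Continuous x
  der : ∀ t, 0 < t → HasDerivAt x (-α * (Real.exp (x (t - 1)) - 1)) t
  zero : x 0 = 0
  neg : ∀ t, -1 ≤ t → t < 0 → x t < 0

structure Loop (α : ℝ) (x : ℝ → ℝ) (q L : ℝ) : Prop extends Traj α x where
  hq : 1 < q
  hL : q + 1 < L
  pos : ∀ t, 0 < t → t < q → 0 < x t
  xq : x q = 0
  negq : ∀ t, q < t → t < L → x t < 0
  xL : x L = 0

namespace Traj
variable {α : ℝ} {x : ℝ → ℝ}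

theorem nonpos (T : Traj α x) {t : ℝ} (h1 : -1 ≤ t) (h2 : t ≤ 0) : x t ≤ 0 := by
  rcases lt_or_eq_of_le h2 with h | h
  · exact (T.neg t h1 h).le
  · rw [h, T.zero]

theorem mono_of_neg (T : Traj α x) (hα : 0 < α) {p r : ℝ} (hp : 0 ≤ p)
    (h : ∀ t, p - 1 ≤ t → t ≤ r - 1 → x t ≤ 0) : MonotoneOn x (Icc p r) := by
  apply monoOn_of_hasDeriv T.cont.continuousOn (fun u hu _ => T.der u (by linarith))
  intro u hu hu2
  have h1 := h (u-1) (by linarith) (by linarith)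
  have h2 : Real.exp (x (u-1)) ≤ 1 := Real.exp_le_one_iff.2 h1
  nlinarith

theorem anti_of_pos (T : Traj α x) (hα : 0 < α) {p r : ℝ} (hp : 0 ≤ p)
    (h : ∀ t, p - 1 ≤ t → t ≤ r - 1 → 0 ≤ x t) : AntitoneOn x (Icc p r) := by
  apply antiOn_of_hasDeriv T.cont.continuousOn (fun u hu _ => T.der u (by linarith))
  intro u hu hu2
  have h1 := h (u-1) (by linarith) (by linarith)
  have h2 : 1 ≤ Real.exp (x (u-1)) := Real.one_le_exp h1
  nlinarith

theorem mono01 (T : Traj α x) (hα : 0 < α) : MonotoneOn x (Icc 0 1) :=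
  T.mono_of_neg hα le_rfl (fun t h1 h2 => T.nonpos (by linarith) (by linarith))

/-- comparison on a unit window: if `x ≤ y` (shifted) on history, then increments are ordered. -/
theorem sub_le_sub {y : ℝ → ℝ} (hx : Traj α x) (hy : Traj α y) (hα : 0 < α) {p r s : ℝ}
    (hp : 0 ≤ p) (hps : 0 ≤ p + s) (hpr : p ≤ r)
    (h : ∀ t, p - 1 ≤ t → t ≤ r - 1 → y t ≤ x (t + s)) :
    x (r + s) - x (p + s) ≤ y r - y p := by
  refine sub_le_sub_of_deriv (w := fun u => x (u + s))
    (w' := fun u => -α * (Real.exp (x (u + s - 1)) - 1))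
    (g' := fun u => -α * (Real.exp (y (u - 1)) - 1)) hpr
    (hx.cont.comp (by fun_prop)).continuousOn hy.cont.continuousOn ?_ ?_ ?_
  · intro u hu _
    exact HasDerivAt.comp_add_const u s (hx.der (u+s) (by linarith))
  · intro u hu _
    exact hy.der u (by linarith)
  · intro u hu hu2
    have h1 := h (u-1) (by linarith) (by linarith)
    rw [show u - 1 + s = u + s - 1 by ring] at h1
    have := Real.exp_le_exp.2 h1
    nlinarith

theorem osc {y : ℝ → ℝ} (hx : Traj α x) (hy : Traj α y) (hα : 0 < α) {a p r : ℝ}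
    (h1 : -1 ≤ a + p) (h2 : -1 ≤ a + r) :
    Osc (fun u => x (u + p) - y (u + r))
      (fun u => -α * (Real.exp (x (u + p - 1)) - Real.exp (y (u + r - 1)))) a where
  cont := (hx.cont.comp (by fun_prop)).sub (hy.cont.comp (by fun_prop))
  der := fun u hu => by
    have e1 := HasDerivAt.comp_add_const u p (hx.der (u+p) (by linarith))
    have e2 := HasDerivAt.comp_add_const u r (hy.der (u+r) (by linarith))
    exact (e1.sub e2).congr_deriv (by ring)
  s1 := fun u hu h => by
    have h : x (u + p - 1) ≤ y (u + r - 1) := by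
      rw [show u + p - 1 = u - 1 + p by ring, show u + r - 1 = u - 1 + r by ring]; linarith
    have := Real.exp_le_exp.2 h
    nlinarith
  s2 := fun u hu h => by
    have h : y (u + r - 1) ≤ x (u + p - 1) := by
      rw [show u + p - 1 = u - 1 + p by ring, show u + r - 1 = u - 1 + r by ring]; linarith
    have := Real.exp_le_exp.2 h
    nlinarith

end Traj

namespace Loop
variable {α : ℝ} {x : ℝ → ℝ} {q L : ℝ}

theorem nonneg (T : Loop α x q L) {t : ℝ} (h1 : 0 ≤ t) (h2 : t ≤ q) : 0 ≤ x t := by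
  rcases lt_or_eq_of_le h2 with h | h
  · rcases lt_or_eq_of_le h1 with h' | h'
    · exact (T.pos t h' h).le
    · rw [← h', T.zero]
  · rw [h, T.xq]

theorem nonposq (T : Loop α x q L) {t : ℝ} (h1 : q ≤ t) (h2 : t ≤ L) : x t ≤ 0 := by
  rcases lt_or_eq_of_le h2 with h | h
  · rcases lt_or_eq_of_le h1 with h' | h'
    · exact (T.negq t h' h).le
    · rw [← h', T.xq]
  · rw [h, T.xL]

theorem anti1 (T : Loop α x q L) (hα : 0 < α) : AntitoneOn x (Icc 1 (q+1)) :=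
  T.anti_of_pos hα (by norm_num) (fun t h1 h2 => T.nonneg (by linarith) (by linarith))

theorem mono2 (T : Loop α x q L) (hα : 0 < α) : MonotoneOn x (Icc (q+1) (L+1)) :=
  T.mono_of_neg hα (by linarith [T.hq]) (fun t h1 h2 => T.nonposq (by linarith) (by linarith))

/-- `x ≤ x 1` on `[-1, L]` -/
theorem le_max (T : Loop α x q L) (hα : 0 < α) {t : ℝ} (h1 : -1 ≤ t) (h2 : t ≤ L) : x t ≤ x 1 := by
  have hq := T.hq
  have h0 : 0 ≤ x 1 := T.nonneg (by norm_num) T.hq.le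
  rcases le_total t 0 with h | h
  · exact (T.nonpos h1 h).trans h0
  rcases le_total t 1 with h' | h'
  · exact T.mono01 hα ⟨h, h'⟩ ⟨by norm_num, le_rfl⟩ h'
  rcases le_total t q with h'' | h''
  · exact T.anti1 hα ⟨le_rfl, by linarith⟩ ⟨h', by linarith⟩ h'
  · exact (T.nonposq h'' h2).trans h0

/-- `x (q+1) ≤ x` on `[0, L]` -/
theorem min_le (T : Loop α x q L) (hα : 0 < α) {t : ℝ} (h1 : 0 ≤ t) (h2 : t ≤ L) : x (q+1) ≤ x t := by
  have hq := T.hq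
  have hL := T.hL
  have h0 : x (q+1) ≤ 0 := T.nonposq (by linarith) hL.le
  rcases le_total t q with h'' | h''
  · exact h0.trans (T.nonneg h1 h'')
  rcases le_total t (q+1) with h' | h'
  · exact T.anti1 hα ⟨by linarith, h'⟩ ⟨by linarith, le_rfl⟩ h'
  · exact T.mono2 hα ⟨le_rfl, by linarith⟩ ⟨h', by linarith⟩ h'

theorem shift (T : Loop α x q L) : Traj α (fun t => x (t + L)) where
  cont := T.cont.comp (by fun_prop)
  der := fun t ht => by
    have hq := T.hq
    have hL := T.hL
    have := HasDerivAt.comp_add_const t L (T.der (t+L) (by linarith))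
    rw [show t + L - 1 = t - 1 + L by ring] at this
    exact this
  zero := by simp [T.xL]
  neg := fun t h1 h2 => T.negq _ (by linarith [T.hL]) (by linarith)

/-- `B t = α t - x t` has derivative `α e^{x(t-1)}`. -/
theorem _root_.Traj.hasDerivB (T : Traj α x) {t : ℝ} (ht : 0 < t) :
    HasDerivAt (fun t => α * t - x t) (α * Real.exp (x (t-1))) t := by
  have := ((hasDerivAt_id t).const_mul α).sub (T.der t ht)
  exact this.congr_deriv (by ring)

theorem _root_.Traj.B_mono (T : Traj α x) (hα : 0 < α) {p r : ℝ} (hp : 0 ≤ p) (hpr : p ≤ r) :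
    α * p - x p ≤ α * r - x r := by
  have := le_sub_of_deriv (C := 0) hpr (w := fun t => α * t - x t)
    ((continuous_const.mul continuous_id).sub T.cont).continuousOn
    (fun u hu _ => T.hasDerivB (by linarith)) (fun u _ _ => by positivity)
  linarith

theorem _root_.Traj.B_le (T : Traj α x) (hα : 0 < α) {p r C : ℝ} (hp : 0 ≤ p) (hpr : p ≤ r)
    (h : ∀ t, p - 1 ≤ t → t ≤ r - 1 → x t ≤ C) :
    (α * r - x r) - (α * p - x p) ≤ α * Real.exp C * (r - p) := by
  have := sub_le_of_deriv (C := α * Real.exp C) hpr (w := fun t => α * t - x t)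
    ((continuous_const.mul continuous_id).sub T.cont).continuousOn
    (fun u hu _ => T.hasDerivB (by linarith)) (fun u h1 h2 => by
      have := Real.exp_le_exp.2 (h (u-1) (by linarith) (by linarith))
      nlinarith)
  linarith

/-- tail estimate, short case -/
theorem tail_short (T : Loop α x q L) (hα : 0 < α) (h2 : q + 2 ≤ L) :
    α * (L - q - 2) + x (q+2) ≤ α * Real.exp (x (L-1)) * (L - q - 2) := by
  have hq := T.hq
  have hL := T.hL
  have := T.B_le hα (p := q+2) (r := L) (C := x (L-1)) (by linarith) h2 (fun t h1 h2 =>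
    T.mono2 hα ⟨by linarith, by linarith⟩ ⟨by linarith, by linarith⟩ h2)
  rw [T.xL] at this
  nlinarith

/-- rising speed -/
theorem speed (T : Loop α x q L) (hα : 0 < α) {p r C : ℝ} (hp : q + 2 ≤ p) (hpr : p ≤ r) (hr : r ≤ L + 1)
    (hC : x (r - 1) ≤ C) : α * (1 - Real.exp C) * (r - p) ≤ x r - x p := by
  have hq := T.hq
  have hL := T.hL
  refine le_sub_of_deriv hpr T.cont.continuousOn (fun u hu _ => T.der u (by linarith)) ?_
  intro u h1 h2
  have h3 : x (u-1) ≤ C := (T.mono2 hα ⟨by linarith, by linarith⟩ ⟨by linarith, by linarith⟩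
    (by linarith)).trans hC
  have := Real.exp_le_exp.2 h3
  nlinarith

/-- tail estimate, long case -/
theorem tail_long (T : Loop α x q L) (hα : 0 < α) (h3 : q + 3 ≤ L) {K : ℝ}
    (hK1 : α * Real.exp (x (L-1)) ≤ K) (hK2 : 1 ≤ K * (Real.exp (-x (L-1)) - 1)) :
    α * (L - q - 2) + x (q+2) ≤ K := by
  have hq := T.hq
  have hL := T.hL
  set c := - x (L-1) with hc
  have hc0 : 0 < c := by have := T.negq (L-1) (by linarith) (by linarith); linarith
  have hxc : x (L-1) = -c := by linarith
  rw [hxc] at hK1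
  have hec : 1 < Real.exp c := by rw [← Real.exp_zero]; exact Real.exp_lt_exp.2 hc0
  have hmul : Real.exp c * Real.exp (-c) = 1 := by rw [← Real.exp_add]; simp
  have hen : 0 < Real.exp (-c) := Real.exp_pos _
  set v := α * (1 - Real.exp (-c)) with hv
  have hv0 : 0 < v := by
    apply mul_pos hα
    nlinarith
  have hlin : ∀ s, q + 2 ≤ s → s ≤ L - 1 → x s ≤ -c - v * (L - 1 - s) := by
    intro s h1 h2
    have h4 : x (L - 1 - 1) ≤ -c := by
      rw [← hxc]
      exact T.mono2 hα ⟨by linarith, by linarith⟩ ⟨by linarith, by linarith⟩ (by linarith)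
    have := T.speed hα (p := s) (r := L-1) h1 h2 (by linarith) h4
    rw [hxc] at this
    linarith
  set κ := Real.exp (-(v * (L - q - 3))) with hκ
  have hκ0 : 0 < κ := Real.exp_pos _
  have hκ1 : κ ≤ 1 := by
    rw [hκ, ← Real.exp_zero]; apply Real.exp_le_exp.2
    have : 0 ≤ v * (L - q - 3) := mul_nonneg hv0.le (by linarith)
    linarith
  have e1 : (α * (q+3) - x (q+3)) - (α * (q+2) - x (q+2)) ≤ α * Real.exp (-c) * κ := by
    have := T.B_le hα (p := q+2) (r := q+3) (C := -c - v * (L - q - 3)) (by linarith) (by linarith)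
      (fun t h1 h2 => by
        have h5 := hlin (q+2) le_rfl (by linarith)
        have h6 : x t ≤ x (q+2) := T.mono2 hα ⟨by linarith, by linarith⟩ ⟨by linarith, by linarith⟩ (by linarith)
        have h7 : L - 1 - (q+2) = L - q - 3 := by ring
        rw [h7] at h5
        linarith)
    have h8 : Real.exp (-c - v * (L - q - 3)) = Real.exp (-c) * κ := by
      rw [hκ, ← Real.exp_add]; congr 1
    rw [h8] at this
    calc _ ≤ _ := this
      _ = _ := by ring
  have e2 : (α * L - x L) - (α * (q+3) - x (q+3)) ≤ α * Real.exp (-c) / v * (1 - κ) := by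
    have := sub_le_sub_of_deriv (w := fun t => α * t - x t) (w' := fun t => α * Real.exp (x (t-1)))
      (g := fun t => α * Real.exp (-c) / v * Real.exp (-(v * (L - t))))
      (g' := fun t => α * Real.exp (-c) / v * (Real.exp (-(v * (L - t))) * v)) (p := q+3) (r := L) h3
      ((continuous_const.mul continuous_id).sub T.cont).continuousOn (by fun_prop)
      (fun u hu _ => T.hasDerivB (by linarith))
      (fun u hu _ => by
        have h1 : HasDerivAt (fun t => -(v * (L - t))) v u := by
          have := ((hasDerivAt_id u).const_sub L).const_mul v |>.neg
          exact this.congr_deriv (by ring)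
        exact (h1.exp).const_mul _)
      (fun u h1 h2 => by
        have h5 := hlin (u-1) (by linarith) (by linarith)
        have h6 : Real.exp (x (u-1)) ≤ Real.exp (-c) * Real.exp (-(v * (L - u))) := by
          rw [← Real.exp_add]; apply Real.exp_le_exp.2; linarith
        calc α * Real.exp (x (u-1)) ≤ α * (Real.exp (-c) * Real.exp (-(v * (L - u)))) :=
              mul_le_mul_of_nonneg_left h6 hα.le
          _ = _ := by field_simp)
    have h7 : Real.exp (-(v * (L - L))) = 1 := by simp
    have h8 : Real.exp (-(v * (L - (q+3)))) = κ := by rw [hκ]; congr 2; ring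
    rw [h7, h8] at this
    linarith
  have e3 : α * Real.exp (-c) / v ≤ K := by
    rw [div_le_iff₀ hv0, hv]
    have h9 : Real.exp (-c) ≤ K * (1 - Real.exp (-c)) := by
      have := mul_le_mul_of_nonneg_right hK2 hen.le
      nlinarith
    nlinarith
  rw [T.xL] at e2
  have e4 : α * Real.exp (-c) * κ ≤ K * κ := mul_le_mul_of_nonneg_right hK1 hκ0.le
  have e5 : α * Real.exp (-c) / v * (1 - κ) ≤ K * (1 - κ) := mul_le_mul_of_nonneg_right e3 (by linarith)
  linarith

/-- Condition (C). -/
theorem condC (T : Loop α x q L) (hα : 1.9 ≤ α) (h2 : q + 2 ≤ L) :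
    α * (L - q - 2) + x (q+2) < 1 := by
  have hα0 : 0 < α := by linarith
  have hq := T.hq
  have hL := T.hL
  set c := - x (L-1) with hc
  have hc0 : 0 < c := by have := T.negq (L-1) (by linarith) (by linarith); linarith
  have hxc : x (L-1) = -c := by linarith
  have hmul : Real.exp c * Real.exp (-c) = 1 := by rw [← Real.exp_add]; simp
  have hen : 0 < Real.exp (-c) := Real.exp_pos _
  have hec : c + 1 < Real.exp c := Real.add_one_lt_exp hc0.ne'
  rcases le_total L (q+3) with h3 | h3
  · have h4 := T.tail_short hα0 h2
    rw [hxc] at h4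
    have h5 := T.speed hα0 (p := q+2) (r := L) (C := -c) le_rfl h2 (by linarith) hxc.le
    have h6 : x (L-1) ≤ x (q+2) := T.mono2 hα0 ⟨by linarith, by linarith⟩ ⟨by linarith, by linarith⟩ (by linarith)
    rw [T.xL, show L - (q+2) = L - q - 2 by ring] at h5
    set A := α * (L - q - 2)
    have h7 : A * (1 - Real.exp (-c)) ≤ c := by
      calc _ = α * (1 - Real.exp (-c)) * (L - q - 2) := by simp only [A]; ring
        _ ≤ c := by linarith
    have h8 : A * Real.exp (-c) < 1 := by
      have h10 : A * Real.exp (-c) * (Real.exp c - 1) ≤ c := by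
        calc _ = A * (Real.exp c * Real.exp (-c)) - A * Real.exp (-c) := by ring
          _ = A * (1 - Real.exp (-c)) := by rw [hmul]; ring
          _ ≤ c := h7
      by_contra hcon
      push Not at hcon
      nlinarith
    calc _ ≤ _ := h4
      _ = A * Real.exp (-c) := by simp only [A]; ring
      _ < 1 := h8
  · have h4 : x (L - 1) ≤ -c := hxc.le
    have h5 := T.speed hα0 (p := L-1) (r := L) (C := -c) (by linarith) (by linarith) (by linarith) h4
    rw [T.xL, hxc] at h5
    have h6 : α * (1 - Real.exp (-c)) ≤ c := by linarith
    -- c ≥ 2 - 2/α ≥ 0.947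
    have h7 : 0.94 ≤ c := by
      have h8 : Real.exp (-c) ≤ 1 - c + c^2/2 := by
        have := Real.quadratic_le_exp_of_nonneg hc0.le
        have h9 : (1 - c + c^2/2) * Real.exp c ≥ 1 := by
          have : 0 < 1 - c + c^2/2 := by nlinarith [sq_nonneg (c-1)]
          nlinarith [sq_nonneg (c^2)]
        nlinarith
      by_contra hcon
      push Not at hcon
      have h10 : α * (c - c^2/2) ≤ c := by
        have : α * (c - c^2/2) ≤ α * (1 - Real.exp (-c)) := mul_le_mul_of_nonneg_left (by linarith) hα0.le
        linarith
      have h11 : α * (1 - c/2) ≤ 1 := by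
        by_contra h
        push Not at h
        have := mul_lt_mul_of_pos_left h hc0
        nlinarith
      nlinarith
    have hlog : α * Real.exp (-c) < 1 := by
      by_contra hcon
      push Not at hcon
      have h8 : c ≤ Real.log α := by
        have : Real.exp c ≤ α := by nlinarith
        rw [← Real.log_exp c]
        exact Real.log_le_log (Real.exp_pos _) this
      have hl0 : 0 < Real.log α := by linarith
      have hl1 : Real.log α < α - 1 := Real.log_lt_sub_one_of_pos hα0 (by linarith)
      -- concavity
      have hconv := convexOn_exp.2 (mem_univ (0:ℝ)) (mem_univ (-Real.log α))
        (show 0 ≤ 1 - c / Real.log α by rw [sub_nonneg, div_le_one hl0]; exact h8)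
        (show 0 ≤ c / Real.log α by positivity) (by ring)
      simp only [smul_eq_mul, mul_zero, zero_add, Real.exp_zero, Real.exp_neg, Real.exp_log hα0] at hconv
      rw [show c / Real.log α * -Real.log α = -c by field_simp] at hconv
      set θ := c / Real.log α with hθ
      have hθc : c = θ * Real.log α := by rw [hθ]; field_simp
      have hθ0 : 0 < θ := by positivity
      have h9 : α * (1 - Real.exp (-c)) ≥ θ * (α - 1) := by
        have h10 : 1 - Real.exp (-c) ≥ θ * (1 - α⁻¹) := by linarith
        have h11 := mul_le_mul_of_nonneg_left h10 hα0.le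
        have h12 : α * (θ * (1 - α⁻¹)) = θ * (α - 1) := by field_simp
        linarith
      nlinarith
    -- choose K < 1
    have hec2 : 2.2 < Real.exp c := by
      have := Real.quadratic_le_exp_of_nonneg hc0.le
      nlinarith
    obtain ⟨K, hKd⟩ : ∃ K, K = max (α * Real.exp (-c)) (1/1.2) := ⟨_, rfl⟩
    have hK1 : α * Real.exp (-c) ≤ K := hKd ▸ le_max_left _ _
    have hK2 : 1/1.2 ≤ K := hKd ▸ le_max_right _ _
    have hK3 : 1 ≤ K * (Real.exp c - 1) := by nlinarith
    have := T.tail_long hα0 h3 (K := K) (by rw [hxc]; exact hK1) (by rw [← hc]; exact hK3)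
    rw [hKd] at this
    calc _ ≤ _ := this
      _ < 1 := max_lt hlog (by norm_num)

end Loop

namespace Loop
variable {α : ℝ} {x y : ℝ → ℝ} {qx Lx qy Ly : ℝ}

theorem strict1 (hy : Loop α y qy Ly) (hα : 0 < α) {σ : ℝ} (h0 : 0 < σ) (h1 : σ ≤ 1) : y (1+σ) < y 1 := by
  have hq := hy.hq
  have hL := hy.hL
  have e1 : y (1+σ/2) ≤ y 1 := hy.anti1 hα ⟨le_rfl, by linarith⟩ ⟨by linarith, by linarith⟩ (by linarith)
  have hp : 0 < y (σ/2) := hy.pos _ (by linarith) (by linarith)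
  have e2 := sub_le_of_deriv (w := y) (p := 1+σ/2) (r := 1+σ) (C := -α * (Real.exp (y (σ/2)) - 1)) (by linarith)
    hy.cont.continuousOn (fun u hu _ => hy.der u (by linarith)) (fun u hu hu2 => by
      have : y (σ/2) ≤ y (u-1) := hy.mono01 hα ⟨by linarith, by linarith⟩ ⟨by linarith, by linarith⟩ (by linarith)
      have := Real.exp_le_exp.2 this
      nlinarith)
  have e3 : 0 < Real.exp (y (σ/2)) - 1 := by linarith [Real.add_one_lt_exp hp.ne']
  have e4 : 0 < α * (Real.exp (y (σ/2)) - 1) * (σ/2) := by positivity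
  nlinarith

/-- Stage A of the monotonicity theorem. -/
theorem stageA (hx : Loop α x qx Lx) (hy : Loop α y qy Ly) (hα : 1 ≤ α)
    (hxy : ∀ t, -1 ≤ t → t ≤ 0 → x t ≤ y t) (hym : MonotoneOn y (Icc (-1) 0)) (hq2 : qy ≤ 2) :
    (∀ t, 0 ≤ t → t ≤ 1 → y t ≤ x t) ∧
    (∀ t, -1 ≤ t → t ≤ 0 → y (qy + t) ≤ x (qx + t)) := by
  have hα0 : 0 < α := by linarith
  have hqx := hx.hq
  have hqy := hy.hq
  have hLx := hx.hL
  have hLy := hy.hL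
  have h01 : ∀ t, 0 ≤ t → t ≤ 1 → y t ≤ x t := by
    intro t h0 h1
    have := Traj.sub_le_sub (s := 0) hy.toTraj hx.toTraj hα0 (p := 0) (r := t) le_rfl (by norm_num) h0
      (fun u h1 h2 => by simpa using hxy u (by linarith) (by linarith))
    simp [hx.zero, hy.zero] at this
    exact this
  refine ⟨h01, ?_⟩
  have hyin : ∀ u v, -1 ≤ u → u ≤ v → v ≤ 1 → y u ≤ y v := by
    intro u v h1 h2 h3
    rcases le_total v 0 with h | h
    · exact hym ⟨h1, by linarith⟩ ⟨by linarith, h⟩ h2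
    · rcases le_total u 0 with h' | h'
      · exact (hy.nonpos h1 h').trans (hy.nonneg h (by linarith))
      · exact hy.mono01 hα0 ⟨h', by linarith⟩ ⟨h, h3⟩ h2
  rcases lt_or_ge qx qy with hlt | hge
  · -- σ > 0
    obtain ⟨σ, hσ⟩ : ∃ σ, σ = qy - qx := ⟨_, rfl⟩
    have hO := Traj.osc hx.toTraj hy.toTraj hα0 (a := σ - 1) (p := -σ) (r := 0) (by linarith) (by linarith)
    have hw : ∀ u, σ - 1 ≤ u → u ≤ σ - 1 + 1 → x (u + -σ) - y (u + 0) ≤ 0 := by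
      intro u h1 h2
      rw [add_zero]
      rcases le_total u 0 with h | h
      · have := hxy (u + -σ) (by linarith) (by linarith)
        have := hyin (u + -σ) u (by linarith) (by linarith) (by linarith)
        linarith
      · have := hx.nonpos (t := u + -σ) (by linarith) (by linarith)
        have := hy.nonneg h (by linarith)
        linarith
    have hwb : x (qy + -σ) - y (qy + 0) = 0 := by
      rw [add_zero, show qy + -σ = qx by rw [hσ]; ring, hx.xq, hy.xq]; simp
    have hpos : 0 < x ((1+σ) + -σ) - y ((1+σ) + 0) := by
      rw [show (1+σ) + -σ = 1 by ring, add_zero]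
      have := hy.strict1 hα0 (σ := σ) (by linarith) (by linarith)
      have := h01 1 (by norm_num) le_rfl
      linarith
    have hfin : ∃ z, 0 ≤ z ∧ z ≤ qy - 1 ∧ ∀ u, z ≤ u → u ≤ qy → 0 ≤ x (u + -σ) - y (u + 0) := by
      rcases hO.adv hw (b := qy) (by linarith) hwb with h | ⟨z, h1, h2, h3, h4, h5, h6⟩
      · have := h (1+σ) (by linarith) (by linarith)
        linarith
      · rcases (hO.mono (show σ - 1 ≤ z by linarith)).adv' h5 (b := qy) (by linarith) hwb with h | ⟨z', h1', h2', _⟩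
        · exact ⟨z, by linarith, by linarith, h⟩
        · linarith
    obtain ⟨z, hz0, hz1, hz⟩ := hfin
    intro t h1 h2
    have := hz (qy + t) (by linarith) (by linarith)
    rw [show qy + t + -σ = qx + t by rw [hσ]; ring, add_zero] at this
    linarith
  · obtain ⟨s, hs⟩ : ∃ s, s = qx - qy := ⟨_, rfl⟩
    have hs0 : 0 ≤ s := by linarith
    obtain ⟨a, ha⟩ : ∃ a, a = max (-s) (-1) := ⟨_, rfl⟩
    have ha1 : -s ≤ a := ha ▸ le_max_left _ _
    have ha2 : -1 ≤ a := ha ▸ le_max_right _ _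
    have ha3 : a ≤ 0 := by rw [ha]; exact max_le (by linarith) (by norm_num)
    have hO := Traj.osc hx.toTraj hy.toTraj hα0 (a := a) (p := s) (r := 0) (by linarith) (by linarith)
    have hw : ∀ u, a ≤ u → u ≤ a + 1 → 0 ≤ x (u + s) - y (u + 0) := by
      intro u h1 h2
      rw [add_zero]
      rcases le_total u 0 with h | h
      · have := hx.nonneg (t := u + s) (by linarith) (by linarith)
        have := hy.nonpos (t := u) (by linarith) h
        linarith
      · have hsl : a + s ≤ 0 ∨ a = -1 := by
          rcases max_choice (-s) (-1) with h' | h' <;> rw [h'] at ha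
          · left; linarith
          · right; exact ha
        rcases hsl with hsl | hsl
        · have := h01 (u + s) (by linarith) (by linarith)
          have := hyin u (u+s) (by linarith) (by linarith) (by linarith)
          linarith
        · have hu0 : u = 0 := by linarith
          rw [hu0, hy.zero]
          have := hx.nonneg (t := 0 + s) (by linarith) (by linarith)
          linarith
    have hwb : x (qy + s) - y (qy + 0) = 0 := by
      rw [add_zero, show qy + s = qx by rw [hs]; ring, hx.xq, hy.xq]; simp
    have hfin : ∀ u, a ≤ u → u ≤ qy → 0 ≤ x (u + s) - y (u + 0) := by
      rcases hO.adv' hw (b := qy) (by linarith) hwb with h | ⟨z, h1, h2, h3, h4, h5, h6⟩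
      · exact h
      exfalso
      simp only [add_zero] at h4 h6
      have hz0 : 0 ≤ z := by linarith
      have hz1 : z < 1 := by linarith
      obtain ⟨ℓ, hℓ⟩ : ∃ ℓ, ℓ = y z := ⟨_, rfl⟩
      have hxℓ : x (z + s) = ℓ := by linarith
      have hℓ0 : 0 ≤ ℓ := by rw [hℓ]; exact hy.nonneg hz0 (by linarith)
      have hfl : ℓ ≤ Real.exp ℓ - 1 := by linarith [Real.add_one_le_exp ℓ]
      obtain ⟨σ, hσ⟩ : ∃ σ, σ = z + s - 1 := ⟨_, rfl⟩
      have hσ0 : 0 ≤ σ := by linarith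
      have hxσ : x (1 + σ) = ℓ := by rw [← hxℓ]; congr 1; linarith
      have hposx : 0 < x (2 + σ) := hx.pos _ (by linarith) (by linarith)
      have hge1 : ∀ u, 1 ≤ u → u ≤ 1 + σ → ℓ ≤ x u := by
        intro u hu1 hu2
        rw [← hxσ]
        exact hx.anti1 hα0 ⟨hu1, by linarith⟩ ⟨by linarith, by linarith⟩ hu2
      have main : ∀ p r, 0 ≤ p → p ≤ r → (∀ u, p - 1 < u → u < r - 1 → ℓ ≤ x u) →
          x r - x p ≤ -α * (Real.exp ℓ - 1) * (r - p) := by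
        intro p r hp hpr hl
        refine sub_le_of_deriv hpr hx.cont.continuousOn (fun u hu _ => hx.der u (by linarith)) ?_
        intro u hu1 hu2
        have := Real.exp_le_exp.2 (hl (u-1) (by linarith) (by linarith))
        nlinarith
      by_cases hcase : z ≤ σ ∨ 1 ≤ σ
      · have := main (1+σ) (2+σ) (by linarith) (by linarith) (by
          intro u hu1 hu2
          rcases le_total 1 u with hu | hu
          · exact hge1 u hu (by linarith)
          · rcases hcase with hc | hc
            · have e1 := h01 u (by linarith) hu
              have e2 := hyin z u (by linarith) (by linarith) hu
              linarith
            · linarith)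
        rw [hxσ, show 2 + σ - (1+σ) = 1 by ring] at this
        nlinarith
      · push Not at hcase
        have e1 := main 2 (2+σ) (by norm_num) (by linarith) (by
          intro u hu1 hu2
          exact hge1 u (by linarith) (by linarith))
        have e2 := Traj.sub_le_sub hx.toTraj hy.toTraj hα0 (p := 1+σ) (r := 2) (s := 0) (by linarith) (by linarith) (by linarith)
          (fun t ht1 ht2 => by simpa using h01 t (by linarith) (by linarith))
        have e3 : -α * (Real.exp ℓ - 1) * (1 + σ - 1) ≤ y (1+σ) - y 1 := by
          refine le_sub_of_deriv (by linarith) hy.cont.continuousOn (fun u hu _ => hy.der u (by linarith)) ?_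
          intro u hu1 hu2
          have := Real.exp_le_exp.2 (hyin (u-1) z (by linarith) (by linarith) (by linarith))
          rw [← hℓ] at this
          nlinarith
        simp only [add_zero] at e2
        rw [show 2 + σ - 2 = σ by ring] at e1
        rw [show 1 + σ - 1 = σ by ring] at e3
        have e4 : y 2 ≤ 0 := hy.nonposq hq2 (by linarith)
        have e5 : ℓ ≤ y 1 := by rw [hℓ]; exact hyin z 1 (by linarith) (by linarith) le_rfl
        linarith
    intro t h1 h2
    have := hfin (qy + t) (by linarith) (by linarith)
    rw [show qy + t + s = qx + t by rw [hs]; ring, add_zero] at this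
    linarith

/-- core of stage B -/
theorem stageB_core (hx : Loop α x qx Lx) (hy : Loop α y qy Ly) (hα : 1.9 ≤ α) {S a us : ℝ}
    (hS : Lx = Ly + S) (ha1 : -1 ≤ a + S) (ha2 : -1 ≤ a)
    (hw : (∀ u, a ≤ u → u ≤ a + 1 → x (u + S) ≤ y u) ∨ (∀ u, a ≤ u → u ≤ a + 1 → y u ≤ x (u + S)))
    (hus : a ≤ us) (hub : us ≤ Ly) (hab : a + 1 ≤ Ly) (hus2 : qx + 2 ≤ us + 1 + S)
    (hwu : x (us + S) < y us) : ∀ t, -1 ≤ t → t ≤ 0 → x (Lx + t) ≤ y (Ly + t) := by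
  have hα0 : 0 < α := by linarith
  have hqx := hx.hq
  have hLx := hx.hL
  have hO := Traj.osc hx.toTraj hy.toTraj hα0 (a := a) (p := S) (r := 0) (by linarith) (by linarith)
  have key := hO.lemR (b := Ly) (us := us) (B := fun u => α * (u + S) - x (u + S))
    (B' := fun u => α * Real.exp (x (u + S - 1)))
    (by
      rcases hw with h | h
      · exact Or.inl fun u h1 h2 => by have := h u h1 h2; simp only [add_zero]; linarith
      · exact Or.inr fun u h1 h2 => by have := h u h1 h2; simp only [add_zero]; linarith)
    hus hub (by simp only [add_zero]; linarith) (by simp only [add_zero]; rw [← hS, hx.xL, hy.xL]; simp) hab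
    (by have := hx.cont; fun_prop)
    (fun u hu => HasDerivAt.comp_add_const u S (hx.hasDerivB (t := u + S) (by linarith)))
    (fun u hu => by positivity)
    (fun u W hu hW h => by
      simp only [add_zero] at h ⊢
      rw [show u - 1 + S = u + S - 1 by ring] at h
      have h1 : Real.exp (x (u+S-1)) * (1 - W) ≤ Real.exp (y (u-1)) := by
        have h2 : 1 - W ≤ Real.exp (-W) := by linarith [Real.add_one_le_exp (-W)]
        calc _ ≤ Real.exp (x (u+S-1)) * Real.exp (-W) := mul_le_mul_of_nonneg_left h2 (Real.exp_pos _).le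
          _ = Real.exp (x (u+S-1) - W) := by rw [← Real.exp_add]; rfl
          _ ≤ _ := Real.exp_le_exp.2 (by linarith)
      nlinarith)
    (fun v1 v2 h1 h2 h3 => by
      have e1 := hx.B_mono hα0 (p := v2 + S) (r := Lx) (by linarith) (by linarith)
      have e2 := hx.B_mono hα0 (p := qx + 2) (r := v1 + S) (by linarith) (by linarith)
      have e3 := hx.condC hα (by linarith)
      rw [hx.xL] at e1
      linarith)
  intro t h1 h2
  have := key (Ly + t) (by linarith) (by linarith)
  simp only [add_zero] at this
  rw [show Ly + t + S = Lx + t by rw [hS]; ring] at this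
  linarith

theorem _root_.Traj.eq_of_window (hx : Traj α x) (hy : Traj α y) {p r : ℝ}
    (hp : 0 ≤ p) (hr : 0 ≤ r) (h : ∀ t, 0 ≤ t → t ≤ 1 → x (p + t) = y (r + t)) :
    ∀ t, 0 ≤ t → x (p + t) = y (r + t) := by
  have key : ∀ n : ℕ, ∀ t : ℝ, 0 ≤ t → t ≤ n + 1 → x (p + t) = y (r + t) := by
    intro n
    induction n with
    | zero => intro t h0 h1; exact h t h0 (by simpa using h1)
    | succ n ih =>
      intro t h0 h1
      push_cast at h1
      rcases le_total t (n+1) with h2 | h2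
      · exact ih t h0 h2
      · have e0 := ih (n+1) (by positivity) le_rfl
        have hn : (0:ℝ) ≤ n := Nat.cast_nonneg n
        have e : ∀ {x y : ℝ → ℝ} (_ : Traj α x) (_ : Traj α y) {p r : ℝ} (_ : 0 ≤ p) (_ : 0 ≤ r)
          (_ : ∀ t : ℝ, 0 ≤ t → t ≤ n + 1 → x (p + t) = y (r + t)), x (p + t) - x (p + (n+1)) ≤ y (r + t) - y (r + (n+1)) := by
          intro x y hx hy p r hp hr ih
          refine sub_le_sub_of_deriv (w := fun u => x (p + u)) (g := fun u => y (r + u)) h2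
            (hx.cont.comp (by fun_prop)).continuousOn (hy.cont.comp (by fun_prop)).continuousOn
            (fun u hu _ => HasDerivAt.comp_const_add p u (hx.der (p+u) (by linarith)))
            (fun u hu _ => HasDerivAt.comp_const_add r u (hy.der (r+u) (by linarith)))
            (fun u h3 h4 => by
              have := ih (u-1) (by linarith) (by linarith)
              rw [show p + u - 1 = p + (u-1) by ring, show r + u - 1 = r + (u-1) by ring, this])
        have e1 := e hx hy hp hr ih
        have e2 := e hy hx hr hp (fun t h1 h2 => (ih t h1 h2).symm)
        linarith
  intro t ht
  obtain ⟨n, hn⟩ := exists_nat_gt t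
  exact key n t ht (by linarith)

theorem monotonicity (hx : Loop α x qx Lx) (hy : Loop α y qy Ly) (hα : 1.9 ≤ α)
    (hxy : ∀ t, -1 ≤ t → t ≤ 0 → x t ≤ y t) (hym : MonotoneOn y (Icc (-1) 0)) (hq2 : qy ≤ 2) :
    (∀ t, 0 ≤ t → t ≤ 1 → y t ≤ x t) ∧
    (∀ t, -1 ≤ t → t ≤ 0 → y (qy + t) ≤ x (qx + t)) ∧
    (∀ t, 0 ≤ t → t ≤ 1 → x (qx + t) ≤ y (qy + t)) ∧
    (∀ t, -1 ≤ t → t ≤ 0 → x (Lx + t) ≤ y (Ly + t)) := by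
  have hα0 : 0 < α := by linarith
  have hqx := hx.hq
  have hqy := hy.hq
  have hLx := hx.hL
  have hLy := hy.hL
  obtain ⟨h01, hA⟩ := stageA hx hy (by linarith) hxy hym hq2
  have hyin : ∀ u v, -1 ≤ u → u ≤ v → v ≤ 1 → y u ≤ y v := by
    intro u v h1 h2 h3
    rcases le_total v 0 with h | h
    · exact hym ⟨h1, by linarith⟩ ⟨by linarith, h⟩ h2
    · rcases le_total u 0 with h' | h'
      · exact (hy.nonpos h1 h').trans (hy.nonneg h (by linarith))
      · exact hy.mono01 hα0 ⟨h', by linarith⟩ ⟨h, h3⟩ h2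
  have hd : ∀ t v, 0 ≤ t → t ≤ v → v ≤ 1 → x (qx + v) - x (qx + t) ≤ y (qy + v) - y (qy + t) := by
    intro t v h0 h1 h2
    have := Traj.sub_le_sub (s := qx - qy) hx.toTraj hy.toTraj hα0 (p := qy + t) (r := qy + v) (by linarith) (by linarith)
      (by linarith)
      (fun u h1 h2 => by
        have := hA (u - qy) (by linarith) (by linarith)
        rwa [show qy + (u - qy) = u by ring, show qx + (u - qy) = u + (qx - qy) by ring] at this)
    rwa [show qy + v + (qx - qy) = qx + v by ring, show qy + t + (qx - qy) = qx + t by ring] at this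
  have hA2 : ∀ t, 0 ≤ t → t ≤ 1 → x (qx + t) ≤ y (qy + t) := by
    intro t h0 h1
    have := hd 0 t le_rfl h0 h1
    simp only [add_zero, hx.xq, hy.xq] at this
    linarith
  refine ⟨h01, hA, hA2, ?_⟩
  rcases lt_or_eq_of_le (hA2 1 (by norm_num) le_rfl) with hm | hm
  swap
  · have hw : ∀ t, 0 ≤ t → t ≤ 1 → x (qx + t) = y (qy + t) := by
      intro t h0 h1
      have := hd t 1 h0 h1 le_rfl
      have := hA2 t h0 h1
      linarith
    have hE := Traj.eq_of_window hx.toTraj hy.toTraj (by linarith) (by linarith) hw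
    have hρ : Lx - qx = Ly - qy := by
      rcases lt_trichotomy (Lx - qx) (Ly - qy) with h | h | h
      · have e1 := hE (Lx - qx) (by linarith)
        rw [show qx + (Lx - qx) = Lx by ring, hx.xL] at e1
        have := hy.negq (qy + (Lx - qx)) (by linarith) (by linarith)
        linarith
      · exact h
      · have e1 := hE (Ly - qy) (by linarith)
        rw [show qy + (Ly - qy) = Ly by ring, hy.xL] at e1
        have := hx.negq (qx + (Ly - qy)) (by linarith) (by linarith)
        linarith
    intro t h1 h2
    have := hE (Lx - qx + t) (by linarith)
    rw [show qx + (Lx - qx + t) = Lx + t by ring] at this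
    rw [this, hρ, show qy + (Ly - qy + t) = Ly + t by ring]
  rcases le_total (Ly - qy) (Lx - qx) with hρ | hρ
  · obtain ⟨s, hs⟩ : ∃ s, s = (Lx - qx) - (Ly - qy) := ⟨_, rfl⟩
    have hs0 : 0 ≤ s := by linarith
    rcases le_total s 1 with hs1 | hs1
    · refine stageB_core hx hy hα (S := Lx - Ly) (a := qy - s) (us := qy + (1 - s)) (by ring) (by linarith)
        (by linarith) (Or.inl ?_) (by linarith) (by linarith) (by linarith) (by linarith) ?_
      · intro u h1 h2
        rcases le_total u qy with h | h
        · have := hx.nonposq (t := u + (Lx - Ly)) (by linarith) (by linarith)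
          have := hy.nonneg (t := u) (by linarith) h
          linarith
        · have e1 := hA2 (u - qy) (by linarith) (by linarith)
          rw [show qy + (u - qy) = u by ring] at e1
          have e2 := hx.anti1 hα0 (a := qx + (u - qy)) (b := u + (Lx - Ly)) ⟨by linarith, by linarith⟩ ⟨by linarith, by linarith⟩ (by linarith)
          linarith
      · rw [show qy + (1 - s) + (Lx - Ly) = qx + 1 by rw [hs]; ring]
        have := hy.min_le hα0 (t := qy + (1-s)) (by linarith) (by linarith)
        linarith
    · refine stageB_core hx hy hα (S := Lx - Ly) (a := qy - 1) (us := qy) (by ring) (by linarith)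
        (by linarith) (Or.inl ?_) (by linarith) (by linarith) (by linarith) (by linarith) ?_
      · intro u h1 h2
        have := hx.nonposq (t := u + (Lx - Ly)) (by linarith) (by linarith)
        have := hy.nonneg (t := u) (by linarith) (by linarith)
        linarith
      · rw [hy.xq]
        exact hx.negq _ (by linarith) (by linarith)
  · obtain ⟨τ, hτ⟩ : ∃ τ, τ = (Ly - qy) - (Lx - qx) := ⟨_, rfl⟩
    have hτ0 : 0 ≤ τ := by linarith
    have hus : x (qy + 1 + τ + (Lx - Ly)) < y (qy + 1 + τ) := by
      rw [show qy + 1 + τ + (Lx - Ly) = qx + 1 by rw [hτ]; ring]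
      have := hy.min_le hα0 (t := qy + 1 + τ) (by linarith) (by linarith)
      linarith
    rcases le_total 1 τ with hτ1 | hτ1
    · refine stageB_core hx hy hα (S := Lx - Ly) (a := qy + τ - 1) (us := qy + 1 + τ) (by ring) (by linarith)
        (by linarith) (Or.inr ?_) (by linarith) (by linarith) (by linarith) (by linarith) hus
      intro u h1 h2
      have := hx.nonneg (t := u + (Lx - Ly)) (by linarith) (by linarith)
      have := hy.nonposq (t := u) (by linarith) (by linarith)
      linarith
    · rcases le_total 0 (Lx - Ly) with hS | hS
      · rcases le_total 1 (Lx - Ly) with hS1 | hS1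
        · refine stageB_core hx hy hα (S := Lx - Ly) (a := -1) (us := qy + 1 + τ) (by ring) (by linarith)
            (by linarith) (Or.inr ?_) (by linarith) (by linarith) (by linarith) (by linarith) hus
          intro u h1 h2
          have := hx.nonneg (t := u + (Lx - Ly)) (by linarith) (by linarith)
          have := hy.nonpos (t := u) (by linarith) (by linarith)
          linarith
        · refine stageB_core hx hy hα (S := Lx - Ly) (a := -(Lx - Ly)) (us := qy + 1 + τ) (by ring) (by linarith)
            (by linarith) (Or.inr ?_) (by linarith) (by linarith) (by linarith) (by linarith) hus
          intro u h1 h2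
          rcases le_total u 0 with h | h
          · have := hx.nonneg (t := u + (Lx - Ly)) (by linarith) (by linarith)
            have := hy.nonpos (t := u) (by linarith) h
            linarith
          · have := h01 (u + (Lx - Ly)) (by linarith) (by linarith)
            have := hyin u (u + (Lx - Ly)) (by linarith) (by linarith) (by linarith)
            linarith
      · refine stageB_core hx hy hα (S := Lx - Ly) (a := -(Lx - Ly) - 1) (us := qy + 1 + τ) (by ring) (by linarith)
            (by linarith) (Or.inl ?_) (by linarith) (by linarith) (by linarith) (by linarith) hus
        intro u h1 h2
        rcases le_total u 0 with h | h
        · have := hxy (u + (Lx - Ly)) (by linarith) (by linarith)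
          have := hyin (u + (Lx - Ly)) u (by linarith) (by linarith) (by linarith)
          linarith
        · have := hx.nonpos (t := u + (Lx - Ly)) (by linarith) (by linarith)
          have := hy.nonneg (t := u) h (by linarith)
          linarith

end Loop

/-- first zero from the negative side -/
theorem first_zero_neg {w : ℝ → ℝ} (hc : Continuous w) {a b : ℝ} (hab : a ≤ b) (ha : w a < 0)
    (hb : 0 ≤ w b) : ∃ z, a < z ∧ z ≤ b ∧ w z = 0 ∧ ∀ u, a ≤ u → u < z → w u < 0 := by
  set P := {u | a ≤ u ∧ u ≤ b ∧ 0 ≤ w u} with hP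
  have hPc : IsClosed P := by
    have : P = Icc a b ∩ w ⁻¹' Ici 0 := by ext u; simp [hP, and_assoc]
    rw [this]
    exact isClosed_Icc.inter (isClosed_Ici.preimage hc)
  have hne : P.Nonempty := ⟨b, hab, le_rfl, hb⟩
  have hbd : BddBelow P := ⟨a, fun u hu => hu.1⟩
  obtain ⟨h1, h2, h3⟩ := hPc.csInf_mem hne hbd
  set z := sInf P
  have hlt : ∀ u, a ≤ u → u < z → w u < 0 := by
    intro u hu huz
    by_contra hcon
    push Not at hcon
    have : z ≤ u := csInf_le hbd ⟨hu, by linarith, hcon⟩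
    linarith
  have haz : a < z := lt_of_le_of_ne h1 (fun h => by rw [← h] at h3; linarith)
  refine ⟨z, haz, h2, le_antisymm ?_ h3, hlt⟩
  by_contra hcon
  push Not at hcon
  have hev : ∀ᶠ u in nhds z, 0 < w u := (hc.tendsto z).eventually (lt_mem_nhds hcon)
  rw [Metric.eventually_nhds_iff] at hev
  obtain ⟨e, he, hev⟩ := hev
  have h4 := hlt (max a (z - e/2)) (le_max_left _ _) (max_lt haz (by linarith))
  have h5 := hev (y := max a (z - e/2)) (by
    rw [Real.dist_eq, abs_lt]
    have := le_max_right a (z - e/2)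
    have := max_lt haz (show z - e/2 < z by linarith)
    constructor <;> linarith)
  linarith

namespace Traj
variable {α : ℝ} {x : ℝ → ℝ}

/-- strict monotonicity -/
theorem strictMono_of_neg (T : Traj α x) (hα : 0 < α) {p r : ℝ} (hp : 0 ≤ p) (hpr : p < r)
    (h : ∀ t, p - 1 < t → t < r - 1 → x t < 0) : x p < x r := by
  have := strictMonoOn_of_deriv_pos (convex_Icc p r) (f := x) T.cont.continuousOn (by
    intro u hu
    rw [interior_Icc] at hu
    rw [(T.der u (by linarith [hu.1])).deriv]
    have h2 : Real.exp (x (u-1)) < 1 := Real.exp_lt_one_iff.2 (h (u-1) (by linarith [hu.1]) (by linarith [hu.2]))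
    nlinarith)
  exact this ⟨le_rfl, hpr.le⟩ ⟨hpr.le, le_rfl⟩ hpr

theorem strictAnti_of_pos (T : Traj α x) (hα : 0 < α) {p r : ℝ} (hp : 0 ≤ p) (hpr : p < r)
    (h : ∀ t, p - 1 < t → t < r - 1 → 0 < x t) : x r < x p := by
  have := strictAntiOn_of_deriv_neg (convex_Icc p r) (f := x) T.cont.continuousOn (by
    intro u hu
    rw [interior_Icc] at hu
    rw [(T.der u (by linarith [hu.1])).deriv]
    have h2 : 1 < Real.exp (x (u-1)) := Real.one_lt_exp_iff.2 (h (u-1) (by linarith [hu.1]) (by linarith [hu.2]))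
    nlinarith)
  exact this ⟨le_rfl, hpr.le⟩ ⟨hpr.le, le_rfl⟩ hpr

theorem pos01 (T : Traj α x) (hα : 0 < α) {t : ℝ} (h0 : 0 < t) (h1 : t ≤ 1) : 0 < x t := by
  have := T.strictMono_of_neg hα (p := 0) (r := t) le_rfl h0
    (fun s hs1 hs2 => T.neg s (by linarith) (by linarith))
  rwa [T.zero] at this

theorem exp_bd {v : ℝ} (h0 : 0 ≤ v) : Real.exp (-v) ≤ 1 - v + v^2/2 := by
  have := Real.quadratic_le_exp_of_nonneg h0
  have h1 : Real.exp v * Real.exp (-v) = 1 := by rw [← Real.exp_add]; simp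
  have h2 := Real.exp_pos (-v)
  have h3 : 0 ≤ v^2 := sq_nonneg v
  have h4 : (1 + v + v^2/2) * Real.exp (-v) ≤ 1 := by nlinarith
  have h5 : (1 + v + v^2/2) * (1 - v + v^2/2) ≥ 1 := by nlinarith [sq_nonneg (v^2)]
  have h6 : 0 < 1 + v + v^2/2 := by positivity
  nlinarith

/-- Existence of the loop from a nonpositive value within `(1,2]`. -/
theorem exists_loop (T : Traj α x) (hα : 1.9 ≤ α) {t1 : ℝ} (h1 : 1 < t1)
    (hx : x t1 ≤ 0) : ∃ q L, Loop α x q L ∧ q ≤ t1 := by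
  have hα0 : 0 < α := by linarith
  obtain ⟨q, hq1, hqt, hq0, hqn⟩ := first_zero_neg (w := fun t => - x t) T.cont.neg h1.le
    (by have := T.pos01 hα0 one_pos le_rfl; linarith) (by linarith)
  have hpos : ∀ t, 0 < t → t < q → 0 < x t := by
    intro t h0 h2
    rcases le_total t 1 with h | h
    · exact T.pos01 hα0 h0 h
    · have := hqn t h h2; linarith
  have hq0 : x q = 0 := by linarith
  have hneg1 : ∀ t, q < t → t ≤ q + 1 → x t < 0 := by
    intro t h2 h3
    have := T.strictAnti_of_pos hα0 (p := q) (r := t) (by linarith) h2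
      (fun s hs1 hs2 => hpos s (by linarith) (by linarith))
    linarith
  have hex : ∃ b, q + 1 ≤ b ∧ 0 ≤ x b := by
    by_contra hcon
    push Not at hcon
    have hneg : ∀ t, q < t → x t < 0 := by
      intro t ht
      rcases le_total t (q+1) with h | h
      · exact hneg1 t ht h
      · exact hcon t h
    have hmono : ∀ s t, q + 1 ≤ s → s ≤ t → x s ≤ x t := by
      intro s t hs hst
      exact T.mono_of_neg hα0 (p := s) (r := t) (by linarith)
        (fun u hu _ => by
          rcases eq_or_lt_of_le (show q ≤ u by linarith) with h | h
          · rw [← h, hq0]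
          · exact (hneg u h).le) ⟨le_rfl, hst⟩ ⟨hst, le_rfl⟩ hst
    have hdeep : ∀ s, q + 2 ≤ s → x s ≤ -0.9 := by
      intro s hs
      by_contra hc
      push Not at hc
      have hs0 := hneg s (by linarith)
      have := le_sub_of_deriv (w := x) (p := s) (r := s+1) (C := α * (1 - Real.exp (x s))) (by linarith)
        T.cont.continuousOn (fun u hu _ => T.der u (by linarith)) (fun u hu1 hu2 => by
          have := Real.exp_le_exp.2 (hmono (u-1) s (by linarith) (by linarith))
          nlinarith)
      have h4 := exp_bd (v := - x s) (by linarith)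
      rw [neg_neg] at h4
      have h5 := hneg (s+1) (by linarith)
      have h6 : α * (1 - Real.exp (x s)) ≥ 1.9 * (- x s * 0.55) := by
        have : 1 - Real.exp (x s) ≥ - x s * 0.55 := by nlinarith
        nlinarith
      nlinarith
    set s := q + 3 + (- x (q+3)) with hs
    have h7 := hneg (q+3) (by linarith)
    have := le_sub_of_deriv (w := x) (p := q+3) (r := q + 3 + 2 * (- x (q+3))) (C := 0.5) (by linarith)
        T.cont.continuousOn (fun u hu _ => T.der u (by linarith)) (fun u hu1 hu2 => by
          have h8 := Real.exp_le_exp.2 (hdeep (u-1) (by linarith))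
          have h9 := exp_bd (v := 0.9) (by norm_num)
          have h11 : (1:ℝ) - 0.9 + 0.9^2/2 = 0.505 := by norm_num
          nlinarith)
    have h10 := hneg (q + 3 + 2 * (- x (q+3))) (by linarith)
    linarith
  obtain ⟨b, hb1, hb2⟩ := hex
  obtain ⟨L, hL1, hL2, hL3, hL4⟩ := first_zero_neg T.cont hb1 (hneg1 (q+1) (by linarith) le_rfl) hb2
  refine ⟨q, L, { toTraj := T, hq := hq1, hL := hL1, pos := hpos, xq := hq0, negq := ?_, xL := hL3 }, hqt⟩
  intro t h2 h3
  rcases le_total t (q+1) with h | h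
  · exact hneg1 t h2 h
  · exact hL4 t h h3

end Traj

namespace Loop
variable {α : ℝ} {x : ℝ → ℝ} {q L : ℝ}

/-- downward chord of the end of the loop -/
theorem lemG (T : Loop α x q L) (hα : 0 < α) {c : ℝ} (hc0 : 0 < c) (h1 : c ≤ - x (L-1))
    (h2 : c ≤ α * (1 - Real.exp (x (L-1)))) {t : ℝ} (ht1 : -1 ≤ t) (ht0 : t ≤ 0) :
    x (L + t) ≤ c * t := by
  have hq := T.hq
  have hL := T.hL
  -- upward closure
  have hup : ∀ s r, L - 2 ≤ s → s ≤ r → r ≤ L - 1 → c ≤ α * (1 - Real.exp (x s)) →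
      c ≤ α * (1 - Real.exp (x r)) := by
    intro s r hs hsr hr hc
    have hsq : q ≤ s := by
      by_contra hcon
      push Not at hcon
      have := Real.one_le_exp (T.nonneg (t := s) (by linarith) hcon.le)
      nlinarith
    have : x r ≤ max (x s) (x (L-1)) := by
      rcases le_total r (q+1) with h | h
      · exact le_max_of_le_left (T.anti1 hα (a := s) (b := r) ⟨by linarith, by linarith⟩ ⟨by linarith, h⟩ hsr)
      · exact le_max_of_le_right (T.mono2 hα ⟨h, by linarith⟩ ⟨by linarith, by linarith⟩ hr)
    rcases max_cases (x s) (x (L-1)) with h | h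
    · have := Real.exp_le_exp.2 (this.trans h.1.le)
      nlinarith
    · have := Real.exp_le_exp.2 (this.trans h.1.le)
      nlinarith
  by_cases hcs : c ≤ α * (1 - Real.exp (x (L + t - 1)))
  · have := le_sub_of_deriv (w := x) (p := L + t) (r := L) (C := c) (by linarith)
      T.cont.continuousOn (fun u hu _ => T.der u (by linarith)) (fun u hu1 hu2 => by
        have := hup (L + t - 1) (u - 1) (by linarith) (by linarith) (by linarith) hcs
        linarith)
    rw [T.xL] at this
    linarith
  · have := sub_le_of_deriv (w := x) (p := L - 1) (r := L + t) (C := c) (by linarith)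
      T.cont.continuousOn (fun u hu _ => T.der u (by linarith)) (fun u hu1 hu2 => by
        by_contra hcon
        push Not at hcon
        exact hcs (hup (u - 1) (L + t - 1) (by linarith) (by linarith) (by linarith) (by linarith)))
    linarith

end Loop

/-- one step of the method of steps -/
noncomputable def stepOp (α : ℝ) (φ : ℝ → ℝ) (x : ℝ → ℝ) (t : ℝ) : ℝ :=
  φ (min t 0) + ∫ s in (0:ℝ)..(max t 0), -α * (Real.exp (x (s - 1)) - 1)

theorem stepOp_cont (α : ℝ) {φ x : ℝ → ℝ} (hφ : Continuous φ) (hx : Continuous x) :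
    Continuous (stepOp α φ x) := by
  unfold stepOp
  apply Continuous.add (hφ.comp (by fun_prop))
  have h : Continuous fun s => -α * (Real.exp (x (s - 1)) - 1) := by fun_prop
  exact (intervalIntegral.continuous_primitive (fun a b => h.intervalIntegrable a b) 0).comp
    (continuous_id.max continuous_const)

theorem exists_sol (α : ℝ) {φ : ℝ → ℝ} (hφ : Continuous φ) (h0 : φ 0 = 0) :
    ∃ x : ℝ → ℝ, Continuous x ∧ (∀ t ≤ 0, x t = φ t) ∧
      ∀ t, 0 < t → HasDerivAt x (-α * (Real.exp (x (t - 1)) - 1)) t := by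
  let X : ℕ → ℝ → ℝ := fun n => (stepOp α φ)^[n] (fun t => φ (min t 0))
  have hX0 : X 0 = fun t => φ (min t 0) := rfl
  have hXs : ∀ n, X (n+1) = stepOp α φ (X n) := fun n => Function.iterate_succ_apply' _ _ _
  have hXc : ∀ n, Continuous (X n) := by
    intro n
    induction n with
    | zero => rw [hX0]; exact hφ.comp (by fun_prop)
    | succ n ih => rw [hXs]; exact stepOp_cont α hφ ih
  have hX1 : ∀ n : ℕ, ∀ t : ℝ, t ≤ n → X (n+1) t = X n t := by
    intro n
    induction n with
    | zero =>
      intro t ht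
      rw [hXs, hX0]
      have : max t 0 = 0 := max_eq_right (by simpa using ht)
      simp [stepOp, this]
    | succ n ih =>
      intro t ht
      have : stepOp α φ (X (n+1)) t = stepOp α φ (X n) t := by
        unfold stepOp
        congr 1
        apply intervalIntegral.integral_congr
        intro s hs
        rw [uIcc_of_le (le_max_right _ _)] at hs
        have hs2 : s ≤ n + 1 := hs.2.trans (max_le (by push_cast at ht; exact ht) (by positivity))
        simp only
        rw [ih (s-1) (by linarith)]
      rw [hXs (n+1), this, ← hXs n]
  have hX2 : ∀ n k : ℕ, ∀ t : ℝ, t ≤ n → X (n+k) t = X n t := by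
    intro n k
    induction k with
    | zero => intro t _; rfl
    | succ k ih =>
      intro t ht
      rw [← ih t ht, ← add_assoc]
      exact hX1 _ _ (ht.trans (by push_cast; linarith [(Nat.cast_nonneg k : (0:ℝ) ≤ k)]))
  set x : ℝ → ℝ := fun t => X ⌈t⌉₊ t with hx
  have hxn : ∀ n : ℕ, ∀ t : ℝ, t ≤ n → x t = X n t := by
    intro n t ht
    obtain ⟨k, hk⟩ := Nat.exists_eq_add_of_le (Nat.ceil_le.2 ht)
    rw [hk, hX2 _ _ _ (Nat.le_ceil t)]
  have hloc : ∀ n : ℕ, ∀ t : ℝ, t < n → x =ᶠ[nhds t] X n := by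
    intro n t ht
    filter_upwards [eventually_lt_nhds ht] with s hs
    exact hxn n s hs.le
  have hxcont : Continuous x := by
    rw [continuous_iff_continuousAt]
    intro t
    obtain ⟨n, hn⟩ := exists_nat_gt t
    exact ((hXc n).continuousAt).congr (hloc n t hn).symm
  refine ⟨x, hxcont, ?_, ?_⟩
  · intro t ht
    rw [hxn 0 t (by simpa using ht), hX0]
    simp [min_eq_left ht]
  · intro t ht
    obtain ⟨n, hn⟩ := exists_nat_gt t
    have hn' : t < (n+1 : ℕ) := hn.trans (by push_cast; linarith)
    have e1 : x =ᶠ[nhds t] fun t => ∫ s in (0:ℝ)..t, -α * (Real.exp (X n (s - 1)) - 1) := by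
      filter_upwards [hloc (n+1) t hn', eventually_gt_nhds ht] with s hs hs0
      rw [hs, hXs, stepOp, min_eq_right hs0.le, max_eq_left hs0.le, h0, zero_add]
    have h : Continuous fun s => -α * (Real.exp (X n (s - 1)) - 1) := by
      have := hXc n
      fun_prop
    have h2 := intervalIntegral.integral_hasDerivAt_right (h.intervalIntegrable 0 t)
      h.stronglyMeasurable.stronglyMeasurableAtFilter h.continuousAt
    rw [hxn n (t-1) (by linarith)]
    exact h2.congr_of_eventuallyEq e1

theorem exp_sub_le {a b : ℝ} : Real.exp b - Real.exp a ≤ Real.exp b * (b - a) := by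
  have h := Real.add_one_le_exp (a - b)
  have h2 : Real.exp a = Real.exp b * Real.exp (a - b) := by rw [← Real.exp_add]; congr 1; ring
  have := Real.exp_pos b
  rw [h2]; nlinarith

/-- Comparison of the negative parts (`x` deeper than `y`). -/
theorem compW {α : ℝ} {x y : ℝ → ℝ} {p r T : ℝ} (hx : Traj α x) (hy : Traj α y) (hα : 0 < α)
    (hp : 1 ≤ p) (hr : 1 ≤ r) (h0 : x p = y r)
    (h : ∀ t, -1 ≤ t → t ≤ 0 → y (r + t) ≤ x (p + t))
    (hE : α * (T - 1) - y (r + T) + y (r + 1) ≤ 1) :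
    (∀ t, 0 ≤ t → t ≤ T → x (p + t) ≤ y (r + t)) ∧
    (∀ t, 0 ≤ t → t ≤ T → y (r + t) - x (p + t) ≤ y (r+1) - x (p+1)) ∧
    (∀ t, 1 ≤ t → t ≤ T → (y (r+1) - x (p+1)) * (1 - (α * (t - 1) - y (r + t) + y (r+1)))
      ≤ y (r + t) - x (p + t)) := by
  set W : ℝ → ℝ := fun t => y (r + t) - x (p + t) with hW
  have hWc : Continuous W := (hy.cont.comp (by fun_prop)).sub (hx.cont.comp (by fun_prop))
  have hWd : ∀ t, -1 < t → HasDerivAt W (α * (Real.exp (x (p + t - 1)) - Real.exp (y (r + t - 1)))) t := by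
    intro t ht
    have e1 := HasDerivAt.comp_const_add r t (hy.der (r+t) (by linarith))
    have e2 := HasDerivAt.comp_const_add p t (hx.der (p+t) (by linarith))
    exact (e1.sub e2).congr_deriv (by ring)
  have hW0 : W 0 = 0 := by simp [hW, h0]
  have hmono : MonotoneOn W (Icc 0 1) := by
    apply monoOn_of_hasDeriv hWc.continuousOn (fun u hu _ => hWd u (by linarith))
    intro u hu hu1
    have := h (u - 1) (by linarith) (by linarith)
    rw [show r + (u - 1) = r + u - 1 by ring, show p + (u - 1) = p + u - 1 by ring] at this
    have := Real.exp_le_exp.2 this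
    nlinarith
  have hD0 : 0 ≤ W 1 := by rw [← hW0]; exact hmono ⟨le_rfl, zero_le_one⟩ ⟨zero_le_one, le_rfl⟩ zero_le_one
  have key : ∀ n : ℕ, ∀ t, 0 ≤ t → t ≤ T → t ≤ n + 1 → 0 ≤ W t ∧ W t ≤ W 1 ∧
      (1 ≤ t → W 1 * (1 - (α * (t - 1) - y (r + t) + y (r+1))) ≤ W t) := by
    intro n
    induction n with
    | zero =>
      intro t ht0 _ ht1
      simp only [Nat.cast_zero, zero_add] at ht1
      refine ⟨by rw [← hW0]; exact hmono ⟨le_rfl, zero_le_one⟩ ⟨ht0, ht1⟩ ht0,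
        hmono ⟨ht0, ht1⟩ ⟨zero_le_one, le_rfl⟩ ht1, fun h1 => ?_⟩
      have : t = 1 := le_antisymm ht1 h1
      subst this
      simp
    | succ n ih =>
      intro t ht0 htT ht1
      rcases le_total t (n+1) with hn | hn
      · exact ih t ht0 htT hn
      push_cast at ht1
      have hn0 : (0:ℝ) ≤ n := Nat.cast_nonneg n
      have h1t : 1 ≤ t := by linarith
      have hprev : ∀ u, 1 < u → u < t → 0 ≤ W (u-1) ∧ W (u-1) ≤ W 1 := by
        intro u h1 h2
        have := ih (u-1) (by linarith) (by linarith) (by linarith)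
        exact ⟨this.1, this.2.1⟩
      have hle : W t - W 1 ≤ 0 := by
        have := sub_le_of_deriv (C := 0) h1t hWc.continuousOn (fun u hu _ => hWd u (by linarith))
          (fun u h1 h2 => by
            have h3 := (hprev u h1 h2).1
            simp only [hW] at h3
            rw [show r + (u - 1) = r + u - 1 by ring, show p + (u - 1) = p + u - 1 by ring] at h3
            have := Real.exp_le_exp.2 (show x (p + u - 1) ≤ y (r + u - 1) by linarith)
            nlinarith)
        linarith
      have hlow : -(W 1) * ((α * (r + t) - y (r + t)) - (α * (r + 1) - y (r + 1))) ≤ W t - W 1 := by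
        have hB : ∀ u, 1 < u → u < t → HasDerivAt (fun u => -(W 1) * (α * (r + u) - y (r + u)))
            (-(W 1) * (α * Real.exp (y (r + u - 1)))) u := by
          intro u h1 h2
          exact (HasDerivAt.comp_const_add r u (hy.hasDerivB (t := r + u) (by linarith))).const_mul _
        have := sub_le_sub_of_deriv h1t (by
            have : Continuous fun u => y (r + u) := hy.cont.comp (by fun_prop)
            exact (continuous_const.mul ((continuous_const.mul
              (continuous_const.add continuous_id)).sub this)).continuousOn)
          hWc.continuousOn hB (fun u hu _ => hWd u (by linarith)) (fun u h1 h2 => by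
            obtain ⟨h3, h4⟩ := hprev u h1 h2
            simp only [hW] at h3 h4
            rw [show r + (u - 1) = r + u - 1 by ring, show p + (u - 1) = p + u - 1 by ring] at h3 h4
            have h5 := exp_sub_le (a := x (p + u - 1)) (b := y (r + u - 1))
            have h6 := Real.exp_pos (y (r + u - 1))
            have h7 : Real.exp (y (r + u - 1)) * (y (r + u - 1) - x (p + u - 1)) ≤
              Real.exp (y (r + u - 1)) * W 1 := by
              apply mul_le_mul_of_nonneg_left _ h6.le
              simpa [hW] using h4
            have h8 := mul_le_mul_of_nonneg_left (h5.trans h7) hα.le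
            linarith)
        linarith
      have hlow' : W 1 * (1 - (α * (t - 1) - y (r + t) + y (r+1))) ≤ W t := by linarith
      refine ⟨?_, by linarith, fun _ => hlow'⟩
      have hBm := hy.B_mono hα (p := r + t) (r := r + T) (by linarith) (by linarith)
      have : 0 ≤ W 1 * (1 - (α * (t - 1) - y (r + t) + y (r+1))) := by
        apply mul_nonneg hD0
        linarith
      linarith
  have key' : ∀ t, 0 ≤ t → t ≤ T → 0 ≤ W t ∧ W t ≤ W 1 ∧
      (1 ≤ t → W 1 * (1 - (α * (t - 1) - y (r + t) + y (r+1))) ≤ W t) := by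
    intro t h0 h1
    obtain ⟨n, hn⟩ := exists_nat_ge t
    exact key n t h0 h1 (by linarith)
  exact ⟨fun t h0 h1 => by have := (key' t h0 h1).1; simp only [hW] at this; linarith,
    fun t h0 h1 => (key' t h0 h1).2.1, fun t h0 h1 => (key' t (by linarith) h1).2.2 h0⟩

/-- periodic loop -/
structure Per (α : ℝ) (x : ℝ → ℝ) (q L : ℝ) : Prop extends Loop α x q L where
  per : Function.Periodic x L

/-- The negative phase of a deeper loop is at least as long. -/
theorem Loop.long {α : ℝ} {x y : ℝ → ℝ} {qx Lx qy Ly T : ℝ} (hx : Loop α x qx Lx)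
    (hy : Loop α y qy Ly) (hα : 1.9 ≤ α) (hxy : ∀ t, -1 ≤ t → t ≤ 0 → x t ≤ y t)
    (hym : MonotoneOn y (Icc (-1) 0)) (hq2 : qy ≤ 2)
    (hE : α * (T - 1) - y (qy + T) + y (qy + 1) ≤ 1) (hT : qy + T < Ly) : qx + T < Lx := by
  have hα0 : 0 < α := by linarith
  obtain ⟨-, h2, -⟩ := hx.monotonicity hy hα hxy hym hq2
  by_contra hcon
  push Not at hcon
  have hLx := hx.hL
  have hqx := hx.hq
  have hqy := hy.hq
  have := (compW hx.toTraj hy.toTraj hα0 hx.hq.le hy.hq.le (by rw [hx.xq, hy.xq]) h2 hE).1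
    (Lx - qx) (by linarith) (by linarith)
  rw [show qx + (Lx - qx) = Lx by ring, hx.xL] at this
  have := hy.negq (qy + (Lx - qx)) (by linarith) (by linarith)
  linarith

/-- admissible histories -/
structure Adm (α c : ℝ) (φ : ℝ → ℝ) : Prop where
  zero : φ 0 = 0
  mono : ∀ s t, -1 ≤ s → s ≤ t → t ≤ 0 → φ s ≤ φ t
  lip : ∀ s t, -1 ≤ s → s ≤ t → t ≤ 0 → φ t - φ s ≤ α * (t - s)
  le : ∀ t, -1 ≤ t → t ≤ 0 → φ t ≤ c * t

theorem Traj.congr_hist {α : ℝ} {x y : ℝ → ℝ} (hx : Traj α x) (hy : Traj α y)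
    (h : ∀ t, -1 ≤ t → t ≤ 0 → x t = y t) : ∀ t, -1 ≤ t → x t = y t := by
  have h01 : ∀ t, 0 ≤ t → t ≤ 1 → x t = y t := by
    intro t h0 h1
    have key : ∀ {x y : ℝ → ℝ}, Traj α x → Traj α y → (∀ t, -1 ≤ t → t ≤ 0 → x t = y t) →
        x t ≤ y t := by
      intro x y hx hy h
      have := sub_le_sub_of_deriv h0 hx.cont.continuousOn hy.cont.continuousOn
        (fun u hu _ => hx.der u hu) (fun u hu _ => hy.der u hu) (fun u h2 h3 => by
          rw [h (u-1) (by linarith) (by linarith)])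
      rw [hx.zero, hy.zero] at this
      linarith
    exact le_antisymm (key hx hy h) (key hy hx (fun t a b => (h t a b).symm))
  intro t ht
  rcases le_total t 0 with h0 | h0
  · exact h t ht h0
  · have := Traj.eq_of_window hx hy (p := 0) (r := 0) le_rfl le_rfl (by simpa using h01) t h0
    simpa using this

/-- `q ≤ 2` from a monotone history and a bound on the maximum -/
theorem Traj.at_two {α : ℝ} {x : ℝ → ℝ} (T : Traj α x) (hα : 1.9 ≤ α)
    (hm : ∀ s t, -1 ≤ s → s ≤ t → t ≤ 0 → x s ≤ x t) (hM : 0.16 ≤ x 1) : x 2 ≤ 0 := by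
  have hα0 : 0 < α := by linarith
  have hconc : ∀ t, 0 ≤ t → t ≤ 1 → x 1 * t ≤ x t := by
    intro t h0 h1
    have e1 := le_sub_of_deriv (w := x) (p := 0) (r := t) (C := -α * (Real.exp (x (t-1)) - 1)) h0
      T.cont.continuousOn (fun u hu _ => T.der u hu) (fun u h2 h3 => by
        have := Real.exp_le_exp.2 (hm (u-1) (t-1) (by linarith) (by linarith) (by linarith))
        nlinarith)
    have e2 := sub_le_of_deriv (w := x) (p := t) (r := 1) (C := -α * (Real.exp (x (t-1)) - 1)) h1
      T.cont.continuousOn (fun u hu _ => T.der u (by linarith)) (fun u h2 h3 => by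
        have := Real.exp_le_exp.2 (hm (t-1) (u-1) (by linarith) (by linarith) (by linarith))
        nlinarith)
    rw [T.zero] at e1
    set C := -α * (Real.exp (x (t-1)) - 1)
    nlinarith
  have hM0 : 0 < x 1 := by linarith
  set M := x 1
  -- x' ≤ -α (M s + (M s)^2/2)
  have := sub_le_sub_of_deriv (w := x) (p := 1) (r := 2)
    (g := fun t => -α * (M * (t-1)^2/2 + M^2 * (t-1)^3/6 + M^3 * (t-1)^4/24))
    (g' := fun t => -α * (M * (t-1) + M^2 * (t-1)^2/2 + M^3*(t-1)^3/6)) (by norm_num)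
    T.cont.continuousOn (by fun_prop) (fun u hu _ => T.der u (by linarith)) (fun u _ _ => by
      have h1 : HasDerivAt (fun t : ℝ => t - 1) 1 u := (hasDerivAt_id u).sub_const 1
      have := ((((h1.pow 2).const_mul M).div_const 2).add (((h1.pow 3).const_mul (M^2)).div_const 6)).add
        (((h1.pow 4).const_mul (M^3)).div_const 24)
      refine (this.const_mul (-α)).congr_deriv ?_
      simp only [Nat.cast_ofNat]
      ring) (fun u h1 h2 => by
      have h3 := hconc (u-1) (by linarith) (by linarith)
      have h4 : 1 + M * (u-1) + (M*(u-1))^2/2 + (M*(u-1))^3/6 ≤ Real.exp (x (u-1)) := by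
        refine le_trans ?_ (Real.exp_le_exp.2 h3)
        have h5 : 0 ≤ M * (u-1) := mul_nonneg hM0.le (by linarith)
        have := Real.sum_le_exp_of_nonneg h5 4
        simp [Finset.sum_range_succ, Nat.factorial] at this
        linarith
      nlinarith)
  norm_num at this
  have h8 : α * (M / 2 + M^2/6 + M^3/24) ≥ M := by
    have : (1.9:ℝ) * (1/2 + M/6 + M^2/24) ≥ 1 := by nlinarith
    have h9 : α * (1/2 + M/6 + M^2/24) ≥ 1 := le_trans this (by
      apply mul_le_mul_of_nonneg_right hα; positivity)
    nlinarith
  show x 2 ≤ 0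
  have : x 2 - M ≤ -(α * (M / 2 + M^2/6 + M^3/24)) := by linarith
  linarith

theorem Adm.mono_c {α c c' : ℝ} {φ : ℝ → ℝ} (h : Adm α c φ) (hc : c' ≤ c) : Adm α c' φ where
  zero := h.zero
  mono := h.mono
  lip := h.lip
  le := fun t h1 h2 => (h.le t h1 h2).trans (by nlinarith)

/-- a trajectory with a given admissible history -/
theorem Adm.traj {α c : ℝ} {φ : ℝ → ℝ} (h : Adm α c φ) (hα : 0 ≤ α) (hc : 0 < c) :
    ∃ x, Traj α x ∧ ∀ t, -1 ≤ t → t ≤ 0 → x t = φ t := by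
  set ψ : ℝ → ℝ := fun t => φ (max (-1) (min t 0)) with hψ
  have hb : ∀ t : ℝ, -1 ≤ max (-1) (min t 0) ∧ max (-1) (min t 0) ≤ 0 := fun t =>
    ⟨le_max_left _ _, max_le (by norm_num) (min_le_right _ _)⟩
  have hmono : Monotone fun t : ℝ => max (-1) (min t 0) := fun s t hst =>
    max_le_max le_rfl (min_le_min hst le_rfl)
  have hone : ∀ s t : ℝ, s ≤ t → max (-1) (min t 0) - max (-1) (min s 0) ≤ t - s := by
    intro s t hst
    rcases max_cases (-1) (min t 0) with h1 | h1 <;> rcases max_cases (-1) (min s 0) with h2 | h2 <;>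
    rcases min_cases t 0 with h3 | h3 <;> rcases min_cases s 0 with h4 | h4 <;> linarith
  have hψc : Continuous ψ := by
    have : LipschitzWith ⟨α, hα⟩ ψ := by
      apply LipschitzWith.of_dist_le_mul
      have key : ∀ s t, s ≤ t → |ψ s - ψ t| ≤ α * |s - t| := by
        intro s t hst
        have h1 := h.mono _ _ (hb s).1 (hmono hst) (hb t).2
        have h2 := h.lip _ _ (hb s).1 (hmono hst) (hb t).2
        have h3 := hone s t hst
        simp only [hψ]
        rw [abs_of_nonpos (by linarith), abs_of_nonpos (by linarith)]
        simp only at h1 h2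
        nlinarith
      intro s t
      rw [Real.dist_eq, Real.dist_eq]
      rcases le_total s t with hst | hst
      · exact key s t hst
      · rw [abs_sub_comm, abs_sub_comm s t]; exact key t s hst
    exact this.continuous
  have hψe : ∀ t, -1 ≤ t → t ≤ 0 → ψ t = φ t := by
    intro t h1 h2
    simp only [hψ]
    rw [min_eq_left h2, max_eq_right h1]
  obtain ⟨x, hx1, hx2, hx3⟩ := exists_sol α hψc (by rw [hψe 0 (by norm_num) le_rfl, h.zero])
  have hxe : ∀ t, -1 ≤ t → t ≤ 0 → x t = φ t := fun t h1 h2 => by rw [hx2 t h2, hψe t h1 h2]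
  refine ⟨x, ⟨hx1, hx3, by rw [hxe 0 (by norm_num) le_rfl, h.zero], ?_⟩, hxe⟩
  intro t h1 h2
  rw [hxe t h1 h2.le]
  have := h.le t h1 h2.le
  nlinarith

theorem Adm.lin {α c : ℝ} (hc : 0 ≤ c) (hcα : c ≤ α) : Adm α c (fun t => c * t) where
  zero := by simp
  mono := fun s t _ h _ => by nlinarith
  lip := fun s t _ h _ => by nlinarith
  le := fun t _ _ => le_rfl

/-- data of the final lower pass: `y` is a loop with linear history `c t` that reproduces the barrier. -/
structure Base (α c : ℝ) (y : ℝ → ℝ) (q L : ℝ) : Prop extends Loop α y q L where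
  hc0 : 0 < c
  hcα : c ≤ α
  hist : ∀ t, -1 ≤ t → t ≤ 0 → y t = c * t
  q2 : q ≤ 2
  M16 : 0.16 ≤ y 1
  A1 : α - y (q + 2) + y (q + 1) ≤ 1
  L2 : q + 2 < L
  ret : ∀ t, -1 ≤ t → t ≤ 0 → y (L + t) ≤ c * t

theorem Base.histMono {α c : ℝ} {y : ℝ → ℝ} {q L : ℝ} (B : Base α c y q L) : MonotoneOn y (Icc (-1) 0) := by
  intro s hs t ht hst
  rw [B.hist s hs.1 hs.2, B.hist t ht.1 ht.2]
  have := B.hc0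
  nlinarith

/-- loops over admissible histories -/
theorem Base.loop {α c : ℝ} {y : ℝ → ℝ} {q L : ℝ} (B : Base α c y q L) (hα : 1.9 ≤ α) {φ : ℝ → ℝ}
    (h : Adm α c φ) : ∃ x qx Lx, Loop α x qx Lx ∧ qx ≤ 2 ∧ (∀ t, -1 ≤ t → t ≤ 0 → x t = φ t) ∧
      Adm α c (fun t => x (Lx + t)) := by
  have hα0 : 0 < α := by linarith
  obtain ⟨x, hx, hxφ⟩ := h.traj hα0.le B.hc0
  have hxy : ∀ t, -1 ≤ t → t ≤ 0 → x t ≤ y t := fun t h1 h2 => by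
    rw [hxφ t h1 h2, B.hist t h1 h2]; exact h.le t h1 h2
  have hM : y 1 ≤ x 1 := by
    have := Traj.sub_le_sub (s := 0) B.toTraj hx hα0 (p := 0) (r := 1) le_rfl (by norm_num) (by norm_num)
      (fun t h1 h2 => by simpa using hxy t (by linarith) (by linarith))
    simp only [add_zero] at this
    rw [hx.zero, B.zero] at this
    linarith
  have h2 : x 2 ≤ 0 := hx.at_two hα (fun s t h1 h2 h3 => by
    rw [hxφ s h1 (by linarith), hxφ t (by linarith) h3]; exact h.mono s t h1 h2 h3) (B.M16.trans hM)
  obtain ⟨qx, Lx, hl, hqx⟩ := hx.exists_loop hα (by norm_num : (1:ℝ) < 2) h2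
  have hl2 : qx + 2 < Lx := hl.long B.toLoop hα hxy B.histMono B.q2 (by linarith [B.A1]) B.L2
  refine ⟨x, qx, Lx, hl, hqx, hxφ, ?_⟩
  have hm := hl.monotonicity B.toLoop hα hxy B.histMono B.q2
  have hq1 := hl.hq
  refine ⟨by simp [hl.xL], ?_, ?_, ?_⟩
  · intro s t h1 h2 h3
    exact hl.mono2 hα0 ⟨by linarith, by linarith⟩ ⟨by linarith, by linarith⟩ (by linarith)
  · intro s t h1 h2 h3
    have := hl.B_mono hα0 (p := Lx + s) (r := Lx + t) (by linarith) (by linarith)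
    linarith
  · intro t h1 h2
    exact (hm.2.2.2 t h1 h2).trans (B.ret t h1 h2)

/-- The periodic extension of a loop which reproduces its history -/
theorem Loop.toPer {α : ℝ} {z : ℝ → ℝ} {q L : ℝ} (T : Loop α z q L)
    (h : ∀ t, -1 ≤ t → t ≤ 0 → z (L + t) = z t) :
    ∃ x, Per α x q L ∧ WrightSol α x ∧ ∀ t, -1 ≤ t → x t = z t := by
  have hL0 : 0 < L := by linarith [T.hL, T.hq]
  have hz : ∀ t, -1 ≤ t → z (t + L) = z t :=
    T.shift.congr_hist T.toTraj (fun t h1 h2 => by rw [add_comm]; exact h t h1 h2)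
  have hzn : ∀ n : ℕ, ∀ t, -1 ≤ t → z (t + n * L) = z t := by
    intro n
    induction n with
    | zero => intro t _; simp
    | succ n ih =>
      intro t ht
      push_cast
      rw [show t + ((n:ℝ) + 1) * L = (t + n * L) + L by ring, hz _ (by
        have : (0:ℝ) ≤ n * L := by positivity
        linarith), ih t ht]
  set x : ℝ → ℝ := fun t => z (t - ⌊t / L⌋ * L) with hx
  have hfl : ∀ t : ℝ, 0 ≤ t - ⌊t / L⌋ * L := by
    intro t
    have h1 := Int.floor_le (t / L)
    rw [le_div_iff₀ hL0] at h1
    linarith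
  have hxz : ∀ n : ℤ, ∀ t, -1 ≤ t + n * L → x t = z (t + n * L) := by
    intro n t ht
    simp only [hx]
    rcases le_total (-⌊t / L⌋) n with h1 | h1
    · obtain ⟨k, hk⟩ := Int.eq_ofNat_of_zero_le (show 0 ≤ n + ⌊t/L⌋ by linarith)
      have hk' : (n:ℝ) + (⌊t/L⌋:ℝ) = k := by exact_mod_cast hk
      rw [show t + n * L = (t - ⌊t / L⌋ * L) + k * L by rw [← hk']; ring,
        hzn k _ (by linarith [hfl t])]
    · obtain ⟨k, hk⟩ := Int.eq_ofNat_of_zero_le (show 0 ≤ - ⌊t/L⌋ - n by linarith)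
      have hk' : - (⌊t/L⌋:ℝ) - n = k := by exact_mod_cast hk
      rw [show t - ⌊t / L⌋ * L = (t + n * L) + k * L by rw [← hk']; ring,
        hzn k _ ht]
  have hw : WrightSol α x := by
    intro t
    obtain ⟨n, hn⟩ := exists_nat_gt ((1 - t) / L)
    rw [div_lt_iff₀ hL0] at hn
    have hd := HasDerivAt.comp_add_const t (n * L) (T.der (t + n * L) (by linarith))
    have e : x =ᶠ[nhds t] fun s => z (s + n * L) := by
      filter_upwards [eventually_gt_nhds (show t - 1 < t by linarith)] with s hs
      have := hxz n s (by push_cast; linarith)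
      simpa using this
    have e2 : x (t - 1) = z (t + n * L - 1) := by
      have := hxz n (t-1) (by push_cast; linarith)
      rw [this]; push_cast; congr 1; ring
    rw [e2]
    exact hd.congr_of_eventuallyEq e
  have hxz0 : ∀ t, -1 ≤ t → x t = z t := fun t ht => by simpa using hxz 0 t (by simpa using ht)
  have hq := T.hq
  have hL := T.hL
  refine ⟨x, ?_, hw, hxz0⟩
  refine { cont := ?_, der := fun t _ => hw t, zero := ?_, neg := ?_, hq := hq, hL := hL,
           pos := ?_, xq := ?_, negq := ?_, xL := ?_, per := ?_ }
  · rw [continuous_iff_continuousAt]; exact fun t => (hw t).continuousAt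
  · rw [hxz0 0 (by norm_num), T.zero]
  · intro t h1 h2; rw [hxz0 t h1]; exact T.neg t h1 h2
  · intro t h1 h2; rw [hxz0 t (by linarith)]; exact T.pos t h1 h2
  · rw [hxz0 q (by linarith), T.xq]
  · intro t h1 h2; rw [hxz0 t (by linarith)]; exact T.negq t h1 h2
  · rw [hxz0 L (by linarith), T.xL]
  · intro t
    obtain ⟨n, hn⟩ := exists_nat_gt ((1 - t) / L)
    rw [div_lt_iff₀ hL0] at hn
    rw [hxz (n+1) t (by push_cast; linarith), hxz n (t + L) (by push_cast; linarith)]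
    congr 1; push_cast; ring

theorem Per.toSOPS {α : ℝ} {x : ℝ → ℝ} {q L : ℝ} (T : Per α x q L) (hw : WrightSol α x) : SOPS α x := by
  have hq := T.hq
  have hL := T.hL
  refine ⟨hw, q, L - q, hq, by linarith, ⟨0, ?_, ?_⟩, ?_, ?_⟩
  · intro t ht; simpa using T.pos t ht.1 ht.2
  · intro t ht; simpa using T.negq t ht.1 (by linarith [ht.2])
  · simpa using T.per
  · intro p hp hper
    rw [show q + (L - q) = L by ring]
    by_contra hcon
    push Not at hcon
    have h0 : x p = 0 := by have := hper 0; rw [zero_add] at this; rw [this, T.zero]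
    rcases lt_trichotomy p q with h | h | h
    · have := T.pos p hp h; linarith
    · have h5 : 0 < min 1 ((L-q)/2) := lt_min one_pos (by linarith)
      have h1 := hper (min 1 ((L - q)/2))
      have h2 := T.pos (min 1 ((L-q)/2)) (lt_min one_pos (by linarith)) (by linarith [min_le_left 1 ((L-q)/2)])
      have h3 := T.negq (min 1 ((L-q)/2) + p) (by linarith) (by linarith [min_le_right 1 ((L-q)/2)])
      linarith
    · have := T.negq p h hcon; linarith

theorem SOPS.toPer {α : ℝ} {x : ℝ → ℝ} (h : SOPS α x) : ∃ τ q L, Per α (fun t => x (t + τ)) q L := by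
  obtain ⟨hw, q, qb, hq, hqb, ⟨τ, h1, h2⟩, hper, -⟩ := h
  have hc : Continuous x := continuous_iff_continuousAt.2 fun t => (hw t).continuousAt
  set z : ℝ → ℝ := fun t => x (t + τ) with hz
  have hzc : Continuous z := hc.comp (by fun_prop)
  have hzp : Function.Periodic z (q + qb) := fun t => by
    simp only [hz]; rw [show t + (q + qb) + τ = (t + τ) + (q + qb) by ring]; exact hper _
  have hneg : ∀ t, -qb < t → t < 0 → z t < 0 := by
    intro t h3 h4
    rw [← hzp t]
    exact h2 _ ⟨by linarith, by linarith⟩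
  -- boundary zeros by continuity
  have bd1 : ∀ {w : ℝ → ℝ} {a b c : ℝ}, Continuous w → a < b → b < c →
      (∀ t, a < t → t < b → w t ≤ 0) → (∀ t, b < t → t < c → 0 ≤ w t) → w b = 0 := by
    intro w a b c hw hab hbc hl hr
    apply le_antisymm
    · have : b ∈ closure (Ioo a b) := by rw [closure_Ioo hab.ne]; exact ⟨hab.le, le_rfl⟩
      have h3 : Ioo a b ⊆ w ⁻¹' Iic 0 := fun t ht => hl t ht.1 ht.2
      exact (closure_minimal h3 (isClosed_Iic.preimage hw)) this
    · have : b ∈ closure (Ioo b c) := by rw [closure_Ioo hbc.ne]; exact ⟨le_rfl, hbc.le⟩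
      have h3 : Ioo b c ⊆ w ⁻¹' Ici 0 := fun t ht => hr t ht.1 ht.2
      exact (closure_minimal h3 (isClosed_Ici.preimage hw)) this
  have hz0 : z 0 = 0 := bd1 hzc (a := -qb) (c := q) (by linarith) (by linarith)
    (fun t h3 h4 => (hneg t h3 h4).le) (fun t h3 h4 => (h1 t ⟨h3, h4⟩).le)
  have hzq : z q = 0 := by
    have := bd1 (w := fun t => - z t) hzc.neg (a := 0) (b := q) (c := q + qb) (by linarith) (by linarith)
      (fun t h3 h4 => by have := h1 t ⟨h3, h4⟩; simp only [hz]; linarith)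
      (fun t h3 h4 => by have := h2 t ⟨h3, h4⟩; simp only [hz]; linarith)
    linarith
  refine ⟨τ, q, q + qb, { cont := hzc, der := ?_, zero := hz0, neg := ?_, hq := hq, hL := by linarith,
                            pos := fun t h3 h4 => h1 t ⟨h3, h4⟩, xq := hzq, negq := fun t h3 h4 => h2 t ⟨h3, h4⟩, xL := ?_, per := hzp }⟩
  · intro t _
    have := HasDerivAt.comp_add_const t τ (hw (t + τ))
    rw [show t + τ - 1 = t - 1 + τ by ring] at this
    exact this
  · intro t h3 h4; exact hneg t (by linarith) h4
  · have := hzp 0; rw [zero_add] at this; exact this.trans hz0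

theorem Base.perAdm {α c : ℝ} {y x : ℝ → ℝ} {q L qx Lx : ℝ} (B : Base α c y q L) (hα : 1.9 ≤ α)
    (hx : Per α x qx Lx) (hb : ∀ t, -1 ≤ t → t ≤ 0 → x t ≤ c * t) : Adm α c x ∧ qx + 2 < Lx ∧ qx ≤ 2 := by
  have hα0 : 0 < α := by linarith
  have hxy : ∀ t, -1 ≤ t → t ≤ 0 → x t ≤ y t := fun t h1 h2 => by
    rw [B.hist t h1 h2]; exact hb t h1 h2
  have hl2 : qx + 2 < Lx := hx.long B.toLoop hα hxy B.histMono B.q2 (by linarith [B.A1]) B.L2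
  have hq1 := hx.hq
  have hA : Adm α c x := by
    refine ⟨hx.zero, ?_, ?_, hb⟩
    · intro s t h1 h2 h3
      have := hx.mono2 hα0 (a := Lx + s) (b := Lx + t) ⟨by linarith, by linarith⟩
        ⟨by linarith, by linarith⟩ (by linarith)
      rwa [add_comm Lx s, add_comm Lx t, hx.per s, hx.per t] at this
    · intro s t h1 h2 h3
      have := hx.B_mono hα0 (p := Lx + s) (r := Lx + t) (by linarith) (by linarith)
      rw [add_comm Lx s, add_comm Lx t, hx.per s, hx.per t] at this
      linarith
  refine ⟨hA, hl2, ?_⟩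
  have hM : y 1 ≤ x 1 := by
    have := (hx.monotonicity B.toLoop hα hxy B.histMono B.q2).1 1 (by norm_num) le_rfl
    exact this
  have := hx.toTraj.at_two hα hA.mono (B.M16.trans hM)
  by_contra hcon
  push Not at hcon
  linarith [hx.pos 2 (by norm_num) hcon]

/-- Tarski: a greatest periodic loop exists. -/
theorem Base.greatest {α c : ℝ} {y : ℝ → ℝ} {q L : ℝ} (B : Base α c y q L) (hα : 1.9 ≤ α) :
    ∃ z qz Lz, Per α z qz Lz ∧ WrightSol α z ∧ Adm α c z ∧
      ∀ x qx Lx, Per α x qx Lx → Adm α c x → ∀ t, -1 ≤ t → t ≤ 0 → x t ≤ z t := by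
  classical
  have hα0 : 0 < α := by linarith
  choose! X Q LL hX using fun (φ : ℝ → ℝ) (h : Adm α c φ) => B.loop hα h
  have hmon : ∀ φ ψ, Adm α c φ → Adm α c ψ → (∀ t, -1 ≤ t → t ≤ 0 → φ t ≤ ψ t) →
      ∀ t, -1 ≤ t → t ≤ 0 → X φ (LL φ + t) ≤ X ψ (LL ψ + t) := by
    intro φ ψ h1 h2 h
    obtain ⟨a1, a2, a3, a4⟩ := hX φ h1
    obtain ⟨b1, b2, b3, b4⟩ := hX ψ h2
    refine (a1.monotonicity b1 hα (fun t ht1 ht2 => ?_) ?_ b2).2.2.2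
    · rw [a3 t ht1 ht2, b3 t ht1 ht2]; exact h t ht1 ht2
    · intro s hs t ht hst
      rw [b3 s hs.1 hs.2, b3 t ht.1 ht.2]
      exact h2.mono s t hs.1 hst ht.2
  set S : Set (ℝ → ℝ) := {φ | Adm α c φ ∧ ∀ t, -1 ≤ t → t ≤ 0 → φ t ≤ X φ (LL φ + t)} with hS
  have hSne : S.Nonempty := by
    have hlin : Adm α c (fun t => α * t) := (Adm.lin hα0.le le_rfl).mono_c B.hcα
    refine ⟨_, hlin, fun t h1 h2 => ?_⟩
    obtain ⟨a1, a2, a3, a4⟩ := hX _ hlin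
    have h3 := a4.lip t 0 h1 h2 le_rfl
    have h4 := a4.zero
    rw [h4] at h3
    linarith
  set Φ : ℝ → ℝ := fun t => ⨆ φ : S, (φ : ℝ → ℝ) t with hΦ
  have : Nonempty S := hSne.to_subtype
  have hbd : ∀ t, -1 ≤ t → t ≤ 0 → BddAbove (range fun φ : S => (φ : ℝ → ℝ) t) := by
    intro t h1 h2
    refine ⟨c * t, ?_⟩
    rintro _ ⟨φ, rfl⟩
    exact φ.2.1.le t h1 h2
  have hle : ∀ φ ∈ S, ∀ t, -1 ≤ t → t ≤ 0 → φ t ≤ Φ t := fun φ hφ t h1 h2 =>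
    le_ciSup (hbd t h1 h2) (⟨φ, hφ⟩ : S)
  have hΦA : Adm α c Φ := by
    refine ⟨?_, ?_, ?_, ?_⟩
    · simp only [hΦ]
      have : ∀ φ : S, (φ : ℝ → ℝ) 0 = 0 := fun φ => φ.2.1.zero
      simp [this]
    · intro s t h1 h2 h3
      apply ciSup_le
      intro φ
      exact (φ.2.1.mono s t h1 h2 h3).trans (hle φ φ.2 t (by linarith) h3)
    · intro s t h1 h2 h3
      rw [sub_le_iff_le_add]
      apply ciSup_le
      intro φ
      have := φ.2.1.lip s t h1 h2 h3
      have := hle φ φ.2 s h1 (by linarith)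
      linarith
    · intro t h1 h2
      apply ciSup_le
      intro φ
      exact φ.2.1.le t h1 h2
  obtain ⟨a1, a2, a3, a4⟩ := hX Φ hΦA
  have hup : ∀ t, -1 ≤ t → t ≤ 0 → Φ t ≤ X Φ (LL Φ + t) := by
    intro t h1 h2
    apply ciSup_le
    intro φ
    exact (φ.2.2 t h1 h2).trans (hmon φ Φ φ.2.1 hΦA (hle φ φ.2) t h1 h2)
  have hfix : ∀ t, -1 ≤ t → t ≤ 0 → X Φ (LL Φ + t) = Φ t := by
    intro t h1 h2
    refine le_antisymm ?_ (hup t h1 h2)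
    exact hle (fun t => X Φ (LL Φ + t)) ⟨a4, hmon Φ _ hΦA a4 hup⟩ t h1 h2
  obtain ⟨z, hz1, hz2, hz3⟩ := a1.toPer (fun t h1 h2 => by rw [hfix t h1 h2, a3 t h1 h2])
  have hzΦ : ∀ t, -1 ≤ t → t ≤ 0 → z t = Φ t := fun t h1 h2 => by rw [hz3 t h1, a3 t h1 h2]
  refine ⟨z, _, _, hz1, hz2, ?_, ?_⟩
  · refine ⟨hz1.zero, ?_, ?_, ?_⟩
    · intro s t h1 h2 h3
      rw [hzΦ s h1 (by linarith), hzΦ t (by linarith) h3]; exact hΦA.mono s t h1 h2 h3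
    · intro s t h1 h2 h3
      rw [hzΦ s h1 (by linarith), hzΦ t (by linarith) h3]; exact hΦA.lip s t h1 h2 h3
    · intro t h1 h2
      rw [hzΦ t h1 h2]; exact hΦA.le t h1 h2
  · intro x qx Lx hx hxA t h1 h2
    rw [hzΦ t h1 h2]
    refine hle x ⟨hxA, fun t h1 h2 => ?_⟩ t h1 h2
    obtain ⟨b1, b2, b3, b4⟩ := hX x hxA
    have := (hx.monotonicity b1 hα (fun t h1 h2 => (b3 t h1 h2).ge) ?_ b2).2.2.2 t h1 h2
    · rwa [add_comm Lx t, hx.per t] at this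
    · intro s hs t ht hst
      rw [b3 s hs.1 hs.2, b3 t ht.1 ht.2]
      exact hxA.mono s t hs.1 hst ht.2

theorem Per.eq_of_nonneg {α : ℝ} {x y : ℝ → ℝ} {qx Lx qy Ly : ℝ} (hx : Per α x qx Lx) (hy : Per α y qy Ly)
    (h1 : ∀ t, 0 ≤ t → x t = y t) : ∀ t, x t = y t := by
  have hqx := hx.hq
  have hqy := hy.hq
  have hLx := hx.hL
  have hLy := hy.hL
  have key : ∀ {x y : ℝ → ℝ} {qx Lx qy Ly : ℝ}, Per α x qx Lx → Per α y qy Ly →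
      (∀ t, 0 ≤ t → x t = y t) → qx ≤ qy := by
    intro x y qx Lx qy Ly hx hy h
    by_contra hcon
    push Not at hcon
    have h2 := hx.pos qy (by linarith [hy.hq]) hcon
    rw [h qy (by linarith [hy.hq]), hy.xq] at h2
    exact lt_irrefl _ h2
  have hq : qx = qy := le_antisymm (key hx hy h1) (key hy hx (fun t ht => (h1 t ht).symm))
  have key : ∀ {x y : ℝ → ℝ} {q Lx Ly : ℝ}, Per α x q Lx → Per α y q Ly →
      (∀ t, 0 ≤ t → x t = y t) → Lx ≤ Ly := by
    intro x y q Lx Ly hx hy h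
    by_contra hcon
    push Not at hcon
    have h2 := hx.negq Ly (by linarith [hy.hL]) hcon
    rw [h Ly (by linarith [hy.hL, hy.hq]), hy.xL] at h2
    exact lt_irrefl _ h2
  subst hq
  have hL : Lx = Ly := le_antisymm (key hx hy h1) (key hy hx (fun t ht => (h1 t ht).symm))
  subst hL
  intro t
  obtain ⟨n, hn⟩ := exists_nat_gt ((- t) / Lx)
  rw [div_lt_iff₀ (by linarith)] at hn
  rw [← hx.per.nat_mul n t, ← hy.per.nat_mul n t]
  exact h1 _ (by linarith)

theorem Per.eq_of_hist {α : ℝ} {x y : ℝ → ℝ} {qx Lx qy Ly : ℝ} (hx : Per α x qx Lx) (hy : Per α y qy Ly)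
    (h : ∀ t, -1 ≤ t → t ≤ 0 → x t = y t) : ∀ t, x t = y t :=
  hx.eq_of_nonneg hy (fun t ht => hx.toTraj.congr_hist hy.toTraj h t (by linarith))

/-- the abstract conclusion -/
theorem Base.conclude {α c : ℝ} {y : ℝ → ℝ} {q L : ℝ} (B : Base α c y q L) (hα : 1.9 ≤ α)
    (hbar : ∀ x qx Lx, Per α x qx Lx → ∀ t, -1 ≤ t → t ≤ 0 → x t ≤ c * t)
    (hU : ∀ x qx Lx z qz Lz, Per α x qx Lx → Per α z qz Lz → Adm α c x → Adm α c z →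
      qx + 2 < Lx → qz + 2 < Lz → qx ≤ 2 → qz ≤ 2 →
      (∀ t, -1 ≤ t → t ≤ 0 → x t ≤ z t) → ∀ t, -1 ≤ t → t ≤ 0 → x t = z t) :
    (∃ x : ℝ → ℝ, SOPS α x) ∧
      (∀ x y : ℝ → ℝ, SOPS α x → SOPS α y → ∃ τ : ℝ, ∀ t : ℝ, y t = x (t + τ)) := by
  obtain ⟨z, qz, Lz, hz, hzw, hzA, hzg⟩ := B.greatest hα
  obtain ⟨-, z2, z3⟩ := B.perAdm hα hz hzA.le
  refine ⟨⟨z, hz.toSOPS hzw⟩, fun x y hx hy => ?_⟩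
  have key : ∀ x, SOPS α x → ∃ τ, ∀ t, x (t + τ) = z t := by
    intro x hx
    obtain ⟨τ, qx, Lx, hP⟩ := hx.toPer
    obtain ⟨x1, x2, x3⟩ := B.perAdm hα hP (hbar _ _ _ hP)
    exact ⟨τ, hP.eq_of_hist hz (hU _ _ _ _ _ _ hP hz x1 hzA x2 z2 x3 z3 (hzg _ _ _ hP x1))⟩
  obtain ⟨τ1, h1⟩ := key x hx
  obtain ⟨τ2, h2⟩ := key y hy
  refine ⟨τ1 - τ2, fun t => ?_⟩
  have e1 := h1 (t - τ2)
  have e2 := h2 (t - τ2)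
  rw [show t - τ2 + τ2 = t by ring] at e2
  rw [show t + (τ1 - τ2) = t - τ2 + τ1 by ring, e1, e2]

/-- all periodic loops lie below the line of slope `c` -/
def Barrier (α c : ℝ) : Prop := ∀ x q L, Per α x q L → ∀ t, -1 ≤ t → t ≤ 0 → x t ≤ c * t

theorem Barrier.mono {α c c' : ℝ} (h : Barrier α c) (hc : c' ≤ c) : Barrier α c' := fun x q L hx t h1 h2 =>
  (h x q L hx t h1 h2).trans (by nlinarith)

/-- one pass of the barrier -/
theorem Barrier.step {α c c' : ℝ} (h : Barrier α c) (hα : 1.9 ≤ α) (hc : 0 ≤ c) {y : ℝ → ℝ} {q L : ℝ}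
    (hy : Loop α y q L) (hist : ∀ t, -1 ≤ t → t ≤ 0 → y t = c * t) (hq : q ≤ 2)
    (hr : ∀ t, -1 ≤ t → t ≤ 0 → y (L + t) ≤ c' * t) : Barrier α c' := by
  intro x qx Lx hx t h1 h2
  have := (hx.monotonicity hy hα (fun t h1 h2 => by rw [hist t h1 h2]; exact h x qx Lx hx t h1 h2)
    (by
      intro s hs t ht hst
      rw [hist s hs.1 hs.2, hist t ht.1 ht.2]
      nlinarith) hq).2.2.2 t h1 h2
  rw [add_comm Lx t, hx.per t] at this
  exact this.trans (hr t h1 h2)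

/-- loops with a long negative phase return deep -/
theorem Loop.deep {α : ℝ} {x : ℝ → ℝ} {q L : ℝ} (T : Loop α x q L) (hα : 0 < α) (h3 : q + 3 ≤ L) :
    α * (1 - Real.exp (x (L-1))) ≤ - x (L-1) := by
  have := T.speed hα (p := L - 1) (r := L) (C := x (L-1)) (by linarith) (by linarith) (by linarith) le_rfl
  rw [T.xL] at this
  linarith

/-- small mode: a uniform expansion for small slopes gives a barrier. -/
theorem Barrier.small {α c0 ε : ℝ} (hα : 1.9 ≤ α) (hc0 : 0 < c0) (hε : 0 < ε)
    (h : ∀ c, 0 < c → c ≤ c0 → ∃ y q L, Loop α y q L ∧ (∀ t, -1 ≤ t → t ≤ 0 → y t = c * t) ∧ q ≤ 2 ∧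
      ∀ t, -1 ≤ t → t ≤ 0 → y (L + t) ≤ (1 + ε) * c * t) : Barrier α c0 := by
  intro x qx Lx hx
  have hα0 : 0 < α := by linarith
  have hL := hx.hL
  have hq := hx.hq
  have hn := hx.negq (Lx - 1) (by linarith) (by linarith)
  set c1 := min (- x (Lx - 1)) (α * (1 - Real.exp (x (Lx - 1)))) with hc1
  have hc1p : 0 < c1 := lt_min (by linarith) (mul_pos hα0 (by
    have := Real.exp_lt_one_iff.2 hn; linarith))
  have step0 : ∀ t, -1 ≤ t → t ≤ 0 → x t ≤ c1 * t := by
    intro t h1 h2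
    have := hx.lemG hα0 hc1p (min_le_left _ _) (min_le_right _ _) h1 h2
    rwa [add_comm Lx t, hx.per t] at this
  have step : ∀ c, 0 < c → c ≤ c0 → (∀ t, -1 ≤ t → t ≤ 0 → x t ≤ c * t) →
      ∀ t, -1 ≤ t → t ≤ 0 → x t ≤ (1 + ε) * c * t := by
    intro c hcp hcc hb t h1 h2
    obtain ⟨y, q, L, hy, hist, hq2, hr⟩ := h c hcp hcc
    have := (hx.monotonicity hy hα (fun t h1 h2 => by rw [hist t h1 h2]; exact hb t h1 h2)
      (by
        intro s hs t ht hst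
        rw [hist s hs.1 hs.2, hist t ht.1 ht.2]
        nlinarith) hq2).2.2.2 t h1 h2
    rw [add_comm Lx t, hx.per t] at this
    exact this.trans (hr t h1 h2)
  have all : ∀ n : ℕ, ∀ t, -1 ≤ t → t ≤ 0 → x t ≤ min c0 ((1 + n * ε) * c1) * t := by
    intro n
    induction n with
    | zero =>
      intro t h1 h2
      have := step0 t h1 h2
      have h3 := min_le_right c0 ((1 + (0:ℕ) * ε) * c1)
      simp only [Nat.cast_zero, zero_mul, add_zero, one_mul] at h3 ⊢
      nlinarith
    | succ n ih =>
      intro t h1 h2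
      have hn0 : (0:ℝ) ≤ n := Nat.cast_nonneg n
      have hp : 0 < (1 + n * ε) * c1 := by positivity
      have := step _ (lt_min hc0 hp) (min_le_left _ _) ih t h1 h2
      refine this.trans (mul_le_mul_of_nonpos_right ?_ h2)
      rcases min_cases c0 ((1 + n * ε) * c1) with h3 | h3
      · rw [h3.1]
        exact (min_le_left _ _).trans (by nlinarith)
      · rw [h3.1]
        refine (min_le_right _ _).trans ?_
        push_cast
        have : 0 ≤ n * ε * ε * c1 := by positivity
        nlinarith
  obtain ⟨n, hn⟩ := exists_nat_gt (c0 / (ε * c1))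
  rw [div_lt_iff₀ (by positivity)] at hn
  have := all n
  rwa [min_eq_left (by nlinarith)] at this

/-- an ordered pair of admissible periodic loops, `x` deeper than `z` -/
structure Pair (α c : ℝ) (x : ℝ → ℝ) (qx Lx : ℝ) (z : ℝ → ℝ) (qz Lz : ℝ) : Prop where
  hα : 1.9 ≤ α
  hc : 0 < c
  hx : Per α x qx Lx
  hz : Per α z qz Lz
  ax : Adm α c x
  az : Adm α c z
  lx : qx + 2 < Lx
  lz : qz + 2 < Lz
  qx2 : qx ≤ 2
  qz2 : qz ≤ 2
  le : ∀ t, -1 ≤ t → t ≤ 0 → x t ≤ z t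

namespace Pair
variable {α c : ℝ} {x z : ℝ → ℝ} {qx Lx qz Lz : ℝ}

theorem mon (P : Pair α c x qx Lx z qz Lz) :
    (∀ t, 0 ≤ t → t ≤ 1 → z t ≤ x t) ∧
    (∀ t, -1 ≤ t → t ≤ 0 → z (qz + t) ≤ x (qx + t)) ∧
    (∀ t, 0 ≤ t → t ≤ 1 → x (qx + t) ≤ z (qz + t)) ∧
    (∀ t, -1 ≤ t → t ≤ 0 → x (Lx + t) ≤ z (Lz + t)) :=
  P.hx.monotonicity P.hz.toLoop P.hα P.le
    (fun s hs t ht hst => P.az.mono s t hs.1 hst ht.2) P.qz2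

theorem D_nonneg (P : Pair α c x qx Lx z qz Lz) : 0 ≤ x 1 - z 1 := by
  have := P.mon.1 1 (by norm_num) le_rfl; linarith

theorem Delta_nonneg (P : Pair α c x qx Lx z qz Lz) : 0 ≤ z (qz+1) - x (qx+1) := by
  have := P.mon.2.2.1 1 (by norm_num) le_rfl; linarith

theorem hasDeriv_d (P : Pair α c x qx Lx z qz Lz) {t : ℝ} (ht : 0 < t) :
    HasDerivAt (fun t => x t - z t) (-(α * (Real.exp (x (t-1)) - Real.exp (z (t-1))))) t :=
  ((P.hx.der t ht).sub (P.hz.der t ht)).congr_deriv (by ring)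

set_option maxHeartbeats 1000000 in
/-- First half of the contraction estimate. -/
theorem contrA (P : Pair α c x qx Lx z qz Lz) {p : ℝ} (hp : x (qx - 1) ≤ p) :
    z (qz+1) - x (qx+1) ≤ (x 1 - z 1) * (α - 1 - x (qx+1) + Real.exp p / 2) := by
  have hα0 : 0 < α := by linarith [P.hα]
  have hqx := P.hx.hq
  have hqz := P.hz.hq
  have hqx2 := P.qx2
  have hlx := P.lx
  have hlz := P.lz
  set D := x 1 - z 1 with hD
  have hD0 : 0 ≤ D := P.D_nonneg
  set d : ℝ → ℝ := fun t => x t - z t with hd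
  have hdc : Continuous d := P.hx.cont.sub P.hz.cont
  have hdd : ∀ t, 0 < t → HasDerivAt d (-(α * (Real.exp (x (t-1)) - Real.exp (z (t-1))))) t :=
    fun t ht => P.hasDeriv_d ht
  have hm01 : MonotoneOn d (Icc 0 1) := by
    apply monoOn_of_hasDeriv hdc.continuousOn (fun u hu _ => hdd u hu)
    intro u h1 h2
    have := Real.exp_le_exp.2 (P.le (u-1) (by linarith) (by linarith))
    nlinarith
  have hd0 : d 0 = 0 := by simp [hd, P.hx.zero, P.hz.zero]
  have hd01 : ∀ t, 0 ≤ t → t ≤ 1 → 0 ≤ d t ∧ d t ≤ D := fun t h0 h1 =>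
    ⟨by rw [← hd0]; exact hm01 ⟨le_rfl, zero_le_one⟩ ⟨h0, h1⟩ h0,
     hm01 ⟨h0, h1⟩ ⟨zero_le_one, le_rfl⟩ h1⟩
  -- derivative bounds
  have hder_lo : ∀ t, 0 < t → -(α * Real.exp (x (t-1)) * d (t-1)) ≤
      -(α * (Real.exp (x (t-1)) - Real.exp (z (t-1)))) := by
    intro t ht
    have := exp_sub_le (a := z (t-1)) (b := x (t-1))
    simp only [hd]
    nlinarith
  -- G = D - d on [1,qx] is monotone
  have hanti : ∀ s t, 1 ≤ s → s ≤ t → t ≤ 2 → d t ≤ d s := by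
    intro s t h1 h2 h3
    have := sub_le_of_deriv (C := 0) h2 hdc.continuousOn (fun u hu _ => hdd u (by linarith))
      (fun u h4 h5 => by
        have := (hd01 (u-1) (by linarith) (by linarith)).1
        have := Real.exp_le_exp.2 (show z (u-1) ≤ x (u-1) by simp only [hd] at this; linarith)
        nlinarith)
    linarith
  have hdD : ∀ t, 0 ≤ t → t ≤ 2 → d t ≤ D := by
    intro t h0 h2
    rcases le_total t 1 with h | h
    · exact (hd01 t h0 h).2
    · exact hanti 1 t le_rfl h h2
  -- slope of G
  set β := α * Real.exp p with hβ
  have hβ0 : 0 < β := by positivity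
  have hslope : ∀ s, 1 ≤ s → s ≤ qx → d s - d qx ≤ β * D * (qx - s) := by
    intro s h1 h2
    have := le_sub_of_deriv (C := -(β * D)) h2 hdc.continuousOn (fun u hu _ => hdd u (by linarith))
      (fun u h4 h5 => by
        refine le_trans ?_ (hder_lo u (by linarith))
        have h6 : x (u-1) ≤ p := (P.hx.mono01 hα0 (a := u-1) (b := qx - 1) ⟨by linarith, by linarith⟩
          ⟨by linarith, by linarith⟩ (by linarith)).trans hp
        have h7 := Real.exp_le_exp.2 h6
        have h8 := hd01 (u-1) (by linarith) (by linarith)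
        have h9 : Real.exp (x (u-1)) * d (u-1) ≤ Real.exp p * D :=
          mul_le_mul h7 h8.2 h8.1 (Real.exp_pos _).le
        simp only [hβ]
        nlinarith)
    linarith
  set g := D - d qx with hg
  have hg0 : 0 ≤ g := by have := hdD qx (by linarith) hqx2; linarith
  set ℓ := min (qx - 1) (1/α) with hℓ
  have hℓ0 : 0 < ℓ := lt_min (by linarith) (by positivity)
  have hℓa : ℓ ≤ qx - 1 := min_le_left _ _
  have hBc : Continuous fun t => α * t - x t := (continuous_const.mul continuous_id).sub P.hx.cont
  -- piece 1
  have p1 : -(D * ((α * (qx - ℓ + 1) - x (qx - ℓ + 1)) - (α * qx - x qx))) ≤ d (qx - ℓ + 1) - d qx := by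
    have := sub_le_sub_of_deriv (w := fun t => -D * (α * t - x t)) (p := qx) (r := qx - ℓ + 1)
      (by linarith) (continuous_const.mul hBc).continuousOn hdc.continuousOn
      (fun u hu _ => (P.hx.hasDerivB (t := u) (by linarith)).const_mul (-D))
      (fun u hu _ => hdd u (by linarith)) (fun u h1 h2 => by
        refine le_trans ?_ (hder_lo u (by linarith))
        have h3 := hdD (u-1) (by linarith) (by linarith)
        have h4 : 0 < α * Real.exp (x (u-1)) := by positivity
        nlinarith)
    linarith
  have p2 : -(D * ((α * (qx + 1) - x (qx + 1)) - (α * (qx - ℓ + 1) - x (qx - ℓ + 1)))) +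
      α * (g * ℓ - β * D * ℓ^2/2) ≤ d (qx+1) - d (qx - ℓ + 1) := by
    have := sub_le_sub_of_deriv
      (w := fun t => -D * (α * t - x t) + α * (g * t + β * D * (qx + 1 - t)^2/2))
      (w' := fun t => -D * (α * Real.exp (x (t-1))) + α * (g - β * D * (qx + 1 - t)))
      (p := qx - ℓ + 1) (r := qx + 1)
      (by linarith) ((continuous_const.mul hBc).add (by fun_prop)).continuousOn hdc.continuousOn
      (fun u hu _ => by
        refine ((P.hx.hasDerivB (t := u) (by linarith)).const_mul (-D)).add ?_
        have h1 : HasDerivAt (fun t : ℝ => qx + 1 - t) (-1) u := by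
          simpa using (hasDerivAt_id u).const_sub (qx + 1)
        have := ((hasDerivAt_id u).const_mul g).add (((h1.pow 2).const_mul (β * D)).div_const 2)
        refine (this.const_mul α).congr_deriv ?_
        simp only [Nat.cast_ofNat]
        ring)
      (fun u hu _ => hdd u (by linarith)) (fun u h1 h2 => by
        refine le_trans ?_ (hder_lo u (by linarith))
        have h3 := hslope (u-1) (by linarith) (by linarith)
        have h4 := hdD (u-1) (by linarith) (by linarith)
        have h5 : 1 ≤ Real.exp (x (u-1)) := Real.one_le_exp (P.hx.nonneg (by linarith) (by linarith))
        have h6 : g - β * D * (qx + 1 - u) ≤ Real.exp (x (u-1)) * (D - d (u-1)) := by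
          have : g - β * D * (qx + 1 - u) ≤ D - d (u-1) := by
            simp only [hg]; linarith
          nlinarith
        have := mul_le_mul_of_nonneg_left h6 hα0.le
        nlinarith)
    nlinarith
  have hz1 : z (qz + 1) ≤ z (qx + 1) := P.hz.min_le hα0 (by linarith) (by linarith)
  have hxq := P.hx.xq
  have hfin : z (qz+1) - x (qx+1) ≤ D * (α - 1 - x (qx+1)) + (g - α * (g * ℓ - β * D * ℓ^2/2)) := by
    have e1 : d (qx + 1) = x (qx+1) - z (qx+1) := rfl
    rw [hxq] at p1
    have e2 : d qx = D - g := by simp only [hg]; ring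
    rw [e2] at p1
    have e3 : D * (α - 1 - x (qx+1)) = D * ((α * (qx + 1) - x (qx + 1)) - (α * (qx - ℓ + 1) - x (qx - ℓ + 1)))
      + D * ((α * (qx - ℓ + 1) - x (qx - ℓ + 1)) - (α * qx - 0)) - D := by ring
    rw [e3]
    linarith
  have hcut : g - α * (g * ℓ - β * D * ℓ^2/2) ≤ D * (Real.exp p / 2) := by
    have hβe : Real.exp p = β / α := by rw [hβ]; field_simp
    have h1 : α * ℓ ≤ 1 := by
      have := mul_le_mul_of_nonneg_left (min_le_right (qx - 1) (1/α)) hα0.le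
      rwa [mul_one_div_cancel hα0.ne'] at this
    have hgl : g * (1 - α * ℓ) ≤ β * D * ℓ * (1 - α * ℓ) := by
      rcases min_cases (qx - 1) (1/α) with h | h
      · have h2 := hslope 1 le_rfl hqx.le
        have h3 : d 1 = D := rfl
        rw [h3, ← h.1] at h2
        apply mul_le_mul_of_nonneg_right _ (by linarith)
        simp only [hg]; exact h2
      · have : α * ℓ = 1 := by rw [hℓ, h.1]; field_simp
        rw [this]; simp
    rw [hβe]
    have h4 : 0 ≤ β * D := by positivity
    have h5 : β * D * ℓ - α * (β * D) * ℓ^2/2 ≤ D * (β / α / 2) := by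
      have : D * (β / α / 2) - (β * D * ℓ - α * (β * D) * ℓ^2/2) = β * D / (2 * α) * (1 - α * ℓ)^2 := by
        field_simp; ring
      have h6 : 0 ≤ β * D / (2 * α) * (1 - α * ℓ)^2 := by positivity
      linarith
    nlinarith
  linarith

theorem eq_of_D (P : Pair α c x qx Lx z qz Lz) (h : x 1 - z 1 ≤ 0) : ∀ t, x t = z t := by
  have hα0 : 0 < α := by linarith [P.hα]
  have hdc : Continuous fun t => x t - z t := P.hx.cont.sub P.hz.cont
  have hm01 : MonotoneOn (fun t => x t - z t) (Icc 0 1) := by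
    apply monoOn_of_hasDeriv hdc.continuousOn (fun u hu _ => P.hasDeriv_d hu)
    intro u h1 h2
    have := Real.exp_le_exp.2 (P.le (u-1) (by linarith) (by linarith))
    nlinarith
  apply P.hx.eq_of_nonneg P.hz
  intro t ht
  have := Traj.eq_of_window P.hx.toTraj P.hz.toTraj (p := 0) (r := 0) le_rfl le_rfl (fun t h0 h1 => by
    have a1 := P.mon.1 t h0 h1
    have a2 := hm01 ⟨h0, h1⟩ ⟨zero_le_one, le_rfl⟩ h1
    simp only at a2
    simp only [zero_add]
    linarith) t ht
  simpa using this

end Pair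

theorem exp_neg_quad {v : ℝ} (hv : 0 ≤ v) : Real.exp (-v) ≤ 1 - v + v^2/2 := Traj.exp_bd hv

namespace Pair
variable {α c : ℝ} {x z : ℝ → ℝ} {qx Lx qz Lz : ℝ}

/-- the facts used by both second half estimates -/
theorem second (P : Pair α c x qx Lx z qz Lz) (hE : α * (Lz - qz - 1) + z (qz + 1) ≤ 1) :
    (∀ t, 0 ≤ t → t ≤ Lz - qz → x (qx + t) ≤ z (qz + t)) ∧
    (∀ t, 0 ≤ t → t ≤ Lz - qz → z (qz + t) - x (qx + t) ≤ z (qz+1) - x (qx+1)) ∧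
    qx + (Lz - qz) ≤ Lx ∧
    (∀ t, -1 ≤ t → t ≤ 0 → z (Lz + t) - x (qx + (Lz - qz) + t) ≤
      - x (qx + (Lz - qz)) + (z (qz+1) - x (qx+1)) * (z (Lz + t) - α * t)) := by
  have hα0 : 0 < α := by linarith [P.hα]
  have hqx := P.hx.hq
  have hqz := P.hz.hq
  have hlx := P.lx
  have hlz := P.lz
  obtain ⟨c1, c2, -⟩ := compW (T := Lz - qz) P.hx.toTraj P.hz.toTraj hα0 hqx.le hqz.le
    (by rw [P.hx.xq, P.hz.xq]) P.mon.2.1 (by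
      rw [show qz + (Lz - qz) = Lz by ring, P.hz.xL]; linarith)
  refine ⟨c1, c2, ?_, ?_⟩
  · by_contra hcon
    push Not at hcon
    have h1 := c1 (Lx - qx) (by linarith) (by linarith)
    rw [show qx + (Lx - qx) = Lx by ring, P.hx.xL] at h1
    have h2 := P.hz.negq (qz + (Lx - qx)) (by linarith) (by linarith)
    linarith
  · intro t h1 h2
    set Δ := z (qz+1) - x (qx+1) with hΔ
    have hBz : Continuous fun s => α * s - z s := (continuous_const.mul continuous_id).sub P.hz.cont
    have key := sub_le_sub_of_deriv (w := fun s => -Δ * (α * (qz + s) - z (qz + s)))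
      (w' := fun s => -Δ * (α * Real.exp (z (qz + s - 1))))
      (g := fun s => z (qz + s) - x (qx + s))
      (g' := fun s => α * (Real.exp (x (qx + s - 1)) - Real.exp (z (qz + s - 1))))
      (p := Lz - qz + t) (r := Lz - qz) (by linarith)
      (continuous_const.mul (hBz.comp (by fun_prop : Continuous fun s => qz + s))).continuousOn
      ((P.hz.cont.comp (by fun_prop)).sub (P.hx.cont.comp (by fun_prop))).continuousOn
      (fun s hs _ => by
        exact (HasDerivAt.comp_const_add qz s (P.hz.hasDerivB (t := qz + s) (by linarith))).const_mul (-Δ))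
      (fun s hs _ => by
        have e1 := HasDerivAt.comp_const_add qz s (P.hz.der (qz+s) (by linarith))
        have e2 := HasDerivAt.comp_const_add qx s (P.hx.der (qx+s) (by linarith))
        exact (e1.sub e2).congr_deriv (by ring))
      (fun s h3 h4 => by
        have h5 := c2 (s - 1) (by linarith) (by linarith)
        have h6 := exp_sub_le (a := x (qx + s - 1)) (b := z (qz + s - 1))
        rw [show qz + (s - 1) = qz + s - 1 by ring, show qx + (s - 1) = qx + s - 1 by ring] at h5
        have h7 : Real.exp (z (qz + s - 1)) * (z (qz + s - 1) - x (qx + s - 1)) ≤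
          Real.exp (z (qz + s - 1)) * Δ := mul_le_mul_of_nonneg_left h5 (Real.exp_pos _).le
        have h8 : Real.exp (z (qz + s - 1)) - Real.exp (x (qx + s - 1)) ≤ Real.exp (z (qz + s - 1)) * Δ := by
          linarith
        nlinarith [mul_le_mul_of_nonneg_left h8 hα0.le])
    simp only [show qz + (Lz - qz) = Lz by ring, show qz + (Lz - qz + t) = Lz + t by ring,
      show qx + (Lz - qz + t) = qx + (Lz - qz) + t by ring, P.hz.xL] at key
    linarith

/-- `α - z 1 ≤ 1` as soon as the barrier is above the fixed point. -/
theorem peak (P : Pair α c x qx Lx z qz Lz) (hcs : α * (1 - Real.exp (-c)) ≤ c) : α - z 1 ≤ 1 := by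
  have hα0 : 0 < α := by linarith [P.hα]
  have hc := P.hc
  have := sub_le_sub_of_deriv (w := fun t => α * t - z t) (w' := fun t => α * Real.exp (z (t-1)))
    (g := fun t => α * Real.exp (c * (t - 1)) / c) (g' := fun t => α * Real.exp (c * (t-1)))
    (p := 0) (r := 1) zero_le_one
    ((continuous_const.mul continuous_id).sub P.hz.cont).continuousOn
    (Continuous.continuousOn (by fun_prop)) (fun u hu _ => P.hz.hasDerivB hu)
    (fun u _ _ => by
      have h1 : HasDerivAt (fun t : ℝ => c * (t - 1)) c u := by
        simpa using ((hasDerivAt_id u).sub_const 1).const_mul c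
      refine ((h1.exp.const_mul α).div_const c).congr_deriv ?_
      field_simp)
    (fun u h1 h2 => by
      have := P.az.le (u-1) (by linarith) (by linarith)
      have := Real.exp_le_exp.2 this
      exact mul_le_mul_of_nonneg_left this hα0.le)
  simp only [P.hz.zero, sub_self, mul_zero, Real.exp_zero, mul_one, zero_sub, mul_neg] at this
  have h2 : α / c - α * Real.exp (-c) / c ≤ 1 := by
    rw [← sub_div, div_le_one hc]; linarith
  linarith

set_option maxHeartbeats 1000000 in
/-- Second half, short tails. -/
theorem contrB (P : Pair α c x qx Lx z qz Lz) (hE : α * (Lz - qz - 1) + z (qz + 1) ≤ 1)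
    (hcs : α * (1 - Real.exp (-c)) ≤ c) (hcα : c ≤ α) :
    x 1 - z 1 ≤ (z (qz+1) - x (qx+1)) * (α * (α - c) * (1 - (1 + c) * Real.exp (-c)) / c^2
      + (α / (α * (1 - Real.exp (-c))) - 1) * (z (qz+1) - x (qx+1)) / 2) := by
  have hα0 : 0 < α := by linarith [P.hα]
  have hqx := P.hx.hq
  have hqz := P.hz.hq
  have hlx := P.lx
  have hlz := P.lz
  have hc := P.hc
  have hpk := P.peak hcs
  have hD0 := P.Delta_nonneg
  obtain ⟨c1, c2, c3, c4⟩ := P.second hE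
  set Δ := z (qz+1) - x (qx+1) with hΔ
  set p0 := qx + (Lz - qz) with hp0
  set w := - x p0 with hw
  have hw0 : 0 ≤ w := by
    have := P.hx.nonposq (t := p0) (by linarith) c3; linarith
  have hwΔ : w ≤ Δ := by
    have := c2 (Lz - qz) (by linarith) le_rfl
    rw [show qz + (Lz - qz) = Lz by ring, P.hz.xL] at this
    linarith
  have hBz : Continuous fun s => α * s - z s := (continuous_const.mul continuous_id).sub P.hz.cont
  have key := sub_le_sub_of_deriv
    (w := fun u => x (p0 + u) - z (Lz + u))
    (w' := fun u => α * (Real.exp (z (Lz + u - 1)) - Real.exp (x (p0 + u - 1))))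
    (g := fun u => (1 - Real.exp (-w)) * (α * (Lz + u) - z (Lz + u)) +
      Δ * (α * (α - c) / c^2) * ((1 + c * (1 - u)) * Real.exp (-(c * (1 - u)))))
    (g' := fun u => (1 - Real.exp (-w)) * (α * Real.exp (z (Lz + u - 1))) +
      Δ * (α * (α - c)) * ((1 - u) * Real.exp (-(c * (1 - u)))))
    (p := 0) (r := 1) zero_le_one
    ((P.hx.cont.comp (by fun_prop)).sub (P.hz.cont.comp (by fun_prop))).continuousOn
    ((continuous_const.mul (hBz.comp (by fun_prop : Continuous fun s => Lz + s))).add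
      (by fun_prop)).continuousOn
    (fun s hs _ => by
      have e1 := HasDerivAt.comp_const_add Lz s (P.hz.der (Lz+s) (by linarith))
      have e2 := HasDerivAt.comp_const_add p0 s (P.hx.der (p0+s) (by linarith))
      exact (e2.sub e1).congr_deriv (by ring))
    (fun s hs _ => by
      have e1 := (HasDerivAt.comp_const_add Lz s
        (P.hz.hasDerivB (t := Lz + s) (by linarith))).const_mul (1 - Real.exp (-w))
      have h1 : HasDerivAt (fun t : ℝ => c * (1 - t)) (-c) s := by
        simpa using ((hasDerivAt_id s).const_sub 1).const_mul c
      have h1n : HasDerivAt (fun t : ℝ => -(c * (1 - t))) c s := h1.neg.congr_deriv (by ring)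
      have e2 := ((h1.const_add 1).mul h1n.exp).const_mul (Δ * (α * (α - c) / c^2))
      refine (e1.add e2).congr_deriv ?_
      field_simp
      ring)
    (fun u h1 h2 => by
      set v := u - 1 with hv
      have a1 := c4 v (by linarith) (by linarith)
      rw [show Lz + u - 1 = Lz + v by rw [hv]; ring, show p0 + u - 1 = p0 + v by rw [hv]; ring]
      have hzz : z (Lz + v) = z v := by rw [add_comm]; exact P.hz.per v
      have a2 := P.az.le v (by linarith) (by linarith)
      have a3 := P.az.lip v 0 (by linarith) (by linarith) le_rfl
      rw [P.az.zero] at a3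
      set φ := z (Lz + v) with hφ
      rw [← hzz] at a2 a3
      set b := Δ * (φ - α * v) with hb
      have hb0 : 0 ≤ b := mul_nonneg hD0 (by linarith)
      have hx1 : φ - (w + b) ≤ x (p0 + v) := by linarith
      have b1 := Real.exp_le_exp.2 hx1
      have b2 : Real.exp (φ - (w + b)) = Real.exp φ * (Real.exp (-w) * Real.exp (-b)) := by
        rw [← Real.exp_add, ← Real.exp_add]; congr 1; ring
      have b3 : 1 - b ≤ Real.exp (-b) := by have := Real.add_one_le_exp (-b); linarith
      have b4 : Real.exp (-w) ≤ 1 := Real.exp_le_one_iff.2 (by linarith)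
      have b5 : Real.exp (-w) - b ≤ Real.exp (-w) * Real.exp (-b) := by
        have := Real.exp_pos (-w)
        nlinarith
      have b6 : Real.exp φ * (Real.exp (-w) - b) ≤ Real.exp (x (p0 + v)) := by
        rw [b2] at b1
        exact le_trans (mul_le_mul_of_nonneg_left b5 (Real.exp_pos _).le) b1
      have b7 : Real.exp φ * (φ - α * v) ≤ Real.exp (-(c * (1 - u))) * ((α - c) * (1 - u)) := by
        apply mul_le_mul
        · apply Real.exp_le_exp.2; rw [hv] at a2; linarith
        · rw [hv] at a2 ⊢; linarith
        · linarith
        · positivity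
      have b8 : Real.exp φ * b ≤ Δ * ((α - c) * ((1 - u) * Real.exp (-(c * (1 - u))))) := by
        have := mul_le_mul_of_nonneg_left b7 hD0
        rw [hb]; linarith
      have b9 := mul_le_mul_of_nonneg_left (show Real.exp φ - Real.exp (x (p0+v)) ≤
        (1 - Real.exp (-w)) * Real.exp φ + Δ * ((α - c) * ((1 - u) * Real.exp (-(c * (1 - u))))) by
          linarith) hα0.le
      linarith)
  have hz1 : z (Lz + 1) = z 1 := by rw [add_comm]; exact P.hz.per 1
  have hx1 : x (Lx + 1) = x 1 := by rw [add_comm]; exact P.hx.per 1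
  simp only [add_zero, sub_self, mul_zero, neg_zero, Real.exp_zero, mul_one, sub_zero, hz1, P.hz.xL] at key
  set s0 := α * (1 - Real.exp (-c)) with hs0
  have hs00 : 0 < s0 := mul_pos hα0 (by
    have := Real.exp_lt_one_iff.2 (show -c < 0 by linarith); linarith)
  have hcL : x (Lx - 1) ≤ -c := by
    have h1 := P.ax.le (-1) le_rfl (by norm_num)
    have h2 := P.hx.per (-1)
    rw [show -1 + Lx = Lx - 1 by ring] at h2
    linarith
  have shift := sub_le_sub_of_deriv
    (w := fun u => x (u + 1)) (w' := fun u => α * (1 - Real.exp (x u)))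
    (g := fun u => α / s0 * (x u - Real.exp (x u)))
    (g' := fun u => α / s0 * ((1 - Real.exp (x u)) * (-α * (Real.exp (x (u - 1)) - 1))))
    (p := p0) (r := Lx) c3 (P.hx.cont.comp (by fun_prop)).continuousOn
    (continuous_const.mul (P.hx.cont.sub (Real.continuous_exp.comp P.hx.cont))).continuousOn
    (fun u h1 h2 => by
      have := HasDerivAt.comp_add_const u 1 (P.hx.der (u+1) (by linarith))
      simp only [add_sub_cancel_right] at this
      exact this.congr_deriv (by ring))
    (fun u h1 h2 => by
      have := P.hx.der u (by linarith)
      exact ((this.sub this.exp).const_mul _).congr_deriv (by ring))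
    (fun u h1 h2 => by
      have a1 : x (u-1) ≤ -c := (P.hx.mono2 hα0 ⟨by linarith, by linarith⟩ ⟨by linarith, by linarith⟩
        (by linarith)).trans hcL
      have a2 := Real.exp_le_exp.2 a1
      have a3 : s0 ≤ -α * (Real.exp (x (u - 1)) - 1) := by rw [hs0]; nlinarith
      have a4 : 0 ≤ 1 - Real.exp (x u) := by
        have := Real.exp_le_one_iff.2 (P.hx.nonposq (t := u) (by linarith) h2.le); linarith
      have a5 : α * (1 - Real.exp (x u)) = α / s0 * ((1 - Real.exp (x u)) * s0) := by
        field_simp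
      rw [a5]
      exact mul_le_mul_of_nonneg_left (mul_le_mul_of_nonneg_left a3 a4) (by positivity))
  simp only [hx1, P.hx.xL, Real.exp_zero] at shift
  have hxw : x p0 = - w := by rw [hw]; ring
  rw [hxw] at shift key
  have hq : w - 1 + Real.exp (-w) ≤ w^2/2 := by have := exp_neg_quad hw0; linarith
  have hq0 : 0 ≤ w - 1 + Real.exp (-w) := by have := Real.add_one_le_exp (-w); linarith
  have hr : 0 ≤ α / s0 - 1 := by
    rw [sub_nonneg, one_le_div hs00, hs0]
    nlinarith [Real.exp_pos (-c)]
  have h1e : 0 ≤ 1 - Real.exp (-w) := by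
    have := Real.exp_le_one_iff.2 (show -w ≤ 0 by linarith); linarith
  have k1 : (1 - Real.exp (-w)) * (α - z 1) ≤ 1 - Real.exp (-w) := by nlinarith
  have k2 : (α / s0 - 1) * (w - 1 + Real.exp (-w)) ≤ (α / s0 - 1) * (Δ^2/2) :=
    mul_le_mul_of_nonneg_left (by nlinarith) hr
  have k3 : Δ * (α * (α - c) / c^2) - Δ * (α * (α - c) / c^2) * ((1 + c) * Real.exp (-c)) =
    Δ * (α * (α - c) * (1 - (1 + c) * Real.exp (-c)) / c^2) := by ring
  rw [mul_add, ← k3]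
  have k4 : Δ * ((α / s0 - 1) * Δ / 2) = (α / s0 - 1) * (Δ^2/2) := by ring
  rw [k4]
  linarith

end Pair

/-- unimodality of a loop on its negative phase -/
theorem Loop.le_ends {α : ℝ} {x : ℝ → ℝ} {q L : ℝ} (T : Loop α x q L) (hα : 0 < α) {a b t : ℝ} (ha : q ≤ a)
    (hat : a ≤ t) (htb : t ≤ b) (hb : b ≤ L) : x t ≤ max (x a) (x b) := by
  have hq := T.hq
  have hL := T.hL
  rcases le_total t (q+1) with h | h
  · exact le_max_of_le_left (T.anti1 hα ⟨by linarith, by linarith⟩ ⟨by linarith, h⟩ hat)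
  · exact le_max_of_le_right (T.mono2 hα ⟨by linarith, by linarith⟩ ⟨by linarith, by linarith⟩ htb)

/-- comparison of the loss integrals after the zero -/
theorem Loop.rise_le {α : ℝ} {x y : ℝ → ℝ} {qx Lx qy Ly : ℝ} (hx : Loop α x qx Lx)
    (hy : Loop α y qy Ly) (hα : 0 < α)
    (h : ∀ t, 0 ≤ t → t ≤ 1 → x (qx + t) ≤ y (qy + t)) :
    y (qy + 2) - y (qy + 1) ≤ x (qx + 2) - x (qx + 1) := by
  have hqx := hx.hq
  have hqy := hy.hq
  have := sub_le_sub_of_deriv (w := fun s => y (qy + s)) (w' := fun s => -α * (Real.exp (y (qy + s - 1)) - 1))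
    (g := fun s => x (qx + s)) (g' := fun s => -α * (Real.exp (x (qx + s - 1)) - 1))
    (p := 1) (r := 2) (by norm_num) (hy.cont.comp (by fun_prop)).continuousOn
    (hx.cont.comp (by fun_prop)).continuousOn
    (fun s hs _ => HasDerivAt.comp_const_add qy s (hy.der (qy+s) (by linarith)))
    (fun s hs _ => HasDerivAt.comp_const_add qx s (hx.der (qx+s) (by linarith)))
    (fun s h1 h2 => by
      have := h (s-1) (by linarith) (by linarith)
      rw [show qx + (s - 1) = qx + s - 1 by ring, show qy + (s - 1) = qy + s - 1 by ring] at this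
      have := Real.exp_le_exp.2 this
      nlinarith)
  exact this

/-- the last unit interval before `L - 1` in the long case -/
theorem Loop.slope_back {α : ℝ} {z : ℝ → ℝ} {q L c s1 : ℝ} (T : Loop α z q L) (hα : 0 < α) (h3 : q + 3 ≤ L)
    (hzc : z (L-1) ≤ -c) (hs1 : s1 ≤ α * (1 - Real.exp (-c))) (hs2 : s1 ≤ z (q+2) - z (q+1)) :
    ∀ r, 0 ≤ r → r ≤ 1 → z (L - 1 - r) ≤ -c - s1 * r := by
  have hq := T.hq
  have hL := T.hL
  have h2c : z (L - 2) ≤ -c := (T.mono2 hα ⟨by linarith, by linarith⟩ ⟨by linarith, by linarith⟩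
    (by linarith)).trans hzc
  have hrise : s1 ≤ z (L-1) - z (L-2) := by
    rcases le_total (z (L-3)) (z (L-2)) with h | h
    · refine hs1.trans ?_
      have := le_sub_of_deriv (C := α * (1 - Real.exp (-c))) (p := L-2) (r := L-1) (by linarith)
        T.cont.continuousOn (fun u hu _ => T.der u (by linarith)) (fun u h1 h2 => by
          have h5 := T.le_ends hα (a := L-3) (b := L-2) (t := u-1) (by linarith) (by linarith) (by linarith)
            (by linarith)
          rw [max_eq_right h] at h5
          have := Real.exp_le_exp.2 (h5.trans h2c)
          nlinarith)
      linarith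
    · refine hs2.trans ?_
      have hr : MonotoneOn (fun τ => z (τ + 2) - z (τ + 1)) (Icc q (L-3)) := by
        apply monoOn_of_hasDeriv (w' := fun τ => α * (Real.exp (z τ) - Real.exp (z (τ+1))))
        · exact ((T.cont.comp (by fun_prop)).sub (T.cont.comp (by fun_prop))).continuousOn
        · intro u h1 h2
          have e1 := HasDerivAt.comp_add_const u 2 (T.der (u+2) (by linarith))
          have e2 := HasDerivAt.comp_add_const u 1 (T.der (u+1) (by linarith))
          rw [show u + 2 - 1 = u + 1 by ring] at e1
          rw [show u + 1 - 1 = u by ring] at e2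
          exact (e1.sub e2).congr_deriv (by ring)
        · intro u h1 h2
          have : z (u+1) ≤ z u := by
            rcases le_total (u+1) (q+1) with h5 | h5
            · exact T.anti1 hα ⟨by linarith, by linarith⟩ ⟨by linarith, by linarith⟩ (by linarith)
            · have h6 : z (u+1) ≤ z (L-2) := T.mono2 hα ⟨by linarith, by linarith⟩
                ⟨by linarith, by linarith⟩ (by linarith)
              by_cases h7 : L - 3 ≤ q + 1
              · have h8 : z (L-3) ≤ z u := T.anti1 hα ⟨by linarith, by linarith⟩
                  ⟨by linarith, by linarith⟩ (by linarith)
                linarith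
              · push Not at h7
                have h8 : z (L-3) < z (L-2) := T.toTraj.strictMono_of_neg hα (by linarith) (by linarith)
                  (fun t h1 h2 => T.negq t (by linarith) (by linarith))
                linarith
          have := Real.exp_le_exp.2 this
          nlinarith
      have := hr ⟨le_rfl, by linarith⟩ ⟨by linarith, le_rfl⟩ (show q ≤ L - 3 by linarith)
      simp only at this
      rw [show L - 3 + 2 = L - 1 by ring, show L - 3 + 1 = L - 2 by ring] at this
      exact this
  intro r hr0 hr1
  -- quasi-convexity of `z t - s1 t`
  set t := L - 1 - r with ht
  suffices h : z t - s1 * t ≤ z (L-1) - s1 * (L-1) by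
    have : s1 * t = s1 * (L-1) - s1 * r := by rw [ht]; ring
    linarith
  by_cases hcase : z (t-1) ≤ -c ∨ s1 ≤ α * (1 - Real.exp (z (t-1)))
  · have hm : s1 * (L - 1 - t) ≤ z (L-1) - z t := by
      refine le_sub_of_deriv (by linarith) T.cont.continuousOn (fun u hu _ => T.der u (by linarith)) ?_
      intro u h1 h2
      have h5 := T.le_ends hα (a := t-1) (b := L-2) (t := u-1) (by linarith) (by linarith) (by linarith)
            (by linarith)
      rcases le_max_iff.1 h5 with h6 | h6
      · rcases hcase with h7 | h7
        · have := Real.exp_le_exp.2 (h6.trans h7)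
          nlinarith
        · have := Real.exp_le_exp.2 h6
          nlinarith
      · have := Real.exp_le_exp.2 (h6.trans h2c)
        nlinarith
    linarith
  · push Not at hcase
    obtain ⟨k1, k2⟩ := hcase
    have ht2 : t - 1 ≤ q + 1 := by
      by_contra hcon
      push Not at hcon
      have : z (t-1) ≤ z (L-2) := T.mono2 hα ⟨by linarith, by linarith⟩
                ⟨by linarith, by linarith⟩ (by linarith)
      linarith
    have hm : z t - z (L-2) ≤ s1 * (t - (L-2)) := by
      refine sub_le_of_deriv (by linarith) T.cont.continuousOn (fun u hu _ => T.der u (by linarith)) ?_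
      intro u h1 h2
      have h6 : z (t-1) ≤ z (u-1) := T.anti1 hα ⟨by linarith, by linarith⟩ ⟨by linarith, by linarith⟩ (by linarith)
      have := Real.exp_le_exp.2 h6
      nlinarith
    linarith

namespace Pair
variable {α c : ℝ} {x z : ℝ → ℝ} {qx Lx qz Lz : ℝ}

set_option maxHeartbeats 1000000 in
/-- Second half, long tails. -/
theorem contrC (P : Pair α c x qx Lx z qz Lz) (hE : α * (Lz - qz - 1) + z (qz + 1) ≤ 1)
    (h3 : qz + 3 ≤ Lz) {s1 : ℝ} (hs0 : 0 < s1) (hsc : s1 ≤ c) (hs1 : s1 ≤ α * (1 - Real.exp (-c)))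
    (hs2 : s1 ≤ z (qz+2) - z (qz+1)) :
    x 1 - z 1 ≤ (z (qz+1) - x (qx+1)) * (α^2 * Real.exp (-c) * (1 - Real.exp (-c))^2 / (2 * c * s1)) := by
  have hα0 : 0 < α := by linarith [P.hα]
  have hqx := P.hx.hq
  have hqz := P.hz.hq
  have hlx := P.lx
  have hc := P.hc
  have hD0 := P.Delta_nonneg
  obtain ⟨c1, c2, c3, c4⟩ := P.second hE
  set Δ := z (qz+1) - x (qx+1) with hΔ
  set p0 := qx + (Lz - qz) with hp0
  have hzc : z (Lz - 1) ≤ -c := by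
    have h1 := P.az.le (-1) le_rfl (by norm_num)
    have h2 := P.hz.per (-1)
    rw [show -1 + Lz = Lz - 1 by ring] at h2
    linarith
  have hV : ∀ t, -2 ≤ t → t ≤ 0 → z (Lz + t) - x (Lx + t) ≤ Δ := by
    intro t h1 h2
    have a1 : x (p0 + t) ≤ x (Lx + t) := P.hx.mono2 hα0 ⟨by linarith, by linarith⟩ ⟨by linarith, by linarith⟩
      (by linarith)
    have a2 := c2 (Lz - qz + t) (by linarith) (by linarith)
    rw [show qz + (Lz - qz + t) = Lz + t by ring, show qx + (Lz - qz + t) = p0 + t by rw [hp0]; ring] at a2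
    linarith
  have hBz : Continuous fun s => α * s - z s := (continuous_const.mul continuous_id).sub P.hz.cont
  have hsl := P.hz.slope_back hα0 h3 hzc hs1 hs2
  -- bound of V on [-1,0]
  have hV1 : ∀ t, -1 ≤ t → t ≤ 0 → z (Lz + t) - x (Lx + t) ≤
      Δ * (α * Real.exp (-c) / s1 * (1 - Real.exp (s1 * t))) := by
    intro t h1 h2
    have key := sub_le_sub_of_deriv (w := fun s => -Δ * (α * Real.exp (-c) / s1 * Real.exp (s1 * s)))
      (w' := fun s => -Δ * (α * Real.exp (-c) * Real.exp (s1 * s)))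
      (g := fun s => z (Lz + s) - x (Lx + s))
      (g' := fun s => α * (Real.exp (x (Lx + s - 1)) - Real.exp (z (Lz + s - 1))))
      (p := t) (r := 0) h2 (Continuous.continuousOn (by fun_prop))
      ((P.hz.cont.comp (by fun_prop)).sub (P.hx.cont.comp (by fun_prop))).continuousOn
      (fun s hs _ => by
        have e1 : HasDerivAt (fun s : ℝ => s1 * s) s1 s := by simpa using (hasDerivAt_id s).const_mul s1
        refine ((e1.exp.const_mul _).const_mul _).congr_deriv ?_
        field_simp)
      (fun s hs _ => by
        have e1 := HasDerivAt.comp_const_add Lz s (P.hz.der (Lz+s) (by linarith))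
        have e2 := HasDerivAt.comp_const_add Lx s (P.hx.der (Lx+s) (by linarith))
        exact (e1.sub e2).congr_deriv (by ring))
      (fun s h4 h5 => by
        have h6 := hV (s - 1) (by linarith) (by linarith)
        rw [show Lz + (s - 1) = Lz + s - 1 by ring, show Lx + (s - 1) = Lx + s - 1 by ring] at h6
        have h7 := exp_sub_le (a := x (Lx + s - 1)) (b := z (Lz + s - 1))
        have h8 := hsl (-s) (by linarith) (by linarith)
        rw [show Lz - 1 - -s = Lz + s - 1 by ring] at h8
        have h9 : Real.exp (z (Lz + s - 1)) ≤ Real.exp (-c) * Real.exp (s1 * s) := by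
          rw [← Real.exp_add]; apply Real.exp_le_exp.2; linarith
        have h10 : Real.exp (z (Lz + s - 1)) * (z (Lz + s - 1) - x (Lx + s - 1)) ≤
            Real.exp (-c) * Real.exp (s1 * s) * Δ :=
          (mul_le_mul_of_nonneg_left h6 (Real.exp_pos _).le).trans (mul_le_mul_of_nonneg_right h9 hD0)
        nlinarith [mul_le_mul_of_nonneg_left (h7.trans h10) hα0.le])
    simp only [add_zero, mul_zero, Real.exp_zero, mul_one, P.hz.xL, P.hx.xL] at key
    linarith
  have key := sub_le_sub_of_deriv
    (w := fun u => x (Lx + u) - z (Lz + u))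
    (w' := fun u => α * (Real.exp (z (Lz + u - 1)) - Real.exp (x (Lx + u - 1))))
    (g := fun u => - (Δ * (α^2 * Real.exp (-c) / s1) * ((1 - Real.exp (c * (u - 1)))^2 / (2 * c))))
    (g' := fun u => Δ * (α^2 * Real.exp (-c) / s1) * (Real.exp (c * (u - 1)) * (1 - Real.exp (c * (u - 1)))))
    (p := 0) (r := 1) zero_le_one
    ((P.hx.cont.comp (by fun_prop)).sub (P.hz.cont.comp (by fun_prop))).continuousOn
    (Continuous.continuousOn (by fun_prop))
    (fun s hs _ => by
      have e1 := HasDerivAt.comp_const_add Lz s (P.hz.der (Lz+s) (by linarith))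
      have e2 := HasDerivAt.comp_const_add Lx s (P.hx.der (Lx+s) (by linarith))
      exact (e2.sub e1).congr_deriv (by ring))
    (fun s hs _ => by
      have h1 : HasDerivAt (fun t : ℝ => c * (t - 1)) c s := by
        simpa using ((hasDerivAt_id s).sub_const 1).const_mul c
      have e2 := (((((h1.exp).const_sub 1).pow 2).div_const (2 * c)).const_mul
        (Δ * (α^2 * Real.exp (-c) / s1))).neg
      refine e2.congr_deriv ?_
      simp only [Nat.cast_ofNat]
      field_simp
      norm_num)
    (fun u h1 h2 => by
      set v := u - 1 with hv
      rw [show Lz + u - 1 = Lz + v by rw [hv]; ring, show Lx + u - 1 = Lx + v by rw [hv]; ring]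
      have a1 := hV1 v (by linarith) (by linarith)
      have hzz : z (Lz + v) = z v := by rw [add_comm]; exact P.hz.per v
      have a2 := P.az.le v (by linarith) (by linarith)
      rw [← hzz] at a2
      have a3 := Real.exp_le_exp.2 a2
      have a4 : 1 - Real.exp (s1 * v) ≤ 1 - Real.exp (c * v) := by
        have := Real.exp_le_exp.2 (show c * v ≤ s1 * v by nlinarith); linarith
      have a4' : 0 ≤ 1 - Real.exp (c * v) := by
        have := Real.exp_le_one_iff.2 (show c * v ≤ 0 by nlinarith); linarith
      have a5 : z (Lz + v) - x (Lx + v) ≤ Δ * (α * Real.exp (-c) / s1 * (1 - Real.exp (c * v))) :=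
        a1.trans (mul_le_mul_of_nonneg_left (mul_le_mul_of_nonneg_left a4 (by positivity)) hD0)
      have a6 := exp_sub_le (a := x (Lx + v)) (b := z (Lz + v))
      have a7 : Real.exp (z (Lz + v)) * (z (Lz + v) - x (Lx + v)) ≤
          Real.exp (c * v) * (Δ * (α * Real.exp (-c) / s1 * (1 - Real.exp (c * v)))) :=
        (mul_le_mul_of_nonneg_left a5 (Real.exp_pos _).le).trans
          (mul_le_mul_of_nonneg_right a3 (mul_nonneg hD0 (mul_nonneg (by positivity) a4')))
      have a8 := mul_le_mul_of_nonneg_left (a6.trans a7) hα0.le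
      refine a8.trans (le_of_eq ?_)
      ring)
  have hz1 : z (Lz + 1) = z 1 := by rw [add_comm]; exact P.hz.per 1
  have hx1 : x (Lx + 1) = x 1 := by rw [add_comm]; exact P.hx.per 1
  simp only [add_zero, sub_self, mul_zero, Real.exp_zero, zero_sub, mul_neg, mul_one, hz1, hx1,
    P.hz.xL, P.hx.xL, sub_zero] at key
  have e : Δ * (α^2 * Real.exp (-c) * (1 - Real.exp (-c))^2 / (2 * c * s1)) =
    Δ * (α^2 * Real.exp (-c) / s1) * ((1 - Real.exp (-c))^2 / (2 * c)) := by
    field_simp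
  rw [e]
  have : ((0:ℝ)^2) = 0 := by norm_num
  rw [this, zero_div, mul_zero] at key
  linarith

end Pair

/-- bounds for the amplitude of periodic loops -/
def Upper (α c m p : ℝ) : Prop := ∀ x q L, Per α x q L → Adm α c x → q ≤ 2 → -m ≤ x (q+1) ∧ x (q-1) ≤ p

/-- periodic loops lie above the line of slope `cb` -/
def UBar (α c cb : ℝ) : Prop := ∀ x q L, Per α x q L → Adm α c x → q ≤ 2 →
  ∀ t, -1 ≤ t → t ≤ 0 → cb * t ≤ x t

theorem UBar.start (α c : ℝ) : UBar α c α := by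
  intro x q L _ hA _ t h1 h2
  have := hA.lip t 0 h1 h2 le_rfl
  rw [hA.zero] at this
  linarith

theorem UBar.mono {α c cb cb' : ℝ} (h : UBar α c cb) (hc : cb ≤ cb') : UBar α c cb' :=
  fun x q L hx hA hq t h1 h2 => le_trans (by nlinarith) (h x q L hx hA hq t h1 h2)

theorem Upper.mono {α c m p m' p' : ℝ} (h : Upper α c m p) (hm : m ≤ m') (hp : p ≤ p') : Upper α c m' p' :=
  fun x q L hx hA hq => ⟨by linarith [(h x q L hx hA hq).1], by linarith [(h x q L hx hA hq).2]⟩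

theorem UBar.upper {α c cb : ℝ} (h : UBar α c cb) (hα : 1.9 ≤ α) {y : ℝ → ℝ} {qy Ly : ℝ} (hy : Loop α y qy Ly)
    (hist : ∀ t, -1 ≤ t → t ≤ 0 → y t = cb * t) : Upper α c (-(y (qy+1))) (y (qy-1)) := by
  intro x q L hx hA hq
  have hm := hy.monotonicity hx.toLoop hα (fun t h1 h2 => by
    rw [hist t h1 h2]; exact h x q L hx hA hq t h1 h2) (fun s hs t ht hst => hA.mono s t hs.1 hst ht.2) hq
  have h1 := hm.2.2.1 1 (by norm_num) le_rfl
  have h2 := hm.2.1 (-1) le_rfl (by norm_num)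
  refine ⟨by linarith, ?_⟩
  simpa [sub_eq_add_neg] using h2

theorem Upper.ubar {α c m p : ℝ} (h : Upper α c m p) (hα : 0 < α) : UBar α c (α * (1 - Real.exp (-m))) := by
  intro x q L hx hA hq t h1 h2
  have hm := (h x q L hx hA hq).1
  have hq1 := hx.hq
  have hL := hx.hL
  have := sub_le_of_deriv (w := x) (p := L + t) (r := L) (C := α * (1 - Real.exp (-m))) (by linarith)
    hx.cont.continuousOn (fun u hu _ => hx.der u (by linarith)) (fun u h3 h4 => by
      have := hm.trans (hx.min_le hα (t := u - 1) (by linarith) (by linarith))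
      have := Real.exp_le_exp.2 this
      nlinarith)
  rw [hx.xL, add_comm L t, hx.per t] at this
  linarith

/-- crude amplitude bound -/
theorem Upper.crude {α c : ℝ} (hα : 0 < α) :
    Upper α c (α * (Real.exp (α - 1 + Real.exp (-α)) - 1)) (α - 1 + Real.exp (-α)) := by
  intro x q L hx hA hq
  have hq1 := hx.hq
  have hL := hx.hL
  have h1 : x 1 ≤ α - 1 + Real.exp (-α) := by
    have := sub_le_sub_of_deriv (w := x) (w' := fun t => -α * (Real.exp (x (t-1)) - 1))
      (g := fun t => α * t - Real.exp (α * (t - 1))) (g' := fun t => α - Real.exp (α * (t-1)) * α)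
      (p := 0) (r := 1) (by norm_num) hx.cont.continuousOn (by fun_prop)
      (fun u hu _ => hx.der u hu) (fun u _ _ => by
        have e1 : HasDerivAt (fun t : ℝ => α * (t - 1)) α u := by
          simpa using ((hasDerivAt_id u).sub_const 1).const_mul α
        have e2 : HasDerivAt (fun t : ℝ => α * t) α u := by
          simpa using (hasDerivAt_id u).const_mul α
        exact e2.sub e1.exp)
      (fun u h2 h3 => by
        have := UBar.start α c x q L hx hA hq (u-1) (by linarith) (by linarith)
        have := Real.exp_le_exp.2 this
        nlinarith)
    rw [hx.zero] at this
    simp only [sub_self, mul_zero, Real.exp_zero, zero_sub, mul_one, mul_neg] at this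
    linarith
  refine ⟨?_, (hx.le_max hα (by linarith) (by linarith)).trans h1⟩
  have := le_sub_of_deriv (w := x) (p := q) (r := q + 1) (C := -(α * (Real.exp (α - 1 + Real.exp (-α)) - 1)))
    (by linarith) hx.cont.continuousOn (fun u hu _ => hx.der u (by linarith)) (fun u h3 h4 => by
      have := (hx.le_max hα (t := u - 1) (by linarith) (by linarith)).trans h1
      have := Real.exp_le_exp.2 this
      nlinarith)
  rw [hx.xq] at this
  linarith

set_option maxHeartbeats 1000000 in
/-- uniqueness and existence, short tails -/
theorem regionI {α c c' A mb p mlo X : ℝ} {y : ℝ → ℝ} {q L : ℝ} (hα : 1.9 ≤ α) (hB : Barrier α c)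
    (hy : Loop α y q L) (hist : ∀ t, -1 ≤ t → t ≤ 0 → y t = c * t) (hc0 : 0 < c) (hcc : c ≤ c') (hcα : c' ≤ α)
    (hq2 : q ≤ 2) (hM : 0.16 ≤ y 1) (hA : α - y (q+2) + y (q+1) ≤ A) (hA1 : A ≤ 1) (hL2 : q + 2 < L)
    (hr : ∀ t, -1 ≤ t → t ≤ 0 → y (L + t) ≤ c' * t) (hmlo : y (q+1) ≤ -mlo) (hup : Upper α c mb p)
    (hX : mb - α + A ≤ X) (hE : A * (1 - Real.exp (-c')) + Real.exp (-c') * X ≤ 1 - Real.exp (-c'))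
    (hcs : α * (1 - Real.exp (-c')) ≤ c')
    (hk : (α - 1 + mb + Real.exp p / 2) * (α * (α - c') * (1 - (1 + c') * Real.exp (-c')) / c'^2
      + (α / (α * (1 - Real.exp (-c'))) - 1) * (mb - mlo) / 2) < 1) :
    (∃ x : ℝ → ℝ, SOPS α x) ∧
      (∀ x y : ℝ → ℝ, SOPS α x → SOPS α y → ∃ τ : ℝ, ∀ t : ℝ, y t = x (t + τ)) := by
  have hα0 : 0 < α := by linarith
  have hc'0 : 0 < c' := by linarith
  have B : Base α c y q L :=
    { hy with
      hc0 := hc0, hcα := by linarith, hist := hist, q2 := hq2, M16 := hM, A1 := by linarith, L2 := hL2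
      ret := fun t h1 h2 => (hr t h1 h2).trans (by nlinarith) }
  have hB' : Barrier α c' := hB.step hα hc0.le hy hist hq2 hr
  have hv0 := Real.exp_pos (-c')
  have hv1 : Real.exp (-c') < 1 := Real.exp_lt_one_iff.2 (by linarith)
  refine B.conclude hα hB ?_
  intro x qx Lx z qz Lz hx hz ax az lx lz qx2 qz2 hle t _ _
  have ax' : Adm α c' x := ⟨ax.zero, ax.mono, ax.lip, hB' x qx Lx hx⟩
  have az' : Adm α c' z := ⟨az.zero, az.mono, az.lip, hB' z qz Lz hz⟩
  have P : Pair α c' x qx Lx z qz Lz := ⟨hα, hc'0, hx, hz, ax', az', lx, lz, qx2, qz2, hle⟩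
  have hqx := hx.hq
  have hqz := hz.hq
  -- comparison of z with the base
  have hzm := hz.monotonicity hy hα (fun t h1 h2 => by rw [hist t h1 h2]; exact az.le t h1 h2) B.histMono hq2
  have hAz := hz.rise_le hy hα0 hzm.2.2.1
  have hzlo : z (qz+1) ≤ -mlo := (hzm.2.2.1 1 (by norm_num) le_rfl).trans hmlo
  have hzup := (hup z qz Lz hz az qz2).1
  obtain ⟨hxup, hxp⟩ := hup x qx Lx hx ax qx2
  have hEz : α * (Lz - qz - 1) + z (qz + 1) ≤ 1 := by
    have e1 := hz.tail_short hα0 (by linarith)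
    have e2 : z (Lz - 1) ≤ -c' := by
      have := hB' z qz Lz hz (-1) le_rfl (by norm_num)
      have h2 := hz.per (-1)
      rw [show (-1 : ℝ) + Lz = Lz - 1 by ring] at h2
      rw [h2]; linarith
    have e3 := Real.exp_le_exp.2 e2
    set v := Real.exp (-c')
    set τ := α * (Lz - qz - 2) with hτ
    have hτ0 : 0 ≤ τ := mul_nonneg hα0.le (by linarith)
    have e4 : τ + z (qz+2) ≤ v * τ := by
      have : α * Real.exp (z (Lz-1)) * (Lz - qz - 2) = Real.exp (z (Lz-1)) * τ := by rw [hτ]; ring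
      rw [this] at e1
      have := mul_le_mul_of_nonneg_right e3 hτ0
      linarith
    have e5 : τ * (1 - v) ≤ X := by linarith
    have e6 := mul_le_mul_of_nonneg_left e5 hv0.le
    have e7 : (A + v * τ) * (1 - v) ≤ 1 * (1 - v) := by linarith
    have e8 := le_of_mul_le_mul_right e7 (by linarith)
    have : α * (Lz - qz - 1) = τ + α := by rw [hτ]; ring
    rw [this]
    linarith
  have hBB := P.contrB hEz hcs hcα
  have hAA := P.contrA hxp
  have hD := P.D_nonneg
  have hΔ := P.Delta_nonneg
  set D := x 1 - z 1
  set Δ := z (qz+1) - x (qx+1)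
  set J := α * (α - c') * (1 - (1 + c') * Real.exp (-c')) / c'^2
  set g := α / (α * (1 - Real.exp (-c'))) - 1 with hg
  have hg0 : 0 ≤ g := by
    rw [hg, sub_nonneg, le_div_iff₀ (mul_pos hα0 (by linarith))]
    have := mul_pos hα0 hv0
    linarith
  have hJ0 : 0 ≤ J := by
    apply div_nonneg _ (by positivity)
    apply mul_nonneg (mul_nonneg hα0.le (by linarith))
    have := Real.add_one_le_exp c'
    have h2 : Real.exp c' * Real.exp (-c') = 1 := by rw [← Real.exp_add]; simp
    have := mul_le_mul_of_nonneg_right this hv0.le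
    linarith
  have hΔ1 : Δ ≤ mb - mlo := by simp only [Δ]; linarith
  have b1 : D ≤ Δ * (J + g * (mb - mlo) / 2) := hBB.trans (by
    apply mul_le_mul_of_nonneg_left _ hΔ
    have := mul_le_mul_of_nonneg_left hΔ1 hg0
    linarith)
  set J1 := J + g * (mb - mlo) / 2 with hJ1
  have hJ10 : 0 ≤ J1 := by
    have : 0 ≤ mb - mlo := hΔ.trans hΔ1
    positivity
  have b2 : Δ ≤ D * (α - 1 + mb + Real.exp p / 2) := hAA.trans (by
    apply mul_le_mul_of_nonneg_left _ hD
    linarith)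
  apply P.eq_of_D
  by_contra hcon
  push Not at hcon
  have : D ≤ D * ((α - 1 + mb + Real.exp p / 2) * J1) := by
    calc D ≤ Δ * J1 := b1
      _ ≤ D * (α - 1 + mb + Real.exp p / 2) * J1 := mul_le_mul_of_nonneg_right b2 hJ10
      _ = _ := by ring
  exact absurd (mul_lt_mul_of_pos_left hk hcon) (by rw [mul_one]; exact not_lt.2 this)

set_option maxHeartbeats 1000000 in
/-- uniqueness and existence, long tails -/
theorem regionII {α c A mb p K s1 : ℝ} {y : ℝ → ℝ} {q L : ℝ} (hα : 1.9 ≤ α) (hB : Barrier α c)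
    (hy : Loop α y q L) (hist : ∀ t, -1 ≤ t → t ≤ 0 → y t = c * t) (hc0 : 0 < c) (hcα : c ≤ α)
    (hq2 : q ≤ 2) (hM : 0.16 ≤ y 1) (hA : α - y (q+2) + y (q+1) ≤ A) (h3 : q + 3 < L)
    (hE3 : α * 2 - y (q+3) + y (q+1) ≤ 1)
    (hr : ∀ t, -1 ≤ t → t ≤ 0 → y (L + t) ≤ c * t) (hup : Upper α c mb p)
    (hK1 : α * Real.exp (-c) ≤ K) (hK2 : 1 ≤ K * (Real.exp c - 1)) (hAK : A + K ≤ 1)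
    (hs0 : 0 < s1) (hsc : s1 ≤ c) (hs1 : s1 ≤ α * (1 - Real.exp (-c))) (hs2 : s1 ≤ α - A)
    (hk : (α - 1 + mb + Real.exp p / 2) * (α^2 * Real.exp (-c) * (1 - Real.exp (-c))^2 / (2 * c * s1)) < 1) :
    (∃ x : ℝ → ℝ, SOPS α x) ∧
      (∀ x y : ℝ → ℝ, SOPS α x → SOPS α y → ∃ τ : ℝ, ∀ t : ℝ, y t = x (t + τ)) := by
  have hα0 : 0 < α := by linarith
  have hv0 := Real.exp_pos (-c)
  have hv1 : Real.exp (-c) < 1 := Real.exp_lt_one_iff.2 (by linarith)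
  have hec : 1 < Real.exp c := by rw [← Real.exp_zero]; exact Real.exp_lt_exp.2 hc0
  have hK0 : 0 < K := lt_of_lt_of_le (mul_pos hα0 hv0) hK1
  have B : Base α c y q L :=
    { hy with
      hc0 := hc0, hcα := by linarith, hist := hist, q2 := hq2, M16 := hM, A1 := by linarith, L2 := by linarith
      ret := hr }
  refine B.conclude hα hB ?_
  intro x qx Lx z qz Lz hx hz ax az lx lz qx2 qz2 hle t _ _
  have P : Pair α c x qx Lx z qz Lz := ⟨hα, hc0, hx, hz, ax, az, lx, lz, qx2, qz2, hle⟩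
  have hqx := hx.hq
  have hqz := hz.hq
  have hzy : ∀ t, -1 ≤ t → t ≤ 0 → z t ≤ y t := fun t h1 h2 => by rw [hist t h1 h2]; exact az.le t h1 h2
  have hzm := hz.monotonicity hy hα hzy B.histMono hq2
  have hAz := hz.rise_le hy hα0 hzm.2.2.1
  have hz3 : qz + 3 < Lz := hz.long hy hα hzy B.histMono hq2 (T := 3) (by linarith) h3
  obtain ⟨hxup, hxp⟩ := hup x qx Lx hx ax qx2
  have hEz : α * (Lz - qz - 1) + z (qz + 1) ≤ 1 := by
    have e2 : z (Lz - 1) ≤ -c := by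
      have := hB z qz Lz hz (-1) le_rfl (by norm_num)
      have h2 := hz.per (-1)
      rw [show (-1 : ℝ) + Lz = Lz - 1 by ring] at h2
      rw [h2]; linarith
    have e3 := Real.exp_le_exp.2 e2
    have e4 : Real.exp c ≤ Real.exp (-z (Lz-1)) := Real.exp_le_exp.2 (by linarith)
    have := hz.tail_long hα0 hz3.le (K := K) ((mul_le_mul_of_nonneg_left e3 hα0.le).trans hK1)
      (hK2.trans (mul_le_mul_of_nonneg_left (by linarith) hK0.le))
    linarith
  have hBB := P.contrC hEz hz3.le hs0 hsc hs1 (by linarith)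
  have hAA := P.contrA hxp
  have hD := P.D_nonneg
  have hΔ := P.Delta_nonneg
  set D := x 1 - z 1
  set Δ := z (qz+1) - x (qx+1)
  set J := α^2 * Real.exp (-c) * (1 - Real.exp (-c))^2 / (2 * c * s1)
  have hJ0 : 0 ≤ J := by positivity
  have b2 : Δ ≤ D * (α - 1 + mb + Real.exp p / 2) := hAA.trans (by
    apply mul_le_mul_of_nonneg_left _ hD
    linarith)
  apply P.eq_of_D
  by_contra hcon
  push Not at hcon
  have : D ≤ D * ((α - 1 + mb + Real.exp p / 2) * J) := by
    calc D ≤ Δ * J := hBB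
      _ ≤ D * (α - 1 + mb + Real.exp p / 2) * J := mul_le_mul_of_nonneg_right b2 hJ0
      _ = _ := by ring
  exact absurd (mul_lt_mul_of_pos_left hk hcon) (by rw [mul_one]; exact not_lt.2 this)

/-- trajectory with a linear history -/
structure Lin (α c : ℝ) (y : ℝ → ℝ) : Prop extends Traj α y where
  hist : ∀ t, t ≤ 0 → y t = c * t

theorem Lin.exists {α c : ℝ} (hc : 0 < c) : ∃ y, Lin α c y := by
  obtain ⟨x, h1, h2, h3⟩ := exists_sol α (φ := fun t => c * t) (by fun_prop) (by simp)
  refine ⟨x, ⟨h1, h3, by rw [h2 0 le_rfl]; simp, ?_⟩, h2⟩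
  intro t _ ht
  rw [h2 t ht.le]
  nlinarith

theorem Traj.loop_of_neg {α : ℝ} {y : ℝ → ℝ} (T : Traj α y) (hα : 1.9 ≤ α) {q1 : ℝ} (h1 : 1 < q1) (h2 : q1 ≤ 2)
    (hn : y q1 < 0) : ∃ q L, Loop α y q L ∧ q < q1 ∧ q1 < L := by
  obtain ⟨q, L, hl, hq⟩ := T.exists_loop hα h1 hn.le
  refine ⟨q, L, hl, lt_of_le_of_ne hq ?_, by linarith [hl.hq, hl.hL]⟩
  rintro rfl
  rw [hl.xq] at hn
  exact lt_irrefl _ hn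

namespace Loop
variable {α : ℝ} {y : ℝ → ℝ} {q L : ℝ}

theorem mark (T : Loop α y q L) (hα : 0 < α) {t0 t : ℝ} (h0L : t0 < L)
    (ht : t ≤ t0 + 1) (hy : y t < 0) : t < L := by
  by_contra h
  push Not at h
  have hL := T.hL
  have := T.mono2 hα (a := L) (b := t) ⟨by linarith, by linarith⟩ ⟨by linarith, by linarith⟩ h
  rw [T.xL] at this
  linarith

theorem lt_q (T : Loop α y q L) {q0 : ℝ} (h2 : q0 ≤ 2) (hy : 0 < y q0) : q0 < q := by
  by_contra h
  push Not at h
  have := T.nonposq h (by linarith [T.hL, T.hq])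
  linarith

theorem L_lt (T : Loop α y q L) {L1 : ℝ} (h : q ≤ L1) (hy : 0 < y L1) : L < L1 := by
  by_contra h2
  push Not at h2
  have := T.nonposq h h2
  linarith

theorem retA (T : Loop α y q L) (hα : 0 < α) {L0 L1 c c1 : ℝ} (h0 : L0 < L) (hq : q ≤ L0 - 1) (h1 : L < L1)
    (h10 : L1 - 1 ≤ L0) (hy0 : y (L0 - 1) ≤ -c1) (hy1 : y (L1 - 1) ≤ -c1) (hc : 0 < c) (hcc : c ≤ c1)
    (hca : c ≤ α * (1 - Real.exp (-c1))) : ∀ t, -1 ≤ t → t ≤ 0 → y (L + t) ≤ c * t := by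
  have h : y (L - 1) ≤ -c1 := (T.le_ends hα (a := L0 - 1) (b := L1 - 1) (t := L - 1) hq (by linarith)
    (by linarith) (by linarith)).trans (max_le hy0 hy1)
  have h2 := Real.exp_le_exp.2 h
  intro t ht1 ht2
  exact T.lemG hα hc (by linarith) (by nlinarith) ht1 ht2

theorem retB (T : Loop α y q L) (hα : 0 < α) {c : ℝ} (h3 : q + 3 ≤ L) (hc : 0 < c)
    (hca : c ≤ α * (1 - Real.exp (-c))) : ∀ t, -1 ≤ t → t ≤ 0 → y (L + t) ≤ c * t := by
  have hd := T.deep hα h3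
  have hneg := T.negq (L-1) (by linarith) (by linarith)
  set u := - y (L-1) with hu
  have hyu : y (L-1) = -u := by linarith
  rw [hyu] at hd
  have hu0 : 0 < u := by linarith
  have hcu : c ≤ u := by
    by_contra hcon
    push Not at hcon
    -- strict convexity of exp
    obtain ⟨_, hs0⟩ := strictConvexOn_exp
    have hs := hs0 (mem_univ (-c)) (mem_univ (0:ℝ)) (by linarith)
      (show 0 < u / c by positivity) (show 0 < 1 - u / c by rw [sub_pos, div_lt_one hc]; exact hcon) (by ring)
    simp only [smul_eq_mul, mul_zero, add_zero, Real.exp_zero, mul_one] at hs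
    rw [show u / c * -c = -u by field_simp] at hs
    have h1 : u / c * c = u := by field_simp
    have h2 : 0 < u / c := by positivity
    have h4 : u / c * c ≤ u / c * (α * (1 - Real.exp (-c))) := mul_le_mul_of_nonneg_left hca h2.le
    nlinarith
  have h2 : Real.exp (-u) ≤ Real.exp (-c) := Real.exp_le_exp.2 (by linarith)
  intro t ht1 ht2
  exact T.lemG hα hc hcu (by rw [hyu]; nlinarith) ht1 ht2

theorem obsm (T : Loop α y q L) (hα : 0 < α) {tm m : ℝ} (h0 : 0 ≤ tm) (h1 : tm ≤ L) (hy : y tm ≤ -m) :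
    y (q+1) ≤ -m := (T.min_le hα h0 h1).trans hy

theorem obs2 (T : Loop α y q L) (hα : 0 < α) {q0 b k : ℝ} (hk2 : 2 ≤ k) (hk : q + k ≤ L + 1) (h0 : 1 ≤ q0)
    (hq : q0 ≤ q) (hq2 : q ≤ 2) (hy : b ≤ y (q0 + k)) : b ≤ y (q + k) :=
  hy.trans (T.mono2 hα ⟨by linarith, by linarith⟩ ⟨by linarith, by linarith⟩ (by linarith))

theorem obsUp (T : Loop α y q L) (hα : 0 < α) {q0 q1 b H : ℝ} (h0 : 1 ≤ q0) (hq : q0 ≤ q) (hq1 : q ≤ q1)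
    (hy : b ≤ y (q0 + 1)) (hH : y q0 ≤ H) (hH2 : H ≤ 1.25) : b - 2 * α * (q1 - q0) * H ≤ y (q+1) := by
  have hH0 : 0 ≤ H := (T.nonneg (by linarith) hq).trans hH
  have := le_sub_of_deriv (w := y) (p := q0 + 1) (r := q + 1) (C := -(2 * α * H))
    (by linarith) T.cont.continuousOn (fun u hu _ => T.der u (by linarith)) (fun u h3 h4 => by
      have h5 : y (u-1) ≤ H := (T.anti1 hα ⟨h0, by linarith⟩ ⟨by linarith, by linarith⟩ (by linarith)).trans hH
      have h6 : 0 ≤ y (u-1) := T.nonneg (by linarith) (by linarith)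
      set v := y (u-1)
      -- exp v ≤ 1 + 2 v on [0, 1.25]
      obtain ⟨_, hs0⟩ := convexOn_exp
      have hcv := hs0 (mem_univ (0:ℝ)) (mem_univ (1.25:ℝ))
        (show 0 ≤ 1 - v / 1.25 by rw [sub_nonneg, div_le_one (by norm_num)]; linarith)
        (show 0 ≤ v / 1.25 by positivity) (by ring)
      simp only [smul_eq_mul, mul_zero, zero_add, Real.exp_zero, mul_one] at hcv
      rw [show v / 1.25 * 1.25 = v by field_simp] at hcv
      have h125 : Real.exp 1.25 ≤ 3.5 := by
        have e1 : Real.exp 1.25 = Real.exp 0.625 * Real.exp 0.625 := by rw [← Real.exp_add]; norm_num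
        have e2 := Real.exp_bound' (x := 0.625) (by norm_num) (by norm_num) (n := 5) (by norm_num)
        norm_num [Finset.sum_range_succ, Nat.factorial] at e2
        have e3 := Real.exp_pos (0.625:ℝ)
        rw [e1]
        norm_num at e3 ⊢
        nlinarith
      have h7 : v / 1.25 * Real.exp 1.25 ≤ v / 1.25 * 3.5 := mul_le_mul_of_nonneg_left h125 (by positivity)
      have h7a : v / 1.25 * 3.5 = 2.8 * v := by ring
      have h7b : v / 1.25 = 0.8 * v := by ring
      have h8 : Real.exp v ≤ 1 + 2 * v := by linarith
      nlinarith)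
  have h9 : 2 * α * H * (q - q0) ≤ 2 * α * H * (q1 - q0) := mul_le_mul_of_nonneg_left (by linarith) (by positivity)
  nlinarith

theorem obsP (T : Loop α y q L) (hα : 0 < α) {q1 p : ℝ} (h : q ≤ q1) (h2 : q1 ≤ 2) (hy : y (q1 - 1) ≤ p) :
    y (q - 1) ≤ p :=
  (T.mono01 hα ⟨by linarith [T.hq], by linarith⟩ ⟨by linarith [T.hq], by linarith⟩ (by linarith)).trans hy
end Loop

/-- trapezoid rule with one-sided second derivative bound -/
theorem trap_lo {W g g1 g2 : ℝ → ℝ} {a h C : ℝ} (hh : 0 < h) (hW : ContinuousOn W (Icc a (a+h)))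
    (hg : ContinuousOn g (Icc a (a+h)))
    (dW : ∀ t, a < t → t < a + h → HasDerivAt W (g t) t)
    (dg : ∀ t, a < t → t < a + h → HasDerivAt g (g1 t) t)
    (dg1 : ∀ t, a < t → t < a + h → HasDerivAt g1 (g2 t) t)
    (hC : ∀ t, a < t → t < a + h → g2 t ≤ C) :
    (g a + g (a+h)) / 2 * h - C * h^3 / 12 ≤ W (a+h) - W a := by
  have hcc : ConcaveOn ℝ (Icc a (a+h)) (fun t => g t - C * t^2 / 2) := by
    apply concaveOn_of_hasDerivWithinAt2_nonpos (convex_Icc _ _) (f' := fun t => g1 t - C * t)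
      (f'' := fun t => g2 t - C)
    · exact hg.sub (by fun_prop)
    · intro t ht
      rw [interior_Icc] at ht
      apply HasDerivAt.hasDerivWithinAt
      have h2 : HasDerivAt (fun t : ℝ => C * t^2 / 2) (C * t) t :=
        (((hasDerivAt_pow 2 t).const_mul C).div_const 2).congr_deriv (by norm_num; ring)
      exact (dg t ht.1 ht.2).sub h2
    · intro t ht
      rw [interior_Icc] at ht
      apply HasDerivAt.hasDerivWithinAt
      have h2 : HasDerivAt (fun t : ℝ => C * t) C t :=
        ((hasDerivAt_id t).const_mul C).congr_deriv (by ring)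
      exact (dg1 t ht.1 ht.2).sub h2
    · intro t ht
      rw [interior_Icc] at ht
      linarith [hC t ht.1 ht.2]
  obtain ⟨_, hcv⟩ := hcc
  have key : ∀ t, a < t → t < a + h →
      g a + (g (a+h) - g a) * (t - a) / h - C / 2 * (h * (t-a) - (t-a)^2) ≤ g t := by
    intro t h1 h2
    have h0 : 0 ≤ (t - a) / h := div_nonneg (by linarith) hh.le
    have h01 : 0 ≤ 1 - (t - a) / h := by rw [sub_nonneg, div_le_one hh]; linarith
    have := hcv (left_mem_Icc.2 (by linarith : a ≤ a + h)) (right_mem_Icc.2 (by linarith : a ≤ a + h)) h01 h0 (by ring)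
    simp only [smul_eq_mul] at this
    obtain ⟨l, hl⟩ : ∃ l, l = (t - a) / h := ⟨_, rfl⟩
    have ht : t = a + l * h := by rw [hl]; field_simp; ring
    rw [← hl] at this
    rw [show (1 - l) * a + l * (a + h) = t by rw [ht]; ring] at this
    have e1 : (g (a+h) - g a) * (t - a) / h = (g (a+h) - g a) * l := by rw [hl]; ring
    have e2 : t - a = l * h := by linarith
    rw [e1, e2]
    have e3 : C * t^2/2 = C * (a + l*h)^2/2 := by rw [← ht]
    linarith
  have hP : ∀ t : ℝ, HasDerivAt (fun t => g a * (t - a) + (g (a+h) - g a) * (t-a)^2 / (2*h)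
      - C/2 * (h * (t-a)^2/2 - (t-a)^3/3))
      (g a + (g (a+h) - g a) * (t - a) / h - C / 2 * (h * (t-a) - (t-a)^2)) t := by
    intro t
    have b1 : HasDerivAt (fun t : ℝ => t - a) 1 t := (hasDerivAt_id t).sub_const a
    have b2 := b1.pow 2
    have b3 := b1.pow 3
    refine (((b1.const_mul (g a)).add ((b2.const_mul (g (a+h) - g a)).div_const (2*h))).sub
      ((((b2.const_mul h).div_const 2).sub (b3.div_const 3)).const_mul (C/2))).congr_deriv ?_
    field_simp
    ring
  have hfin := sub_le_sub_of_deriv (p := a) (r := a + h) (by linarith)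
    (fun t _ => (hP t).continuousAt.continuousWithinAt) hW (fun t _ _ => hP t) dW key
  refine le_trans (le_of_eq ?_) hfin
  field_simp
  ring

/-- the scaled nonlinearity -/
noncomputable def Fk (κ y : ℝ) : ℝ := (Real.exp (κ * y) - 1) / κ

/-- scaled equation -/
structure Sc (α κ : ℝ) (Y : ℝ → ℝ) : Prop where
  cont : Continuous Y
  der : ∀ t, 0 < t → HasDerivAt Y (-(α * Fk κ (Y (t-1)))) t

def SmR (Y : ℝ → ℝ) (a h pa pb ea eb : ℝ) : Prop :=
  ∃ Y1 Y2 : ℝ → ℝ, ∀ t, a < t → t < a + h → HasDerivAt Y (Y1 t) t ∧ HasDerivAt Y1 (Y2 t) t ∧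
    pa ≤ Y1 t ∧ Y1 t ≤ pb ∧ ea ≤ Y2 t ∧ Y2 t ≤ eb

theorem Fk_deriv {κ : ℝ} (hκ : 0 < κ) {Y : ℝ → ℝ} {t Y1 : ℝ} (h : HasDerivAt Y Y1 t) :
    HasDerivAt (fun t => Fk κ (Y t)) (Real.exp (κ * Y t) * Y1) t := by
  unfold Fk
  refine ((((h.const_mul κ).exp).sub_const 1).div_const κ).congr_deriv ?_
  field_simp

theorem Fk_cont {κ : ℝ} {Y : ℝ → ℝ} (h : Continuous Y) : Continuous (fun t => Fk κ (Y t)) := by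
  unfold Fk
  fun_prop

theorem Fk_mono {κ : ℝ} (hκ : 0 < κ) {a b : ℝ} (h : a ≤ b) : Fk κ a ≤ Fk κ b := by
  unfold Fk
  gcongr

theorem mk_real {α κ : ℝ} {Y : ℝ → ℝ} (hY : Sc α κ Y) (hα : 0 < α) (hκ : 0 < κ)
    {a h pa pb ea eb Fl Fh Dl Dh f0l f0u f1l f1u q0 q1 w0 w1 G0 G1 g0 g1 : ℝ} (ha : -1 ≤ a) (hh : 0 < h)
    (hs : SmR Y a h pa pb ea eb)
    (hF : ∀ t, a ≤ t → t ≤ a + h → Fl ≤ Fk κ (Y t) ∧ Fk κ (Y t) ≤ Fh)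
    (hD : ∀ t, a ≤ t → t ≤ a + h → Dl ≤ Real.exp (κ * Y t) ∧ Real.exp (κ * Y t) ≤ Dh)
    (h0 : f0l ≤ Fk κ (Y a) ∧ Fk κ (Y a) ≤ f0u) (h1 : f1l ≤ Fk κ (Y (a+h)) ∧ Fk κ (Y (a+h)) ≤ f1u)
    (hq : ∀ p, pa ≤ p → p ≤ pb → q0 ≤ p^2 ∧ p^2 ≤ q1)
    (hw0 : w0 ≤ κ * q0 + ea) (hw1 : κ * q1 + eb ≤ w1)
    (hG : ∀ d w, 0 < d → Dl ≤ d → d ≤ Dh → w0 ≤ w → w ≤ w1 → G0 ≤ d * w ∧ d * w ≤ G1)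
    (hg : ∀ d w, 0 < d → Dl ≤ d → d ≤ Dh → pa ≤ w → w ≤ pb → g0 ≤ d * w ∧ d * w ≤ g1) :
    α * ((f0l + f1l) / 2 * h - G1 * h^3 / 12) ≤ -(Y (a + 1 + h) - Y (a + 1)) ∧
    -(Y (a + 1 + h) - Y (a + 1)) ≤ α * ((f0u + f1u) / 2 * h - G0 * h^3 / 12) ∧
    SmR Y (a+1) h (-(α * Fh)) (-(α * Fl)) (-(α * g1)) (-(α * g0)) := by
  obtain ⟨Y1, Y2, hs⟩ := hs
  -- second derivative of the drive
  have d1 : ∀ t, a < t → t < a + h → HasDerivAt (fun t => Fk κ (Y t)) (Real.exp (κ * Y t) * Y1 t) t :=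
    fun t u v => Fk_deriv hκ (hs t u v).1
  have d2 : ∀ t, a < t → t < a + h → HasDerivAt (fun t => Real.exp (κ * Y t) * Y1 t)
      (Real.exp (κ * Y t) * (κ * (Y1 t)^2 + Y2 t)) t := by
    intro t u v
    obtain ⟨e1, e2, _⟩ := hs t u v
    exact (((e1.const_mul κ).exp).mul e2).congr_deriv (by ring)
  have b2 : ∀ t, a < t → t < a + h → G0 ≤ Real.exp (κ * Y t) * (κ * (Y1 t)^2 + Y2 t) ∧
      Real.exp (κ * Y t) * (κ * (Y1 t)^2 + Y2 t) ≤ G1 := by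
    intro t u v
    obtain ⟨_, _, e3, e4, e5, e6⟩ := hs t u v
    obtain ⟨i1, i2⟩ := hq _ e3 e4
    obtain ⟨j1, j2⟩ := hD t u.le v.le
    have := mul_le_mul_of_nonneg_left i1 hκ.le
    have := mul_le_mul_of_nonneg_left i2 hκ.le
    exact hG _ _ (Real.exp_pos _) j1 j2 (by linarith) (by linarith)
  have hW : ∀ t, a < t → t < a + h → HasDerivAt (fun t => -(Y (t+1)) / α) (Fk κ (Y t)) t := by
    intro t u v
    have e := (hY.der (t+1) (by linarith)).comp_add_const t 1
    rw [add_sub_cancel_right] at e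
    refine (e.neg.div_const α).congr_deriv ?_
    field_simp
  have hc1 : Continuous (fun t => -(Y (t+1)) / α) := by
    have := hY.cont
    fun_prop
  have hcF := Fk_cont (κ := κ) hY.cont
  refine ⟨?_, ?_, ?_⟩
  · have T := trap_lo hh hc1.continuousOn hcF.continuousOn hW d1 d2 (fun t u v => (b2 t u v).2)
    rw [show a + 1 + h = a + h + 1 by ring]
    have e : -(Y (a + h + 1) - Y (a+1)) = α * (-Y (a + h + 1) / α - -Y (a + 1) / α) := by
      field_simp; ring
    rw [e]
    refine mul_le_mul_of_nonneg_left (le_trans ?_ T) hα.le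
    have : (f0l + f1l) / 2 * h ≤ (Fk κ (Y a) + Fk κ (Y (a+h))) / 2 * h := by
      apply mul_le_mul_of_nonneg_right _ hh.le
      linarith [h0.1, h1.1]
    linarith
  · have T := trap_lo (W := fun t => -(-(Y (t+1)) / α)) (g := fun t => -(Fk κ (Y t)))
      (g1 := fun t => -(Real.exp (κ * Y t) * Y1 t)) (g2 := fun t => -(Real.exp (κ * Y t) * (κ * (Y1 t)^2 + Y2 t)))
      (C := -G0) hh hc1.neg.continuousOn hcF.neg.continuousOn
      (fun t u v => (hW t u v).neg) (fun t u v => (d1 t u v).neg) (fun t u v => (d2 t u v).neg)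
      (fun t u v => by linarith [(b2 t u v).1])
    rw [show a + 1 + h = a + h + 1 by ring]
    have e : -(Y (a + h + 1) - Y (a+1)) = α * (-Y (a + h + 1) / α - -Y (a + 1) / α) := by
      field_simp; ring
    rw [e]
    refine mul_le_mul_of_nonneg_left ?_ hα.le
    have : (Fk κ (Y a) + Fk κ (Y (a+h))) / 2 * h ≤ (f0u + f1u) / 2 * h := by
      apply mul_le_mul_of_nonneg_right _ hh.le
      linarith [h0.2, h1.2]
    linarith
  · refine ⟨fun t => -(α * Fk κ (Y (t-1))), fun t => -(α * (Real.exp (κ * Y (t-1)) * Y1 (t-1))), fun t u v => ?_⟩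
    have u' : a < t - 1 := by linarith
    have v' : t - 1 < a + h := by linarith
    obtain ⟨_, _, e3, e4, _⟩ := hs (t-1) u' v'
    obtain ⟨j1, j2⟩ := hD (t-1) u'.le v'.le
    obtain ⟨k1, k2⟩ := hF (t-1) u'.le v'.le
    obtain ⟨l1, l2⟩ := hg _ _ (Real.exp_pos _) j1 j2 e3 e4
    refine ⟨hY.der t (by linarith), ?_, ?_, ?_, ?_, ?_⟩
    · exact (((d1 (t-1) u' v').comp_sub_const t 1).const_mul α).neg
    · exact neg_le_neg (mul_le_mul_of_nonneg_left k2 hα.le)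
    · exact neg_le_neg (mul_le_mul_of_nonneg_left k1 hα.le)
    · exact neg_le_neg (mul_le_mul_of_nonneg_left l2 hα.le)
    · exact neg_le_neg (mul_le_mul_of_nonneg_left l1 hα.le)

/-- linear interpolation from the left and the right node -/
theorem SmR.interp {Y : ℝ → ℝ} {a h pa pb ea eb : ℝ} (hs : SmR Y a h pa pb ea eb) (hc : Continuous Y)
    {s : ℝ} (h0 : 0 ≤ s) (h1 : s ≤ h) :
    Y a + pa * s ≤ Y (a+s) ∧ Y (a+s) ≤ Y a + pb * s ∧ Y (a+h) - pb * (h - s) ≤ Y (a+s) ∧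
      Y (a+s) ≤ Y (a+h) - pa * (h - s) := by
  obtain ⟨Y1, Y2, hs⟩ := hs
  have l1 := le_sub_of_deriv (w := Y) (p := a) (r := a+s) (C := pa) (by linarith) hc.continuousOn
    (fun t u v => (hs t u (by linarith)).1) (fun t u v => (hs t u (by linarith)).2.2.1)
  have l2 := sub_le_of_deriv (w := Y) (p := a) (r := a+s) (C := pb) (by linarith) hc.continuousOn
    (fun t u v => (hs t u (by linarith)).1) (fun t u v => (hs t u (by linarith)).2.2.2.1)
  have l3 := le_sub_of_deriv (w := Y) (p := a+s) (r := a+h) (C := pa) (by linarith) hc.continuousOn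
    (fun t u v => (hs t (by linarith) v).1) (fun t u v => (hs t (by linarith) v).2.2.1)
  have l4 := sub_le_of_deriv (w := Y) (p := a+s) (r := a+h) (C := pb) (by linarith) hc.continuousOn
    (fun t u v => (hs t (by linarith) v).1) (fun t u v => (hs t (by linarith) v).2.2.2.1)
  refine ⟨by linarith, by linarith, by linarith, by linarith⟩

/-! fixed point arithmetic, evaluated by the kernel -/
def SZ : ℤ := 1099511627776

theorem SZ_pos : (0:ℝ) < (SZ : ℝ) := by norm_num [SZ]
theorem SZ_posZ : 0 < SZ := by norm_num [SZ]

/-- force the evaluation of an integer -/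
noncomputable def fz (x : ℤ) (k : ℤ → Bool) : Bool :=
  Int.rec (motive := fun _ => Bool)
    (fun p => Nat.rec (motive := fun _ => Bool) (k (Int.ofNat (nat_lit 0))) (fun m _ => k (Int.ofNat (Nat.succ m))) p)
    (fun p => Nat.rec (motive := fun _ => Bool) (k (Int.negSucc (nat_lit 0))) (fun m _ => k (Int.negSucc (Nat.succ m))) p) x

theorem fz_eq (x : ℤ) (k : ℤ → Bool) : fz x k = k x := by
  unfold fz
  cases x with
  | ofNat p => cases p <;> rfl
  | negSucc p => cases p <;> rfl

/-- sign test -/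
noncomputable def sg {β : Type} (x : ℤ) (n p : β) : β :=
  Int.rec (motive := fun _ => β) (fun _ => p) (fun _ => n) x

theorem sg_eq {β : Type} (x : ℤ) (n p : β) : sg x n p = if x < 0 then n else p := by
  unfold sg
  cases x with
  | ofNat m => simp
  | negSucc m => simp [Int.negSucc_lt_zero]

theorem sg_false {x : ℤ} {b : Bool} (h : sg x false b = true) : 0 ≤ x ∧ b = true := by
  rw [sg_eq] at h
  split_ifs at h with h1
  exact ⟨by omega, h⟩

theorem fdiv_le (a : ℤ) {b : ℤ} (hb : 0 < b) : ((a / b : ℤ) : ℝ) ≤ (a : ℝ) / b := by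
  have hb' : (0:ℝ) < b := by exact_mod_cast hb
  rw [le_div_iff₀ hb']
  exact_mod_cast Int.ediv_mul_le a hb.ne'

theorem lt_fdiv (a : ℤ) {b : ℤ} (hb : 0 < b) : (a : ℝ) / b < ((a / b : ℤ) : ℝ) + 1 := by
  have hb' : (0:ℝ) < b := by exact_mod_cast hb
  rw [div_lt_iff₀ hb']
  exact_mod_cast Int.lt_ediv_add_one_mul_self a hb

/-! integer operations through recursors: much cheaper for the kernel than the instances -/
noncomputable def isn (x y : ℕ) : ℤ :=
  Bool.rec (motive := fun _ => ℤ) (Int.negSucc (Nat.sub (Nat.sub y x) (nat_lit 1))) (Int.ofNat (Nat.sub x y)) (Nat.ble y x)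
noncomputable def inz (z : ℕ) : ℤ :=
  Nat.rec (motive := fun _ => ℤ) (Int.ofNat (nat_lit 0)) (fun m _ => Int.negSucc m) z
noncomputable def iad (a b : ℤ) : ℤ := Int.rec (motive := fun _ => ℤ)
  (fun x => Int.rec (motive := fun _ => ℤ) (fun y => Int.ofNat (Nat.add x y)) (fun y => isn x (Nat.succ y)) b)
  (fun x => Int.rec (motive := fun _ => ℤ) (fun y => isn y (Nat.succ x))
    (fun y => Int.negSucc (Nat.succ (Nat.add x y))) b) a
noncomputable def isb (a b : ℤ) : ℤ := Int.rec (motive := fun _ => ℤ)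
  (fun x => Int.rec (motive := fun _ => ℤ) (fun y => isn x y) (fun y => Int.ofNat (Nat.succ (Nat.add x y))) b)
  (fun x => Int.rec (motive := fun _ => ℤ) (fun y => Int.negSucc (Nat.add x y)) (fun y => isn y x) b) a
noncomputable def ing (a : ℤ) : ℤ :=
  Int.rec (motive := fun _ => ℤ) (fun x => inz x) (fun x => Int.ofNat (Nat.succ x)) a
noncomputable def iml (a b : ℤ) : ℤ := Int.rec (motive := fun _ => ℤ)
  (fun x => Int.rec (motive := fun _ => ℤ) (fun y => Int.ofNat (Nat.mul x y)) (fun y => inz (Nat.mul x (Nat.succ y))) b)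
  (fun x => Int.rec (motive := fun _ => ℤ) (fun y => inz (Nat.mul (Nat.succ x) y))
    (fun y => Int.ofNat (Nat.mul (Nat.succ x) (Nat.succ y))) b) a
noncomputable def idi (a b : ℤ) : ℤ := Int.rec (motive := fun _ => ℤ)
  (fun n => Int.rec (motive := fun _ => ℤ) (fun x => Int.ofNat (Nat.div x n))
    (fun x => Nat.rec (motive := fun _ => ℤ) (Int.ofNat (nat_lit 0)) (fun m _ => Int.negSucc (Nat.div x (Nat.succ m))) n) a)
  (fun _ => a / b) b
noncomputable def isd (a : ℤ) : ℤ := Int.rec (motive := fun _ => ℤ)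
  (fun x => Int.ofNat (Nat.div x (nat_lit 1099511627776))) (fun x => Int.negSucc (Nat.div x (nat_lit 1099511627776))) a

notation:65 a:65 "+ᵢ" b:66 => iad a b
notation:65 a:65 "-ᵢ" b:66 => isb a b
notation:70 a:70 "*ᵢ" b:71 => iml a b
notation:70 a:70 "/ᵢ" b:71 => idi a b

theorem isn_eq (x y : ℕ) : isn x y = (x:ℤ) - y := by
  unfold isn
  rcases h : Nat.ble y x with _ | _
  · have : ¬ y ≤ x := fun h' => by rw [Nat.ble_eq_true_of_le h'] at h; exact absurd h (by simp)
    change Int.negSucc (y - x - 1) = _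
    rw [Int.negSucc_eq]; omega
  · have := Nat.le_of_ble_eq_true h
    change Int.ofNat (x - y) = _
    rw [Int.ofNat_eq_natCast]; omega
theorem inz_eq (z : ℕ) : inz z = -(z:ℤ) := by
  cases z with
  | zero => rfl
  | succ m => change Int.negSucc m = _; rw [Int.negSucc_eq]; push_cast; rfl
theorem iad_eq (a b : ℤ) : iad a b = a + b := by
  rcases a with x | x <;> rcases b with y | y
  · change Int.ofNat (x + y) = _; simp
  · change isn x (y + 1) = _; rw [isn_eq, Int.negSucc_eq]; simp; omega
  · change isn y (x + 1) = _; rw [isn_eq, Int.negSucc_eq]; simp; omega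
  · rfl
theorem isb_eq (a b : ℤ) : isb a b = a - b := by
  rcases a with x | x <;> rcases b with y | y
  · change isn x y = _; rw [isn_eq]; rfl
  · change Int.ofNat (x + y + 1) = _; rw [Int.negSucc_eq]; simp; omega
  · change Int.negSucc (x + y) = _; rw [Int.negSucc_eq, Int.negSucc_eq]; simp; omega
  · change isn y x = _; rw [isn_eq, Int.negSucc_eq, Int.negSucc_eq]; omega
theorem ing_eq (a : ℤ) : ing a = -a := by
  rcases a with x | x
  · change inz x = _; rw [inz_eq]; rfl
  · rfl
theorem iml_eq (a b : ℤ) : iml a b = a * b := by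
  rcases a with x | x <;> rcases b with y | y
  · rfl
  · change inz (x * (y + 1)) = _; rw [inz_eq, Int.negSucc_eq]; push_cast; simp; ring
  · change inz ((x + 1) * y) = _; rw [inz_eq, Int.negSucc_eq]; push_cast; simp; ring
  · rfl
theorem idi_eq (a b : ℤ) : idi a b = a / b := by
  rcases b with n | n
  · rcases a with x | x
    · rfl
    · cases n with
      | zero => simp [idi]
      | succ m => rfl
  · rfl
theorem isd_eq (a : ℤ) : isd a = a / SZ := by
  rcases a with x | x <;> rfl

/-- `x * l / SZ` for natural `x` -/
noncomputable def mlp (x : ℕ) (l : ℤ) : ℤ := Int.rec (motive := fun _ => ℤ)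
  (fun y => Int.ofNat (Nat.div (Nat.mul x y) (nat_lit 1099511627776))) (fun y => isd (inz (Nat.mul x (Nat.succ y)))) l
noncomputable def mln (x : ℕ) (l : ℤ) : ℤ := Int.rec (motive := fun _ => ℤ)
  (fun y => isd (inz (Nat.mul (Nat.succ x) y))) (fun y => isd (Int.ofNat (Nat.mul (Nat.succ x) (Nat.succ y)))) l
noncomputable def mulLo (w l h : ℤ) : ℤ := Int.rec (motive := fun _ => ℤ) (fun x => mlp x l) (fun x => mln x h) w
noncomputable def mulHi (w l h : ℤ) : ℤ := Int.rec (motive := fun _ => ℤ) (fun x => mlp x h) (fun x => mln x l) w +ᵢ 1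

theorem mlp_eq (x : ℕ) (l : ℤ) : mlp x l = l * (Int.ofNat x) / SZ := by
  rcases l with y | y
  · rw [mul_comm]; rfl
  · change isd (inz (x * (y + 1))) = _; rw [isd_eq, inz_eq, Int.negSucc_eq]; congr 1; push_cast; simp; ring
theorem mln_eq (x : ℕ) (l : ℤ) : mln x l = l * (Int.negSucc x) / SZ := by
  rcases l with y | y
  · change isd (inz ((x + 1) * y)) = _; rw [isd_eq, inz_eq, Int.negSucc_eq]; congr 1; push_cast; simp; ring
  · rw [mul_comm]; change isd (Int.ofNat ((x + 1) * (y + 1))) = _; rw [isd_eq]; rfl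
theorem mulLo_eq (w l h : ℤ) : mulLo w l h = sg w h l * w / SZ := by
  rcases w with x | x
  · exact mlp_eq x l
  · exact mln_eq x h
theorem mulHi_eq (w l h : ℤ) : mulHi w l h = sg w l h * w / SZ + 1 := by
  rcases w with x | x
  · change mlp x h +ᵢ 1 = _; rw [iad_eq, mlp_eq]; rfl
  · change mln x l +ᵢ 1 = _; rw [iad_eq, mln_eq]; rfl

theorem mulLo_le {w l h : ℤ} {d x : ℝ} (hd : 0 < d) (hl : (l:ℝ) ≤ SZ * d) (hh : SZ * d ≤ (h:ℝ))
    (hw : (w:ℝ) ≤ SZ * x) : (mulLo w l h : ℝ) ≤ SZ * (d * x) := by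
  rw [mulLo_eq]
  refine (fdiv_le _ SZ_posZ).trans ?_
  have hS := SZ_pos
  rw [div_le_iff₀ hS, sg_eq]
  have h1 : SZ * d * w ≤ SZ * d * (SZ * x) := mul_le_mul_of_nonneg_left hw (by positivity)
  split_ifs with hneg
  · have : (w:ℝ) ≤ 0 := by exact_mod_cast hneg.le
    push_cast
    nlinarith [mul_le_mul_of_nonpos_right hh this]
  · have : (0:ℝ) ≤ (w:ℝ) := by exact_mod_cast (not_lt.1 hneg)
    push_cast
    nlinarith [mul_le_mul_of_nonneg_right hl this]

theorem le_mulHi {w l h : ℤ} {d x : ℝ} (hd : 0 < d) (hl : (l:ℝ) ≤ SZ * d) (hh : SZ * d ≤ (h:ℝ))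
    (hw : SZ * x ≤ (w:ℝ)) : SZ * (d * x) ≤ (mulHi w l h : ℝ) := by
  rw [mulHi_eq]
  push_cast
  refine le_trans ?_ (lt_fdiv _ SZ_posZ).le
  have hS := SZ_pos
  rw [le_div_iff₀ hS, sg_eq]
  have h1 : SZ * d * (SZ * x) ≤ SZ * d * w := mul_le_mul_of_nonneg_left hw (by positivity)
  split_ifs with hneg
  · have : (w:ℝ) ≤ 0 := by exact_mod_cast hneg.le
    push_cast
    nlinarith [mul_le_mul_of_nonpos_right hl this]
  · have : (0:ℝ) ≤ (w:ℝ) := by exact_mod_cast (not_lt.1 hneg)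
    push_cast
    nlinarith [mul_le_mul_of_nonneg_right hh this]

/-! exponential -/
noncomputable def coreE (x : ℤ) : ℤ :=
  ((((x +ᵢ 281474976710656) *ᵢ x +ᵢ 59421121885698253195157962752) *ᵢ x
    +ᵢ 8362779449448983678075894352243135564742656) *ᵢ x
    +ᵢ 588478287692501321609605258425718726509595822918503235584) /ᵢ 535217884764734955396857238543560676143529984

noncomputable def errE (x : ℤ) : ℤ := sg (x +ᵢ 4398046511104) 340000 (sg (4398046511104 -ᵢ x) 340000 10600)

noncomputable def qD (p : ℕ) : ℕ := Nat.div (Nat.mul p p) (nat_lit 1099511627776)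
noncomputable def qU (p : ℕ) : ℕ := Nat.succ (Nat.div (Nat.mul p p) (nat_lit 1099511627776))
noncomputable def sqD (a : ℤ) (k : ℤ → Bool) : Bool :=
  Int.rec (motive := fun _ => Bool) (fun p => fz (Int.ofNat (qD (qD (qD (qD (qD (qD p))))))) k) (fun _ => false) a
noncomputable def sqU (a : ℤ) (k : ℤ → Bool) : Bool :=
  Int.rec (motive := fun _ => Bool) (fun p => fz (Int.ofNat (qU (qU (qU (qU (qU (qU p))))))) k) (fun _ => false) a

noncomputable def loC (x : ℤ) (k : ℤ → Bool) : Bool := sqD (coreE x -ᵢ errE x) k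
noncomputable def hiC (x : ℤ) (k : ℤ → Bool) : Bool := sqU (coreE x +ᵢ errE x +ᵢ 1) k

noncomputable def expLo (x : ℤ) (k : ℤ → Bool) : Bool :=
  sg (x +ᵢ 8796093022208) (k 0) (sg (8796093022208 -ᵢ x) (loC 8796093022208 k) (loC x k))
noncomputable def expHi (x : ℤ) (k : ℤ → Bool) : Bool :=
  sg (8796093022208 -ᵢ x) false (sg (x +ᵢ 8796093022208) (hiC (-8796093022208) k) (hiC x k))

theorem qD_eq (p : ℕ) : Int.ofNat (qD p) = Int.ofNat p * Int.ofNat p / SZ := rfl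
theorem qU_eq (p : ℕ) : Int.ofNat (qU p) = Int.ofNat p * Int.ofNat p / SZ + 1 := rfl

theorem core_near {x : ℤ} (h1 : -8796093022208 ≤ x) (h2 : x ≤ 8796093022208) :
    (coreE x - errE x : ℝ) ≤ SZ * Real.exp ((x:ℝ) / (64 * SZ)) ∧
    SZ * Real.exp ((x:ℝ) / (64 * SZ)) ≤ (coreE x + errE x + 1 : ℝ) := by
  obtain ⟨r, hr⟩ : ∃ r : ℝ, r = (x:ℝ) / (64 * SZ) := ⟨_, rfl⟩
  rw [← hr]
  have hx : (x:ℝ) = r * 70368744177664 := by rw [hr]; norm_num [SZ]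
  have g1 : (-8796093022208:ℝ) ≤ x := by exact_mod_cast h1
  have g2 : (x:ℝ) ≤ 8796093022208 := by exact_mod_cast h2
  have a1 : -(1/8) ≤ r := by linarith
  have a2 : r ≤ 1/8 := by linarith
  have habs : |r| ≤ 1/8 := abs_le.2 ⟨a1, a2⟩
  have hb := Real.exp_bound (x := r) (by linarith) (n := 5) (by norm_num)
  norm_num [Finset.sum_range_succ, Nat.factorial] at hb
  have herr : (SZ:ℝ) * (|r|^5 / 100) ≤ errE x := by
    unfold errE
    simp only [iad_eq, isb_eq]
    have c1 : (SZ:ℝ) * (|r|^5 / 100) ≤ 340000 := by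
      have : |r|^5 ≤ (1/8)^5 := pow_le_pow_left₀ (abs_nonneg _) habs 5
      norm_num [SZ] at this ⊢
      linarith
    rw [sg_eq, sg_eq]
    split_ifs with i1 i2
    · exact_mod_cast c1
    · exact_mod_cast c1
    · have j1 : (-4398046511104:ℝ) ≤ x := by exact_mod_cast (by omega : (-4398046511104:ℤ) ≤ x)
      have j2 : (x:ℝ) ≤ 4398046511104 := by exact_mod_cast (by omega : x ≤ (4398046511104:ℤ))
      have habs' : |r| ≤ 1/16 := abs_le.2 ⟨by linarith, by linarith⟩
      have : |r|^5 ≤ (1/16)^5 := pow_le_pow_left₀ (abs_nonneg _) habs' 5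
      norm_num [SZ] at this ⊢
      linarith
  have hc1 : (coreE x : ℝ) ≤ SZ * (1 + r + r^2/2 + r^3/6 + r^4/24) := by
    unfold coreE
    simp only [iad_eq, iml_eq, idi_eq]
    refine (fdiv_le _ (by norm_num)).trans (le_of_eq ?_)
    push_cast
    rw [hx]
    norm_num [SZ]
    ring
  have hc2 : SZ * (1 + r + r^2/2 + r^3/6 + r^4/24) ≤ (coreE x : ℝ) + 1 := by
    unfold coreE
    simp only [iad_eq, iml_eq, idi_eq]
    refine le_trans (le_of_eq ?_) (lt_fdiv _ (by norm_num)).le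
    push_cast
    rw [hx]
    norm_num [SZ]
    ring
  rw [abs_le] at hb
  have hS := SZ_pos
  have m1 := mul_le_mul_of_nonneg_left hb.1 hS.le
  have m2 := mul_le_mul_of_nonneg_left hb.2 hS.le
  constructor <;> linarith

theorem sq_lo1 {a : ℤ} {v : ℝ} (h0 : 0 ≤ a) (hv : (a:ℝ) ≤ SZ * v) (hv0 : 0 < v) :
    0 ≤ a * a / SZ ∧ ((a * a / SZ : ℤ) : ℝ) ≤ SZ * v^2 := by
  refine ⟨Int.ediv_nonneg (mul_self_nonneg a) SZ_posZ.le, (fdiv_le _ SZ_posZ).trans ?_⟩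
  have hS := SZ_pos
  rw [div_le_iff₀ hS]
  push_cast
  have : (0:ℝ) ≤ a := by exact_mod_cast h0
  nlinarith [mul_le_mul hv hv this (by positivity)]

theorem sq_hi1 {a : ℤ} {v : ℝ} (hv : SZ * v ≤ (a:ℝ)) (hv0 : 0 < v) :
    SZ * v^2 ≤ ((a * a / SZ + 1 : ℤ) : ℝ) := by
  push_cast
  refine le_trans ?_ (lt_fdiv _ SZ_posZ).le
  have hS := SZ_pos
  rw [le_div_iff₀ hS]
  push_cast
  have h : 0 ≤ SZ * v := by positivity
  nlinarith [mul_le_mul hv hv h (by linarith)]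

theorem sqD_sound {a : ℤ} {v : ℝ} {k : ℤ → Bool} (h0 : 0 ≤ a) (hv : (a:ℝ) ≤ SZ * v) (hv0 : 0 < v)
    (h : sqD a k = true) : ∃ b : ℤ, k b = true ∧ 0 ≤ b ∧ (b:ℝ) ≤ SZ * v^64 := by
  obtain ⟨p, rfl⟩ : ∃ p : ℕ, a = Int.ofNat p := ⟨a.toNat, (Int.toNat_of_nonneg h0).symm⟩
  simp only [sqD, fz_eq, qD_eq] at h
  obtain ⟨p1, r1⟩ := sq_lo1 h0 hv hv0
  obtain ⟨p2, r2⟩ := sq_lo1 p1 r1 (by positivity)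
  obtain ⟨p3, r3⟩ := sq_lo1 p2 r2 (by positivity)
  obtain ⟨p4, r4⟩ := sq_lo1 p3 r3 (by positivity)
  obtain ⟨p5, r5⟩ := sq_lo1 p4 r4 (by positivity)
  obtain ⟨p6, r6⟩ := sq_lo1 p5 r5 (by positivity)
  refine ⟨_, h, p6, r6.trans (le_of_eq ?_)⟩
  ring

theorem sqU_sound {a : ℤ} {v : ℝ} {k : ℤ → Bool} (hv : SZ * v ≤ (a:ℝ)) (hv0 : 0 < v)
    (h : sqU a k = true) : ∃ b : ℤ, k b = true ∧ SZ * v^64 ≤ (b:ℝ) := by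
  obtain ⟨p, rfl⟩ : ∃ p : ℕ, a = Int.ofNat p := by
    rcases a with p | p
    · exact ⟨p, rfl⟩
    · exact absurd h (by simp [sqU])
  simp only [sqU, fz_eq, qU_eq] at h
  have r1 := sq_hi1 hv hv0
  have r2 := sq_hi1 r1 (by positivity)
  have r3 := sq_hi1 r2 (by positivity)
  have r4 := sq_hi1 r3 (by positivity)
  have r5 := sq_hi1 r4 (by positivity)
  have r6 := sq_hi1 r5 (by positivity)
  refine ⟨_, h, le_trans (le_of_eq ?_) r6⟩
  ring

theorem exp64 (x : ℤ) : Real.exp ((x:ℝ) / (64 * SZ)) ^ 64 = Real.exp ((x:ℝ) / SZ) := by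
  rw [← Real.exp_nat_mul]
  congr 1
  have := SZ_pos
  push_cast
  field_simp

theorem loC_sound {x : ℤ} {k : ℤ → Bool} (h1 : -8796093022208 ≤ x) (h2 : x ≤ 8796093022208)
    (h : loC x k = true) : ∃ b : ℤ, k b = true ∧ 0 ≤ b ∧ (b:ℝ) ≤ SZ * Real.exp ((x:ℝ) / SZ) := by
  simp only [loC, isb_eq] at h
  have h0 : 0 ≤ coreE x - errE x := by
    rcases hh : coreE x - errE x with p | p
    · simp
    · rw [hh] at h; exact absurd h (by simp [sqD])
  have := (core_near h1 h2).1
  rw [← exp64]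
  exact sqD_sound h0 (by push_cast; exact this) (Real.exp_pos _) h

theorem hiC_sound {x : ℤ} {k : ℤ → Bool} (h1 : -8796093022208 ≤ x) (h2 : x ≤ 8796093022208)
    (h : hiC x k = true) : ∃ b : ℤ, k b = true ∧ SZ * Real.exp ((x:ℝ) / SZ) ≤ (b:ℝ) := by
  simp only [hiC, iad_eq] at h
  have := (core_near h1 h2).2
  rw [← exp64]
  exact sqU_sound (by push_cast; exact this) (Real.exp_pos _) h

theorem expLo_sound {x : ℤ} {k : ℤ → Bool} (h : expLo x k = true) :
    ∃ b : ℤ, k b = true ∧ 0 ≤ b ∧ ∀ y : ℝ, (x:ℝ) ≤ SZ * y → (b:ℝ) ≤ SZ * Real.exp y := by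
  have hS := SZ_pos
  have aux : ∀ z : ℤ, z ≤ x → (∃ b : ℤ, k b = true ∧ 0 ≤ b ∧ (b:ℝ) ≤ SZ * Real.exp ((z:ℝ) / SZ)) →
      ∃ b : ℤ, k b = true ∧ 0 ≤ b ∧ ∀ y : ℝ, (x:ℝ) ≤ SZ * y → (b:ℝ) ≤ SZ * Real.exp y := by
    rintro z hz ⟨b, hb, h0, hb2⟩
    refine ⟨b, hb, h0, fun y hy => hb2.trans (mul_le_mul_of_nonneg_left (Real.exp_le_exp.2 ?_) hS.le)⟩
    rw [div_le_iff₀ hS]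
    have : (z:ℝ) ≤ x := by exact_mod_cast hz
    linarith
  simp only [expLo, sg_eq, iad_eq, isb_eq] at h
  split_ifs at h with i1 i2
  · exact ⟨0, h, le_rfl, fun y _ => by push_cast; positivity⟩
  · exact aux _ (by omega) (loC_sound (by norm_num) (by norm_num) h)
  · exact aux _ le_rfl (loC_sound (by omega) (by omega) h)

theorem expHi_sound {x : ℤ} {k : ℤ → Bool} (h : expHi x k = true) :
    ∃ b : ℤ, k b = true ∧ ∀ y : ℝ, SZ * y ≤ (x:ℝ) → SZ * Real.exp y ≤ (b:ℝ) := by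
  have hS := SZ_pos
  have aux : ∀ z : ℤ, x ≤ z → (∃ b : ℤ, k b = true ∧ SZ * Real.exp ((z:ℝ) / SZ) ≤ (b:ℝ)) →
      ∃ b : ℤ, k b = true ∧ ∀ y : ℝ, SZ * y ≤ (x:ℝ) → SZ * Real.exp y ≤ (b:ℝ) := by
    rintro z hz ⟨b, hb, hb2⟩
    refine ⟨b, hb, fun y hy => (mul_le_mul_of_nonneg_left (Real.exp_le_exp.2 ?_) hS.le).trans hb2⟩
    rw [le_div_iff₀ hS]
    have : (x:ℝ) ≤ z := by exact_mod_cast hz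
    linarith
  simp only [expHi, iad_eq, isb_eq] at h
  obtain ⟨h0, h⟩ := sg_false h
  rw [sg_eq] at h
  split_ifs at h with i1
  · exact aux _ (by omega) (hiC_sound (by norm_num) (by norm_num) h)
  · exact aux _ le_rfl (hiC_sound (by omega) (by omega) h)

/-- parameters of a run -/
structure Pm where
  n : ℤ
  n2 : ℤ
  n3 : ℤ
  a0 : ℤ
  a1 : ℤ
  k0 : ℤ
  k1 : ℤ

structure Pm.Ok (P : Pm) (α κ : ℝ) : Prop where
  hn : 0 < P.n
  hn2 : P.n2 = 2 * P.n
  hn3 : P.n3 = 12 * P.n * P.n * P.n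
  ha0 : (P.a0 : ℝ) ≤ SZ * α
  ha1 : SZ * α ≤ (P.a1 : ℝ)
  hα : 0 < α
  hk0 : (P.k0 : ℝ) ≤ SZ * κ
  hk1 : SZ * κ ≤ (P.k1 : ℝ)
  hκ : 0 < κ
  hone : 0 < P.k0 → κ = 1
  hnn : 0 ≤ P.k0

noncomputable def evE (P : Pm) (l u : ℤ) (k : ℤ → ℤ → ℤ → ℤ → Bool) : Bool :=
  sg (P.k0 -ᵢ 1)
    (fz (isd (P.k1 *ᵢ u) +ᵢ 1) fun z => sg (3 *ᵢ SZ -ᵢ 10 *ᵢ z) false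
      (fz (u +ᵢ 6 *ᵢ P.k1 *ᵢ u *ᵢ u /ᵢ (10 *ᵢ SZ *ᵢ SZ) +ᵢ 1) fun fu =>
       fz (sg l (SZ +ᵢ isd (P.k1 *ᵢ l)) SZ) fun dl =>
       fz (sg (u -ᵢ 1) SZ (SZ +ᵢ 12 *ᵢ z /ᵢ 10 +ᵢ 1)) fun du => k l fu dl du))
    (expLo l fun a => expHi u fun b => fz (a -ᵢ SZ) fun fl => fz (b -ᵢ SZ) fun fu => k fl fu a b)

theorem exp_quad {x : ℝ} (hx : x ≤ 0.3) : Real.exp x ≤ 1 + x + 0.6 * x^2 := by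
  rcases le_total 0 x with h | h
  · have hb := Real.exp_bound' (x := x) h (by linarith) (n := 3) (by norm_num)
    norm_num [Finset.sum_range_succ, Nat.factorial] at hb
    nlinarith [mul_nonneg (sq_nonneg x) (by linarith : (0:ℝ) ≤ 0.3 - x)]
  · have h1 := Real.quadratic_le_exp_of_nonneg (x := -x) (by linarith)
    have h2 : Real.exp x * Real.exp (-x) = 1 := by rw [← Real.exp_add]; simp
    have h3 := Real.exp_pos x
    have h4 : Real.exp x * (1 - x + x^2/2) ≤ 1 := by
      rw [← h2]
      apply mul_le_mul_of_nonneg_left _ h3.le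
      linarith [neg_sq x]
    by_contra hcon
    push Not at hcon
    have h5 : 0 < 1 - x + x^2/2 := by nlinarith [sq_nonneg x]
    have h6 : (1 + x + 0.6 * x^2) * (1 - x + x^2/2) < 1 := (mul_lt_mul_of_pos_right hcon h5).trans_le h4
    nlinarith [sq_nonneg x, sq_nonneg (x^2), mul_nonneg (sq_nonneg x) (by linarith : (0:ℝ) ≤ -x)]

/-- enclosure of `F` and `F'` on an interval -/
def EvF (κ : ℝ) (l u fl fu dl du : ℤ) : Prop := ∀ y : ℝ, (l:ℝ) ≤ SZ * y → SZ * y ≤ (u:ℝ) →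
  (fl:ℝ) ≤ SZ * Fk κ y ∧ SZ * Fk κ y ≤ (fu:ℝ) ∧ (dl:ℝ) ≤ SZ * Real.exp (κ * y) ∧ SZ * Real.exp (κ * y) ≤ (du:ℝ)

theorem evE_sound {P : Pm} {α κ : ℝ} (hP : P.Ok α κ) {l u : ℤ} {k : ℤ → ℤ → ℤ → ℤ → Bool}
    (h : evE P l u k = true) : ∃ fl fu dl du, k fl fu dl du = true ∧ EvF κ l u fl fu dl du := by
  have hS := SZ_pos
  rw [evE, sg_eq, isb_eq] at h
  split_ifs at h with hk
  · simp only [fz_eq, iad_eq, isb_eq, iml_eq, idi_eq, isd_eq] at h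
    obtain ⟨hz, h⟩ := sg_false h
    refine ⟨_, _, _, _, h, ?_⟩
    intro y hl hu
    have hκ := hP.hκ
    have hz' : 10 * ((P.k1 * u / SZ + 1 : ℤ) : ℝ) ≤ 3 * SZ := by exact_mod_cast (by omega : 10 * (P.k1 * u / SZ + 1) ≤ 3 * SZ)
    have hzz : ((P.k1 : ℝ) * u) / SZ ≤ ((P.k1 * u / SZ + 1 : ℤ) : ℝ) := by
      have := (lt_fdiv (P.k1 * u) SZ_posZ).le
      push_cast at this ⊢
      exact this
    have hk1 : (0:ℝ) < P.k1 := lt_of_lt_of_le (by positivity) hP.hk1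
    -- the argument is at most z
    have hx : 0 ≤ y → SZ * (κ * y) ≤ ((P.k1 * u / SZ + 1 : ℤ) : ℝ) := by
      intro hy
      refine le_trans ?_ hzz
      rw [le_div_iff₀ hS]
      have := mul_le_mul hP.hk1 hu (by positivity) hk1.le
      linarith
    have hx3 : κ * y ≤ 0.3 := by
      rcases le_total 0 y with hy | hy
      · have := hx hy
        norm_num
        nlinarith
      · have := mul_nonneg hκ.le (neg_nonneg.2 hy)
        norm_num
        nlinarith
    have hq := exp_quad hx3
    have ha := Real.add_one_le_exp (κ * y)
    refine ⟨?_, ?_, ?_, ?_⟩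
    · refine hl.trans (mul_le_mul_of_nonneg_left ?_ hS.le)
      unfold Fk
      rw [le_div_iff₀ hκ]
      linarith
    · have e1 : Fk κ y ≤ y + 0.6 * κ * y^2 := by
        unfold Fk
        rw [div_le_iff₀ hκ]
        nlinarith
      -- monotone in y: compare at u
      have e2 : Fk κ y ≤ u / SZ + 0.6 * κ * (u / SZ)^2 := by
        rcases le_total 0 (κ * (u / SZ) - 0.3) with h9 | h9
        · exfalso
          have h10 : (0:ℝ) < u := by
            by_contra hcon
            push Not at hcon
            have : (u:ℝ) / SZ ≤ 0 := div_nonpos_of_nonpos_of_nonneg hcon hS.le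
            have := mul_nonneg hκ.le (neg_nonneg.2 this)
            linarith
          have h11 : κ * (u / SZ) ≤ (P.k1 * u / SZ) / SZ := by
            rw [mul_div_assoc', div_le_div_iff_of_pos_right hS, le_div_iff₀ hS]
            nlinarith [mul_le_mul_of_nonneg_right hP.hk1 h10.le]
          have h12 : ((P.k1 * u / SZ : ℤ) : ℝ) + 1 ≤ 0.3 * SZ := by
            push_cast at hz'
            linarith
          have h13 := lt_fdiv (P.k1 * u) SZ_posZ
          push_cast at h13
          have h14 : ((P.k1:ℝ) * u / SZ) / SZ < 0.3 := by
            rw [div_lt_iff₀ hS]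
            linarith
          linarith
        · have hyu : y ≤ u / SZ := by rw [le_div_iff₀ hS]; linarith
          refine (Fk_mono hκ hyu).trans ?_
          have hq2 := exp_quad (x := κ * (u / SZ)) (by linarith)
          unfold Fk
          rw [div_le_iff₀ hκ]
          linarith
      have e3 : SZ * Fk κ y ≤ u + 0.6 * P.k1 * u^2 / (SZ^2) := by
        have h20 := mul_le_mul_of_nonneg_left e2 hS.le
        have h21 : (SZ:ℝ) * (u / SZ + 0.6 * κ * (u / SZ)^2) = u + 0.6 * (SZ * κ) * u^2 / SZ^2 := by
          field_simp
        rw [h21] at h20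
        refine h20.trans ?_
        have h22 := mul_le_mul_of_nonneg_right hP.hk1 (by positivity : (0:ℝ) ≤ 0.6 * u^2 / SZ^2)
        have h23 : 0.6 * ((SZ:ℝ) * κ) * u^2 / SZ^2 = SZ * κ * (0.6 * u^2 / SZ^2) := by ring
        have h24 : 0.6 * (P.k1:ℝ) * u^2 / SZ^2 = P.k1 * (0.6 * u^2 / SZ^2) := by ring
        rw [h23, h24]
        linarith
      have h30 := lt_fdiv (6 * P.k1 * u * u) (b := 10 * SZ * SZ) (by norm_num [SZ])
      have h31 : ((6 * P.k1 * u * u : ℤ) : ℝ) / ((10 * SZ * SZ : ℤ) : ℝ) = 0.6 * P.k1 * u^2 / (SZ^2) := by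
        push_cast
        field_simp
        norm_num
        ring
      rw [h31] at h30
      push_cast at h30 ⊢
      linarith
    · have e4 : (SZ:ℝ) + SZ * (κ * y) ≤ SZ * Real.exp (κ * y) := by nlinarith
      rw [sg_eq]
      split_ifs with hl0
      · have h40 := fdiv_le (P.k1 * l) SZ_posZ
        have hl0' : (l:ℝ) ≤ 0 := by exact_mod_cast hl0.le
        push_cast at h40 ⊢
        have h41 : (P.k1 : ℝ) * l / SZ ≤ κ * l := by
          rw [div_le_iff₀ hS]
          nlinarith [mul_le_mul_of_nonpos_right hP.hk1 hl0']
        have h42 : κ * l ≤ SZ * (κ * y) := by nlinarith [mul_le_mul_of_nonneg_left hl hκ.le]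
        linarith
      · have hl0' : (0:ℝ) ≤ l := by exact_mod_cast (not_lt.1 hl0)
        have : 0 ≤ SZ * (κ * y) := by nlinarith [mul_le_mul_of_nonneg_left hl hκ.le, mul_nonneg hκ.le hl0']
        linarith
    · rw [sg_eq]
      have hneg : y ≤ 0 → SZ * Real.exp (κ * y) ≤ SZ := by
        intro hy
        have : Real.exp (κ * y) ≤ 1 := Real.exp_le_one_iff.2 (mul_nonpos_of_nonneg_of_nonpos hκ.le hy)
        nlinarith
      split_ifs with hu0
      · apply hneg
        have : (u:ℝ) ≤ 0 := by exact_mod_cast (by omega : u ≤ 0)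
        by_contra hcon
        push Not at hcon
        nlinarith [mul_pos hS hcon]
      · set z : ℤ := P.k1 * u / SZ + 1 with hzdef
        have h50 := lt_fdiv (12 * z) (b := 10) (by norm_num)
        push_cast at h50 ⊢
        have hz0 : (0:ℝ) ≤ z := by
          have h51 : (1:ℝ) ≤ u := by exact_mod_cast (by omega : 1 ≤ u)
          have : (0:ℝ) ≤ (P.k1:ℝ) * u / SZ := by positivity
          linarith
        rcases le_total 0 y with hy | hy
        · have h52 := hx hy
          have h53 : 0 ≤ κ * y := mul_nonneg hκ.le hy
          have h54 : Real.exp (κ * y) ≤ 1 + 1.2 * (κ * y) := by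
            nlinarith [mul_nonneg h53 (by linarith : 0 ≤ 0.3 - κ * y)]
          have h55 := mul_le_mul_of_nonneg_left h54 hS.le
          linarith
        · have := hneg hy
          linarith
  · have hone := hP.hone (by omega)
    subst hone
    obtain ⟨a, h, _, ha⟩ := expLo_sound h
    obtain ⟨b, h, hb⟩ := expHi_sound h
    simp only [fz_eq, isb_eq] at h
    refine ⟨_, _, _, _, h, ?_⟩
    intro y hl hu
    have h1 := ha y hl
    have h2 := hb y hu
    have e : Fk 1 y = Real.exp y - 1 := by simp [Fk]
    rw [e, one_mul]
    push_cast
    exact ⟨by linarith, by linarith, h1, h2⟩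

structure Nd where
  l : ℤ
  u : ℤ
  fl : ℤ
  fu : ℤ
  dl : ℤ
  du : ℤ

structure Dr where
  il : ℤ
  iu : ℤ
  sl : ℤ
  su : ℤ
  tl : ℤ
  tu : ℤ

structure Ce where
  l : ℤ
  u : ℤ
  l' : ℤ
  u' : ℤ
  pa : ℤ
  pb : ℤ

noncomputable def mx (a b : ℤ) : ℤ := sg (a -ᵢ b) b a
noncomputable def mn (a b : ℤ) : ℤ := sg (a -ᵢ b) a b

theorem mx_eq (a b : ℤ) : mx a b = max a b := by
  rw [mx, sg_eq, isb_eq]; split_ifs <;> omega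
theorem mn_eq (a b : ℤ) : mn a b = min a b := by
  rw [mn, sg_eq, isb_eq]; split_ifs <;> omega

noncomputable def rngE (P : Pm) (x y : Nd) (pa pb : ℤ) (k : ℤ → ℤ → ℤ → ℤ → Bool) : Bool :=
  sg pa (sg (ing pb)
      (fz (mx (x.l +ᵢ pa /ᵢ P.n) (y.l -ᵢ pb /ᵢ P.n -ᵢ 1)) fun cl =>
       fz (mn (x.u +ᵢ pb /ᵢ P.n +ᵢ 1) (y.u -ᵢ pa /ᵢ P.n)) fun cu => evE P cl cu k)
      (k y.fl x.fu y.dl x.du))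
    (k x.fl y.fu x.dl y.du)

noncomputable def sqE (pa pb : ℤ) (k : ℤ → ℤ → Bool) : Bool :=
  sg pa (sg (ing pb) (k 0 (isd (mx (pa *ᵢ pa) (pb *ᵢ pb)) +ᵢ 1))
      (k (isd (pb *ᵢ pb)) (isd (pa *ᵢ pa) +ᵢ 1)))
    (k (isd (pa *ᵢ pa)) (isd (pb *ᵢ pb) +ᵢ 1))

noncomputable def dr6 (a b c d e f : ℤ) (k : Dr → Bool) : Bool :=
  fz a fun a => fz b fun b => fz c fun c => fz d fun d => fz e fun e => fz f fun f => k ⟨a, b, c, d, e, f⟩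

noncomputable def mk2 (P : Pm) (x y : Nd) (pa pb fl fh dl dh w0 w1 : ℤ) (k : Dr → Bool) : Bool :=
  dr6 (mulLo ((x.fl +ᵢ y.fl) /ᵢ P.n2 -ᵢ mulHi w1 dl dh /ᵢ P.n3 -ᵢ 1) P.a0 P.a1)
    (mulHi ((x.fu +ᵢ y.fu) /ᵢ P.n2 +ᵢ 1 -ᵢ mulLo w0 dl dh /ᵢ P.n3) P.a0 P.a1)
    (mulLo fl P.a0 P.a1) (mulHi fh P.a0 P.a1)
    (mulLo (mulLo pa dl dh) P.a0 P.a1) (mulHi (mulHi pb dl dh) P.a0 P.a1) k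

noncomputable def mkE (P : Pm) (x y : Nd) (pa pb ea eb : ℤ) (k : Dr → Bool) : Bool :=
  rngE P x y pa pb fun fl fh dl dh => sqE pa pb fun q0 q1 =>
  mk2 P x y pa pb fl fh dl dh (isd (P.k0 *ᵢ q0) +ᵢ ea) (isd (P.k1 *ᵢ q1) +ᵢ 1 +ᵢ eb) k

structure NdF (κ : ℝ) (Y : ℝ → ℝ) (a : ℝ) (x : Nd) : Prop where
  l : (x.l : ℝ) ≤ SZ * Y a
  u : SZ * Y a ≤ (x.u : ℝ)
  fl : (x.fl : ℝ) ≤ SZ * Fk κ (Y a)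
  fu : SZ * Fk κ (Y a) ≤ (x.fu : ℝ)
  dl : (x.dl : ℝ) ≤ SZ * Real.exp (κ * Y a)
  du : SZ * Real.exp (κ * Y a) ≤ (x.du : ℝ)

structure DrF (P : Pm) (Y : ℝ → ℝ) (a : ℝ) (d : Dr) : Prop where
  il : (d.il : ℝ) ≤ SZ * -(Y (a + 1 / P.n) - Y a)
  iu : SZ * -(Y (a + 1 / P.n) - Y a) ≤ (d.iu : ℝ)
  sm : SmR Y a (1 / P.n) (((-d.su : ℤ) : ℝ) / SZ) (((-d.sl : ℤ) : ℝ) / SZ)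
    (((-d.tu : ℤ) : ℝ) / SZ) (((-d.tl : ℤ) : ℝ) / SZ)

theorem SmR.mono {Y : ℝ → ℝ} {a h pa pb ea eb pa' pb' ea' eb' : ℝ} (hs : SmR Y a h pa pb ea eb)
    (h1 : pa' ≤ pa) (h2 : pb ≤ pb') (h3 : ea' ≤ ea) (h4 : eb ≤ eb') : SmR Y a h pa' pb' ea' eb' := by
  obtain ⟨Y1, Y2, hs⟩ := hs
  refine ⟨Y1, Y2, fun t u v => ?_⟩
  obtain ⟨e1, e2, e3, e4, e5, e6⟩ := hs t u v
  exact ⟨e1, e2, by linarith, by linarith, by linarith, by linarith⟩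

theorem rngE_sound {P : Pm} {α κ : ℝ} (hP : P.Ok α κ) {Y : ℝ → ℝ} (hY : Continuous Y) {a : ℝ} {x y : Nd}
    {pa pb : ℤ} {ea eb : ℝ} (hx : NdF κ Y a x) (hy : NdF κ Y (a + 1 / P.n) y)
    (hs : SmR Y a (1 / P.n) ((pa:ℝ)/SZ) ((pb:ℝ)/SZ) ea eb) {k : ℤ → ℤ → ℤ → ℤ → Bool}
    (h : rngE P x y pa pb k = true) :
    ∃ fl fu dl du, k fl fu dl du = true ∧ ∀ t, a ≤ t → t ≤ a + 1 / P.n →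
      ((fl:ℝ) ≤ SZ * Fk κ (Y t) ∧ SZ * Fk κ (Y t) ≤ (fu:ℝ)) ∧
      ((dl:ℝ) ≤ SZ * Real.exp (κ * Y t) ∧ SZ * Real.exp (κ * Y t) ≤ (du:ℝ)) := by
  have hS := SZ_pos
  have hn : (0:ℝ) < P.n := by exact_mod_cast hP.hn
  have hκ := hP.hκ
  have ip : ∀ t, a ≤ t → t ≤ a + 1 / P.n → _ := fun t h1 h2 =>
    hs.interp hY (s := t - a) (by linarith) (by linarith)
  have hmono : ∀ {b c : ℝ}, b ≤ c → SZ * Fk κ b ≤ SZ * Fk κ c ∧ SZ * Real.exp (κ * b) ≤ SZ * Real.exp (κ * c) :=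
    fun {b c} hbc => ⟨mul_le_mul_of_nonneg_left (Fk_mono hκ hbc) hS.le,
      mul_le_mul_of_nonneg_left (Real.exp_le_exp.2 (mul_le_mul_of_nonneg_left hbc hκ.le)) hS.le⟩
  simp only [rngE, sg_eq, ing_eq] at h
  split_ifs at h with h1 h2
  · -- non monotone
    simp only [fz_eq, iad_eq, isb_eq, idi_eq] at h
    obtain ⟨fl, fu, dl, du, hk, hE⟩ := evE_sound hP h
    refine ⟨fl, fu, dl, du, hk, fun t ht1 ht2 => ?_⟩
    obtain ⟨i1, i2, i3, i4⟩ := ip t ht1 ht2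
    rw [add_sub_cancel] at i1 i2 i3 i4
    have hpa : (pa:ℝ) ≤ 0 := by exact_mod_cast h1.le
    have hpb : (0:ℝ) ≤ pb := by exact_mod_cast (by omega : 0 ≤ pb)
    have s0 : 0 ≤ t - a := by linarith
    have s1 : t - a ≤ 1 / P.n := by linarith
    have s2 : 0 ≤ 1 / P.n - (t - a) := by linarith
    have s3 : 1 / P.n - (t - a) ≤ 1 / (P.n:ℝ) := by linarith
    have j1 : (pa:ℝ) / P.n ≤ pa * (t - a) := by
      have := mul_le_mul_of_nonpos_left s1 hpa
      linarith [mul_one_div (pa:ℝ) P.n]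
    have j1' : (pa:ℝ) / P.n ≤ pa * (1 / P.n - (t - a)) := by
      have := mul_le_mul_of_nonpos_left s3 hpa
      linarith [mul_one_div (pa:ℝ) P.n]
    have j2 : pb * (t - a) ≤ (pb:ℝ) / P.n := by
      have := mul_le_mul_of_nonneg_left s1 hpb
      linarith [mul_one_div (pb:ℝ) P.n]
    have j2' : pb * (1 / P.n - (t - a)) ≤ (pb:ℝ) / P.n := by
      have := mul_le_mul_of_nonneg_left s3 hpb
      linarith [mul_one_div (pb:ℝ) P.n]
    have f1 := fdiv_le pa hP.hn
    have f2 := (lt_fdiv pb hP.hn).le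
    have m1 := mul_le_mul_of_nonneg_left i1 hS.le
    have m2 := mul_le_mul_of_nonneg_left i2 hS.le
    have m3 := mul_le_mul_of_nonneg_left i3 hS.le
    have m4 := mul_le_mul_of_nonneg_left i4 hS.le
    have r : ∀ p s : ℝ, SZ * (p / SZ * s) = p * s := fun p s => by field_simp
    have e1 : (x.l:ℝ) + (pa / P.n : ℤ) ≤ SZ * Y t := by
      rw [mul_add, r] at m1; linarith [hx.l]
    have e2 : SZ * Y t ≤ (x.u:ℝ) + (pb / P.n : ℤ) + 1 := by
      rw [mul_add, r] at m2; linarith [hx.u]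
    have e3 : (y.l:ℝ) - (pb / P.n : ℤ) - 1 ≤ SZ * Y t := by
      rw [mul_sub, r] at m3; linarith [hy.l]
    have e4 : SZ * Y t ≤ (y.u:ℝ) - (pa / P.n : ℤ) := by
      rw [mul_sub, r] at m4; linarith [hy.u]
    have := hE (Y t) (by rw [mx_eq]; push_cast; exact max_le e1 e3) (by rw [mn_eq]; push_cast; exact le_min e2 e4)
    exact ⟨⟨this.1, this.2.1⟩, this.2.2⟩
  · -- decreasing
    refine ⟨_, _, _, _, h, fun t ht1 ht2 => ?_⟩
    obtain ⟨i1, i2, i3, i4⟩ := ip t ht1 ht2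
    rw [add_sub_cancel] at i1 i2 i3 i4
    have hpb : (pb:ℝ)/SZ ≤ 0 := div_nonpos_of_nonpos_of_nonneg (by exact_mod_cast (by omega : pb ≤ 0)) hS.le
    have u1 : Y t ≤ Y a := by nlinarith
    have u2 : Y (a + 1 / P.n) ≤ Y t := by nlinarith
    have a1 := hmono u1
    have a2 := hmono u2
    exact ⟨⟨hy.fl.trans a2.1, a1.1.trans hx.fu⟩, ⟨hy.dl.trans a2.2, a1.2.trans hx.du⟩⟩
  · refine ⟨_, _, _, _, h, fun t ht1 ht2 => ?_⟩
    obtain ⟨i1, i2, i3, i4⟩ := ip t ht1 ht2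
    rw [add_sub_cancel] at i1 i2 i3 i4
    have hpa : 0 ≤ (pa:ℝ)/SZ := div_nonneg (by exact_mod_cast (by omega : 0 ≤ pa)) hS.le
    have u1 : Y a ≤ Y t := by nlinarith
    have u2 : Y t ≤ Y (a + 1 / P.n) := by nlinarith
    have a1 := hmono u1
    have a2 := hmono u2
    exact ⟨⟨hx.fl.trans a1.1, a2.1.trans hy.fu⟩, ⟨hx.dl.trans a1.2, a2.2.trans hy.du⟩⟩

theorem sqE_sound {pa pb : ℤ} {k : ℤ → ℤ → Bool} (h : sqE pa pb k = true) :
    ∃ q0 q1 : ℤ, k q0 q1 = true ∧ ∀ p : ℝ, (pa:ℝ)/SZ ≤ p → p ≤ (pb:ℝ)/SZ →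
      (q0:ℝ)/SZ ≤ p^2 ∧ p^2 ≤ (q1:ℝ)/SZ := by
  have hS := SZ_pos
  have hi : ∀ (z w : ℤ) (p : ℝ), |p| ≤ |(z:ℝ)/SZ| → z * z ≤ w → p^2 ≤ ((w / SZ + 1 : ℤ):ℝ)/SZ := by
    intro z w p hp hzw
    rw [le_div_iff₀ hS]
    push_cast
    refine le_trans ?_ (lt_fdiv w SZ_posZ).le
    rw [le_div_iff₀ hS]
    have := sq_le_sq.2 hp
    have h2 : (z:ℝ)*z ≤ w := by exact_mod_cast hzw
    have h3 : ((z:ℝ)/SZ)^2 * SZ * SZ = z * z := by field_simp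
    have h4 := mul_le_mul_of_nonneg_right this (mul_pos hS hS).le
    nlinarith
  have lo : ∀ (z : ℤ) (p : ℝ), |(z:ℝ)/SZ| ≤ |p| → ((z * z / SZ : ℤ):ℝ)/SZ ≤ p^2 := by
    intro z p hp
    rw [div_le_iff₀ hS]
    refine (fdiv_le _ SZ_posZ).trans ?_
    rw [div_le_iff₀ hS]
    have := sq_le_sq.2 hp
    push_cast
    have h3 : ((z:ℝ)/SZ)^2 * SZ * SZ = z * z := by field_simp
    have h4 := mul_le_mul_of_nonneg_right this (mul_pos hS hS).le
    nlinarith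
  simp only [sqE, sg_eq, ing_eq, iad_eq, iml_eq, isd_eq] at h
  split_ifs at h with h1 h2
  · refine ⟨_, _, h, fun p hp1 hp2 => ⟨by simp; positivity, ?_⟩⟩
    rw [mx_eq]
    rcases le_total 0 p with h0 | h0
    · refine hi pb _ p ?_ (le_max_right _ _)
      rw [abs_of_nonneg h0]; exact hp2.trans (le_abs_self _)
    · refine hi pa _ p ?_ (le_max_left _ _)
      rw [abs_of_nonpos h0]
      exact (by linarith : -p ≤ -((pa:ℝ)/SZ)).trans (neg_le_abs _)
  · have hpb : (pb:ℝ)/SZ ≤ 0 := div_nonpos_of_nonpos_of_nonneg (by exact_mod_cast (by omega : pb ≤ 0)) hS.le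
    refine ⟨_, _, h, fun p hp1 hp2 => ⟨lo _ _ ?_, hi _ _ _ ?_ le_rfl⟩⟩
    · rw [abs_of_nonpos hpb, abs_of_nonpos (hp2.trans hpb)]; linarith
    · rw [abs_of_nonpos (hp2.trans hpb), abs_of_nonpos (hp1.trans (hp2.trans hpb))]; linarith
  · have hpa : 0 ≤ (pa:ℝ)/SZ := div_nonneg (by exact_mod_cast (by omega : 0 ≤ pa)) hS.le
    refine ⟨_, _, h, fun p hp1 hp2 => ⟨lo _ _ ?_, hi _ _ _ ?_ le_rfl⟩⟩
    · rw [abs_of_nonneg hpa, abs_of_nonneg (hpa.trans hp1)]; linarith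
    · rw [abs_of_nonneg (hpa.trans hp1), abs_of_nonneg (hpa.trans (hp1.trans hp2))]; linarith

set_option maxHeartbeats 1000000 in
theorem mkE_sound {P : Pm} {α κ : ℝ} (hP : P.Ok α κ) {Y : ℝ → ℝ} (hY : Sc α κ Y) {a : ℝ} (ha : -1 ≤ a) {x y : Nd}
    {pa pb ea eb : ℤ} (hx : NdF κ Y a x) (hy : NdF κ Y (a + 1 / P.n) y)
    (hs : SmR Y a (1 / P.n) ((pa:ℝ)/SZ) ((pb:ℝ)/SZ) ((ea:ℝ)/SZ) ((eb:ℝ)/SZ)) {k : Dr → Bool}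
    (h : mkE P x y pa pb ea eb k = true) :
    ∃ d, k d = true ∧ DrF P Y (a + 1) d := by
  have hS := SZ_pos
  have hS' := hS.ne'
  have hn : (0:ℝ) < P.n := by exact_mod_cast hP.hn
  have hκ := hP.hκ
  obtain ⟨fl, fh, dl, dh, h, hR⟩ := rngE_sound hP hY.cont hx hy hs h
  obtain ⟨q0, q1, h, hq⟩ := sqE_sound h
  simp only [mk2, dr6, fz_eq, iad_eq, isb_eq, iml_eq, idi_eq, isd_eq] at h
  refine ⟨_, h, ?_⟩
  have sd : ∀ r : ℝ, SZ * (r / SZ) = r := fun r => by field_simp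
  obtain ⟨w0, hw0⟩ : ∃ w0, w0 = P.k0 * q0 / SZ + ea := ⟨_, rfl⟩
  obtain ⟨w1, hw1⟩ : ∃ w1, w1 = P.k1 * q1 / SZ + 1 + eb := ⟨_, rfl⟩
  rw [← hw0, ← hw1]
  have hp0 : (pa:ℝ)/SZ ≤ pb / SZ := by
    obtain ⟨Y1, Y2, hs⟩ := hs
    have hp : 0 < 1 / (P.n:ℝ) := by positivity
    have := hs (a + 1 / P.n / 2) (by linarith) (by linarith)
    exact this.2.2.1.trans this.2.2.2.1
  have hq1 : 0 ≤ (q1:ℝ) := by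
    have := (sq_nonneg _).trans (hq _ le_rfl hp0).2
    by_contra hcon
    push Not at hcon
    have := div_neg_of_neg_of_pos hcon hS
    linarith
  have w0r : (w0:ℝ)/SZ ≤ κ * (max q0 0 / SZ) + ea / SZ := by
    rw [div_le_iff₀ hS, hw0]
    push_cast
    have f := fdiv_le (P.k0 * q0) SZ_posZ
    push_cast at f
    have h1 : (P.k0:ℝ) * q0 / SZ ≤ κ * max (q0:ℝ) 0 := by
      rw [div_le_iff₀ hS]
      have h0 : (0:ℝ) ≤ P.k0 := by exact_mod_cast hP.hnn
      have i1 : (P.k0:ℝ) * q0 ≤ P.k0 * max (q0:ℝ) 0 := mul_le_mul_of_nonneg_left (le_max_left _ _) h0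
      have i2 := mul_le_mul_of_nonneg_right hP.hk0 (le_max_right (q0:ℝ) 0)
      linarith
    have h2 : (κ * (max (q0:ℝ) 0 / SZ) + ea / SZ) * SZ = κ * max (q0:ℝ) 0 + ea := by field_simp
    rw [h2]
    linarith
  have w1r : κ * (q1 / SZ) + eb / SZ ≤ (w1:ℝ)/SZ := by
    rw [le_div_iff₀ hS, hw1]
    push_cast
    have f := (lt_fdiv (P.k1 * q1) SZ_posZ).le
    push_cast at f
    have h1 : κ * q1 ≤ (P.k1:ℝ) * q1 / SZ := by
      rw [le_div_iff₀ hS]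
      have i2 := mul_le_mul_of_nonneg_right hP.hk1 hq1
      linarith
    have h2 : (κ * ((q1:ℝ) / SZ) + eb / SZ) * SZ = κ * q1 + eb := by field_simp
    rw [h2]
    linarith
  have dle : ∀ {l h : ℤ} {d w : ℝ}, (l:ℝ)/SZ ≤ d → d ≤ (h:ℝ)/SZ → (l:ℝ) ≤ SZ * d ∧ SZ * d ≤ (h:ℝ) := by
    intro l h d w i1 i2
    rw [div_le_iff₀ hS] at i1
    rw [le_div_iff₀ hS] at i2
    exact ⟨by linarith, by linarith⟩
  have tod : ∀ {r : ℝ} {z : ℤ}, (z:ℝ) ≤ SZ * r → (z:ℝ)/SZ ≤ r := by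
    intro r z hz
    rw [div_le_iff₀ hS]; linarith
  have tou : ∀ {r : ℝ} {z : ℤ}, SZ * r ≤ (z:ℝ) → r ≤ (z:ℝ)/SZ := by
    intro r z hz
    rw [le_div_iff₀ hS]; linarith
  have prod : ∀ {l u : ℤ}, ∀ d w : ℝ, 0 < d → (dl:ℝ)/SZ ≤ d → d ≤ (dh:ℝ)/SZ → (l:ℝ)/SZ ≤ w → w ≤ (u:ℝ)/SZ →
      (mulLo l dl dh:ℝ)/SZ ≤ d * w ∧ d * w ≤ (mulHi u dl dh:ℝ)/SZ := by
    intro l u d w hd i1 i2 i3 i4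
    obtain ⟨j1, j2⟩ := dle (w := w) i1 i2
    obtain ⟨j3, j4⟩ := dle (w := w) i3 i4
    exact ⟨tod (mulLo_le hd j1 j2 j3), tou (le_mulHi hd j1 j2 j4)⟩
  have main := mk_real hY hP.hα hκ (h := 1 / P.n) (Fl := fl / SZ) (Fh := fh / SZ) (Dl := dl / SZ) (Dh := dh / SZ)
    (f0l := x.fl / SZ) (f0u := x.fu / SZ) (f1l := y.fl / SZ) (f1u := y.fu / SZ)
    (q0 := max q0 0 / SZ) (q1 := q1 / SZ) (w0 := w0 / SZ) (w1 := w1 / SZ)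
    (G0 := mulLo w0 dl dh / SZ) (G1 := mulHi w1 dl dh / SZ) (g0 := mulLo pa dl dh / SZ) (g1 := mulHi pb dl dh / SZ)
    ha (by positivity) hs
    (fun t u v => ⟨tod (hR t u v).1.1, tou (hR t u v).1.2⟩)
    (fun t u v => ⟨tod (hR t u v).2.1, tou (hR t u v).2.2⟩)
    ⟨tod hx.fl, tou hx.fu⟩ ⟨tod hy.fl, tou hy.fu⟩
    (fun p u v => ⟨by
      rcases le_total q0 0 with hz | hz
      · rw [max_eq_right hz]; simp; positivity
      · rw [max_eq_left hz]; exact (hq p u v).1, (hq p u v).2⟩)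
    w0r w1r (fun d w => prod d w) (fun d w => prod d w)
  obtain ⟨m1, m2, m3⟩ := main
  have al := hP.ha0
  have au := hP.ha1
  have hα := hP.hα
  have hn2 : (P.n2:ℝ) = 2 * P.n := by rw [hP.hn2]; push_cast; ring
  have hn3 : (P.n3:ℝ) = 12 * P.n * P.n * P.n := by rw [hP.hn3]; push_cast; ring
  have hn0 := hP.hn
  have hn2p : 0 < P.n2 := by rw [hP.hn2]; omega
  have hn3p : 0 < P.n3 := by rw [hP.hn3]; positivity
  refine ⟨?_, ?_, ?_⟩
  · refine le_trans ?_ (mul_le_mul_of_nonneg_left m1 hS.le)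
    apply mulLo_le hα al au
    push_cast
    have f1 := fdiv_le (x.fl + y.fl) hn2p
    have f2 := (lt_fdiv (mulHi w1 dl dh) hn3p).le
    rw [hn2] at f1
    rw [hn3] at f2
    push_cast at f1
    have e : (SZ:ℝ) * ((x.fl / SZ + y.fl / SZ) / 2 * (1 / P.n) - mulHi w1 dl dh / SZ * (1 / P.n)^3/12) =
      (x.fl + y.fl) / (2 * P.n) - mulHi w1 dl dh / (12 * P.n * P.n * P.n) := by
      field_simp
    rw [e]
    linarith
  · refine le_trans (mul_le_mul_of_nonneg_left m2 hS.le) ?_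
    apply le_mulHi hα al au
    push_cast
    have f1 := (lt_fdiv (x.fu + y.fu) hn2p).le
    have f2 := fdiv_le (mulLo w0 dl dh) hn3p
    rw [hn2] at f1
    rw [hn3] at f2
    push_cast at f1
    have e : (SZ:ℝ) * ((x.fu / SZ + y.fu / SZ) / 2 * (1 / P.n) - mulLo w0 dl dh / SZ * (1 / P.n)^3/12) =
      (x.fu + y.fu) / (2 * P.n) - mulLo w0 dl dh / (12 * P.n * P.n * P.n) := by
      field_simp
    rw [e]
    linarith
  · have hi : ∀ z : ℤ, ((-(mulHi z P.a0 P.a1) : ℤ) : ℝ) / SZ ≤ -(α * (z / SZ)) := by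
      intro z
      have := tou (le_mulHi (x := z / SZ) hα al au (by rw [sd]))
      push_cast
      rw [neg_div]
      linarith
    have lo : ∀ z : ℤ, -(α * (z / SZ)) ≤ ((-(mulLo z P.a0 P.a1) : ℤ) : ℝ) / SZ := by
      intro z
      have := tod (mulLo_le (x := z / SZ) hα al au (by rw [sd]))
      push_cast
      rw [neg_div]
      linarith
    exact m3.mono (hi _) (lo _) (hi _) (lo _)

noncomputable def stepB (P : Pm) (d : Dr) (x y : Nd) (pa pb : ℤ) (k : Nd → Ce → Dr → Bool) : Bool :=
  mkE P x y pa pb (ing d.tu) (ing d.tl) (k y ⟨x.l, x.u, y.l, y.u, pa, pb⟩)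

noncomputable def stepE (P : Pm) (d : Dr) (x : Nd) (k : Nd → Ce → Dr → Bool) : Bool :=
  fz (x.l -ᵢ d.iu) fun l => fz (x.u -ᵢ d.il) fun u =>
  evE P l u fun fl fu dl du => stepB P d x ⟨l, u, fl, fu, dl, du⟩ (ing d.su) (ing d.sl) k

noncomputable def unitE (P : Pm) (ds : List Dr) : Nd → (Nd → List Ce → List Dr → Bool) → Bool :=
  List.rec (motive := fun _ => Nd → (Nd → List Ce → List Dr → Bool) → Bool) (fun x k => k x [] [])
    (fun d _ ih x k => stepE P d x fun y c d' => ih y fun z cs ds => k z (c :: cs) (d' :: ds)) ds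

noncomputable def unitsE (P : Pm) (m : ℕ) : List Dr → Nd → (List (List Ce) → Bool) → Bool :=
  Nat.rec (motive := fun _ => List Dr → Nd → (List (List Ce) → Bool) → Bool) (fun _ _ k => k [])
    (fun _ ih ds x k => unitE P ds x fun y cs ds' => ih ds' y fun us => k (cs :: us)) m

noncomputable def initE (P : Pm) (c : ℤ) (j : ℕ) : Nd → (List Dr → Bool) → Bool :=
  Nat.rec (motive := fun _ => Nd → (List Dr → Bool) → Bool) (fun _ k => k [])
    (fun j ih x k => fz (ing (c *ᵢ (j:ℤ)) /ᵢ P.n) fun l => fz (l +ᵢ 1) fun u =>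
      evE P l u fun fl fu dl du => mkE P x ⟨l, u, fl, fu, dl, du⟩ c c 0 0 fun d =>
      ih ⟨l, u, fl, fu, dl, du⟩ fun ds => k (d :: ds)) j

noncomputable def runE (P : Pm) (c : ℤ) (m : ℕ) (k : List (List Ce) → Bool) : Bool :=
  fz (ing c) fun l => evE P l l fun fl fu dl du => initE P c P.n.toNat ⟨l, l, fl, fu, dl, du⟩ fun ds =>
  evE P 0 0 fun fl fu dl du => unitsE P m ds ⟨0, 0, fl, fu, dl, du⟩ k

noncomputable def nthE {β : Type} (l : List β) : ℕ → (β → Bool) → Bool :=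
  List.rec (motive := fun _ => ℕ → (β → Bool) → Bool) (fun _ _ => false)
    (fun c _ ih i k => Nat.rec (motive := fun _ => Bool) (k c) (fun j _ => ih j k) i) l

noncomputable def loE (P : Pm) (us : List (List Ce)) (T : ℕ) (k : ℤ → Bool) : Bool :=
  nthE us (T / (64 * P.n.toNat)) fun u => nthE u (T % (64 * P.n.toNat) / 64) fun c =>
    fz (mx (c.l +ᵢ ((T % 64 : ℕ) : ℤ) *ᵢ c.pa /ᵢ (64 *ᵢ P.n))
      (c.l' -ᵢ (64 -ᵢ ((T % 64 : ℕ) : ℤ)) *ᵢ c.pb /ᵢ (64 *ᵢ P.n) -ᵢ 1)) k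
noncomputable def hiE (P : Pm) (us : List (List Ce)) (T : ℕ) (k : ℤ → Bool) : Bool :=
  nthE us (T / (64 * P.n.toNat)) fun u => nthE u (T % (64 * P.n.toNat) / 64) fun c =>
    fz (mn (c.u +ᵢ ((T % 64 : ℕ) : ℤ) *ᵢ c.pb /ᵢ (64 *ᵢ P.n) +ᵢ 1)
      (c.u' -ᵢ (64 -ᵢ ((T % 64 : ℕ) : ℤ)) *ᵢ c.pa /ᵢ (64 *ᵢ P.n))) k

structure CeF (P : Pm) (Y : ℝ → ℝ) (a : ℝ) (c : Ce) : Prop where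
  l : (c.l : ℝ) ≤ SZ * Y a
  u : SZ * Y a ≤ (c.u : ℝ)
  l' : (c.l' : ℝ) ≤ SZ * Y (a + 1 / P.n)
  u' : SZ * Y (a + 1 / P.n) ≤ (c.u' : ℝ)
  sm : ∃ ea eb, SmR Y a (1 / P.n) ((c.pa : ℝ) / SZ) ((c.pb : ℝ) / SZ) ea eb

def UnF (P : Pm) (Y : ℝ → ℝ) : ℝ → List Ce → Prop
  | _, [] => True
  | a, c :: cs => CeF P Y a c ∧ UnF P Y (a + 1 / P.n) cs

def DsF (P : Pm) (Y : ℝ → ℝ) : ℝ → List Dr → Prop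
  | _, [] => True
  | a, d :: ds => DrF P Y a d ∧ DsF P Y (a + 1 / P.n) ds

def SoF (P : Pm) (Y : ℝ → ℝ) : ℝ → List (List Ce) → Prop
  | _, [] => True
  | a, u :: us => UnF P Y a u ∧ SoF P Y (a + 1) us

theorem NdF.of_ev {κ : ℝ} {Y : ℝ → ℝ} {a : ℝ} {l u fl fu dl du : ℤ} (hE : EvF κ l u fl fu dl du)
    (hl : (l:ℝ) ≤ SZ * Y a) (hu : SZ * Y a ≤ (u:ℝ)) : NdF κ Y a ⟨l, u, fl, fu, dl, du⟩ := by
  obtain ⟨h1, h2, h3, h4⟩ := hE _ hl hu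
  exact ⟨hl, hu, h1, h2, h3, h4⟩

section
variable {P : Pm} {α κ : ℝ} {Y : ℝ → ℝ}

theorem stepE_sound (hP : P.Ok α κ) (hY : Sc α κ Y) {a : ℝ} (ha : 0 ≤ a) {d : Dr} {x : Nd}
    (hd : DrF P Y a d) (hx : NdF κ Y a x) {k : Nd → Ce → Dr → Bool} (h : stepE P d x k = true) :
    ∃ y c d', k y c d' = true ∧ NdF κ Y (a + 1 / P.n) y ∧ CeF P Y a c ∧ DrF P Y (a + 1) d' := by
  simp only [stepE, stepB, fz_eq, isb_eq, ing_eq] at h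
  obtain ⟨fl, fu, dl, du, h, hE⟩ := evE_sound hP h
  have hl : ((x.l - d.iu : ℤ):ℝ) ≤ SZ * Y (a + 1 / P.n) := by
    push_cast; linarith [hx.l, hd.iu]
  have hu : SZ * Y (a + 1 / P.n) ≤ ((x.u - d.il : ℤ):ℝ) := by
    push_cast; linarith [hx.u, hd.il]
  have hy := NdF.of_ev hE hl hu
  obtain ⟨d', h, hd'⟩ := mkE_sound hP hY (by linarith) hx hy hd.sm h
  exact ⟨_, _, _, h, hy, ⟨hx.l, hx.u, hl, hu, _, _, hd.sm⟩, hd'⟩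

theorem unitE_sound (hP : P.Ok α κ) (hY : Sc α κ Y) (ds : List Dr) : ∀ {a : ℝ} (_ : 0 ≤ a) {x : Nd}
    (_ : DsF P Y a ds) (_ : NdF κ Y a x) {k : Nd → List Ce → List Dr → Bool} (_ : unitE P ds x k = true),
    ∃ y cs ds', k y cs ds' = true ∧ NdF κ Y (a + ds.length / P.n) y ∧ UnF P Y a cs ∧ DsF P Y (a + 1) ds' ∧
      ds'.length = ds.length := by
  have hn : (0:ℝ) < P.n := by exact_mod_cast hP.hn
  induction ds with
  | nil =>
    intro a ha x _ hx k h
    exact ⟨x, [], [], h, by simpa using hx, trivial, trivial, rfl⟩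
  | cons d ds ih =>
    intro a ha x hd hx k h
    change stepE P d x (fun y c d' => unitE P ds y fun z cs ds => k z (c :: cs) (d' :: ds)) = true at h
    obtain ⟨y, c, d', h, hy, hc, hd'⟩ := stepE_sound hP hY ha hd.1 hx h
    obtain ⟨z, cs, ds', h, hz, hcs, hds, hlen⟩ := ih (by positivity) hd.2 hy h
    refine ⟨z, c :: cs, d' :: ds', h, ?_, ⟨hc, hcs⟩, ⟨hd', ?_⟩, by simp [hlen]⟩
    · convert hz using 1
      push_cast [List.length_cons]
      ring
    · convert hds using 1
      ring

theorem unitsE_sound (hP : P.Ok α κ) (hY : Sc α κ Y) (m : ℕ) : ∀ {a : ℝ} (_ : 0 ≤ a) {x : Nd} {ds : List Dr}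
    (_ : (ds.length : ℝ) = P.n) (_ : DsF P Y a ds) (_ : NdF κ Y a x) {k : List (List Ce) → Bool}
    (_ : unitsE P m ds x k = true), ∃ us, k us = true ∧ SoF P Y a us := by
  have hn : (0:ℝ) < P.n := by exact_mod_cast hP.hn
  induction m with
  | zero =>
    intro a ha x ds hl hd hx k h
    exact ⟨[], h, trivial⟩
  | succ m ih =>
    intro a ha x ds hl hd hx k h
    change unitE P ds x (fun y cs ds' => unitsE P m ds' y fun us => k (cs :: us)) = true at h
    obtain ⟨y, cs, ds', h, hy, hcs, hds, hlen⟩ := unitE_sound hP hY ds ha hd hx h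
    rw [hl, div_self hn.ne'] at hy
    obtain ⟨us, h, hus⟩ := ih (by linarith) (by rw [hlen, hl]) hds hy h
    exact ⟨cs :: us, h, hcs, hus⟩

theorem initE_sound (hP : P.Ok α κ) (hY : Sc α κ Y) {c : ℤ} (hist : ∀ t, t ≤ 0 → Y t = (c:ℝ) / SZ * t) (j : ℕ) :
    ∀ {x : Nd} (_ : (j:ℝ) ≤ P.n) (_ : NdF κ Y (-(j / P.n)) x) {k : List Dr → Bool} (_ : initE P c j x k = true),
    ∃ ds, k ds = true ∧ ds.length = j ∧ DsF P Y (-(j / P.n) + 1) ds := by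
  have hn : (0:ℝ) < P.n := by exact_mod_cast hP.hn
  have hS := SZ_pos
  induction j with
  | zero =>
    intro x _ _ k h
    exact ⟨[], h, rfl, trivial⟩
  | succ j ih =>
    intro x hj hx k h
    change (fz (ing (c *ᵢ (j:ℤ)) /ᵢ P.n) fun l => fz (l +ᵢ 1) fun u =>
      evE P l u fun fl fu dl du => mkE P x ⟨l, u, fl, fu, dl, du⟩ c c 0 0 fun d =>
      initE P c j ⟨l, u, fl, fu, dl, du⟩ fun ds => k (d :: ds)) = true at h
    simp only [fz_eq, ing_eq, iml_eq, idi_eq, iad_eq] at h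
    push_cast at hj hx
    obtain ⟨fl, fu, dl, du, h, hE⟩ := evE_sound hP h
    have e : (SZ:ℝ) * Y (-(j / P.n)) = ((-(c * (j:ℤ)) : ℤ) : ℝ) / P.n := by
      rw [hist _ (by have : (0:ℝ) ≤ j / P.n := by positivity
                     linarith)]
      push_cast
      field_simp
    have hy : NdF κ Y (-(j / P.n)) _ := NdF.of_ev hE (by rw [e]; exact fdiv_le _ hP.hn)
      (by rw [e]; push_cast; have := (lt_fdiv (-(c * (j:ℤ))) hP.hn).le; push_cast at this; exact this)
    have ea : -(((j:ℝ) + 1) / P.n) + 1 / P.n = -(j / P.n) := by ring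
    have hj1 : ((j:ℝ) + 1) / P.n ≤ 1 := by rw [div_le_one hn]; exact hj
    have hj0 : (0:ℝ) ≤ j / P.n := by positivity
    have hs : SmR Y (-(((j:ℝ) + 1) / P.n)) (1 / P.n) ((c:ℝ)/SZ) ((c:ℝ)/SZ) (((0:ℤ):ℝ)/SZ) (((0:ℤ):ℝ)/SZ) := by
      refine ⟨fun _ => (c:ℝ)/SZ, fun _ => 0, fun t u v => ⟨?_, hasDerivAt_const _ _, le_rfl, le_rfl, by simp, by simp⟩⟩
      rw [ea] at v
      have : HasDerivAt (fun t : ℝ => (c:ℝ) / SZ * t) ((c:ℝ)/SZ) t := by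
        simpa using (hasDerivAt_id t).const_mul ((c:ℝ)/SZ)
      refine this.congr_of_eventuallyEq ?_
      filter_upwards [Iio_mem_nhds (show t < 0 by linarith)] with s hs
      exact hist s (le_of_lt hs)
    obtain ⟨d, h, hd⟩ := mkE_sound hP hY (a := -(((j:ℝ) + 1) / P.n)) (by linarith) hx (by rw [ea]; exact hy) hs h
    obtain ⟨ds, h, hlen, hds⟩ := ih (by linarith) hy h
    refine ⟨d :: ds, h, by simp [hlen], ?_, ?_⟩
    · push_cast; exact hd
    · convert hds using 1
      push_cast
      ring

theorem runE_sound (hP : P.Ok α κ) (hY : Sc α κ Y) {c : ℤ} (hist : ∀ t, t ≤ 0 → Y t = (c:ℝ) / SZ * t) {m : ℕ}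
    {k : List (List Ce) → Bool} (h : runE P c m k = true) : ∃ us, k us = true ∧ SoF P Y 0 us := by
  have hn : (0:ℝ) < P.n := by exact_mod_cast hP.hn
  have hS := SZ_pos
  have htn : ((P.n.toNat : ℕ) : ℝ) = P.n := by
    have := Int.toNat_of_nonneg hP.hn.le
    exact_mod_cast this
  simp only [runE, fz_eq, ing_eq] at h
  obtain ⟨fl, fu, dl, du, h, hE⟩ := evE_sound hP h
  have e : (SZ:ℝ) * Y (-1) = ((-c : ℤ) : ℝ) := by
    rw [hist _ (by norm_num)]
    push_cast
    field_simp
  obtain ⟨ds, h, hlen, hds⟩ := initE_sound hP hY hist _ (by rw [htn])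
    (by rw [htn, div_self hn.ne']; exact NdF.of_ev hE e.ge e.le) h
  rw [htn, div_self hn.ne', neg_add_cancel] at hds
  obtain ⟨fl, fu, dl, du, h, hE⟩ := evE_sound hP h
  have e0 : (SZ:ℝ) * Y 0 = ((0:ℤ) : ℝ) := by
    rw [hist _ le_rfl]
    simp
  exact unitsE_sound hP hY m le_rfl (by rw [hlen, htn]) hds (NdF.of_ev hE e0.ge e0.le) h

theorem nthE_unit {us : List (List Ce)} : ∀ {a : ℝ} {i : ℕ} {k : List Ce → Bool} (_ : SoF P Y a us)
    (_ : nthE us i k = true), ∃ u, k u = true ∧ UnF P Y (a + i) u := by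
  induction us with
  | nil => intro a i k _ h; exact absurd h (by simp [nthE])
  | cons u us ih =>
    intro a i k hs h
    cases i with
    | zero => exact ⟨u, h, by simpa using hs.1⟩
    | succ i =>
      obtain ⟨v, hv, h2⟩ := ih hs.2 h
      exact ⟨v, hv, by convert h2 using 1; push_cast; ring⟩

theorem nthE_cell {cs : List Ce} : ∀ {a : ℝ} {i : ℕ} {k : Ce → Bool} (_ : UnF P Y a cs)
    (_ : nthE cs i k = true), ∃ c, k c = true ∧ CeF P Y (a + i / P.n) c := by
  induction cs with
  | nil => intro a i k _ h; exact absurd h (by simp [nthE])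
  | cons u us ih =>
    intro a i k hs h
    cases i with
    | zero => exact ⟨u, h, by simpa using hs.1⟩
    | succ i =>
      obtain ⟨v, hv, h2⟩ := ih hs.2 h
      exact ⟨v, hv, by convert h2 using 1; push_cast; ring⟩

/-- the time belonging to the index `T` -/
noncomputable def tm (P : Pm) (T : ℕ) : ℝ := T / (64 * P.n)

theorem cell_at (hP : P.Ok α κ) (T : ℕ) : (0:ℝ) + ((T / (64 * P.n.toNat) : ℕ):ℝ)
    + ((T % (64 * P.n.toNat) / 64 : ℕ):ℝ) / P.n + ((T % 64 : ℕ):ℝ) / (64 * P.n) = tm P T := by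
  have hn : (0:ℝ) < P.n := by exact_mod_cast hP.hn
  have htn : ((P.n.toNat : ℕ) : ℝ) = P.n := by
    have := Int.toNat_of_nonneg hP.hn.le
    exact_mod_cast this
  set N := P.n.toNat
  have e1 : 64 * N * (T / (64 * N)) + T % (64 * N) = T := Nat.div_add_mod _ _
  have e2 : 64 * (T % (64 * N) / 64) + T % (64 * N) % 64 = T % (64 * N) := Nat.div_add_mod _ _
  have e3 : T % (64 * N) % 64 = T % 64 := Nat.mod_mul_right_mod _ _ _
  rw [e3] at e2
  have r1 : (64:ℝ) * N * ((T / (64 * N) : ℕ):ℝ) + ((T % (64 * N) : ℕ):ℝ) = T := by exact_mod_cast e1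
  have r2 : (64:ℝ) * ((T % (64 * N) / 64 : ℕ):ℝ) + ((T % 64 : ℕ):ℝ) = ((T % (64 * N) : ℕ):ℝ) := by exact_mod_cast e2
  unfold tm
  rw [htn] at r1
  field_simp
  linarith

theorem loE_sound (hP : P.Ok α κ) (hY : Continuous Y) {us : List (List Ce)} (hs : SoF P Y 0 us) {T : ℕ} {k : ℤ → Bool}
    (h : loE P us T k = true) : ∃ v : ℤ, k v = true ∧ (v:ℝ) ≤ SZ * Y (tm P T) := by
  have hn : (0:ℝ) < P.n := by exact_mod_cast hP.hn
  have hS := SZ_pos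
  obtain ⟨u, h, hu⟩ := nthE_unit hs h
  obtain ⟨c, h, hc⟩ := nthE_cell hu h
  simp only [fz_eq, iad_eq, isb_eq, iml_eq, idi_eq] at h
  refine ⟨_, h, ?_⟩
  obtain ⟨ea, eb, hsm⟩ := hc.sm
  obtain ⟨j, hj⟩ : ∃ j : ℕ, j = T % 64 := ⟨_, rfl⟩
  have hj64 : (j:ℝ) ≤ 64 := by exact_mod_cast (by omega : j ≤ 64)
  obtain ⟨i1, i2, i3, i4⟩ := hsm.interp hY (s := (j:ℝ) / (64 * P.n)) (by positivity)
    (by rw [div_le_div_iff₀ (by positivity) hn]; nlinarith)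
  rw [← hj]
  have e := cell_at hP T
  rw [← hj] at e
  rw [e] at i1 i2 i3 i4
  rw [mx_eq]
  push_cast
  have hN : 0 < 64 * P.n := by have := hP.hn; omega
  apply max_le
  · have f := fdiv_le ((j:ℤ) * c.pa) hN
    push_cast at f
    have m := mul_le_mul_of_nonneg_left i1 hS.le
    rw [mul_add, show (SZ:ℝ) * (c.pa / SZ * (j / (64 * P.n))) = j * c.pa / (64 * P.n) by field_simp] at m
    linarith [hc.l]
  · have f := (lt_fdiv ((64 - (j:ℤ)) * c.pb) hN).le
    push_cast at f
    have m := mul_le_mul_of_nonneg_left i3 hS.le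
    rw [mul_sub, show (SZ:ℝ) * (c.pb / SZ * (1 / P.n - j / (64 * P.n))) = (64 - j) * c.pb / (64 * P.n) by field_simp] at m
    linarith [hc.l']

theorem hiE_sound (hP : P.Ok α κ) (hY : Continuous Y) {us : List (List Ce)} (hs : SoF P Y 0 us) {T : ℕ} {k : ℤ → Bool}
    (h : hiE P us T k = true) : ∃ v : ℤ, k v = true ∧ SZ * Y (tm P T) ≤ (v:ℝ) := by
  have hn : (0:ℝ) < P.n := by exact_mod_cast hP.hn
  have hS := SZ_pos
  obtain ⟨u, h, hu⟩ := nthE_unit hs h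
  obtain ⟨c, h, hc⟩ := nthE_cell hu h
  simp only [fz_eq, iad_eq, isb_eq, iml_eq, idi_eq] at h
  refine ⟨_, h, ?_⟩
  obtain ⟨ea, eb, hsm⟩ := hc.sm
  obtain ⟨j, hj⟩ : ∃ j : ℕ, j = T % 64 := ⟨_, rfl⟩
  have hj64 : (j:ℝ) ≤ 64 := by exact_mod_cast (by omega : j ≤ 64)
  obtain ⟨i1, i2, i3, i4⟩ := hsm.interp hY (s := (j:ℝ) / (64 * P.n)) (by positivity)
    (by rw [div_le_div_iff₀ (by positivity) hn]; nlinarith)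
  rw [← hj]
  have e := cell_at hP T
  rw [← hj] at e
  rw [e] at i1 i2 i3 i4
  rw [mn_eq]
  push_cast
  have hN : 0 < 64 * P.n := by have := hP.hn; omega
  apply le_min
  · have f := (lt_fdiv ((j:ℤ) * c.pb) hN).le
    push_cast at f
    have m := mul_le_mul_of_nonneg_left i2 hS.le
    rw [mul_add, show (SZ:ℝ) * (c.pb / SZ * (j / (64 * P.n))) = j * c.pb / (64 * P.n) by field_simp] at m
    linarith [hc.u]
  · have f := fdiv_le ((64 - (j:ℤ)) * c.pa) hN
    push_cast at f
    have m := mul_le_mul_of_nonneg_left i4 hS.le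
    rw [mul_sub, show (SZ:ℝ) * (c.pa / SZ * (1 / P.n - j / (64 * P.n))) = (64 - j) * c.pa / (64 * P.n) by field_simp] at m
    linarith [hc.u']
end

structure Rn (P : Pm) (U : ℕ) (Y : ℝ → ℝ) (us : List (List Ce)) : Prop where
  hU : 0 < U
  lo : ∀ {T : ℕ} {k : ℤ → Bool}, loE P us T k = true → ∃ v : ℤ, k v = true ∧ (v:ℝ) ≤ SZ * Y ((T:ℝ) / U)
  hi : ∀ {T : ℕ} {k : ℤ → Bool}, hiE P us T k = true → ∃ v : ℤ, k v = true ∧ SZ * Y ((T:ℝ) / U) ≤ (v:ℝ)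

theorem Rn.of {P : Pm} {α κ : ℝ} {Y : ℝ → ℝ} (hP : P.Ok α κ) (hY : Sc α κ Y) {c : ℤ} {m : ℕ}
    {k : List (List Ce) → Bool} (hist : ∀ t, t ≤ 0 → Y t = (c:ℝ) / SZ * t) (h : runE P c m k = true) {U : ℕ}
    (hU : (U:ℤ) = 64 * P.n) : ∃ us, k us = true ∧ Rn P U Y us := by
  obtain ⟨us, h1, h2⟩ := runE_sound hP hY hist h
  have e : ∀ T : ℕ, tm P T = (T:ℝ) / U := by
    intro T
    have : (U:ℝ) = 64 * P.n := by exact_mod_cast hU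
    rw [this]; rfl
  refine ⟨us, h1, ?_, ?_, ?_⟩
  · have := hP.hn
    omega
  · intro T k h
    rw [← e]; exact loE_sound hP hY.cont h2 h
  · intro T k h
    rw [← e]; exact hiE_sound hP hY.cont h2 h

/-- lazy guards -/
noncomputable def nle (a b : ℕ) (r : Bool) : Bool := Bool.rec (motive := fun _ => Bool) false r (Nat.ble a b)
theorem nle_sound {a b : ℕ} {r : Bool} (h : nle a b r = true) : a ≤ b ∧ r = true := by
  unfold nle at h
  cases hb : Nat.ble a b with
  | false => rw [hb] at h; exact absurd h (by simp)
  | true => rw [hb] at h; exact ⟨Nat.le_of_ble_eq_true hb, h⟩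
noncomputable def zle (a b : ℤ) (r : Bool) : Bool := sg (b -ᵢ a) false r
theorem zle_sound {a b : ℤ} {r : Bool} (h : zle a b r = true) : a ≤ b ∧ r = true := by
  unfold zle at h
  rw [isb_eq] at h
  obtain ⟨h1, h2⟩ := sg_false h
  exact ⟨by omega, h2⟩

noncomputable def negE (P : Pm) (us : List (List Ce)) (T : ℕ) (r : Bool) : Bool := hiE P us T fun v => zle v (-1) r
noncomputable def posE (P : Pm) (us : List (List Ce)) (T : ℕ) (r : Bool) : Bool := loE P us T fun v => zle 1 v r

section
variable {P : Pm} {U : ℕ} {Y y : ℝ → ℝ} {us : List (List Ce)} {α κ q L : ℝ}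

theorem negE_sound (R : Rn P U Y us) (hκ : 0 < κ) (hy : ∀ t, y t = κ * Y t) {T : ℕ} {r : Bool}
    (h : negE P us T r = true) : y ((T:ℝ)/U) < 0 ∧ r = true := by
  obtain ⟨v, h1, h2⟩ := R.hi h
  obtain ⟨h1, h3⟩ := zle_sound h1
  refine ⟨?_, h3⟩
  rw [hy]
  have h4 : (v:ℝ) ≤ -1 := by exact_mod_cast h1
  have hS := SZ_pos
  have : Y ((T:ℝ)/U) < 0 := by
    by_contra hc
    push Not at hc
    have := mul_nonneg hS.le hc
    linarith
  exact mul_neg_of_pos_of_neg hκ this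

theorem posE_sound (R : Rn P U Y us) (hκ : 0 < κ) (hy : ∀ t, y t = κ * Y t) {T : ℕ} {r : Bool}
    (h : posE P us T r = true) : 0 < y ((T:ℝ)/U) ∧ r = true := by
  obtain ⟨v, h1, h2⟩ := R.lo h
  obtain ⟨h1, h3⟩ := zle_sound h1
  refine ⟨?_, h3⟩
  rw [hy]
  have h4 : (1:ℝ) ≤ v := by exact_mod_cast h1
  have hS := SZ_pos
  have : 0 < Y ((T:ℝ)/U) := by
    by_contra hc
    push Not at hc
    have := mul_nonneg hS.le (neg_nonneg.2 hc)
    linarith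
  exact mul_pos hκ this

noncomputable def shE (P : Pm) (U : ℕ) (us : List (List Ce)) (q0 q1 : ℕ) (r : Bool) : Bool :=
  nle U q0 <| nle q0 (2*U) <| nle (U+1) q1 <| nle q1 (2*U) <| posE P us q0 <| negE P us q1 r

structure Sh (α : ℝ) (y : ℝ → ℝ) (U q0 q1 : ℕ) (q L : ℝ) : Prop extends Loop α y q L where
  hU : (0:ℝ) < U
  h0 : 1 ≤ (q0:ℝ)/U
  h1 : (q0:ℝ)/U < q
  h2 : q < (q1:ℝ)/U
  h3 : (q1:ℝ)/U ≤ 2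
  h4 : (q1:ℝ)/U < L

theorem shE_sound (R : Rn P U Y us) (hκ : 0 < κ) (hy : ∀ t, y t = κ * Y t) (hα : 1.9 ≤ α) (T : Traj α y) {q0 q1 : ℕ}
    {r : Bool} (h : shE P U us q0 q1 r = true) : r = true ∧ ∃ q L, Sh α y U q0 q1 q L := by
  unfold shE at h
  obtain ⟨a1, h⟩ := nle_sound h
  obtain ⟨a4, h⟩ := nle_sound h
  obtain ⟨a2, h⟩ := nle_sound h
  obtain ⟨a3, h⟩ := nle_sound h
  obtain ⟨b1, h⟩ := posE_sound R hκ hy h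
  obtain ⟨b2, h⟩ := negE_sound R hκ hy h
  have hU : (0:ℝ) < U := by exact_mod_cast R.hU
  have c1 : (1:ℝ) ≤ (q0:ℝ)/U := by rw [le_div_iff₀ hU, one_mul]; exact_mod_cast a1
  have c2 : (1:ℝ) < (q1:ℝ)/U := by rw [lt_div_iff₀ hU, one_mul]; exact_mod_cast a2
  have c3 : (q1:ℝ)/U ≤ 2 := by rw [div_le_iff₀ hU]; exact_mod_cast a3
  obtain ⟨q, L, hl, d1, d2⟩ := T.loop_of_neg hα c2 c3 b2
  exact ⟨h, q, L, hl, hU, c1, hl.lt_q (by rw [div_le_iff₀ hU]; exact_mod_cast a4) b1, d1, c3, d2⟩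

theorem add_div_U (hU : (0:ℝ) < U) (T k : ℕ) : ((T + k * U : ℕ):ℝ) / U = (T:ℝ)/U + k := by
  push_cast
  field_simp

/-- marks `T + U, T + 2U, …, T + kU` all negative -/
noncomputable def mkU (P : Pm) (U : ℕ) (us : List (List Ce)) (T k : ℕ) (r : Bool) : Bool :=
  Nat.rec (motive := fun _ => Bool → Bool) (fun r => r)
    (fun j ih r => ih (negE P us (T + (j+1) * U) r)) k r

theorem mkU_sound (R : Rn P U Y us) (hκ : 0 < κ) (hy : ∀ t, y t = κ * Y t) (hα : 0 < α) (hl : Loop α y q L) {T : ℕ}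
    (hT : (T:ℝ)/U < L) (k : ℕ) : ∀ {r : Bool}, mkU P U us T k r = true → r = true ∧ (T:ℝ)/U + k < L := by
  have hU : (0:ℝ) < U := by exact_mod_cast R.hU
  induction k with
  | zero => intro r h; exact ⟨h, by simpa using hT⟩
  | succ k ih =>
    intro r h
    change mkU P U us T k (negE P us (T + (k+1) * U) r) = true at h
    obtain ⟨h, h1⟩ := ih h
    obtain ⟨h2, h⟩ := negE_sound R hκ hy h
    rw [add_div_U hU] at h2
    exact ⟨h, hl.mark hα h1 (by push_cast; linarith) h2⟩

/-- endpoints of a full loop; returns the bound `c1` -/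
noncomputable def enE (P : Pm) (U : ℕ) (us : List (List Ce)) (q0 q1 L0 L1 : ℕ) (k : ℤ → Bool) : Bool :=
  shE P U us q0 q1 <| mkU P U us q1 ((L0 - q1) / U) <| nle (q1 + U) L0 <| nle L0 (q1 + ((L0 - q1) / U) * U + U) <|
  nle L1 (L0 + U) <| nle L0 L1 <| negE P us L0 <| posE P us L1 <|
  hiE P us (L0 - U) fun u0 => hiE P us (L1 - U) fun u1 => fz (ing (mx u0 u1)) k

structure En (α : ℝ) (y : ℝ → ℝ) (U q0 q1 L0 L1 : ℕ) (c1 : ℝ) (q L : ℝ) : Prop extends Sh α y U q0 q1 q L where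
  g0 : (L0:ℝ)/U < L
  g1 : L < (L1:ℝ)/U
  g2 : (q1:ℝ)/U ≤ (L0:ℝ)/U - 1
  g3 : (L1:ℝ)/U - 1 ≤ (L0:ℝ)/U
  v0 : y ((L0:ℝ)/U - 1) ≤ -c1
  v1 : y ((L1:ℝ)/U - 1) ≤ -c1

theorem enE_sound (R : Rn P U Y us) (hκ : 0 < κ) (hy : ∀ t, y t = κ * Y t) (hα : 1.9 ≤ α) (T : Traj α y)
    {q0 q1 L0 L1 : ℕ} {k : ℤ → Bool} (h : enE P U us q0 q1 L0 L1 k = true) :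
    ∃ c1 : ℤ, k c1 = true ∧ ∃ q L, En α y U q0 q1 L0 L1 (κ * (c1 / SZ)) q L := by
  have hU : (0:ℝ) < U := by exact_mod_cast R.hU
  have hS := SZ_pos
  unfold enE at h
  obtain ⟨h, q, L, hs⟩ := shE_sound R hκ hy hα T h
  obtain ⟨h, m1⟩ := mkU_sound R hκ hy (by linarith) hs.toLoop hs.h4 _ h
  obtain ⟨a1, h⟩ := nle_sound h
  obtain ⟨a2, h⟩ := nle_sound h
  obtain ⟨a3, h⟩ := nle_sound h
  obtain ⟨a4, h⟩ := nle_sound h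
  obtain ⟨b1, h⟩ := negE_sound R hκ hy h
  obtain ⟨b2, h⟩ := posE_sound R hκ hy h
  obtain ⟨u0, h, e0⟩ := R.hi h
  obtain ⟨u1, h, e1⟩ := R.hi h
  simp only [fz_eq, ing_eq, mx_eq] at h
  have d1 : (q1:ℝ)/U ≤ (L0:ℝ)/U - 1 := by
    rw [le_sub_iff_add_le, ← div_self hU.ne', ← add_div]
    gcongr
    exact_mod_cast a1
  have d2 : (L0:ℝ)/U ≤ (q1:ℝ)/U + ((L0 - q1) / U : ℕ) + 1 := by
    have : ((L0:ℕ):ℝ)/U ≤ ((q1 + ((L0 - q1) / U) * U + U : ℕ):ℝ)/U := by gcongr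
    refine this.trans (le_of_eq ?_)
    rw [show q1 + ((L0 - q1) / U) * U + U = q1 + ((L0 - q1) / U + 1) * U by ring, add_div_U hU]
    push_cast; ring
  have d3 : (L1:ℝ)/U - 1 ≤ (L0:ℝ)/U := by
    rw [sub_le_iff_le_add, ← div_self hU.ne', ← add_div]
    gcongr
    exact_mod_cast a3
  have w0 : ((L0 - U : ℕ):ℝ)/U = (L0:ℝ)/U - 1 := by
    rw [Nat.cast_sub (by omega), sub_div, div_self hU.ne']
  have w1 : ((L1 - U : ℕ):ℝ)/U = (L1:ℝ)/U - 1 := by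
    rw [Nat.cast_sub (by omega), sub_div, div_self hU.ne']
  rw [w0] at e0
  rw [w1] at e1
  have g0 := hs.mark (by linarith) m1 d2 b1
  have d4 : (L0:ℝ)/U ≤ (L1:ℝ)/U := by gcongr
  refine ⟨_, h, q, L, hs, g0, hs.L_lt (by linarith [hs.h2]) b2, d1, d3, ?_, ?_⟩
  · have : (u0:ℝ) ≤ ((max u0 u1 : ℤ):ℝ) := by exact_mod_cast le_max_left _ _
    rw [hy]
    have : Y ((L0:ℝ)/U - 1) ≤ ((max u0 u1 : ℤ):ℝ) / SZ := by rw [le_div_iff₀ hS]; linarith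
    calc κ * _ ≤ κ * (((max u0 u1 : ℤ):ℝ) / SZ) := by gcongr
      _ = _ := by push_cast; ring
  · have : (u1:ℝ) ≤ ((max u0 u1 : ℤ):ℝ) := by exact_mod_cast le_max_right _ _
    rw [hy]
    have : Y ((L1:ℝ)/U - 1) ≤ ((max u0 u1 : ℤ):ℝ) / SZ := by rw [le_div_iff₀ hS]; linarith
    calc κ * _ ≤ κ * (((max u0 u1 : ℤ):ℝ) / SZ) := by gcongr
      _ = _ := by push_cast; ring

theorem En.ret {U q0 q1 L0 L1 : ℕ} {c1 c : ℝ} (E : En α y U q0 q1 L0 L1 c1 q L) (hα : 0 < α) (hc : 0 < c) (hcc : c ≤ c1)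
    (hca : c ≤ α * (1 - Real.exp (-c1))) : ∀ t, -1 ≤ t → t ≤ 0 → y (L + t) ≤ c * t :=
  E.retA hα E.g0 (by linarith [E.h2, E.g2]) E.g1 E.g3 E.v0 E.v1 hc hcc hca
end

/-- cell parameters: `n` steps per unit, `α ∈ [a0,a1]` -/
noncomputable def pmR (n n2 n3 a0 a1 : ℤ) : Pm := ⟨n, n2, n3, a0, a1, SZ, SZ⟩

structure InC (n n2 n3 a0 a1 : ℤ) (U : ℕ) (α : ℝ) : Prop where
  hn : 0 < n
  hn2 : n2 = 2 * n
  hn3 : n3 = 12 * n * n * n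
  hU : (U:ℤ) = 64 * n
  ha0 : (a0:ℝ) ≤ SZ * α
  ha1 : SZ * α ≤ (a1:ℝ)
  hα : 1.9 ≤ α
  hp : 0 < a0

theorem InC.ok {n n2 n3 a0 a1 : ℤ} {U : ℕ} {α : ℝ} (h : InC n n2 n3 a0 a1 U α) : (pmR n n2 n3 a0 a1).Ok α 1 :=
  ⟨h.hn, h.hn2, h.hn3, h.ha0, h.ha1, by linarith [h.hα], by simp [pmR], by simp [pmR], one_pos, fun _ => rfl,
    SZ_posZ.le⟩

theorem InC.oks {n n2 n3 a0 a1 c0 : ℤ} {U : ℕ} {α κ : ℝ} (h : InC n n2 n3 a0 a1 U α) (hκ : 0 < κ) (hk : SZ * κ ≤ (c0:ℝ)) :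
    (Pm.mk n n2 n3 a0 a1 0 c0).Ok α κ :=
  ⟨h.hn, h.hn2, h.hn3, h.ha0, h.ha1, by linarith [h.hα], by simpa using (mul_pos SZ_pos hκ).le, hk, hκ,
    fun h => absurd h (lt_irrefl _), le_rfl⟩

theorem Lin.sc {α c : ℝ} {y : ℝ → ℝ} (h : Lin α c y) : Sc α 1 y :=
  ⟨h.cont, fun t ht => by
    have := h.der t ht
    unfold Fk
    convert this using 1
    simp⟩

theorem Lin.scS {α κ : ℝ} {y : ℝ → ℝ} (hκ : 0 < κ) (h : Lin α κ y) : Sc α κ (fun t => y t / κ) :=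
  ⟨h.cont.div_const _, fun t ht => by
    have := (h.der t ht).div_const κ
    unfold Fk
    have e : -(α * ((Real.exp (κ * (y (t-1) / κ)) - 1) / κ)) = -α * (Real.exp (y (t - 1)) - 1) / κ := by
      rw [mul_div_cancel₀ _ hκ.ne']
      ring
    rw [e]
    exact this⟩

structure QL where
  q0 : ℕ
  q1 : ℕ
  L0 : ℕ
  L1 : ℕ

noncomputable def stA (P : Pm) (U : ℕ) (c : ℤ) (Q : QL) (k : List (List Ce) → ℤ → Bool) : Bool :=
  runE P c (Q.L1 / U + 1) fun us => enE P U us Q.q0 Q.q1 Q.L0 Q.L1 fun c1 =>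
    expHi (ing c1) fun e => zle e SZ <| fz (mn c1 (isd (P.a0 *ᵢ (SZ -ᵢ e)))) fun c' => zle 1 c' (k us c')

section
variable {n n2 n3 a0 a1 c : ℤ} {U : ℕ} {α : ℝ}

theorem InC.lin (hC : InC n n2 n3 a0 a1 U α) (hc : 0 < c) {m : ℕ} {k : List (List Ce) → Bool}
    (h : runE (pmR n n2 n3 a0 a1) c m k = true) : ∃ y us, k us = true ∧ Rn (pmR n n2 n3 a0 a1) U y us ∧
      Lin α ((c:ℝ)/SZ) y := by
  have hcR : (0:ℝ) < (c:ℝ)/SZ := div_pos (by exact_mod_cast hc) SZ_pos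
  obtain ⟨y, hy⟩ := Lin.exists (α := α) hcR
  obtain ⟨us, h, R⟩ := Rn.of hC.ok hy.sc hy.hist h (U := U) hC.hU
  exact ⟨y, us, h, R, hy⟩

theorem stA_sound (hC : InC n n2 n3 a0 a1 U α) (hc : 0 < c) {Q : QL} {k : List (List Ce) → ℤ → Bool}
    (h : stA (pmR n n2 n3 a0 a1) U c Q k = true) : ∃ (c' : ℤ) (us : List (List Ce)) (y : ℝ → ℝ) (q L c1 : ℝ),
      k us c' = true ∧ 0 < c' ∧ Rn (pmR n n2 n3 a0 a1) U y us ∧ Lin α ((c:ℝ)/SZ) y ∧ En α y U Q.q0 Q.q1 Q.L0 Q.L1 c1 q L ∧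
      (c':ℝ) ≤ SZ * α ∧ ∀ t, -1 ≤ t → t ≤ 0 → y (L + t) ≤ (c':ℝ)/SZ * t := by
  have hS := SZ_pos
  have hα0 : 0 < α := by linarith [hC.hα]
  unfold stA at h
  obtain ⟨y, us, h, R, hy⟩ := hC.lin hc h
  obtain ⟨c1, h, q, L, hE⟩ := enE_sound R one_pos (fun t => (one_mul _).symm) hC.hα hy.toTraj h
  obtain ⟨e, h, he⟩ := expHi_sound h
  obtain ⟨h1, h⟩ := zle_sound h
  simp only [fz_eq, ing_eq, mn_eq, isb_eq, iml_eq, isd_eq] at h he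
  obtain ⟨h2, h⟩ := zle_sound h
  rw [one_mul] at hE
  have he' := he (-((c1:ℝ)/SZ)) (by push_cast; field_simp; exact le_rfl)
  set c' := min c1 ((pmR n n2 n3 a0 a1).a0 * (SZ - e) / SZ) with hc'
  have hc'0 : (0:ℝ) < c' := by exact_mod_cast (show 0 < c' by omega)
  have hcc : (c':ℝ) ≤ c1 := by exact_mod_cast min_le_left _ _
  have h1' : (e:ℝ) ≤ SZ := by exact_mod_cast h1
  have hca : (c':ℝ)/SZ ≤ α * (1 - Real.exp (-((c1:ℝ)/SZ))) := by
    have e1 : (c':ℝ) ≤ ((a0 * (SZ - e) / SZ : ℤ):ℝ) := by exact_mod_cast min_le_right _ _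
    have e2 := fdiv_le (a0 * (SZ - e)) SZ_posZ
    push_cast at e1 e2
    have e3 : (c':ℝ) * SZ ≤ a0 * (SZ - e) := by
      rw [← le_div_iff₀ hS]; exact e1.trans e2
    have e4 : (a0:ℝ) * (SZ - e) ≤ SZ * α * (SZ - e) := by
      have := hC.ha0
      have : 0 ≤ (SZ:ℝ) - e := by linarith
      gcongr
    have e5 : SZ * α * (SZ - e) ≤ SZ * α * (SZ * (1 - Real.exp (-((c1:ℝ)/SZ)))) := by
      have : (SZ:ℝ) - e ≤ SZ * (1 - Real.exp (-((c1:ℝ)/SZ))) := by linarith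
      gcongr
    rw [div_le_iff₀ hS]
    have : (c':ℝ) * SZ ≤ (α * (1 - Real.exp (-((c1:ℝ)/SZ))) * SZ) * SZ := by linarith
    exact le_of_mul_le_mul_right this hS
  refine ⟨c', us, y, q, L, _, h, by omega, R, hy, hE, ?_, hE.ret hα0 (by positivity) (by gcongr) hca⟩
  have := Real.exp_pos (-((c1:ℝ)/SZ))
  rw [div_le_iff₀ hS] at hca
  nlinarith [mul_pos (mul_pos hα0 hS) this]

theorem stA_bar (hC : InC n n2 n3 a0 a1 U α) (hc : 0 < c) (hB : Barrier α ((c:ℝ)/SZ)) {Q : QL} {k : List (List Ce) → ℤ → Bool}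
    (h : stA (pmR n n2 n3 a0 a1) U c Q k = true) : ∃ (c' : ℤ) (us : List (List Ce)), k us c' = true ∧ 0 < c' ∧
      Barrier α ((c':ℝ)/SZ) := by
  obtain ⟨c', us, y, q, L, c1, h, h0, R, hy, hE, _, hr⟩ := stA_sound hC hc h
  have : (0:ℝ) < (c:ℝ)/SZ := div_pos (by exact_mod_cast hc) SZ_pos
  exact ⟨c', us, h, h0, hB.step hC.hα this.le hE.toLoop (fun t _ h => hy.hist t h) (by linarith [hE.h2, hE.h3]) hr⟩

/-- chain of passes -/
noncomputable def chA (P : Pm) (U : ℕ) (l : List QL) : ℤ → (ℤ → Bool) → Bool :=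
  List.rec (motive := fun _ => ℤ → (ℤ → Bool) → Bool) (fun c k => k c)
    (fun Q _ ih c k => stA P U c Q fun _ c' => ih c' k) l

theorem chA_sound (hC : InC n n2 n3 a0 a1 U α) (l : List QL) : ∀ {c : ℤ} (_ : 0 < c) (_ : Barrier α ((c:ℝ)/SZ)) {k : ℤ → Bool}
    (_ : chA (pmR n n2 n3 a0 a1) U l c k = true), ∃ c' : ℤ, k c' = true ∧ 0 < c' ∧ Barrier α ((c':ℝ)/SZ) := by
  induction l with
  | nil => intro c hc hB k h; exact ⟨c, h, hc, hB⟩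
  | cons Q l ih =>
    intro c hc hB k h
    change stA (pmR n n2 n3 a0 a1) U c Q (fun _ c' => chA (pmR n n2 n3 a0 a1) U l c' k) = true at h
    obtain ⟨c', us, h, h0, hB'⟩ := stA_bar hC hc hB h
    exact ih h0 hB' h

/-- small amplitudes, `c0 = 0.02` -/
noncomputable def smE (n n2 n3 a0 a1 : ℤ) (U : ℕ) (Q : QL) (r : Bool) : Bool :=
  runE (Pm.mk n n2 n3 a0 a1 0 21990232556) SZ (Q.L1 / U + 1) fun us =>
    enE (Pm.mk n n2 n3 a0 a1 0 21990232556) U us Q.q0 Q.q1 Q.L0 Q.L1 fun c1 => zle (102 *ᵢ SZ) (100 *ᵢ c1) r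

theorem smE_sound (hC : InC n n2 n3 a0 a1 U α) {Q : QL} {r : Bool} (h : smE n n2 n3 a0 a1 U Q r = true) :
    r = true ∧ Barrier α (((21990232555:ℤ):ℝ)/SZ) := by
  have hS := SZ_pos
  have hα := hC.hα
  have key : ∀ κ : ℝ, 0 < κ → κ ≤ ((21990232555:ℤ):ℝ)/SZ → r = true ∧ ∃ y q L, Loop α y q L ∧
      (∀ t, -1 ≤ t → t ≤ 0 → y t = κ * t) ∧ q ≤ 2 ∧ ∀ t, -1 ≤ t → t ≤ 0 → y (L + t) ≤ (1 + 0.01) * κ * t := by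
    intro κ hκ hk
    have hk2 : κ ≤ 0.02 := by
      refine hk.trans ?_
      norm_num [SZ]
    have hP := hC.oks (c0 := 21990232556) hκ (by
      rw [le_div_iff₀ hS] at hk
      push_cast at hk ⊢
      linarith)
    obtain ⟨y, hy⟩ := Lin.exists (α := α) hκ
    unfold smE at h
    obtain ⟨us, h, R⟩ := Rn.of hP (hy.scS hκ) (fun t ht => by
      rw [hy.hist t ht]; field_simp) h (U := U) hC.hU
    obtain ⟨c1, h, q, L, hE⟩ := enE_sound R hκ (fun t => by field_simp) hα hy.toTraj h
    simp only [iml_eq] at h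
    obtain ⟨h1, h⟩ := zle_sound h
    have h1' : 1.02 ≤ (c1:ℝ)/SZ := by
      rw [le_div_iff₀ hS]
      have : (102 * SZ : ℝ) ≤ 100 * c1 := by exact_mod_cast h1
      linarith
    have h2 : 1.02 * κ ≤ κ * (c1/SZ) := by nlinarith
    refine ⟨h, y, q, L, hE.toLoop, fun t _ h => hy.hist t h, by linarith [hE.h2, hE.h3], ?_⟩
    refine hE.ret (by linarith) (by positivity) (by linarith) ?_
    have e1 : Real.exp (-(κ * (c1/SZ))) ≤ Real.exp (-(1.02 * κ)) := Real.exp_le_exp.2 (by linarith)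
    have e2 : Real.exp (-(1.02*κ)) ≤ 1 + (-(1.02*κ)) + 0.6 * (-(1.02*κ))^2 := exp_quad (by linarith)
    have e3 : 0.9 * κ ≤ 1 - Real.exp (-(κ * (c1/SZ))) := by nlinarith
    nlinarith
  have h0 : (0:ℝ) < ((21990232555:ℤ):ℝ)/SZ := div_pos (by norm_num) hS
  refine ⟨(key _ h0 le_rfl).1, Barrier.small (ε := 0.01) hα h0 (by norm_num) fun c h1 h2 => (key c h1 h2).2⟩

/-- coarse certificate, ends with a barrier -/
noncomputable def coA (n n2 n3 a0 a1 : ℤ) (U : ℕ) (Q : QL) (l : List QL) (k : ℤ → Bool) : Bool :=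
  smE n n2 n3 a0 a1 U Q (chA (pmR n n2 n3 a0 a1) U l 21990232555 k)

theorem coA_sound (hC : InC n n2 n3 a0 a1 U α) {Q : QL} {l : List QL} {k : ℤ → Bool}
    (h : coA n n2 n3 a0 a1 U Q l k = true) : ∃ c' : ℤ, k c' = true ∧ 0 < c' ∧ Barrier α ((c':ℝ)/SZ) := by
  unfold coA at h
  obtain ⟨h, hB⟩ := smE_sound hC h
  exact chA_sound hC l (by norm_num) hB h

/-- type B ending -/
noncomputable def tyB (P : Pm) (U : ℕ) (c : ℤ) (q0 q1 : ℕ) (r : Bool) : Bool :=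
  runE P c (q1 / U + 4) fun us => shE P U us q0 q1 <| mkU P U us q1 3 r

theorem tyB_sound (hC : InC n n2 n3 a0 a1 U α) (hc : 0 < c) (hB : Barrier α ((c:ℝ)/SZ)) {q0 q1 : ℕ} {r : Bool}
    (h : tyB (pmR n n2 n3 a0 a1) U c q0 q1 r = true) :
    r = true ∧ ∀ c' : ℝ, 0 < c' → c' ≤ α * (1 - Real.exp (-c')) → Barrier α c' := by
  unfold tyB at h
  have hα := hC.hα
  obtain ⟨y, us, h, R, hy⟩ := hC.lin hc h
  obtain ⟨h, q, L, hs⟩ := shE_sound R one_pos (fun t => (one_mul _).symm) hα hy.toTraj h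
  obtain ⟨h, m1⟩ := mkU_sound R one_pos (fun t => (one_mul _).symm) (by linarith) hs.toLoop hs.h4 _ h
  have : (0:ℝ) < (c:ℝ)/SZ := div_pos (by exact_mod_cast hc) SZ_pos
  push_cast at m1
  refine ⟨h, fun c' h1 h2 => hB.step hα this.le hs.toLoop (fun t _ h => hy.hist t h) (by linarith [hs.h2, hs.h3])
    (hs.retB (by linarith) (by linarith [hs.h2]) h1 h2)⟩
end

noncomputable def upE (P : Pm) (U : ℕ) (cb : ℤ) (q0 q1 : ℕ) (k : ℤ → ℤ → Bool) : Bool :=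
  runE P cb 3 fun us => shE P U us q0 q1 <| hiE P us q0 fun h0 => zle (4 *ᵢ h0) (5 *ᵢ SZ) <|
    loE P us (q0 + 1 * U) fun l1 => hiE P us (q1 - U) fun p =>
    fz (2 *ᵢ P.a1 *ᵢ ((q1 - q0 : ℕ) : ℤ) *ᵢ h0 /ᵢ (SZ *ᵢ (U:ℤ)) +ᵢ 1 -ᵢ l1) fun m => zle 0 m (k m p)

noncomputable def nxE (P : Pm) (m : ℤ) (k : ℤ → Bool) : Bool :=
  expLo (ing m) fun e => fz (isd (P.a1 *ᵢ (SZ -ᵢ e)) +ᵢ 1) k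

section
variable {n n2 n3 a0 a1 c cb : ℤ} {U : ℕ} {α : ℝ}

theorem InC.a1pos (hC : InC n n2 n3 a0 a1 U α) : 0 < a1 := by
  have h1 := hC.ha1
  have : 0 < SZ * α := mul_pos SZ_pos (by linarith [hC.hα])
  exact_mod_cast this.trans_le h1

theorem upE_sound (hC : InC n n2 n3 a0 a1 U α) (hcb : 0 < cb) {cc : ℝ} (hU : UBar α cc ((cb:ℝ)/SZ)) {q0 q1 : ℕ}
    {k : ℤ → ℤ → Bool} (h : upE (pmR n n2 n3 a0 a1) U cb q0 q1 k = true) :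
    ∃ m p : ℤ, k m p = true ∧ 0 ≤ m ∧ Upper α cc ((m:ℝ)/SZ) ((p:ℝ)/SZ) := by
  have hS := SZ_pos
  have hα := hC.hα
  have hα0 : 0 < α := by linarith
  unfold upE at h
  obtain ⟨y, us, h, R, hy⟩ := hC.lin hcb h
  obtain ⟨h, q, L, hs⟩ := shE_sound R one_pos (fun t => (one_mul _).symm) hα hy.toTraj h
  obtain ⟨h0, h, e0⟩ := R.hi h
  obtain ⟨h1, h⟩ := zle_sound h
  obtain ⟨l1, h, e1⟩ := R.lo h
  obtain ⟨p, h, e2⟩ := R.hi h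
  simp only [fz_eq, iml_eq, iad_eq, isb_eq, idi_eq] at h h1
  obtain ⟨h2, h⟩ := zle_sound h
  have hU0 := hs.hU
  have hqq : q0 ≤ q1 := by
    have : (q0:ℝ)/U < (q1:ℝ)/U := hs.h1.trans hs.h2
    rw [div_lt_div_iff_of_pos_right hU0] at this
    exact_mod_cast this.le
  have hqU : U ≤ q1 := by
    have : 1 < (q1:ℝ)/U := lt_of_le_of_lt hs.h0 (hs.h1.trans hs.h2)
    rw [lt_div_iff₀ hU0, one_mul] at this
    exact_mod_cast this.le
  rw [add_div_U hU0] at e1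
  rw [Nat.cast_sub hqU, sub_div, div_self hU0.ne'] at e2
  have hy0 : 0 < y ((q0:ℝ)/U) := hs.pos _ (by linarith [hs.h0]) hs.h1
  have hh0 : (0:ℝ) < h0 := lt_of_lt_of_le (mul_pos hS hy0) e0
  have hH : y ((q0:ℝ)/U) ≤ (h0:ℝ)/SZ := by rw [le_div_iff₀ hS]; linarith
  have hH2 : (h0:ℝ)/SZ ≤ 1.25 := by
    rw [div_le_iff₀ hS]
    have : (4:ℝ) * h0 ≤ 5 * SZ := by exact_mod_cast h1
    linarith
  have hl : (l1:ℝ)/SZ ≤ y ((q0:ℝ)/U + 1) := by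
    rw [div_le_iff₀ hS]
    push_cast at e1
    linarith
  have o1 := hs.obsUp hα0 hs.h0 hs.h1.le hs.h2.le hl hH hH2
  have o2 := hs.obsP hα0 hs.h2.le hs.h3 (p := (p:ℝ)/SZ) (by rw [le_div_iff₀ hS]; linarith)
  refine ⟨_, p, h, h2, (hU.upper hα hs.toLoop (fun t _ h => hy.hist t h)).mono ?_ o2⟩
  have f1 := (lt_fdiv (2 * a1 * ((q1 - q0 : ℕ):ℤ) * h0) (b := SZ * (U:ℤ)) (mul_pos SZ_posZ (by exact_mod_cast R.hU))).le
  have f2 : SZ * (2 * α * ((q1:ℝ)/U - (q0:ℝ)/U) * (h0/SZ)) ≤ ((2 * a1 * ((q1 - q0 : ℕ):ℤ) * h0 : ℤ):ℝ) / ((SZ * (U:ℤ) : ℤ):ℝ) := by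
    push_cast [Nat.cast_sub hqq]
    rw [show SZ * (2 * α * ((q1:ℝ)/U - (q0:ℝ)/U) * (h0/SZ)) = 2 * (SZ * α) * (q1 - q0) * h0 / (SZ * U) by field_simp]
    have : (0:ℝ) ≤ (q1:ℝ) - q0 := by rw [sub_nonneg]; exact_mod_cast hqq
    have := hC.ha1
    gcongr
  change -y (q+1) ≤ ((2 * a1 * ((q1 - q0 : ℕ):ℤ) * h0 / (SZ * U) + 1 - l1 : ℤ):ℝ)/SZ
  rw [le_div_iff₀ hS]
  set F := (2 * a1 * ((q1 - q0 : ℕ):ℤ) * h0 / (SZ * U) : ℤ) with hF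
  have f3 := f2.trans f1
  have f4 : -(y (q+1)) * SZ ≤ (-(l1/SZ) + 2 * α * ((q1:ℝ)/U - (q0:ℝ)/U) * (h0/SZ)) * SZ :=
    mul_le_mul_of_nonneg_right (by linarith) hS.le
  have f5 : (-((l1:ℝ)/SZ)) * SZ = -l1 := by field_simp
  have f6 : ((F + 1 - l1 : ℤ):ℝ) = (F:ℝ) + 1 - l1 := by push_cast; ring
  rw [f6]
  nlinarith

theorem nxE_sound (hC : InC n n2 n3 a0 a1 U α) {cc p : ℝ} {m : ℤ} (hm : 0 ≤ m) (hU : Upper α cc ((m:ℝ)/SZ) p) {k : ℤ → Bool}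
    (h : nxE (pmR n n2 n3 a0 a1) m k = true) : ∃ cb : ℤ, k cb = true ∧ 0 < cb ∧ UBar α cc ((cb:ℝ)/SZ) := by
  have hS := SZ_pos
  have hα0 : 0 < α := by linarith [hC.hα]
  unfold nxE at h
  obtain ⟨e, h, he0, he⟩ := expLo_sound h
  simp only [fz_eq, iml_eq, iad_eq, isb_eq, ing_eq, isd_eq] at h he
  have he' := he (-((m:ℝ)/SZ)) (by push_cast; field_simp; exact le_rfl)
  have hm' : (0:ℝ) ≤ (m:ℝ)/SZ := div_nonneg (by exact_mod_cast hm) hS.le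
  have hv : Real.exp (-((m:ℝ)/SZ)) ≤ 1 := Real.exp_le_one_iff.2 (by linarith)
  have heS : (e:ℝ) ≤ SZ := by nlinarith
  have ha1 : (0:ℝ) < a1 := by exact_mod_cast hC.a1pos
  have f1 := lt_fdiv (a1 * (SZ - e)) SZ_posZ
  refine ⟨_, h, ?_, (hU.ubar hα0).mono ?_⟩
  · have : 0 ≤ a1 * (SZ - e) / SZ := Int.ediv_nonneg (mul_nonneg hC.a1pos.le (by
      have : e ≤ SZ := by exact_mod_cast heS
      omega)) SZ_posZ.le
    change 0 < a1 * (SZ - e) / SZ + 1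
    omega
  · rw [le_div_iff₀ hS]
    change _ ≤ ((a1 * (SZ - e) / SZ + 1 : ℤ):ℝ)
    push_cast at f1 ⊢
    refine le_trans ?_ f1.le
    rw [le_div_iff₀ hS]
    calc α * (1 - Real.exp (-((m:ℝ)/SZ))) * SZ * SZ = (SZ * α) * (SZ - SZ * Real.exp (-((m:ℝ)/SZ))) := by ring
      _ ≤ a1 * (SZ - e) := by
        have h1 := hC.ha1
        have : (SZ:ℝ) - SZ * Real.exp (-((m:ℝ)/SZ)) ≤ SZ - e := by linarith
        have h2 : (0:ℝ) ≤ SZ - SZ * Real.exp (-((m:ℝ)/SZ)) := by nlinarith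
        gcongr
end

/-- final scalar test, region I -/
noncomputable def scI (a0 a1 cn A m p hm : ℤ) : Bool :=
  expLo (ing cn) fun V0 => expHi (ing cn) fun V1 => expHi p fun Ep =>
  fz (mx 0 (m -ᵢ a0 +ᵢ A)) fun X => zle (V1 *ᵢ X) ((SZ -ᵢ A) *ᵢ (SZ -ᵢ V1)) <|
  zle (a1 *ᵢ (SZ -ᵢ V0)) (cn *ᵢ SZ) <| zle (ing hm) m <| zle (V1 +ᵢ 1) SZ <|
  fz (a1 *ᵢ (a1 -ᵢ cn) *ᵢ (SZ *ᵢ SZ -ᵢ (SZ +ᵢ cn) *ᵢ V0) /ᵢ (cn *ᵢ cn *ᵢ SZ) +ᵢ 1) fun Q1 =>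
  fz (V1 *ᵢ (m +ᵢ hm) /ᵢ (2 *ᵢ (SZ -ᵢ V1)) +ᵢ 1) fun Q2 =>
  fz (a1 -ᵢ SZ +ᵢ m +ᵢ Ep /ᵢ 2 +ᵢ 1) fun K1 => zle (K1 *ᵢ (Q1 +ᵢ Q2) +ᵢ 1) (SZ *ᵢ SZ) true

set_option maxHeartbeats 800000 in
theorem scI_sound {a0 a1 cn A m p hm : ℤ} {α : ℝ} (hα : 1.9 ≤ α) (ha0 : (a0:ℝ) ≤ SZ * α) (ha1 : SZ * α ≤ (a1:ℝ))
    (hcn : 0 < cn) (hca : (cn:ℝ) ≤ SZ * α) (hA : A ≤ SZ) (hm0 : 0 ≤ m) (h : scI a0 a1 cn A m p hm = true) :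
    ∃ X : ℝ, (m:ℝ)/SZ - α + (A:ℝ)/SZ ≤ X ∧
      (A:ℝ)/SZ * (1 - Real.exp (-((cn:ℝ)/SZ))) + Real.exp (-((cn:ℝ)/SZ)) * X ≤ 1 - Real.exp (-((cn:ℝ)/SZ)) ∧
      α * (1 - Real.exp (-((cn:ℝ)/SZ))) ≤ (cn:ℝ)/SZ ∧
      (α - 1 + (m:ℝ)/SZ + Real.exp ((p:ℝ)/SZ) / 2) * (α * (α - (cn:ℝ)/SZ) * (1 - (1 + (cn:ℝ)/SZ) * Real.exp (-((cn:ℝ)/SZ))) / ((cn:ℝ)/SZ)^2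
      + (α / (α * (1 - Real.exp (-((cn:ℝ)/SZ)))) - 1) * ((m:ℝ)/SZ - -((hm:ℝ)/SZ)) / 2) < 1 := by
  have hS := SZ_pos
  have hα0 : 0 < α := by linarith
  unfold scI at h
  obtain ⟨V0, h, hV0', hV0⟩ := expLo_sound h
  obtain ⟨V1, h, hV1⟩ := expHi_sound h
  obtain ⟨Ep, h, hEp⟩ := expHi_sound h
  simp only [fz_eq, iml_eq, iad_eq, isb_eq, ing_eq, idi_eq, mx_eq] at h hV0 hV1 hEp
  obtain ⟨h1, h⟩ := zle_sound h
  obtain ⟨h2, h⟩ := zle_sound h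
  obtain ⟨h3, h⟩ := zle_sound h
  obtain ⟨h4, h⟩ := zle_sound h
  obtain ⟨h5, h⟩ := zle_sound h
  clear h
  set c : ℝ := (cn:ℝ)/SZ with hc
  have hcS : (cn:ℝ) = SZ * c := by rw [hc]; field_simp
  set v := Real.exp (-c) with hv
  have hv0 : 0 < v := Real.exp_pos _
  have w0 : (V0:ℝ) ≤ SZ * v := hV0 (-c) (by push_cast; rw [hcS]; linarith)
  have w1 : SZ * v ≤ (V1:ℝ) := hV1 (-c) (by push_cast; rw [hcS]; linarith)
  have w2 : SZ * Real.exp ((p:ℝ)/SZ) ≤ (Ep:ℝ) := hEp _ (by field_simp; exact le_rfl)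
  have hc0 : 0 < c := div_pos (by exact_mod_cast hcn) hS
  have hcα : c ≤ α := by
    rw [hcS] at hca
    exact le_of_mul_le_mul_left hca hS
  have hV1S : (V1:ℝ) + 1 ≤ SZ := by exact_mod_cast h4
  have hv1 : v < 1 := by
    by_contra hcon
    push Not at hcon
    nlinarith
  have hA' : (A:ℝ) ≤ SZ := by exact_mod_cast hA
  have hm' : (0:ℝ) ≤ m := by exact_mod_cast hm0
  have h3' : -(hm:ℝ) ≤ m := by exact_mod_cast h3
  refine ⟨((max 0 (m - a0 + A) : ℤ):ℝ)/SZ, ?_, ?_, ?_, ?_⟩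
  · rw [le_div_iff₀ hS]
    have : ((m - a0 + A : ℤ):ℝ) ≤ ((max 0 (m - a0 + A) : ℤ):ℝ) := by exact_mod_cast le_max_right _ _
    push_cast at this
    refine le_trans ?_ (by push_cast; exact this)
    have : ((m:ℝ)/SZ - α + A/SZ) * SZ = m - SZ * α + A := by field_simp
    rw [this]; linarith
  · set X : ℤ := max 0 (m - a0 + A) with hX
    have hX0 : (0:ℝ) ≤ X := by exact_mod_cast le_max_left _ _
    have h1' : (V1:ℝ) * X ≤ (SZ - A) * (SZ - V1) := by exact_mod_cast h1
    have g1 : (SZ * v) * X ≤ (SZ - A) * (SZ - SZ * v) := by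
      calc (SZ * v) * X ≤ V1 * X := by gcongr
        _ ≤ (SZ - A) * (SZ - V1) := h1'
        _ ≤ _ := by
          have : (0:ℝ) ≤ SZ - A := by linarith
          gcongr
    have g2 : v * (X/SZ) ≤ (1 - A/SZ) * (1 - v) := by
      have : (SZ * SZ) * (v * (X/SZ)) ≤ (SZ * SZ) * ((1 - A/SZ) * (1 - v)) := by
        calc (SZ * SZ) * (v * ((X:ℝ)/SZ)) = (SZ * v) * X := by field_simp
          _ ≤ _ := g1
          _ = _ := by field_simp
      exact le_of_mul_le_mul_left this (by positivity)
    nlinarith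
  · have h2' : (a1:ℝ) * (SZ - V0) ≤ cn * SZ := by exact_mod_cast h2
    have g1 : (SZ * α) * (SZ - SZ * v) ≤ (SZ * c) * SZ := by
      rw [← hcS]
      refine le_trans ?_ h2'
      have : (0:ℝ) ≤ SZ - SZ * v := by nlinarith
      have : (SZ:ℝ) - SZ * v ≤ SZ - V0 := by linarith
      gcongr
      · linarith [mul_pos hS hα0]
    have : (SZ * SZ) * (α * (1 - v)) ≤ (SZ * SZ) * c := by linarith
    exact le_of_mul_le_mul_left this (by positivity)
  · set Q1 : ℤ := a1 * (a1 - cn) * (SZ * SZ - (SZ + cn) * V0) / (cn * cn * SZ) + 1 with hQ1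
    set Q2 : ℤ := V1 * (m + hm) / (2 * (SZ - V1)) + 1 with hQ2
    set K1 : ℤ := a1 - SZ + m + Ep / 2 + 1 with hK1
    have k1 : SZ * (α - 1 + (m:ℝ)/SZ + Real.exp ((p:ℝ)/SZ) / 2) ≤ K1 := by
      have := (lt_fdiv Ep (b := 2) (by norm_num)).le
      push_cast at this
      have e : SZ * ((m:ℝ)/SZ) = m := by field_simp
      rw [hK1]
      push_cast
      nlinarith
    have gc : 0 ≤ 1 - (1 + c) * v := by
      have : (1 + c) * v ≤ Real.exp c * v := by gcongr; linarith [Real.add_one_le_exp c]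
      rw [hv, ← Real.exp_add] at this
      simp only [add_neg_cancel, Real.exp_zero] at this
      linarith
    have k2 : SZ * (α * (α - c) * (1 - (1 + c) * v) / c^2) ≤ Q1 := by
      have := (lt_fdiv (a1 * (a1 - cn) * (SZ * SZ - (SZ + cn) * V0)) (b := cn * cn * SZ) (by
        have := SZ_posZ
        positivity)).le
      rw [hQ1]
      push_cast at this ⊢
      refine le_trans ?_ this
      rw [hcS]
      have g1 : SZ * α * (SZ * α - SZ * c) * (SZ * SZ - (SZ + SZ * c) * (SZ * v)) ≤
          a1 * (a1 - SZ * c) * (SZ * SZ - (SZ + SZ * c) * V0) := by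
        have i1 : 0 ≤ SZ * α - SZ * c := by nlinarith
        have i2 : 0 ≤ SZ * SZ - (SZ + SZ * c) * (SZ * v) := by
          have : SZ * SZ - (SZ + SZ * c) * (SZ * v) = SZ * SZ * (1 - (1 + c) * v) := by ring
          rw [this]; positivity
        have i3 : (0:ℝ) ≤ a1 := by nlinarith
        have i4 : (0:ℝ) ≤ a1 - SZ * c := by linarith
        gcongr
      rw [le_div_iff₀ (by positivity)]
      calc SZ * (α * (α - c) * (1 - (1 + c) * v) / c^2) * (SZ * c * (SZ * c) * SZ)
          = SZ * α * (SZ * α - SZ * c) * (SZ * SZ - (SZ + SZ * c) * (SZ * v)) := by field_simp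
        _ ≤ _ := g1
    have k3 : SZ * ((α / (α * (1 - v)) - 1) * ((m:ℝ)/SZ - -((hm:ℝ)/SZ)) / 2) ≤ Q2 := by
      have := (lt_fdiv (V1 * (m + hm)) (b := 2 * (SZ - V1)) (by omega)).le
      rw [hQ2]
      push_cast at this ⊢
      refine le_trans ?_ this
      have j : 0 < 1 - v := by linarith
      have : SZ * ((α / (α * (1 - v)) - 1) * ((m:ℝ)/SZ - -((hm:ℝ)/SZ)) / 2) = (SZ * v) * (m + hm) / (2 * (SZ - SZ * v)) := by
        have : SZ - SZ * v = SZ * (1 - v) := by ring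
        rw [this]
        field_simp
        ring
      rw [this]
      have : (0:ℝ) < SZ - V1 := by linarith
      have : (0:ℝ) ≤ m + hm := by linarith
      have : (0:ℝ) ≤ V1 := le_trans (by positivity) w1
      gcongr
    have h5' : (K1:ℝ) * (Q1 + Q2) + 1 ≤ SZ * SZ := by exact_mod_cast h5
    set T1 := α * (α - c) * (1 - (1 + c) * v) / c^2
    set T2 := (α / (α * (1 - v)) - 1) * ((m:ℝ)/SZ - -((hm:ℝ)/SZ)) / 2
    set T0 := α - 1 + (m:ℝ)/SZ + Real.exp ((p:ℝ)/SZ) / 2 with hT0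
    have t0 : 0 ≤ T0 := by
      have : (0:ℝ) ≤ (m:ℝ)/SZ := by positivity
      have := Real.exp_pos ((p:ℝ)/SZ)
      linarith
    have t1 : 0 ≤ T1 := by
      have : 0 ≤ α - c := by linarith
      positivity
    have t2 : 0 ≤ T2 := by
      have j : 0 < 1 - v := by linarith
      have e1 : α / (α * (1 - v)) - 1 = v / (1 - v) := by field_simp; ring
      have e2 : (m:ℝ)/SZ - -((hm:ℝ)/SZ) = (m + hm)/SZ := by ring
      have : (0:ℝ) ≤ m + hm := by linarith
      change 0 ≤ (α / (α * (1 - v)) - 1) * ((m:ℝ)/SZ - -((hm:ℝ)/SZ)) / 2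
      rw [e1, e2]
      positivity
    have : (SZ * T0) * (SZ * (T1 + T2)) ≤ K1 * (Q1 + Q2) := by
      have : SZ * (T1 + T2) ≤ Q1 + Q2 := by linarith
      have : (0:ℝ) ≤ K1 := le_trans (by positivity) k1
      gcongr
    have : (SZ * SZ) * (T0 * (T1 + T2)) < (SZ * SZ) * 1 := by linarith
    exact lt_of_mul_lt_mul_left this (by positivity)

/-- the conclusion -/
def Concl (α : ℝ) : Prop := (∃ x : ℝ → ℝ, SOPS α x) ∧
      (∀ x y : ℝ → ℝ, SOPS α x → SOPS α y → ∃ τ : ℝ, ∀ t : ℝ, y t = x (t + τ))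

structure FI where
  a1 : ℕ
  A : QL
  B : QL
  tm : ℕ
  u0 : ℕ
  u1 : ℕ
  v0 : ℕ
  v1 : ℕ
  w0 : ℕ
  w1 : ℕ

noncomputable def obE (P : Pm) (U : ℕ) (us : List (List Ce)) (q0 tm : ℕ) (k : ℤ → ℤ → Bool) : Bool :=
  loE P us U fun lM => zle (16 *ᵢ SZ) (100 *ᵢ lM) <| hiE P us tm fun hm => loE P us (q0 + 2 * U) fun l2 =>
  fz (P.a1 +ᵢ hm -ᵢ l2) fun A => zle A SZ (k hm A)

noncomputable def fiI (P : Pm) (U : ℕ) (c : ℤ) (F : FI) : Bool :=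
  stA P U c F.A fun _ c1 => fz (c1 -ᵢ 536870912) fun c2 => zle 1 c2 <| stA P U c2 F.B fun us cn =>
  zle c2 cn <| nle (F.B.q1 + 2 * U) F.B.L0 <| nle F.tm F.B.L0 <| obE P U us F.B.q0 F.tm fun hm A =>
  upE P U P.a1 F.u0 F.u1 fun m _ => nxE P m fun cb => upE P U cb F.v0 F.v1 fun m _ => nxE P m fun cb =>
  upE P U cb F.w0 F.w1 fun m p => scI P.a0 P.a1 cn A m p hm

section
variable {n n2 n3 a0 a1 c : ℤ} {U : ℕ} {α : ℝ}

theorem obE_sound (hC : InC n n2 n3 a0 a1 U α) {y : ℝ → ℝ} {us : List (List Ce)} (R : Rn (pmR n n2 n3 a0 a1) U y us)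
    {q0 q1 tm : ℕ} {q L : ℝ} (hs : Sh α y U q0 q1 q L) (ht : (tm:ℝ)/U ≤ L) {k : ℤ → ℤ → Bool}
    (h : obE (pmR n n2 n3 a0 a1) U us q0 tm k = true) : ∃ hm A : ℤ, k hm A = true ∧ A ≤ SZ ∧ 0.16 ≤ y 1 ∧
      y (q+1) ≤ (hm:ℝ)/SZ ∧ α - y (q+2) + y (q+1) ≤ (A:ℝ)/SZ := by
  have hS := SZ_pos
  have hU := hs.hU
  have hα0 : 0 < α := by linarith [hC.hα]
  unfold obE at h
  obtain ⟨lM, h, e1⟩ := R.lo h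
  obtain ⟨h1, h⟩ := zle_sound h
  obtain ⟨hm, h, e2⟩ := R.hi h
  obtain ⟨l2, h, e3⟩ := R.lo h
  simp only [fz_eq, iml_eq, iad_eq, isb_eq] at h h1
  obtain ⟨h2, h⟩ := zle_sound h
  rw [div_self hU.ne'] at e1
  rw [add_div_U hU] at e3
  have o1 : y (q+1) ≤ (hm:ℝ)/SZ := by
    have := hs.obsm hα0 (tm := (tm:ℝ)/U) (m := -((hm:ℝ)/SZ)) (by positivity) ht (by rw [neg_neg, le_div_iff₀ hS]; linarith)
    linarith
  have o2 : (l2:ℝ)/SZ ≤ y (q+2) := hs.obs2 hα0 le_rfl (by linarith [hs.hL]) hs.h0 hs.h1.le (by linarith [hs.h2, hs.h3])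
    (by rw [div_le_iff₀ hS]; push_cast at e3; linarith)
  refine ⟨hm, _, h, h2, ?_, o1, ?_⟩
  · have : (16 * SZ : ℝ) ≤ 100 * lM := by exact_mod_cast h1
    have : SZ * 0.16 ≤ SZ * y 1 := by linarith
    exact le_of_mul_le_mul_left this hS
  · change _ ≤ ((a1 + hm - l2 : ℤ):ℝ)/SZ
    push_cast
    rw [sub_div, add_div]
    have : α ≤ a1/SZ := by rw [le_div_iff₀ hS]; linarith [hC.ha1]
    linarith

theorem fiI_sound (hC : InC n n2 n3 a0 a1 U α) (hc : 0 < c) (hB : Barrier α ((c:ℝ)/SZ)) {F : FI}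
    (h : fiI (pmR n n2 n3 a0 a1) U c F = true) : Concl α := by
  have hS := SZ_pos
  have hα0 : 0 < α := by linarith [hC.hα]
  unfold fiI at h
  obtain ⟨c1, _, h, h0, hB1⟩ := stA_bar hC hc hB h
  simp only [fz_eq, isb_eq] at h
  obtain ⟨h1, h⟩ := zle_sound h
  set c2 := c1 - 536870912 with hc2
  have hB2 : Barrier α ((c2:ℝ)/SZ) := hB1.mono (by
    gcongr
    exact_mod_cast (show c2 ≤ c1 by omega))
  obtain ⟨cn, us, y, q, L, d1, h, h3, R, hy, hE, hcn, hr⟩ := stA_sound hC (show 0 < c2 by omega) h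
  obtain ⟨i1, h⟩ := zle_sound h
  obtain ⟨i2, h⟩ := nle_sound h
  obtain ⟨i3, h⟩ := nle_sound h
  have hU := hE.hU
  have i2' : (F.B.q1:ℝ)/U + 2 ≤ (F.B.L0:ℝ)/U := by
    have := add_div_U hU F.B.q1 2
    push_cast at this
    rw [← this]
    gcongr
    exact_mod_cast i2
  have i3' : (F.tm:ℝ)/U ≤ (F.B.L0:ℝ)/U := by gcongr
  obtain ⟨hm, A, h, j1, j2, j3, j4⟩ := obE_sound hC R hE.toSh (by linarith [hE.g0]) h
  have hub : UBar α ((c2:ℝ)/SZ) ((a1:ℝ)/SZ) := (UBar.start α _).mono (by rw [le_div_iff₀ hS]; linarith [hC.ha1])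
  obtain ⟨m, p, h, k1, hu⟩ := upE_sound hC hC.a1pos hub h
  obtain ⟨cb, h, k2, hub⟩ := nxE_sound hC k1 hu h
  obtain ⟨m, p, h, k1, hu⟩ := upE_sound hC k2 hub h
  obtain ⟨cb, h, k2, hub⟩ := nxE_sound hC k1 hu h
  obtain ⟨m, p, h, k1, hu⟩ := upE_sound hC k2 hub h
  obtain ⟨X, s1, s2, s3, s4⟩ := scI_sound hC.hα hC.ha0 hC.ha1 h3 hcn j1 k1 h
  have hc2R : (0:ℝ) < (c2:ℝ)/SZ := div_pos (by exact_mod_cast (show 0 < c2 by omega)) hS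
  refine regionI (c := (c2:ℝ)/SZ) (c' := (cn:ℝ)/SZ) (A := (A:ℝ)/SZ) (mb := (m:ℝ)/SZ) (p := (p:ℝ)/SZ)
    (mlo := -((hm:ℝ)/SZ)) (X := X) hC.hα hB2 hE.toLoop (fun t _ h => hy.hist t h) hc2R (by gcongr) ?_
    (by linarith [hE.h2, hE.h3]) j2 j4 ?_ (by linarith [hE.h2, hE.g0]) hr (by linarith) hu s1 s2 s3 s4
  · rw [div_le_iff₀ hS]; linarith
  · rw [div_le_one hS]; exact_mod_cast j1

end

structure FII where
  a1 : ℕ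
  c : ℕ
  q0 : ℕ
  q1 : ℕ
  tm : ℕ

noncomputable def scII (a0 a1 c A : ℤ) : Bool :=
  expLo (ing c) fun V0 => expHi (ing c) fun V1 => expLo c fun W => expHi (ing a0) fun z =>
  fz (a1 -ᵢ SZ +ᵢ z) fun p => expHi p fun Ep => fz (isd (a1 *ᵢ (Ep -ᵢ SZ)) +ᵢ 1) fun m =>
  zle (a1 *ᵢ V1) ((SZ -ᵢ A) *ᵢ SZ) <| zle (SZ *ᵢ SZ) ((SZ -ᵢ A) *ᵢ (W -ᵢ SZ)) <| zle V1 SZ <|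
  zle (c *ᵢ SZ) (a0 *ᵢ (SZ -ᵢ V1)) <| fz (mn c (a0 -ᵢ A)) fun s => zle 1 s <|
  fz (a1 -ᵢ SZ +ᵢ m +ᵢ Ep /ᵢ 2 +ᵢ 1) fun K1 => fz (SZ -ᵢ V0) fun r =>
  zle (K1 *ᵢ a1 *ᵢ a1 *ᵢ V1 *ᵢ r *ᵢ r +ᵢ 1) (2 *ᵢ c *ᵢ s *ᵢ SZ *ᵢ SZ *ᵢ SZ *ᵢ SZ) true

noncomputable def fiII (P : Pm) (U : ℕ) (c : ℤ) (F : FII) : Bool :=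
  runE P c (F.q1 / U + 4) fun us => shE P U us F.q0 F.q1 <| mkU P U us F.q1 3 <| nle F.tm (F.q1 + 3 * U) <|
  obE P U us F.q0 F.tm fun hm A => loE P us (F.q0 + 3 * U) fun l3 => zle (2 *ᵢ P.a1 +ᵢ hm -ᵢ l3) SZ <|
  scII P.a0 P.a1 c A

set_option maxHeartbeats 800000 in
theorem scII_sound {a0 a1 c A : ℤ} {α : ℝ} (hα : 1.9 ≤ α) (ha0 : (a0:ℝ) ≤ SZ * α) (ha1 : SZ * α ≤ (a1:ℝ)) (hc0 : 0 < c)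
    (hA : A ≤ SZ) (hp : 0 < a0) (h : scII a0 a1 c A = true) (cc : ℝ) : ∃ mb p s1 : ℝ, Upper α cc mb p ∧
      α * Real.exp (-((c:ℝ)/SZ)) ≤ 1 - (A:ℝ)/SZ ∧ 1 ≤ (1 - (A:ℝ)/SZ) * (Real.exp ((c:ℝ)/SZ) - 1) ∧
      0 < s1 ∧ s1 ≤ (c:ℝ)/SZ ∧ (c:ℝ)/SZ ≤ α * (1 - Real.exp (-((c:ℝ)/SZ))) ∧ s1 ≤ α - (A:ℝ)/SZ ∧
      (α - 1 + mb + Real.exp p / 2) * (α^2 * Real.exp (-((c:ℝ)/SZ)) * (1 - Real.exp (-((c:ℝ)/SZ)))^2 / (2 * ((c:ℝ)/SZ) * s1)) < 1 := by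
  have hS := SZ_pos
  have hα0 : 0 < α := by linarith
  unfold scII at h
  obtain ⟨V0, h, hV0', hV0⟩ := expLo_sound h
  obtain ⟨V1, h, hV1⟩ := expHi_sound h
  obtain ⟨W, h, _, hW⟩ := expLo_sound h
  obtain ⟨z, h, hz⟩ := expHi_sound h
  rw [fz_eq] at h
  obtain ⟨Ep, h, hEp⟩ := expHi_sound h
  simp only [fz_eq, iml_eq, iad_eq, isb_eq, ing_eq, idi_eq, mn_eq, isd_eq] at h hV0 hV1 hEp hW hz
  obtain ⟨h1, h⟩ := zle_sound h
  obtain ⟨h2, h⟩ := zle_sound h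
  obtain ⟨h3, h⟩ := zle_sound h
  obtain ⟨h4, h⟩ := zle_sound h
  obtain ⟨h5, h⟩ := zle_sound h
  obtain ⟨h6, h⟩ := zle_sound h
  clear h
  set γ : ℝ := (c:ℝ)/SZ with hγ
  have hcS : (c:ℝ) = SZ * γ := by rw [hγ]; field_simp
  have hγ0 : 0 < γ := div_pos (by exact_mod_cast hc0) hS
  set v := Real.exp (-γ) with hv
  have hv0 : 0 < v := Real.exp_pos _
  have hv1 : v < 1 := Real.exp_lt_one_iff.2 (by linarith)
  have w0 : (V0:ℝ) ≤ SZ * v := hV0 (-γ) (by push_cast; rw [hcS]; linarith)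
  have w1 : SZ * v ≤ (V1:ℝ) := hV1 (-γ) (by push_cast; rw [hcS]; linarith)
  have w2 : (W:ℝ) ≤ SZ * Real.exp γ := hW γ (by rw [hcS])
  have wz : SZ * Real.exp (-α) ≤ (z:ℝ) := hz _ (by push_cast; linarith)
  have hA' : (A:ℝ) ≤ SZ := by exact_mod_cast hA
  have hV1S : (V1:ℝ) ≤ SZ := by exact_mod_cast h3
  have ha1' : (0:ℝ) < a1 := lt_of_lt_of_le (mul_pos hS hα0) ha1
  set p0 := α - 1 + Real.exp (-α) with hp0
  have wp : SZ * p0 ≤ ((a1 - SZ + z : ℤ):ℝ) := by push_cast; rw [hp0]; linarith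
  have wE : SZ * Real.exp p0 ≤ (Ep:ℝ) := hEp _ wp
  set s : ℤ := min c (a0 - A) with hs
  have hs0 : (0:ℝ) < s := by exact_mod_cast (show 0 < s by omega)
  have hsc : (s:ℝ) ≤ c := by exact_mod_cast min_le_left _ _
  have hsa : (s:ℝ) ≤ a0 - A := by exact_mod_cast min_le_right _ _
  have hp00 : 0 < p0 := by
    have := Real.exp_pos (-α)
    linarith
  have hE1 : 1 < Real.exp p0 := Real.one_lt_exp_iff.2 hp00
  refine ⟨α * (Real.exp p0 - 1), p0, (s:ℝ)/SZ, Upper.crude hα0, ?_, ?_, by positivity, ?_, ?_, ?_, ?_⟩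
  · have h1' : (a1:ℝ) * V1 ≤ (SZ - A) * SZ := by exact_mod_cast h1
    have g : (SZ * α) * (SZ * v) ≤ a1 * V1 := by gcongr
    have : (SZ * SZ) * (α * v) ≤ (SZ * SZ) * (1 - A/SZ) := by
      calc (SZ * SZ) * (α * v) = (SZ * α) * (SZ * v) := by ring
        _ ≤ (SZ - A) * SZ := g.trans h1'
        _ = _ := by field_simp
    exact le_of_mul_le_mul_left this (by positivity)
  · have h2' : (SZ:ℝ) * SZ ≤ (SZ - A) * (W - SZ) := by exact_mod_cast h2
    have g : ((SZ:ℝ) - A) * (W - SZ) ≤ (SZ - A) * (SZ * Real.exp γ - SZ) := by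
      have : (0:ℝ) ≤ SZ - A := by linarith
      gcongr
    have : (SZ * SZ) * (1:ℝ) ≤ (SZ * SZ) * ((1 - A/SZ) * (Real.exp γ - 1)) := by
      calc ((SZ:ℝ) * SZ) * 1 ≤ (SZ - A) * (SZ * Real.exp γ - SZ) := by linarith
        _ = _ := by field_simp
    exact le_of_mul_le_mul_left this (by positivity)
  · rw [hγ]; gcongr
  · have h4' : (c:ℝ) * SZ ≤ a0 * (SZ - V1) := by exact_mod_cast h4
    have g : (a0:ℝ) * (SZ - V1) ≤ (SZ * α) * (SZ - SZ * v) := by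
      have : (0:ℝ) ≤ SZ - V1 := by linarith
      have : (0:ℝ) < a0 := by exact_mod_cast hp
      gcongr
    have : (SZ * SZ) * γ ≤ (SZ * SZ) * (α * (1 - v)) := by
      rw [hcS] at h4'
      linarith
    exact le_of_mul_le_mul_left this (by positivity)
  · rw [div_le_iff₀ hS]
    have : (α - (A:ℝ)/SZ) * SZ = SZ * α - A := by field_simp
    rw [this]; linarith
  · set m : ℤ := a1 * (Ep - SZ) / SZ + 1 with hm
    set K1 : ℤ := a1 - SZ + m + Ep / 2 + 1 with hK1
    have km : SZ * (α * (Real.exp p0 - 1)) ≤ m := by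
      have := (lt_fdiv (a1 * (Ep - SZ)) SZ_posZ).le
      rw [hm]
      push_cast at this ⊢
      refine le_trans ?_ this
      rw [le_div_iff₀ hS]
      calc SZ * (α * (Real.exp p0 - 1)) * SZ = (SZ * α) * (SZ * Real.exp p0 - SZ) := by ring
        _ ≤ a1 * (Ep - SZ) := by
          have : 0 ≤ SZ * Real.exp p0 - SZ := by nlinarith
          gcongr
    have k1 : SZ * (α - 1 + α * (Real.exp p0 - 1) + Real.exp p0 / 2) ≤ K1 := by
      have := (lt_fdiv Ep (b := 2) (by norm_num)).le
      push_cast at this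
      rw [hK1]
      push_cast
      nlinarith
    have h6' : (K1:ℝ) * a1 * a1 * V1 * (SZ - V0) * (SZ - V0) + 1 ≤ 2 * c * s * SZ * SZ * SZ * SZ := by exact_mod_cast h6
    set T0 := α - 1 + α * (Real.exp p0 - 1) + Real.exp p0 / 2 with hT0
    have t0 : 0 ≤ T0 := by
      have : 0 ≤ α * (Real.exp p0 - 1) := mul_nonneg hα0.le (by linarith)
      linarith
    have hK0 : (0:ℝ) ≤ K1 := le_trans (by positivity) k1
    have hV10 : (0:ℝ) ≤ V1 := le_trans (by positivity) w1
    have hr0 : 0 ≤ (SZ:ℝ) - SZ * v := by nlinarith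
    have g : (SZ * T0) * (SZ * α) * (SZ * α) * (SZ * v) * (SZ - SZ * v) * (SZ - SZ * v) ≤
        K1 * a1 * a1 * V1 * (SZ - V0) * (SZ - V0) := by
      have : (SZ:ℝ) - SZ * v ≤ SZ - V0 := by linarith
      have hq : (0:ℝ) ≤ SZ - V0 := by linarith
      gcongr
    have e : 2 * γ * (s/SZ) > 0 := by positivity
    rw [← mul_div_assoc, div_lt_one e]
    have : SZ^6 * (T0 * (α^2 * v * (1 - v)^2)) < SZ^6 * (2 * γ * (s/SZ)) := by
      calc SZ^6 * (T0 * (α^2 * v * (1 - v)^2)) = (SZ * T0) * (SZ * α) * (SZ * α) * (SZ * v) * (SZ - SZ * v) * (SZ - SZ * v) := by ring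
        _ < 2 * c * s * SZ * SZ * SZ * SZ := by linarith
        _ = _ := by rw [hcS]; field_simp
    exact lt_of_mul_lt_mul_left this (by positivity)

section
variable {n n2 n3 a0 a1 c : ℤ} {U : ℕ} {α : ℝ}

theorem fiII_sound (hC : InC n n2 n3 a0 a1 U α) (hc : 0 < c)
    (hB : ∀ c' : ℝ, 0 < c' → c' ≤ α * (1 - Real.exp (-c')) → Barrier α c') {F : FII}
    (h : fiII (pmR n n2 n3 a0 a1) U c F = true) : Concl α := by
  have hS := SZ_pos
  have hα := hC.hα
  have hα0 : 0 < α := by linarith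
  have hcR : (0:ℝ) < (c:ℝ)/SZ := div_pos (by exact_mod_cast hc) SZ_pos
  unfold fiII at h
  obtain ⟨y, us, h, R, hy⟩ := hC.lin hc h
  obtain ⟨h, q, L, hs⟩ := shE_sound R one_pos (fun t => (one_mul _).symm) hα hy.toTraj h
  obtain ⟨h, m1⟩ := mkU_sound R one_pos (fun t => (one_mul _).symm) hα0 hs.toLoop hs.h4 _ h
  obtain ⟨h1, h⟩ := nle_sound h
  have hU := hs.hU
  have i3 : (F.tm:ℝ)/U ≤ (F.q1:ℝ)/U + (3:ℕ) := by
    rw [← add_div_U hU]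
    gcongr
  obtain ⟨hm, A, h, j1, j2, j3, j4⟩ := obE_sound hC R hs (by linarith) h
  obtain ⟨l3, h, e3⟩ := R.lo h
  simp only [iml_eq, iad_eq, isb_eq] at h
  obtain ⟨h2, h⟩ := zle_sound h
  rw [add_div_U hU] at e3
  push_cast at e3 m1
  have o3 : (l3:ℝ)/SZ ≤ y (q+3) := hs.obs2 hα0 (by norm_num) (by linarith [hs.h2]) hs.h0 hs.h1.le (by linarith [hs.h2, hs.h3])
    (by rw [div_le_iff₀ hS]; linarith)
  obtain ⟨mb, p, s1, hu, s2, s3, s4, s5, s6, s7, s8⟩ := scII_sound hα hC.ha0 hC.ha1 hc j1 hC.hp h ((c:ℝ)/SZ)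
  have hcα : (c:ℝ)/SZ ≤ α := by
    refine s6.trans ?_
    have := Real.exp_pos (-((c:ℝ)/SZ))
    nlinarith
  refine regionII (c := (c:ℝ)/SZ) (A := (A:ℝ)/SZ) (K := 1 - (A:ℝ)/SZ) (s1 := s1) hα (hB _ hcR s6) hs.toLoop (fun t _ h => hy.hist t h) hcR hcα
    (by linarith [hs.h2, hs.h3]) j2 j4 (by linarith [hs.h2]) ?_
    (hs.retB hα0 (by linarith [hs.h2]) hcR s6) hu s2 s3 (by linarith) s4 s5 (by linarith) s7 s8
  have h2' : ((2 * a1 + hm - l3 : ℤ):ℝ) ≤ SZ := by exact_mod_cast h2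
  push_cast at h2'
  have : α ≤ a1/SZ := by rw [le_div_iff₀ hS]; linarith [hC.ha1]
  have g : (2 * (a1:ℝ)/SZ + hm/SZ - l3/SZ) ≤ 1 := by
    rw [← add_div, ← sub_div, div_le_one hS]; exact h2'
  have : 2 * (a1:ℝ)/SZ = 2 * (a1/SZ) := by ring
  linarith
end

noncomputable def gz (k : ℕ) (r : ℤ → Bool) : Bool := fz (Int.ofNat (Nat.mul k (nat_lit 1048576))) r

theorem gz_eq (k : ℕ) (r : ℤ → Bool) : gz k r = r ((k:ℤ) * 1048576) := by
  rw [gz, fz_eq]; congr 1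

noncomputable def bnd (a b : Bool) : Bool := Bool.rec (motive := fun _ => Bool) false b a

theorem bnd_sound {a b : Bool} (h : bnd a b = true) : a = true ∧ b = true := by
  cases a
  · exact absurd h (by simp [bnd])
  · exact ⟨rfl, h⟩

/-- `α` lies in the cell `[a, b]`, in grid units -/
def Bt (a b : ℕ) (α : ℝ) : Prop := (a:ℝ) ≤ 1048576 * α ∧ 1048576 * α < b

theorem SZ_grid : ((SZ:ℤ):ℝ) = 1048576 * 1048576 := by norm_num [SZ]

theorem InC.mk' {n n2 n3 : ℤ} {U a b : ℕ} {α : ℝ} (hn : 0 < n) (hn2 : n2 = 2 * n) (hn3 : n3 = 12 * n * n * n) (hU : (U:ℤ) = 64 * n)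
    (hα : 1.9 ≤ α) (ha : 0 < a) (h : Bt a b α) : InC n n2 n3 ((a:ℤ) * 1048576) ((b:ℤ) * 1048576) U α where
  hn := hn
  hn2 := hn2
  hn3 := hn3
  hU := hU
  ha0 := by
    rw [SZ_grid]; push_cast; nlinarith [h.1]
  ha1 := by
    rw [SZ_grid]; push_cast; nlinarith [h.2]
  hα := hα
  hp := by positivity

/-- generic tiling by cells -/
noncomputable def tile {β : Type} (e : β → ℕ) (t : ℕ → β → Bool) (l : List β) (b : ℕ) : ℕ → Bool :=
  List.rec (motive := fun _ => ℕ → Bool) (fun a => Nat.ble b a) (fun F _ ih a => bnd (t a F) (ih (e F))) l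

theorem tile_sound {β : Type} {e : β → ℕ} {t : ℕ → β → Bool} {b : ℕ} {G : ℝ → Prop}
    (H : ∀ a F, 0 < a → t a F = true → a ≤ e F ∧ ∀ α, 1.9 ≤ α → Bt a (e F) α → G α) (l : List β) :
    ∀ a, 0 < a → tile e t l b a = true → ∀ α : ℝ, 1.9 ≤ α → (a:ℝ) ≤ 1048576 * α → 1048576 * α < b → G α := by
  induction l with
  | nil =>
    intro a _ h α _ h1 h2
    have : b ≤ a := Nat.le_of_ble_eq_true h
    have : (b:ℝ) ≤ a := by exact_mod_cast this
    linarith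
  | cons F l ih =>
    intro a ha h α hα h1 h2
    have h : bnd (t a F) (tile e t l b (e F)) = true := h
    obtain ⟨h3, h4⟩ := bnd_sound h
    obtain ⟨h5, h6⟩ := H a F ha h3
    rcases lt_or_ge (1048576 * α) (e F) with h7 | h7
    · exact h6 α hα ⟨h1, h7⟩
    · exact ih _ (by omega) h4 α hα h7 h2

noncomputable def cI (c : ℤ) (a : ℕ) (F : FI) : Bool :=
  nle a F.a1 <| gz a fun a0 => gz F.a1 fun a1 => fiI (pmR 16 32 49152 a0 a1) 1024 c F

theorem cI_sound {c : ℤ} (hc : 0 < c) {a : ℕ} {F : FI} (ha : 0 < a) (h : cI c a F = true) : a ≤ F.a1 ∧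
    ∀ α, 1.9 ≤ α → Bt a F.a1 α → Barrier α ((c:ℝ)/SZ) → Concl α := by
  unfold cI at h
  obtain ⟨h1, h⟩ := nle_sound h
  rw [gz_eq, gz_eq] at h
  exact ⟨h1, fun α hα hb hB => fiI_sound (InC.mk' (by norm_num) (by norm_num) (by norm_num) (by norm_num) hα ha hb) hc hB h⟩

structure CI where
  a1 : ℕ
  Q : QL
  l : List QL
  f : List FI

noncomputable def cA (a : ℕ) (F : CI) : Bool :=
  nle a F.a1 <| gz a fun a0 => gz F.a1 fun a1 => coA 8 16 6144 a0 a1 512 F.Q F.l fun c => tile FI.a1 (cI c) F.f F.a1 a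

theorem cA_sound (a : ℕ) (F : CI) (ha : 0 < a) (h : cA a F = true) : a ≤ F.a1 ∧ ∀ α, 1.9 ≤ α → Bt a F.a1 α → Concl α := by
  unfold cA at h
  obtain ⟨h1, h⟩ := nle_sound h
  rw [gz_eq, gz_eq] at h
  refine ⟨h1, fun α hα hb => ?_⟩
  obtain ⟨c, h, hc, hB⟩ := coA_sound (InC.mk' (by norm_num) (by norm_num) (by norm_num) (by norm_num) hα ha hb) h
  exact tile_sound (G := fun α => Barrier α ((c:ℝ)/SZ) → Concl α) (fun a F ha h => cI_sound hc ha h) _ a ha h α hα hb.1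
    hb.2 hB

structure CB where
  a1 : ℕ
  Q : QL
  l : List QL
  q0 : ℕ
  q1 : ℕ

noncomputable def cB (a : ℕ) (F : CB) : Bool :=
  nle a F.a1 <| gz a fun a0 => gz F.a1 fun a1 => coA 8 16 6144 a0 a1 512 F.Q F.l fun c =>
    tyB (pmR 8 16 6144 a0 a1) 512 c F.q0 F.q1 true

def BarAll (α : ℝ) : Prop := ∀ c' : ℝ, 0 < c' → c' ≤ α * (1 - Real.exp (-c')) → Barrier α c'

theorem cB_sound (a : ℕ) (F : CB) (ha : 0 < a) (h : cB a F = true) : a ≤ F.a1 ∧ ∀ α, 1.9 ≤ α → Bt a F.a1 α → BarAll α := by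
  unfold cB at h
  obtain ⟨h1, h⟩ := nle_sound h
  rw [gz_eq, gz_eq] at h
  refine ⟨h1, fun α hα hb => ?_⟩
  have hC : InC 8 16 6144 ((a:ℤ) * 1048576) ((F.a1:ℤ) * 1048576) 512 α :=
    InC.mk' (by norm_num) (by norm_num) (by norm_num) (by norm_num) hα ha hb
  obtain ⟨c, h, hc, hB⟩ := coA_sound hC h
  exact (tyB_sound hC hc hB h).2

noncomputable def cF (a : ℕ) (F : FII) : Bool :=
  nle a F.a1 <| gz a fun a0 => gz F.a1 fun a1 => gz F.c fun c => zle 1 c <| fiII (pmR 20 40 96000 a0 a1) 1280 c F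

theorem cF_sound (a : ℕ) (F : FII) (ha : 0 < a) (h : cF a F = true) : a ≤ F.a1 ∧
    ∀ α, 1.9 ≤ α → Bt a F.a1 α → BarAll α → Concl α := by
  unfold cF at h
  obtain ⟨h1, h⟩ := nle_sound h
  rw [gz_eq, gz_eq, gz_eq] at h
  obtain ⟨h2, h⟩ := zle_sound h
  exact ⟨h1, fun α hα hb hB => fiII_sound (InC.mk' (by norm_num) (by norm_num) (by norm_num) (by norm_num) hα ha hb) (by omega) hB h⟩

/-- `P` holds on the cell -/
def Cov (P : ℝ → Prop) (a b : ℕ) : Prop := ∀ α : ℝ, 1.9 ≤ α → (a:ℝ) ≤ 1048576 * α → 1048576 * α < b → P α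

theorem Cov.tr {P : ℝ → Prop} {a b c : ℕ} (h1 : Cov P a b) (h2 : Cov P b c) : Cov P a c := fun α hα h3 h4 =>
  (lt_or_ge (1048576 * α) (b:ℝ)).elim (h1 α hα h3) fun h => h2 α hα h h4

theorem covA {l : List CI} {a b : ℕ} (h : tile CI.a1 cA l b a = true) (ha : Nat.ble 1 a = true) : Cov Concl a b :=
  tile_sound cA_sound l a (Nat.le_of_ble_eq_true ha) h

theorem covB {l : List CB} {a b : ℕ} (h : tile CB.a1 cB l b a = true) (ha : Nat.ble 1 a = true) : Cov BarAll a b :=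
  tile_sound cB_sound l a (Nat.le_of_ble_eq_true ha) h

theorem covF {l : List FII} {a b : ℕ} (h : tile FII.a1 cF l b a = true) (ha : Nat.ble 1 a = true) :
    Cov (fun α => BarAll α → Concl α) a b :=
  tile_sound cF_sound l a (Nat.le_of_ble_eq_true ha) h

set_option maxRecDepth 1000000

set_option maxHeartbeats 0 in
theorem certI0 : tile CI.a1 cA [⟨2008340,⟨941,957,1892,1956⟩,[⟨944,953,1907,1940⟩,⟨944,953,1908,1940⟩,⟨943,952,1908,1940⟩,⟨943,952,1908,1940⟩,⟨942,951,1909,1941⟩,⟨942,951,1909,1941⟩,⟨941,950,1910,1942⟩,⟨940,949,1910,1942⟩,⟨939,948,1911,1943⟩,⟨938,947,1913,1945⟩,⟨936,945,1914,1946⟩,⟨934,943,1916,1948⟩,⟨932,941,1919,1951⟩,⟨929,938,1923,1956⟩,⟨926,935,1928,1962⟩,⟨922,931,1935,1970⟩,⟨917,926,1946,1982⟩,⟨911,920,1963,2001⟩,⟨906,913,1988,2029⟩,⟨900,908,2019,2064⟩,⟨896,903,2056,2105⟩,⟨892,899,2088,2142⟩,⟨890,898,2106,2162⟩,⟨890,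897,2115,2171⟩],
  [⟨1993116,⟨1788,1790,4288,4296⟩,⟨1785,1788,4325,4333⟩,2812,1775,1778,1779,1781,1780,1782⟩,
  ⟨1993977,⟨1788,1790,4288,4296⟩,⟨1785,1787,4325,4334⟩,2811,1775,1778,1778,1781,1779,1782⟩,
  ⟨1994879,⟨1788,1790,4288,4296⟩,⟨1785,1787,4326,4335⟩,2811,1775,1778,1778,1781,1779,1782⟩,
  ⟨1995824,⟨1787,1789,4288,4296⟩,⟨1785,1787,4326,4336⟩,2811,1775,1778,1778,1781,1779,1781⟩,
  ⟨1996715,⟨1787,1789,4288,4296⟩,⟨1784,1787,4327,4336⟩,2811,1774,1778,1778,1780,1778,1781⟩,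
  ⟨1997648,⟨1787,1789,4288,4297⟩,⟨1784,1786,4328,4337⟩,2810,1774,1777,1777,1780,1778,1781⟩,
  ⟨1998734,⟨1786,1789,4288,4297⟩,⟨1784,1786,4328,4338⟩,2810,1774,1777,1777,1780,1778,1781⟩,
  ⟨1999655,⟨1786,1788,4288,4297⟩,⟨1783,1786,4330,4339⟩,2810,1774,1777,1777,1780,1777,1780⟩,
  ⟨2000619,⟨1786,1788,4288,4297⟩,⟨1783,1785,4330,4340⟩,2809,1773,1777,1776,1779,1777,1780⟩,
  ⟨2001629,⟨1786,1788,4288,4297⟩,⟨1783,1785,4331,4341⟩,2809,1773,1776,1776,1779,1777,1780⟩,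
  ⟨2002582,⟨1785,1788,4288,4297⟩,⟨1782,1785,4332,4341⟩,2809,1773,1776,1776,1779,1777,1779⟩,
  ⟨2003691,⟨1785,1787,4288,4298⟩,⟨1782,1785,4332,4342⟩,2809,1772,1776,1775,1779,1776,1779⟩,
  ⟨2004853,⟨1785,1787,4288,4298⟩,⟨1782,1784,4333,4343⟩,2808,1772,1776,1775,1778,1776,1779⟩,
  ⟨2005949,⟨1785,1787,4288,4298⟩,⟨1781,1784,4334,4344⟩,2808,1772,1775,1775,1778,1775,1779⟩,
  ⟨2007098,⟨1784,1787,4288,4298⟩,⟨1781,1784,4335,4345⟩,2808,1771,1775,1774,1778,1775,1778⟩,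
  ⟨2008340,⟨1784,1786,4288,4299⟩,⟨1781,1783,4335,4346⟩,2807,1771,1775,1774,1777,1775,1778⟩]⟩] 2008340 1992294 = true := by decide +kernel

set_option maxHeartbeats 0 in
theorem certI1 : tile CI.a1 cA [⟨2025182,⟨939,955,1888,1952⟩,[⟨942,951,1903,1936⟩,⟨941,950,1903,1936⟩,⟨941,950,1903,1936⟩,⟨940,950,1904,1937⟩,⟨940,949,1904,1937⟩,⟨939,948,1904,1938⟩,⟨938,947,1905,1938⟩,⟨937,946,1906,1939⟩,⟨936,945,1907,1940⟩,⟨934,944,1909,1942⟩,⟨932,942,1911,1944⟩,⟨930,939,1914,1947⟩,⟨927,936,1918,1952⟩,⟨923,933,1924,1958⟩,⟨919,928,1932,1968⟩,⟨914,923,1944,1981⟩,⟨908,916,1965,2005⟩,⟨902,909,1994,2037⟩,⟨896,903,2033,2082⟩,⟨891,899,2073,2126⟩,⟨888,896,2104,2161⟩,⟨887,895,2118,2176⟩],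
  [⟨2009735,⟨1783,1785,4301,4313⟩,⟨1780,1783,4338,4350⟩,2807,1771,1774,1774,1777,1774,1778⟩,
  ⟨2011198,⟨1782,1785,4301,4313⟩,⟨1780,1783,4339,4351⟩,2807,1770,1774,1773,1777,1774,1777⟩,
  ⟨2012578,⟨1782,1784,4301,4313⟩,⟨1779,1782,4341,4352⟩,2806,1770,1774,1773,1776,1773,1777⟩,
  ⟨2014026,⟨1781,1784,4301,4313⟩,⟨1779,1782,4342,4354⟩,2806,1769,1773,1772,1776,1773,1776⟩,
  ⟨2015392,⟨1781,1784,4302,4313⟩,⟨1778,1781,4343,4355⟩,2805,1769,1773,1772,1775,1773,1776⟩,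
  ⟨2016984,⟨1781,1783,4302,4314⟩,⟨1778,1781,4344,4356⟩,2805,1769,1773,1771,1775,1772,1776⟩,
  ⟨2018486,⟨1780,1783,4302,4314⟩,⟨1777,1780,4345,4358⟩,2804,1768,1772,1771,1775,1772,1775⟩,
  ⟨2020061,⟨1780,1783,4302,4315⟩,⟨1777,1780,4346,4359⟩,2804,1768,1772,1770,1774,1771,1775⟩,
  ⟨2021547,⟨1779,1782,4303,4315⟩,⟨1776,1780,4348,4360⟩,2804,1767,1771,1770,1774,1771,1774⟩,
  ⟨2023105,⟨1779,1782,4303,4315⟩,⟨1776,1779,4349,4362⟩,2803,1767,1771,1770,1773,1770,1774⟩,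
  ⟨2024738,⟨1778,1782,4303,4316⟩,⟨1775,1779,4350,4363⟩,2803,1766,1771,1769,1773,1770,1774⟩,
  ⟨2025182,⟨1779,1781,4306,4312⟩,⟨1775,1778,4357,4363⟩,2802,1767,1770,1769,1772,1770,1773⟩]⟩] 2025182 2008340 = true := by decide +kernel

set_option maxHeartbeats 0 in
theorem certI2 : tile CI.a1 cA [⟨2044825,⟨936,953,1882,1950⟩,[⟨939,949,1896,1933⟩,⟨938,949,1897,1934⟩,⟨938,948,1897,1934⟩,⟨937,948,1897,1934⟩,⟨937,947,1898,1935⟩,⟨936,946,1898,1935⟩,⟨935,945,1899,1936⟩,⟨934,944,1900,1937⟩,⟨932,943,1901,1939⟩,⟨930,941,1903,1941⟩,⟨928,939,1906,1944⟩,⟨925,936,1909,1948⟩,⟨922,932,1915,1954⟩,⟨917,927,1923,1964⟩,⟨912,922,1936,1977⟩,⟨906,915,1956,2001⟩,⟨899,908,1988,2036⟩,⟨893,901,2030,2085⟩,⟨888,897,2074,2134⟩,⟨885,894,2105,2170⟩,⟨883,893,2121,2187⟩],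
  [⟨2026906,⟨1778,1781,4306,4320⟩,⟨1775,1778,4352,4366⟩,2802,1766,1770,1768,1773,1769,1773⟩,
  ⟨2028533,⟨1777,1780,4307,4320⟩,⟨1774,1778,4354,4368⟩,2802,1765,1770,1768,1772,1769,1772⟩,
  ⟨2030239,⟨1777,1780,4307,4320⟩,⟨1774,1777,4356,4369⟩,2801,1765,1769,1767,1772,1768,1772⟩,
  ⟨2032029,⟨1776,1780,4307,4321⟩,⟨1773,1777,4357,4371⟩,2801,1764,1769,1767,1771,1767,1772⟩,
  ⟨2033907,⟨1776,1779,4307,4322⟩,⟨1773,1776,4358,4373⟩,2800,1764,1768,1766,1771,1767,1771⟩,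
  ⟨2035679,⟨1775,1779,4308,4322⟩,⟨1772,1776,4360,4374⟩,2800,1763,1768,1766,1770,1766,1771⟩,
  ⟨2037537,⟨1775,1778,4308,4322⟩,⟨1772,1775,4362,4376⟩,2799,1763,1767,1765,1770,1766,1770⟩,
  ⟨2039485,⟨1774,1778,4308,4323⟩,⟨1771,1775,4363,4378⟩,2799,1762,1767,1765,1769,1765,1770⟩,
  ⟨2041323,⟨1774,1777,4309,4323⟩,⟨1770,1774,4365,4380⟩,2798,1762,1767,1764,1769,1765,1769⟩,
  ⟨2043250,⟨1773,1777,4309,4323⟩,⟨1770,1774,4367,4382⟩,2798,1761,1766,1764,1768,1764,1769⟩,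
  ⟨2044825,⟨1773,1776,4310,4323⟩,⟨1769,1773,4370,4383⟩,2797,1761,1766,1763,1768,1764,1768⟩]⟩] 2044825 2025182 = true := by decide +kernel

set_option maxHeartbeats 0 in
theorem certI3 : tile CI.a1 cA [⟨2063382,⟨934,951,1878,1944⟩,[⟨936,946,1893,1927⟩,⟨936,946,1893,1927⟩,⟨935,945,1894,1928⟩,⟨935,945,1894,1928⟩,⟨934,944,1895,1929⟩,⟨933,943,1895,1930⟩,⟨932,942,1896,1931⟩,⟨931,940,1898,1932⟩,⟨929,939,1899,1935⟩,⟨926,936,1902,1938⟩,⟨923,933,1906,1942⟩,⟨919,929,1912,1949⟩,⟨914,924,1923,1960⟩,⟨909,917,1938,1977⟩,⟨902,910,1964,2007⟩,⟨894,902,2005,2052⟩,⟨887,895,2060,2114⟩,⟨882,891,2110,2170⟩,⟨880,890,2133,2197⟩],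
  [⟨2046954,⟨1771,1775,4331,4347⟩,⟨1769,1773,4373,4390⟩,2797,1760,1765,1763,1767,1763,1768⟩,
  ⟨2049187,⟨1770,1774,4332,4348⟩,⟨1768,1772,4375,4392⟩,2796,1760,1765,1762,1767,1762,1767⟩,
  ⟨2051528,⟨1770,1774,4332,4349⟩,⟨1767,1772,4376,4394⟩,2796,1759,1764,1761,1766,1762,1767⟩,
  ⟨2053738,⟨1769,1773,4333,4349⟩,⟨1767,1771,4379,4396⟩,2795,1759,1764,1761,1766,1761,1766⟩,
  ⟨2056056,⟨1769,1773,4333,4350⟩,⟨1766,1770,4381,4399⟩,2794,1758,1763,1760,1765,1760,1765⟩,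
  ⟨2058487,⟨1768,1772,4333,4351⟩,⟨1765,1770,4383,4401⟩,2794,1757,1763,1759,1765,1760,1765⟩,
  ⟨2061038,⟨1767,1772,4333,4351⟩,⟨1764,1769,4385,4404⟩,2793,1757,1762,1759,1764,1759,1764⟩,
  ⟨2063382,⟨1767,1771,4335,4351⟩,⟨1764,1768,4388,4406⟩,2792,1756,1761,1758,1763,1759,1764⟩]⟩] 2063382 2044825 = true := by decide +kernel

set_option maxHeartbeats 0 in
theorem certI4 : tile CI.a1 cA [⟨2082860,⟨931,948,1874,1939⟩,[⟨934,944,1888,1923⟩,⟨933,944,1888,1923⟩,⟨933,943,1889,1924⟩,⟨932,942,1889,1924⟩,⟨931,941,1890,1925⟩,⟨930,940,1891,1926⟩,⟨929,939,1892,1927⟩,⟨927,937,1894,1929⟩,⟨925,935,1896,1932⟩,⟨922,932,1900,1937⟩,⟨918,928,1906,1943⟩,⟨913,922,1916,1954⟩,⟨907,916,1931,1972⟩,⟨900,908,1959,2002⟩,⟨892,900,2003,2052⟩,⟨883,893,2065,2122⟩,⟨878,889,2118,2182⟩,⟨877,887,2142,2210⟩],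
  [⟨2066011,⟨1765,1770,4346,4365⟩,⟨1763,1768,4390,4410⟩,2792,1756,1761,1758,1763,1758,1763⟩,
  ⟨2068769,⟨1765,1769,4346,4366⟩,⟨1762,1767,4393,4413⟩,2791,1755,1760,1757,1762,1757,1762⟩,
  ⟨2071372,⟨1764,1769,4348,4366⟩,⟨1761,1766,4396,4415⟩,2790,1754,1759,1756,1761,1756,1762⟩,
  ⟨2074102,⟨1763,1768,4348,4367⟩,⟨1761,1766,4398,4418⟩,2790,1754,1759,1755,1761,1756,1761⟩,
  ⟨2076966,⟨1762,1768,4348,4368⟩,⟨1760,1765,4401,4422⟩,2789,1753,1758,1755,1760,1755,1760⟩,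
  ⟨2079670,⟨1762,1767,4350,4369⟩,⟨1759,1764,4404,4424⟩,2788,1752,1757,1754,1759,1754,1759⟩,
  ⟨2082506,⟨1761,1766,4350,4370⟩,⟨1758,1764,4407,4427⟩,2782,1752,1757,1753,1758,1754,1759⟩,
  ⟨2082860,⟨1762,1765,4357,4363⟩,⟨1759,1762,4420,4426⟩,2783,1752,1756,1754,1757,1754,1758⟩]⟩] 2082860 2063382 = true := by decide +kernel

set_option maxHeartbeats 0 in
theorem certI5 : tile CI.a1 cA [⟨2101260,⟨929,946,1871,1933⟩,[⟨932,941,1885,1917⟩,⟨931,941,1885,1918⟩,⟨931,940,1886,1918⟩,⟨930,939,1886,1919⟩,⟨929,938,1887,1920⟩,⟨928,937,1888,1921⟩,⟨926,935,1890,1923⟩,⟨924,933,1892,1925⟩,⟨921,930,1896,1930⟩,⟨917,926,1902,1936⟩,⟨912,921,1911,1947⟩,⟨905,914,1928,1966⟩,⟨898,905,1958,1999⟩,⟨888,896,2009,2055⟩,⟨880,889,2080,2137⟩,⟨875,886,2137,2200⟩],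
  [⟨2085782,⟨1760,1765,4365,4386⟩,⟨1758,1763,4411,4433⟩,2782,1751,1756,1753,1758,1753,1758⟩,
  ⟨2089189,⟨1759,1764,4365,4389⟩,⟨1757,1762,4412,4436⟩,2781,1750,1755,1752,1757,1752,1757⟩,
  ⟨2092405,⟨1758,1763,4367,4389⟩,⟨1756,1761,4417,4440⟩,2780,1749,1754,1751,1756,1751,1756⟩,
  ⟨2095780,⟨1757,1763,4367,4390⟩,⟨1755,1760,4420,4444⟩,2779,1748,1753,1750,1755,1750,1755⟩,
  ⟨2099322,⟨1756,1762,4368,4392⟩,⟨1754,1759,4423,4448⟩,2778,1748,1753,1749,1754,1749,1754⟩,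
  ⟨2101260,⟨1756,1761,4373,4388⟩,⟨1754,1758,4433,4449⟩,2778,1747,1752,1749,1753,1749,1753⟩]⟩] 2101260 2082860 = true := by decide +kernel

set_option maxHeartbeats 0 in
theorem certI6 : tile CI.a1 cA [⟨2122721,⟨926,944,1864,1931⟩,[⟨929,939,1879,1915⟩,⟨928,939,1879,1915⟩,⟨928,938,1879,1916⟩,⟨927,937,1880,1917⟩,⟨926,936,1881,1918⟩,⟨924,935,1882,1919⟩,⟨922,933,1884,1921⟩,⟨919,930,1887,1925⟩,⟨916,926,1892,1930⟩,⟨911,921,1900,1940⟩,⟨905,915,1914,1956⟩,⟨898,906,1940,1983⟩,⟨888,897,1987,2038⟩,⟨878,889,2060,2120⟩,⟨872,884,2130,2201⟩,⟨870,883,2156,2230⟩],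
  [⟨2104868,⟨1755,1760,4378,4403⟩,⟨1753,1758,4429,4455⟩,2777,1746,1751,1748,1753,1748,1753⟩,
  ⟨2108653,⟨1754,1759,4379,4404⟩,⟨1752,1757,4433,4460⟩,2776,1745,1750,1747,1752,1747,1752⟩,
  ⟨2112625,⟨1753,1759,4380,4406⟩,⟨1751,1756,4436,4464⟩,2775,1745,1749,1746,1751,1746,1751⟩,
  ⟨2116793,⟨1752,1758,4380,4408⟩,⟨1750,1755,4440,4469⟩,2774,1744,1749,1745,1750,1745,1750⟩,
  ⟨2120729,⟨1751,1757,4383,4409⟩,⟨1749,1754,4446,4473⟩,2773,1743,1747,1744,1749,1744,1749⟩,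
  ⟨2122721,⟨1751,1755,4389,4404⟩,⟨1748,1752,4458,4475⟩,2772,1743,1746,1744,1748,1744,1748⟩]⟩] 2122721 2101260 = true := by decide +kernel

set_option maxHeartbeats 0 in
theorem certI7 : tile CI.a1 cA [⟨2145248,⟨923,941,1859,1926⟩,[⟨926,937,1873,1911⟩,⟨925,936,1874,1911⟩,⟨925,936,1874,1912⟩,⟨924,935,1875,1913⟩,⟨922,933,1876,1914⟩,⟨921,931,1878,1916⟩,⟨918,929,1881,1919⟩,⟨915,925,1885,1923⟩,⟨911,920,1892,1932⟩,⟨905,914,1904,1946⟩,⟨897,906,1928,1973⟩,⟨887,896,1974,2025⟩,⟨876,887,2049,2110⟩,⟨869,882,2132,2205⟩,⟨867,880,2164,2241⟩],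
  [⟨2127176,⟨1749,1755,4398,4428⟩,⟨1747,1752,4451,4482⟩,2771,1741,1746,1742,1747,1743,1748⟩,
  ⟨2131383,⟨1748,1754,4401,4429⟩,⟨1746,1751,4458,4487⟩,2770,1740,1745,1741,1746,1742,1746⟩,
  ⟨2135797,⟨1747,1753,4402,4431⟩,⟨1745,1750,4462,4493⟩,2769,1739,1744,1740,1745,1741,1745⟩,
  ⟨2140429,⟨1746,1752,4403,4433⟩,⟨1744,1749,4466,4498⟩,2768,1738,1743,1739,1744,1740,1744⟩,
  ⟨2145248,⟨1745,1751,4404,4436⟩,⟨1743,1748,4471,4504⟩,2767,1737,1742,1738,1743,1738,1743⟩]⟩] 2145248 2122721 = true := by decide +kernel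

set_option maxHeartbeats 0 in
theorem certI8 : tile CI.a1 cA [⟨2166529,⟨921,938,1856,1919⟩,[⟨924,934,1870,1905⟩,⟨923,933,1870,1905⟩,⟨922,933,1871,1906⟩,⟨921,931,1872,1907⟩,⟨920,930,1873,1909⟩,⟨917,927,1876,1911⟩,⟨914,924,1879,1915⟩,⟨910,920,1885,1922⟩,⟨905,914,1896,1934⟩,⟨897,906,1918,1958⟩,⟨887,896,1960,2006⟩,⟨875,886,2038,2095⟩,⟨867,879,2136,2205⟩,⟨865,877,2181,2256⟩],
  [⟨2150198,⟨1743,1749,4427,4460⟩,⟨1741,1747,4478,4512⟩,2765,1736,1741,1737,1742,1737,1742⟩,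
  ⟨2154873,⟨1742,1747,4430,4461⟩,⟨1740,1745,4485,4518⟩,2764,1735,1740,1736,1741,1736,1741⟩,
  ⟨2159779,⟨1741,1746,4432,4464⟩,⟨1739,1744,4490,4524⟩,2763,1734,1738,1735,1739,1735,1740⟩,
  ⟨2164927,⟨1740,1745,4433,4467⟩,⟨1738,1743,4495,4531⟩,2762,1733,1737,1734,1738,1734,1738⟩,
  ⟨2166529,⟨1740,1744,4444,4458⟩,⟨1738,1741,4517,4531⟩,2762,1733,1736,1734,1737,1734,1737⟩]⟩] 2166529 2145248 = true := by decide +kernel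

set_option maxHeartbeats 0 in
theorem certI9 : tile CI.a1 cA [⟨2186633,⟨919,935,1852,1914⟩,[⟨922,931,1867,1899⟩,⟨921,931,1867,1899⟩,⟨920,930,1868,1900⟩,⟨919,928,1869,1902⟩,⟨917,926,1871,1904⟩,⟨914,923,1874,1907⟩,⟨911,920,1879,1912⟩,⟨906,914,1887,1922⟩,⟨899,907,1904,1941⟩,⟨888,897,1940,1980⟩,⟨876,886,2014,2063⟩,⟨866,878,2127,2190⟩,⟨862,875,2197,2270⟩],
  [⟨2172030,⟨1738,1743,4455,4491⟩,⟨1736,1741,4503,4541⟩,2760,1731,1736,1732,1737,1732,1737⟩,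
  ⟨2177803,⟨1737,1742,4457,4495⟩,⟨1735,1740,4509,4548⟩,2759,1730,1735,1731,1735,1731,1736⟩,
  ⟨2183255,⟨1736,1741,4460,4496⟩,⟨1734,1739,4518,4556⟩,2758,1729,1733,1730,1734,1730,1734⟩,
  ⟨2186633,⟨1735,1739,4469,4492⟩,⟨1733,1737,4535,4560⟩,2757,1729,1732,1729,1733,1730,1733⟩]⟩] 2186633 2166529 = true := by decide +kernel

set_option maxHeartbeats 0 in
theorem certI10 : tile CI.a1 cA [⟨2207736,⟨917,933,1846,1910⟩,[⟨919,929,1862,1895⟩,⟨918,928,1863,1895⟩,⟨917,927,1864,1896⟩,⟨916,926,1865,1898⟩,⟨914,923,1867,1900⟩,⟨911,920,1870,1904⟩,⟨907,916,1877,1911⟩,⟨901,909,1889,1924⟩,⟨892,900,1913,1952⟩,⟨880,889,1966,2012⟩,⟨867,879,2070,2128⟩,⟨861,873,2184,2257⟩],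
  [⟨2192746,⟨1733,1738,4474,4514⟩,⟨1732,1736,4527,4569⟩,2756,1727,1731,1728,1732,1728,1732⟩,
  ⟨2198519,⟨1732,1737,4478,4516⟩,⟨1731,1735,4537,4577⟩,2755,1726,1730,1726,1731,1726,1731⟩,
  ⟨2204577,⟨1731,1736,4480,4520⟩,⟨1729,1734,4544,4585⟩,2753,1724,1729,1725,1729,1725,1729⟩,
  ⟨2207736,⟨1731,1734,4491,4514⟩,⟨1729,1732,4565,4589⟩,2753,1724,1727,1725,1728,1725,1728⟩]⟩] 2207736 2186633 = true := by decide +kernel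

set_option maxHeartbeats 0 in
theorem certI11 : tile CI.a1 cA [⟨2227671,⟨915,930,1843,1904⟩,[⟨917,926,1859,1889⟩,⟨916,925,1860,1890⟩,⟨915,924,1861,1891⟩,⟨914,922,1862,1893⟩,⟨911,920,1865,1896⟩,⟨908,916,1869,1901⟩,⟨903,911,1878,1910⟩,⟨896,903,1895,1929⟩,⟨884,893,1932,1971⟩,⟨870,881,2018,2067⟩,⟨861,872,2156,2222⟩],
  [⟨2213849,⟨1729,1733,4500,4540⟩,⟨1727,1731,4557,4598⟩,2752,1722,1727,1723,1727,1723,1727⟩,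
  ⟨2220264,⟨1727,1732,4503,4544⟩,⟨1725,1730,4564,4607⟩,2752,1720,1725,1721,1726,1721,1726⟩,
  ⟨2226322,⟨1726,1731,4507,4547⟩,⟨1724,1729,4574,4616⟩,2752,1719,1724,1719,1724,1719,1725⟩,
  ⟨2227671,⟨1727,1729,4523,4535⟩,⟨1724,1726,4604,4617⟩,2750,1719,1722,1720,1723,1720,1723⟩]⟩] 2227671 2207736 = true := by decide +kernel

set_option maxHeartbeats 0 in
theorem certI12 : tile CI.a1 cA [⟨2248596,⟨912,928,1838,1900⟩,[⟨915,924,1854,1885⟩,⟨914,923,1855,1886⟩,⟨913,922,1856,1887⟩,⟨911,920,1858,1889⟩,⟨908,917,1861,1893⟩,⟨904,913,1867,1899⟩,⟨899,907,1877,1911⟩,⟨889,898,1900,1937⟩,⟨876,886,1956,1998⟩,⟨863,875,2077,2135⟩,⟨856,869,2214,2289⟩],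
  [⟨2233784,⟨1724,1729,4524,4565⟩,⟨1722,1727,4585,4627⟩,2751,1717,1722,1718,1723,1718,1723⟩,
  ⟨2240199,⟨1722,1727,4527,4569⟩,⟨1720,1725,4593,4637⟩,2749,1715,1721,1716,1722,1716,1722⟩,
  ⟨2246257,⟨1721,1726,4532,4572⟩,⟨1719,1724,4604,4646⟩,2748,1714,1720,1715,1720,1715,1720⟩,
  ⟨2248596,⟨1721,1724,4545,4563⟩,⟨1719,1722,4630,4649⟩,2746,1714,1718,1715,1718,1715,1718⟩]⟩] 2248596 2227671 = true := by decide +kernel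

set_option maxHeartbeats 0 in
theorem certI13 : tile CI.a1 cA [⟨2268364,⟨910,925,1835,1894⟩,[⟨913,921,1851,1880⟩,⟨912,921,1852,1880⟩,⟨911,919,1853,1882⟩,⟨909,917,1855,1884⟩,⟨906,914,1859,1888⟩,⟨901,909,1866,1896⟩,⟨895,902,1880,1912⟩,⟨883,892,1912,1948⟩,⟨869,879,1992,2036⟩,⟨857,869,2151,2214⟩],
  [⟨2254709,⟨1719,1724,4555,4596⟩,⟨1717,1722,4616,4658⟩,2746,1712,1718,1713,1718,1713,1718⟩,
  ⟨2260482,⟨1717,1722,4560,4598⟩,⟨1715,1721,4627,4667⟩,2745,1711,1717,1711,1717,1711,1717⟩,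
  ⟨2266540,⟨1716,1721,4563,4603⟩,⟨1714,1719,4635,4676⟩,2743,1709,1715,1710,1716,1710,1716⟩,
  ⟨2268364,⟨1716,1720,4577,4593⟩,⟨1714,1717,4663,4680⟩,2741,1710,1714,1710,1714,1710,1714⟩]⟩] 2268364 2248596 = true := by decide +kernel

set_option maxHeartbeats 0 in
theorem certI14 : tile CI.a1 cA [⟨2289114,⟨908,923,1831,1891⟩,[⟨911,919,1846,1876⟩,⟨910,918,1847,1877⟩,⟨908,917,1848,1878⟩,⟨906,915,1851,1881⟩,⟨903,911,1855,1885⟩,⟨898,906,1863,1895⟩,⟨890,898,1881,1914⟩,⟨877,887,1923,1961⟩,⟨863,874,2028,2079⟩,⟨853,865,2206,2278⟩],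
  [⟨2273865,⟨1714,1719,4585,4623⟩,⟨1712,1718,4649,4688⟩,2742,1708,1714,1708,1714,1708,1714⟩,
  ⟨2279060,⟨1713,1718,4590,4625⟩,⟨1711,1716,4660,4697⟩,2740,1707,1713,1707,1713,1707,1713⟩,
  ⟨2283966,⟨1712,1717,4594,4628⟩,⟨1710,1715,4669,4704⟩,2739,1706,1711,1706,1712,1706,1712⟩,
  ⟨2289114,⟨1711,1716,4597,4632⟩,⟨1709,1714,4676,4713⟩,2738,1704,1711,1705,1711,1705,1711⟩]⟩] 2289114 2268364 = true := by decide +kernel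

set_option maxHeartbeats 0 in
theorem certI15 : tile CI.a1 cA [⟨2308716,⟨906,921,1828,1885⟩,[⟨909,917,1843,1871⟩,⟨908,916,1844,1872⟩,⟨906,914,1845,1873⟩,⟨904,912,1848,1876⟩,⟨901,908,1853,1882⟩,⟨895,902,1863,1893⟩,⟨885,893,1885,1917⟩,⟨871,881,1943,1981⟩,⟨857,868,2092,2147⟩,⟨850,860,2268,2343⟩],
  [⟨2294064,⟨1709,1715,4618,4652⟩,⟨1708,1713,4685,4721⟩,2737,1703,1709,1704,1710,1704,1710⟩,
  ⟨2298739,⟨1708,1714,4622,4655⟩,⟨1706,1712,4694,4728⟩,2736,1702,1708,1703,1709,1703,1709⟩,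
  ⟨2303154,⟨1707,1713,4626,4657⟩,⟨1705,1711,4703,4735⟩,2735,1701,1707,1702,1708,1702,1708⟩,
  ⟨2307787,⟨1706,1712,4629,4661⟩,⟨1704,1710,4709,4743⟩,2734,1700,1707,1701,1707,1701,1707⟩,
  ⟨2308716,⟨1707,1711,4641,4652⟩,⟨1705,1708,4734,4745⟩,2732,1701,1705,1701,1706,1701,1706⟩]⟩] 2308716 2289114 = true := by decide +kernel

set_option maxHeartbeats 0 in
theorem certI16 : tile CI.a1 cA [⟨2327233,⟨904,919,1825,1880⟩,[⟨907,915,1839,1866⟩,⟨906,914,1841,1867⟩,⟨905,912,1842,1869⟩,⟨902,909,1846,1872⟩,⟨898,905,1852,1878⟩,⟨892,899,1864,1891⟩,⟨881,889,1892,1923⟩,⟨865,876,1969,2008⟩,⟨852,863,2156,2215⟩],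
  [⟨2313171,⟨1705,1710,4659,4691⟩,⟨1703,1709,4719,4752⟩,2733,1699,1706,1700,1706,1700,1706⟩,
  ⟨2317378,⟨1704,1709,4663,4693⟩,⟨1702,1708,4728,4760⟩,2732,1698,1705,1699,1705,1699,1705⟩,
  ⟨2321350,⟨1703,1709,4667,4696⟩,⟨1701,1707,4736,4766⟩,2731,1697,1704,1698,1704,1698,1704⟩,
  ⟨2325101,⟨1702,1708,4670,4698⟩,⟨1701,1706,4744,4773⟩,2730,1697,1703,1697,1703,1697,1703⟩,
  ⟨2327233,⟨1702,1707,4677,4695⟩,⟨1700,1705,4758,4777⟩,2729,1697,1702,1697,1702,1697,1702⟩]⟩] 2327233 2308716 = true := by decide +kernel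

set_option maxHeartbeats 0 in
theorem certI17 : tile CI.a1 cA [⟨2346670,⟨903,917,1822,1877⟩,[⟨905,913,1835,1863⟩,⟨904,912,1836,1864⟩,⟨903,910,1838,1866⟩,⟨900,907,1842,1869⟩,⟨896,903,1848,1876⟩,⟨888,896,1862,1891⟩,⟨876,885,1896,1929⟩,⟨861,871,1994,2037⟩,⟨849,858,2215,2282⟩],
  [⟨2331242,⟨1701,1706,4686,4715⟩,⟨1699,1705,4753,4783⟩,2729,1696,1702,1696,1702,1696,1702⟩,
  ⟨2335027,⟨1700,1706,4690,4718⟩,⟨1698,1704,4760,4790⟩,2728,1695,1701,1695,1701,1695,1701⟩,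
  ⟨2338601,⟨1699,1705,4693,4720⟩,⟨1698,1703,4768,4796⟩,2727,1694,1700,1694,1701,1694,1701⟩,
  ⟨2341976,⟨1699,1704,4697,4722⟩,⟨1697,1703,4775,4802⟩,2727,1694,1700,1694,1700,1694,1700⟩,
  ⟨2345518,⟨1698,1704,4699,4725⟩,⟨1696,1702,4780,4808⟩,2726,1693,1699,1693,1699,1693,1699⟩,
  ⟨2346670,⟨1698,1703,4708,4720⟩,⟨1696,1701,4798,4811⟩,2725,1693,1698,1693,1698,1693,1698⟩]⟩] 2346670 2327233 = true := by decide +kernel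

set_option maxHeartbeats 0 in
theorem certI18 : tile CI.a1 cA [⟨2365032,⟨901,914,1819,1872⟩,[⟨903,910,1833,1858⟩,⟨902,909,1834,1860⟩,⟨901,908,1836,1862⟩,⟨898,905,1839,1865⟩,⟨893,900,1847,1873⟩,⟨885,892,1864,1892⟩,⟨871,881,1907,1939⟩,⟨856,866,2038,2083⟩,⟨845,854,2282,2352⟩],
  [⟨2349917,⟨1697,1702,4718,4743⟩,⟨1695,1701,4790,4816⟩,2725,1692,1698,1692,1698,1692,1698⟩,
  ⟨2353324,⟨1696,1702,4721,4747⟩,⟨1695,1701,4795,4822⟩,2725,1691,1698,1692,1698,1692,1698⟩,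
  ⟨2356540,⟨1695,1701,4724,4749⟩,⟨1694,1700,4802,4828⟩,2718,1691,1697,1691,1697,1691,1697⟩,
  ⟨2359577,⟨1695,1701,4727,4751⟩,⟨1693,1699,4809,4834⟩,2717,1690,1696,1691,1696,1691,1696⟩,
  ⟨2362444,⟨1694,1700,4730,4753⟩,⟨1693,1699,4815,4839⟩,2717,1690,1696,1690,1696,1690,1696⟩,
  ⟨2365032,⟨1694,1700,4734,4755⟩,⟨1692,1698,4821,4844⟩,2716,1689,1695,1690,1695,1690,1695⟩]⟩] 2365032 2346670 = true := by decide +kernel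

set_option maxHeartbeats 0 in
theorem certI19 : tile CI.a1 cA [⟨2382378,⟨899,912,1817,1868⟩,[⟨902,908,1830,1854⟩,⟨901,907,1831,1855⟩,⟨899,905,1833,1858⟩,⟨896,902,1837,1862⟩,⟨891,897,1846,1871⟩,⟨881,889,1866,1892⟩,⟨867,876,1920,1952⟩,⟨852,861,2085,2132⟩,⟨843,851,2335,2407⟩],
  [⟨2367954,⟨1693,1699,4744,4768⟩,⟨1692,1698,4824,4849⟩,2716,1689,1694,1689,1695,1689,1695⟩,
  ⟨2370713,⟨1693,1698,4747,4770⟩,⟨1691,1697,4830,4854⟩,2715,1688,1694,1689,1694,1689,1694⟩,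
  ⟨2373607,⟨1692,1698,4750,4773⟩,⟨1691,1696,4834,4859⟩,2715,1688,1693,1688,1693,1688,1693⟩,
  ⟨2376340,⟨1692,1697,4752,4775⟩,⟨1690,1696,4840,4864⟩,2714,1687,1693,1688,1693,1688,1693⟩,
  ⟨2378920,⟨1691,1697,4755,4777⟩,⟨1690,1695,4846,4869⟩,2714,1687,1692,1687,1692,1687,1692⟩,
  ⟨2381627,⟨1691,1696,4757,4779⟩,⟨1689,1695,4851,4874⟩,2713,1686,1692,1687,1692,1687,1692⟩,
  ⟨2382378,⟨1691,1696,4764,4775⟩,⟨1689,1694,4865,4876⟩,2713,1686,1691,1687,1691,1687,1691⟩]⟩] 2382378 2365032 = true := by decide +kernel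

set_option maxHeartbeats 0 in
theorem certI20 : tile CI.a1 cA [⟨2400585,⟨898,911,1813,1865⟩,[⟨900,907,1827,1852⟩,⟨899,906,1828,1853⟩,⟨897,904,1830,1855⟩,⟨894,900,1834,1859⟩,⟨888,895,1844,1869⟩,⟨878,886,1867,1894⟩,⟨863,873,1933,1966⟩,⟨848,857,2134,2187⟩],
  [⟨2384744,⟨1690,1695,4787,4807⟩,⟨1689,1694,4859,4880⟩,2713,1686,1691,1686,1691,1686,1691⟩,
  ⟨2387226,⟨1689,1695,4789,4810⟩,⟨1688,1693,4863,4885⟩,2712,1685,1690,1686,1691,1686,1691⟩,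
  ⟨2389829,⟨1689,1694,4791,4813⟩,⟨1688,1693,4867,4889⟩,2712,1685,1690,1685,1690,1685,1690⟩,
  ⟨2392286,⟨1689,1694,4794,4815⟩,⟨1687,1692,4872,4894⟩,2711,1685,1689,1685,1690,1685,1690⟩,
  ⟨2394605,⟨1688,1693,4797,4817⟩,⟨1687,1692,4877,4899⟩,2711,1684,1689,1684,1689,1684,1689⟩,
  ⟨2397038,⟨1688,1693,4798,4819⟩,⟨1686,1691,4881,4903⟩,2710,1684,1688,1684,1689,1684,1689⟩,
  ⟨2399333,⟨1687,1692,4801,4821⟩,⟨1686,1691,4887,4908⟩,2710,1683,1688,1683,1688,1683,1688⟩,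
  ⟨2400585,⟨1687,1692,4806,4819⟩,⟨1686,1690,4896,4911⟩,2710,1683,1687,1683,1687,1683,1687⟩]⟩] 2400585 2382378 = true := by decide +kernel

set_option maxHeartbeats 0 in
theorem certI21 : tile CI.a1 cA [⟨2411724,⟨897,908,1815,1858⟩,[⟨900,904,1828,1845⟩,⟨898,903,1829,1846⟩,⟨897,901,1832,1849⟩,⟨893,897,1837,1854⟩,⟨886,891,1849,1865⟩,⟨875,881,1878,1897⟩,⟨859,867,1970,1995⟩,⟨844,851,2242,2287⟩],
  [⟨2402714,⟨1686,1691,4861,4881⟩,⟨1685,1690,4894,4914⟩,2709,1683,1687,1683,1687,1683,1687⟩,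
  ⟨2404947,⟨1685,1690,4863,4883⟩,⟨1685,1690,4897,4918⟩,2709,1682,1687,1682,1687,1682,1687⟩,
  ⟨2407053,⟨1685,1690,4865,4885⟩,⟨1685,1689,4902,4922⟩,2709,1682,1686,1682,1686,1682,1686⟩,
  ⟨2409262,⟨1685,1689,4867,4887⟩,⟨1684,1689,4906,4927⟩,2708,1682,1686,1682,1686,1682,1686⟩,
  ⟨2411347,⟨1684,1689,4870,4889⟩,⟨1684,1688,4911,4931⟩,2708,1681,1686,1681,1686,1681,1686⟩,
  ⟨2411724,⟨1685,1688,4876,4885⟩,⟨1684,1688,4923,4932⟩,2708,1681,1685,1681,1685,1681,1685⟩]⟩] 2411724 2400585 = true := by decide +kernel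

set_option maxHeartbeats 0 in
theorem certB0 : tile CB.a1 cB [⟨2428500,⟨895,908,1810,1859⟩,[⟨898,904,1823,1846⟩,⟨896,902,1824,1847⟩,⟨894,900,1827,1849⟩,⟨890,897,1831,1854⟩,⟨884,891,1843,1867⟩,⟨872,881,1873,1899⟩,⟨856,866,1969,2004⟩,⟨842,850,2247,2306⟩],839,846⟩,
  ⟨2450240,⟨892,906,1804,1858⟩,[⟨895,902,1817,1845⟩,⟨894,901,1818,1846⟩,⟨891,899,1821,1849⟩,⟨887,895,1826,1854⟩,⟨880,889,1838,1868⟩,⟨868,879,1872,1904⟩,⟨853,863,1982,2027⟩,⟨839,847,2280,2357⟩],837,845⟩,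
  ⟨2473060,⟨890,904,1800,1855⟩,[⟨893,900,1813,1842⟩,⟨891,899,1815,1843⟩,⟨889,897,1817,1846⟩,⟨884,893,1823,1852⟩,⟨877,886,1837,1867⟩,⟨864,875,1878,1912⟩,⟨848,857,2021,2071⟩,⟨836,844,2354,2442⟩],836,843⟩,
  ⟨2502634,⟨886,903,1793,1854⟩,[⟨889,899,1806,1841⟩,⟨888,898,1807,1842⟩,⟨885,895,1810,1846⟩,⟨880,891,1816,1852⟩,⟨872,884,1832,1870⟩,⟨859,872,1880,1923⟩,⟨843,853,2057,2124⟩],833,842⟩] 2502634 2411724 = true := by decide +kernel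

set_option maxHeartbeats 0 in
theorem certB1 : tile CB.a1 cB [⟨2540961,⟨881,901,1782,1853⟩,[⟨884,897,1797,1840⟩,⟨883,895,1798,1841⟩,⟨880,893,1801,1845⟩,⟨875,889,1808,1853⟩,⟨867,881,1827,1874⟩,⟨853,867,1886,1942⟩,⟨837,848,2111,2204⟩],829,840⟩,
  ⟨2581193,⟨877,897,1774,1847⟩,[⟨880,894,1790,1833⟩,⟨879,892,1792,1835⟩,⟨876,889,1796,1840⟩,⟨870,884,1804,1849⟩,⟨861,875,1828,1877⟩,⟨846,859,1914,1977⟩,⟨830,840,2240,2358⟩],825,837⟩,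
  ⟨2623425,⟨873,894,1768,1841⟩,[⟨876,890,1782,1827⟩,⟨874,889,1785,1829⟩,⟨871,886,1790,1834⟩,⟨866,880,1800,1846⟩,⟨856,870,1830,1882⟩,⟨839,851,1954,2026⟩,⟨822,834,2360,2501⟩],822,834⟩,
  ⟨2684238,⟨867,892,1754,1841⟩,[⟨870,888,1766,1827⟩,⟨868,887,1768,1829⟩,⟨865,884,1772,1835⟩,⟨860,879,1784,1848⟩,⟨850,867,1817,1887⟩,⟨833,848,1953,2054⟩],814,832⟩] 2684238 2502634 = true := by decide +kernel

set_option maxHeartbeats 0 in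
theorem certB2 : tile CB.a1 cB [⟨2771808,⟨859,889,1736,1841⟩,[⟨861,886,1747,1827⟩,⟨860,884,1749,1830⟩,⟨857,881,1754,1836⟩,⟨851,875,1765,1851⟩,⟨841,862,1805,1902⟩,⟨820,841,1990,2146⟩],804,829⟩,
  ⟨2838821,⟨856,881,1735,1817⟩,[⟨858,877,1746,1804⟩,⟨856,875,1749,1807⟩,⟨853,871,1755,1816⟩,⟨845,862,1775,1841⟩,⟨830,845,1863,1947⟩,⟨803,823,2332,2527⟩],802,822⟩,
  ⟨2946041,⟨846,879,1708,1821⟩,[⟨848,875,1723,1808⟩,⟨847,873,1726,1811⟩,⟨843,868,1733,1821⟩,⟨835,859,1755,1852⟩,⟨815,840,1860,1993⟩],794,820⟩,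
  ⟨3100437,⟨835,874,1682,1820⟩,[⟨837,870,1693,1806⟩,⟨835,868,1696,1810⟩,⟨832,863,1703,1822⟩,⟨821,853,1730,1858⟩,⟨801,833,1862,2056⟩],784,816⟩] 3100437 2684238 = true := by decide +kernel

set_option maxHeartbeats 0 in
theorem certB3 : tile CB.a1 cB [⟨3206774,⟨832,859,1685,1784⟩,[⟨834,855,1696,1770⟩,⟨832,852,1700,1776⟩,⟨825,846,1715,1792⟩,⟨807,831,1783,1881⟩],783,806⟩,
  ⟨3344586,⟨820,853,1668,1778⟩,[⟨823,850,1678,1764⟩,⟨820,847,1683,1771⟩,⟨812,840,1699,1793⟩,⟨796,824,1793,1920⟩],774,797⟩,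
  ⟨3461766,⟨815,844,1663,1754⟩,[⟨817,840,1674,1741⟩,⟨814,837,1680,1750⟩,⟨805,828,1705,1784⟩,⟨785,808,1909,2045⟩],768,784⟩,
  ⟨3561404,⟨810,836,1657,1736⟩,[⟨813,832,1670,1725⟩,⟨809,829,1677,1734⟩,⟨799,819,1713,1780⟩,⟨776,793,2107,2266⟩],761,777⟩] 3561404 3100437 = true := by decide +kernel

set_option maxHeartbeats 0 in
theorem certB4 : tile CB.a1 cB [⟨3677621,⟨804,831,1642,1729⟩,[⟨806,828,1658,1719⟩,⟨803,825,1667,1728⟩,⟨792,814,1710,1785⟩,⟨769,785,2268,2494⟩],755,774⟩,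
  ⟨3813175,⟨798,827,1630,1723⟩,[⟨800,824,1642,1712⟩,⟨796,820,1653,1722⟩,⟨786,809,1706,1789⟩],756,777⟩,
  ⟨3879731,⟨798,818,1637,1697⟩,[⟨800,814,1651,1685⟩,⟨796,810,1666,1699⟩,⟨782,794,1760,1807⟩],744,762⟩] 3879731 3561404 = true := by decide +kernel

set_option maxHeartbeats 0 in
theorem certF0 : tile FII.a1 cF [⟨2428500,2078878,2101,2112,3392⟩,
  ⟨2450240,2100012,2094,2109,3389⟩,
  ⟨2473060,2127311,2088,2104,3384⟩,
  ⟨2497014,2155859,2083,2099,3379⟩,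
  ⟨2522158,2185710,2077,2094,3374⟩,
  ⟨2545912,2216920,2072,2088,3352⟩,
  ⟨2570846,2246290,2067,2083,3347⟩,
  ⟨2597018,2277002,2062,2077,3342⟩,
  ⟨2624491,2309114,2056,2071,3336⟩,
  ⟨2653329,2342687,2051,2066,3331⟩] 2653329 2411724 = true := by decide +kernel

set_option maxHeartbeats 0 in
theorem certF1 : tile FII.a1 cF [⟨2680572,2377783,2046,2059,3328⟩,
  ⟨2709169,2410805,2039,2054,3328⟩,
  ⟨2736185,2445332,2034,2048,3328⟩,
  ⟨2764543,2477826,2027,2043,3323⟩,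
  ⟨2791333,2511808,2022,2038,3318⟩,
  ⟨2816642,2543793,2018,2033,3313⟩,
  ⟨2843209,2573909,2013,2029,3309⟩,
  ⟨2868308,2605419,2009,2024,3289⟩,
  ⟨2892019,2635092,2006,2019,3286⟩,
  ⟨2916908,2663040,2002,2015,3282⟩] 2916908 2653329 = true := by decide +kernel

set_option maxHeartbeats 0 in
theorem certF2 : tile FII.a1 cF [⟨2940421,2692292,1998,2010,3278⟩,
  ⟨2965102,2719849,1995,2006,3275⟩,
  ⟨2988419,2748694,1991,2002,3271⟩,
  ⟨3010447,2775870,1988,1998,3268⟩,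
  ⟨3033569,2801480,1985,1995,3265⟩,
  ⟨3055412,2828295,1982,1991,3264⟩,
  ⟨3076047,2853565,1978,1987,3264⟩,
  ⟨3097707,2877385,1974,1984,3264⟩,
  ⟨3118169,2902332,1971,1981,3261⟩,
  ⟨3137500,2925848,1968,1978,3258⟩] 3137500 2916908 = true := by decide +kernel

set_option maxHeartbeats 0 in
theorem certF3 : tile FII.a1 cF [⟨3157791,2948020,1965,1975,3255⟩,
  ⟨3176960,2971247,1962,1972,3252⟩,
  ⟨3195068,2993148,1959,1969,3249⟩,
  ⟨3212174,3013798,1956,1967,3247⟩,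
  ⟨3230129,3033274,1953,1965,3245⟩,
  ⟨3247091,3053682,1951,1962,3242⟩,
  ⟨3263114,3072930,1949,1960,3229⟩,
  ⟨3279932,3091085,1947,1958,3227⟩,
  ⟨3295819,3110112,1945,1956,3225⟩,
  ⟨3310828,3128059,1944,1954,3224⟩] 3310828 3137500 = true := by decide +kernel

set_option maxHeartbeats 0 in
theorem certF4 : tile FII.a1 cF [⟨3326582,3144992,1942,1952,3222⟩,
  ⟨3341464,3162741,1940,1949,3220⟩,
  ⟨3357085,3179485,1938,1947,3218⟩,
  ⟨3371841,3197037,1936,1945,3216⟩,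
  ⟨3385781,3213597,1935,1943,3215⟩,
  ⟨3400413,3229221,1933,1941,3213⟩,
  ⟨3414235,3245602,1932,1939,3212⟩,
  ⟨3428743,3261058,1930,1937,3210⟩,
  ⟨3442448,3277262,1929,1936,3209⟩,
  ⟨3455394,3292553,1927,1934,3207⟩] 3455394 3310828 = true := by decide +kernel

set_option maxHeartbeats 0 in
theorem certF5 : tile FII.a1 cF [⟨3468982,3306980,1926,1932,3206⟩,
  ⟨3481818,3322108,1925,1930,3205⟩,
  ⟨3495291,3336384,1923,1929,3203⟩,
  ⟨3508018,3351352,1922,1927,3202⟩,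
  ⟨3520040,3365478,1921,1926,3201⟩,
  ⟨3532658,3378809,1920,1924,3200⟩,
  ⟨3544577,3392787,1918,1923,3200⟩,
  ⟨3555836,3405979,1917,1921,3200⟩,
  ⟨3567653,3418430,1915,1920,3200⟩,
  ⟨3578815,3431487,1913,1919,3199⟩] 3578815 3455394 = true := by decide +kernel

set_option maxHeartbeats 0 in
theorem certF6 : tile FII.a1 cF [⟨3589359,3443810,1912,1917,3197⟩,
  ⟨3600426,3455441,1911,1916,3196⟩,
  ⟨3610880,3467640,1909,1915,3195⟩,
  ⟨3620754,3479154,1908,1914,3194⟩,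
  ⟨3631118,3490022,1907,1913,3193⟩,
  ⟨3640908,3501421,1905,1911,3191⟩,
  ⟨3650156,3512181,1904,1910,3190⟩,
  ⟨3658891,3522339,1903,1909,3189⟩,
  ⟨3668060,3531927,1902,1908,3188⟩,
  ⟨3676720,3541985,1901,1908,3188⟩] 3676720 3578815 = true := by decide +kernel

set_option maxHeartbeats 0 in
theorem certF7 : tile FII.a1 cF [⟨3684901,3551480,1900,1907,3187⟩,
  ⟨3693487,3560444,1899,1906,3186⟩,
  ⟨3701596,3569847,1898,1905,3185⟩,
  ⟨3709255,3578722,1897,1904,3184⟩,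
  ⟨3717293,3587101,1896,1903,3183⟩,
  ⟨3724885,3595889,1895,1902,3182⟩,
  ⟨3732056,3604186,1894,1902,3182⟩,
  ⟨3739581,3612019,1893,1901,3181⟩,
  ⟨3746689,3620234,1892,1900,3180⟩,
  ⟨3753403,3627991,1892,1899,3179⟩] 3753403 3676720 = true := by decide +kernel

set_option maxHeartbeats 0 in
theorem certF8 : tile FII.a1 cF [⟨3760450,3635314,1891,1899,3179⟩,
  ⟨3767106,3642998,1890,1898,3178⟩,
  ⟨3773392,3650252,1889,1897,3177⟩,
  ⟨3779989,3657099,1889,1897,3177⟩,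
  ⟨3786220,3664283,1888,1896,3168⟩,
  ⟨3792105,3671066,1887,1896,3167⟩,
  ⟨3798281,3677469,1887,1895,3167⟩,
  ⟨3804113,3684187,1886,1894,3166⟩,
  ⟨3810233,3690528,1886,1894,3166⟩,
  ⟨3816013,3697179,1885,1893,3165⟩] 3816013 3753403 = true := by decide +kernel

set_option maxHeartbeats 0 in
theorem certF9 : tile FII.a1 cF [⟨3821472,3703459,1885,1893,3165⟩,
  ⟨3827201,3709388,1884,1892,3164⟩,
  ⟨3832611,3715609,1884,1892,3164⟩,
  ⟨3838289,3721480,1883,1891,3163⟩,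
  ⟨3843651,3727641,1883,1891,3163⟩,
  ⟨3849278,3733457,1882,1890,3162⟩,
  ⟨3854591,3739559,1882,1890,3162⟩,
  ⟨3859609,3745318,1881,1889,3161⟩,
  ⟨3864874,3750755,1881,1889,3161⟩,
  ⟨3869846,3756459,1880,1888,3160⟩] 3869846 3816013 = true := by decide +kernel

set_option maxHeartbeats 0 in
theorem certF10 : tile FII.a1 cF [⟨3875064,3761843,1880,1887,3160⟩,
  ⟨3879731,3767492,1879,1887,3159⟩] 3879731 3869846 = true := by decide +kernel

theorem cert_I : Cov Concl 1992294 2411724 :=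
  (covA certI0 rfl).tr <| (covA certI1 rfl).tr <| (covA certI2 rfl).tr <| (covA certI3 rfl).tr <| (covA certI4
  rfl).tr <| (covA certI5 rfl).tr <| (covA certI6 rfl).tr <| (covA certI7 rfl).tr <| (covA certI8 rfl).tr <| (covA
  certI9 rfl).tr <| (covA certI10 rfl).tr <| (covA certI11 rfl).tr <| (covA certI12 rfl).tr <| (covA certI13
  rfl).tr <| (covA certI14 rfl).tr <| (covA certI15 rfl).tr <| (covA certI16 rfl).tr <| (covA certI17 rfl).tr <|
  (covA certI18 rfl).tr <| (covA certI19 rfl).tr <| (covA certI20 rfl).tr <| covA certI21 rfl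

theorem cert_B : Cov BarAll 2411724 3879731 :=
  (covB certB0 rfl).tr <| (covB certB1 rfl).tr <| (covB certB2 rfl).tr <| (covB certB3 rfl).tr <| covB certB4 rfl

theorem cert_F : Cov (fun α => BarAll α → Concl α) 2411724 3879731 :=
  (covF certF0 rfl).tr <| (covF certF1 rfl).tr <| (covF certF2 rfl).tr <| (covF certF3 rfl).tr <| (covF certF4
  rfl).tr <| (covF certF5 rfl).tr <| (covF certF6 rfl).tr <| (covF certF7 rfl).tr <| (covF certF8 rfl).tr <| (covF
  certF9 rfl).tr <| covF certF10 rfl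

theorem cert_lo {α : ℝ} (h1 : 1.9 ≤ α) (h2 : α < 3.6999) : Concl α := by
  rcases lt_or_ge (1048576 * α) ((2411724:ℕ):ℝ) with h | h
  · exact cert_I α h1 (by push_cast; linarith) h
  · exact cert_F α h1 h (by push_cast; linarith) (cert_B α h1 h (by push_cast; linarith))

/-- concave functions lie above chords -/
theorem chord {w w' : ℝ → ℝ} {p r t : ℝ} (hc : Continuous w) (hd : ∀ u, p < u → u < r → HasDerivAt w (w' u) u)
    (ha : ∀ u v, p < u → u ≤ v → v < r → w' v ≤ w' u) (h1 : p ≤ t) (h2 : t ≤ r) :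
    w p * (r - t) + w r * (t - p) ≤ w t * (r - p) := by
  rcases h1.eq_or_lt with rfl | h1
  · linarith
  rcases h2.eq_or_lt with rfl | h2
  · linarith
  have e1 := le_sub_of_deriv (w := w) (C := w' t) h1.le hc.continuousOn (fun u h3 h4 => hd u h3 (by linarith))
    (fun u h3 h4 => ha u t h3 h4.le h2)
  have e2 := sub_le_of_deriv (w := w) (C := w' t) h2.le hc.continuousOn (fun u h3 h4 => hd u (by linarith) h4)
    (fun u h3 h4 => ha t u h1 h3.le h4)
  have e3 := mul_le_mul_of_nonneg_right e1 (sub_nonneg.2 h2.le)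
  have e4 := mul_le_mul_of_nonneg_right e2 (sub_nonneg.2 h1.le)
  nlinarith

/-- antiderivative of the exponential of a linear function -/
theorem hasDeriv_expLin (k b d A u : ℝ) (hk : k ≠ 0) :
    HasDerivAt (fun t => A * t - A * (Real.exp (k * (t - b) + d) / k)) (-A * (Real.exp (k * (u - b) + d) - 1)) u := by
  have e1 : HasDerivAt (fun t : ℝ => k * (t - b) + d) k u := by
    simpa using (((hasDerivAt_id u).sub_const b).const_mul k).add_const d
  have e2 : HasDerivAt (fun t : ℝ => A * t) A u := by simpa using (hasDerivAt_id u).const_mul A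
  refine (e2.sub ((e1.exp.div_const k).const_mul A)).congr_deriv ?_
  field_simp
  ring

namespace Traj
variable {α : ℝ} {x : ℝ → ℝ}

theorem conc01 (T : Traj α x) (hα : 0 < α) (hm : ∀ s t, -1 ≤ s → s ≤ t → t ≤ 0 → x s ≤ x t) {t : ℝ}
    (h0 : 0 ≤ t) (h1 : t ≤ 1) : x 1 * t ≤ x t := by
  have := chord T.cont (p := 0) (r := 1) (fun u h _ => T.der u h) (fun u v h2 h3 h4 => by
    have := Real.exp_le_exp.2 (hm (u-1) (v-1) (by linarith) (by linarith) (by linarith))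
    nlinarith) h0 h1
  rw [T.zero] at this
  linarith

theorem M_lo (T : Traj α x) (hα : 0 < α) {c : ℝ} (hc : 0 < c) (h : ∀ t, -1 ≤ t → t ≤ 0 → x t ≤ c * t) :
    α - α * ((1 - Real.exp (-c)) / c) ≤ x 1 := by
  have := sub_le_sub_of_deriv (p := 0) (r := 1) (g := x) (g' := fun t => -α * (Real.exp (x (t-1)) - 1)) (by norm_num)
    (by fun_prop) T.cont.continuousOn
    (fun u _ _ => hasDeriv_expLin c 1 0 α u hc.ne') (fun u hu _ => T.der u hu) (fun u h1 h2 => by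
      have := Real.exp_le_exp.2 (h (u-1) (by linarith) (by linarith))
      simp only [add_zero]
      nlinarith)
  simp only [T.zero, sub_self, mul_zero, add_zero, Real.exp_zero, zero_sub, mul_neg, mul_one] at this
  rw [sub_div]
  linarith

theorem at2 (T : Traj α x) (hα : 0 < α) (hm : ∀ s t, -1 ≤ s → s ≤ t → t ≤ 0 → x s ≤ x t) :
    x 2 ≤ x 1 - α * ((Real.exp (x 1) - 1) / x 1 - 1) := by
  have hM := T.pos01 hα one_pos le_rfl
  have := sub_le_sub_of_deriv (p := 1) (r := 2) (w := x) (w' := fun t => -α * (Real.exp (x (t-1)) - 1)) (by norm_num)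
    T.cont.continuousOn (by fun_prop) (fun u hu _ => T.der u (by linarith))
    (fun u _ _ => hasDeriv_expLin (x 1) 1 0 α u hM.ne') (fun u h1 h2 => by
      have := Real.exp_le_exp.2 (T.conc01 hα hm (t := u - 1) (by linarith) (by linarith))
      simp only [add_zero]
      nlinarith)
  norm_num at this
  have e : x 1 * (2 - 1) = x 1 := by ring
  have e2 : α * (Real.exp (x 1) / x 1) - α * (1 / x 1) = α * ((Real.exp (x 1) - 1) / x 1) := by ring
  simp only [one_div] at e2
  linarith
end Traj

namespace Loop
variable {α : ℝ} {y : ℝ → ℝ} {q L : ℝ}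

theorem fp_lo (T : Loop α y q L) (hα : 0 < α) (hq2 : q ≤ 2) : y 1 ≤ α * (q - 1) * (Real.exp (y (q-1)) - 1) := by
  have hq := T.hq
  have := le_sub_of_deriv (w := y) (C := -α * (Real.exp (y (q-1)) - 1)) hq.le T.cont.continuousOn
    (fun u h1 _ => T.der u (by linarith)) (fun u h1 h2 => by
      have := Real.exp_le_exp.2 (T.mono01 hα (a := u-1) (b := q-1) ⟨by linarith, by linarith⟩ ⟨by linarith, by linarith⟩ (by linarith))
      nlinarith)
  rw [T.xq] at this
  linarith

theorem m_lo (T : Loop α y q L) (hα : 0 < α) (hq2 : q ≤ 2) (hm : ∀ s t, -1 ≤ s → s ≤ t → t ≤ 0 → y s ≤ y t) :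
    y (q+1) ≤ y 1 - α * q * ((Real.exp (y 1) - 1) / y 1 - 1) := by
  have hM := T.pos01 hα one_pos le_rfl
  have hq := T.hq
  have h2 := T.at2 hα hm
  have ha : 0 < q - 1 := by linarith
  have hcv : ∀ t, 1 ≤ t → t ≤ q → -(y 1 / (q-1)) * (t - q) ≤ y t := by
    intro t h1 h2
    have := chord T.cont (p := 1) (r := q) (fun u h _ => T.der u (by linarith)) (fun u v h2 h3 h4 => by
      have := Real.exp_le_exp.2 (T.mono01 hα (a := u-1) (b := v-1) ⟨by linarith, by linarith⟩ ⟨by linarith, by linarith⟩ (by linarith))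
      nlinarith) h1 h2
    rw [T.xq] at this
    rw [show -(y 1 / (q-1)) * (t - q) = y 1 * (q - t) / (q - 1) by ring, div_le_iff₀ ha]
    linarith
  have := sub_le_sub_of_deriv (p := 2) (r := q+1) (w := y) (w' := fun t => -α * (Real.exp (y (t-1)) - 1)) (by linarith)
    T.cont.continuousOn (by fun_prop) (fun u hu _ => T.der u (by linarith))
    (fun u _ _ => hasDeriv_expLin (-(y 1 / (q-1))) (q+1) 0 α u (neg_ne_zero.2 (div_pos hM ha).ne')) (fun u h1 h2 => by
      have := Real.exp_le_exp.2 (hcv (u - 1) (by linarith) (by linarith))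
      rw [show u - 1 - q = u - (q + 1) by ring] at this
      simp only [add_zero]
      nlinarith)
  simp only [add_zero, sub_self, mul_zero, Real.exp_zero] at this
  have e : -(y 1 / (q - 1)) * (2 - (q + 1)) = y 1 := by field_simp; ring
  have e2 : ∀ z : ℝ, z / -(y 1 / (q-1)) = - ((q-1) * (z / y 1)) := by intro z; field_simp
  rw [e, e2, e2] at this
  rw [sub_div] at h2 ⊢
  linarith

/-- a criterion for the return below the line of slope `γ` -/
theorem retC (T : Loop α y q L) (hα : 0 < α) (hq2 : q ≤ 2) {γ : ℝ} (hγ : 0 < γ) (hγα : γ ≤ α * (1 - Real.exp (-γ)))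
    (h2 : y 2 ≤ -γ) (hm : γ * (1 - Real.exp (-γ)) ≤ (-y (q+1) - γ) * (Real.exp (y (q-1)) - 1)) :
    ∀ t, -1 ≤ t → t ≤ 0 → y (L + t) ≤ γ * t := by
  have hq := T.hq
  have hL := T.hL
  have hp : 0 < y (q-1) := T.pos _ (by linarith) (by linarith)
  have hf : 0 < Real.exp (y (q-1)) - 1 := by have := Real.add_one_le_exp (y (q-1)); linarith
  obtain ⟨t0, ⟨h3, h4⟩, h5⟩ := intermediate_value_Icc' (f := y) (a := q) (b := 2) hq2 T.cont.continuousOn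
    (show -γ ∈ Icc (y 2) (y q) from ⟨h2, by rw [T.xq]; linarith⟩)
  -- speed of the descent
  have d1 := sub_le_of_deriv (w := y) (C := -α * (Real.exp (y (q-1)) - 1)) h3 T.cont.continuousOn
    (fun u h1 _ => T.der u (by linarith)) (fun u h1 h2 => by
      have := Real.exp_le_exp.2 (T.mono01 hα (a := q-1) (b := u-1) ⟨by linarith, by linarith⟩ ⟨by linarith, by linarith⟩ (by linarith))
      nlinarith)
  rw [T.xq, h5] at d1
  have d2 := sub_le_of_deriv (w := y) (p := q+1) (r := t0+1) (C := α * (1 - Real.exp (-γ))) (by linarith) T.cont.continuousOn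
    (fun u h1 _ => T.der u (by linarith)) (fun u h1 h2 => by
      have := Real.exp_le_exp.2 (T.anti1 hα (a := u-1) (b := t0) ⟨by linarith, by linarith⟩ ⟨by linarith, by linarith⟩ (by linarith))
      rw [h5] at this
      nlinarith)
  have hv : Real.exp (-γ) < 1 := Real.exp_lt_one_iff.2 (by linarith)
  have h6 : y (t0+1) ≤ -γ := by
    have e1 : (1 - Real.exp (-γ)) * (α * (Real.exp (y (q-1)) - 1) * (t0 - q)) ≤ (1 - Real.exp (-γ)) * γ :=
      mul_le_mul_of_nonneg_left (by linarith) (by linarith)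
    have e2 : (α * (1 - Real.exp (-γ)) * (t0 - q)) * (Real.exp (y (q-1)) - 1) ≤ (-y (q+1) - γ) * (Real.exp (y (q-1)) - 1) := by
      linarith
    have := le_of_mul_le_mul_right e2 hf
    linarith
  have h7 : t0 + 1 < L := T.mark hα (t0 := t0) (by linarith) le_rfl (by linarith)
  have key : y (L-1) ≤ -γ := by
    rcases le_total (L-1) (t0+1) with h | h
    · have := T.le_ends hα (a := t0) (b := t0+1) (t := L-1) h3 (by linarith) h (by linarith)
      rw [h5] at this
      exact this.trans (max_le le_rfl h6)
    · by_contra hcon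
      push Not at hcon
      obtain ⟨r, ⟨r1, r2⟩, r3⟩ := intermediate_value_Icc (f := y) (a := t0+1) (b := L-1) h T.cont.continuousOn
        (show -γ ∈ Icc (y (t0+1)) (y (L-1)) from ⟨h6, hcon.le⟩)
      have r4 : r < L - 1 := lt_of_le_of_ne r2 (by rintro rfl; linarith)
      have := le_sub_of_deriv (w := y) (p := r) (r := r+1) (C := α * (1 - Real.exp (-γ))) (by linarith) T.cont.continuousOn
        (fun u h1 _ => T.der u (by linarith)) (fun u h1 h2 => by
          have g := T.le_ends hα (a := t0) (b := r) (t := u-1) h3 (by linarith) (by linarith) (by linarith)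
          rw [h5, r3, max_self] at g
          have := Real.exp_le_exp.2 g
          nlinarith)
      have := T.negq (r+1) (by linarith) (by linarith)
      linarith
  have := Real.exp_le_exp.2 key
  intro t ht1 ht2
  exact T.lemG hα hγ (by linarith) (by nlinarith) ht1 ht2
end Loop

theorem one_sub_exp_le {c : ℝ} (hc : 0 ≤ c) : (1 - Real.exp (-c)) * (2 + c) ≤ 2 * c := by
  have := le_sub_of_deriv (w := fun u => (2 + u) * Real.exp (-u) + u) (C := 0)
    (w' := fun u => (1 * Real.exp (-u) + (2 + u) * (Real.exp (-u) * (-1))) + 1) hc (by fun_prop)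
    (fun u _ _ => ((((hasDerivAt_id u).const_add 2).mul (hasDerivAt_neg u).exp).add (hasDerivAt_id u)))
    (fun u h1 h2 => by
      have := Real.add_one_le_exp u
      have h3 : Real.exp (-u) * Real.exp u = 1 := by rw [← Real.exp_add]; simp
      have := Real.exp_pos (-u)
      nlinarith)
  norm_num at this
  linarith

theorem exp_cubic {M : ℝ} (hM : 0 ≤ M) : 1 + M + M^2/2 + M^3/6 ≤ Real.exp M := by
  have := Real.sum_le_exp_of_nonneg hM 4
  norm_num [Finset.sum_range_succ, Nat.factorial] at this
  linarith

theorem e369 {α : ℝ} (hα : 3.69 ≤ α) : α * Real.exp (-α) ≤ 3.69 * 0.025 := by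
  have h1 := Real.add_one_le_exp (α - 3.69)
  have h2 : Real.exp (-α) * Real.exp (α - 3.69) = Real.exp (-3.69) := by rw [← Real.exp_add]; congr 1; ring
  have h3 : Real.exp (-3.69) ≤ 0.025 := by
    have e := Real.sum_le_exp_of_nonneg (show (0:ℝ) ≤ 0.69 by norm_num) 6
    norm_num [Finset.sum_range_succ, Nat.factorial] at e
    have e1 := Real.exp_one_gt_d9
    have e2 : Real.exp 3.69 = Real.exp 1 ^ 3 * Real.exp 0.69 := by rw [← Real.exp_nat_mul, ← Real.exp_add]; norm_num
    have e3 : (2.7182818283:ℝ)^3 ≤ Real.exp 1 ^ 3 := by gcongr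
    have : (40:ℝ) ≤ Real.exp 3.69 := by
      rw [e2]
      calc (40:ℝ) ≤ (2.7182818283:ℝ)^3 * 1.993 := by norm_num
        _ ≤ _ := by
          apply mul_le_mul e3 _ (by norm_num) (by positivity)
          norm_num at e ⊢; linarith
    rw [Real.exp_neg]
    calc _ ≤ (40:ℝ)⁻¹ := inv_anti₀ (by norm_num) this
      _ = _ := by norm_num
  have := Real.exp_pos (-α)
  nlinarith

theorem e012 : Real.exp 0.12 ≤ 1.1276 := by
  have e2 := Real.exp_bound' (x := 0.12) (by norm_num) (by norm_num) (n := 4) (by norm_num)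
  norm_num [Finset.sum_range_succ, Nat.factorial] at e2
  norm_num
  linarith

theorem c1_ok {α : ℝ} (hα : 3.69 ≤ α) : α * Real.exp (-(α - 0.12)) ≤ 0.1041 := by
  have h : Real.exp (-(α - 0.12)) = Real.exp (-α) * Real.exp 0.12 := by rw [← Real.exp_add]; congr 1; ring
  rw [h, ← mul_assoc]
  have := e369 hα
  have := e012
  calc _ ≤ (3.69 * 0.025) * (1.1276:ℝ) := by gcongr
    _ ≤ _ := by norm_num

theorem gam_ok {α γ : ℝ} (hα : 3.69 ≤ α) (h0 : 0 < γ) (h1 : γ ≤ α - 0.12) : γ ≤ α * (1 - Real.exp (-γ)) := by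
  have hc := c1_ok hα
  have hp : 0 < α - 0.12 := by linarith
  obtain ⟨_, hs⟩ := convexOn_exp
  have h := hs (mem_univ (-(α - 0.12))) (mem_univ (0:ℝ))
      (show 0 ≤ γ / (α - 0.12) by positivity) (show 0 ≤ 1 - γ / (α - 0.12) by rw [sub_nonneg, div_le_one hp]; exact h1) (by ring)
  simp only [smul_eq_mul, mul_zero, add_zero, Real.exp_zero, mul_one] at h
  rw [show γ / (α - 0.12) * -(α - 0.12) = -γ by field_simp] at h
  have e1 : γ / (α - 0.12) * (α - 0.12) = γ := by field_simp
  have hr : 0 < γ / (α - 0.12) := by positivity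
  set r := γ / (α - 0.12)
  set v := Real.exp (-(α - 0.12))
  have : α * Real.exp (-γ) ≤ α * (r * v + (1 - r)) := mul_le_mul_of_nonneg_left h (by linarith)
  have : r * (α * v) ≤ r * 0.1041 := mul_le_mul_of_nonneg_left hc hr.le
  nlinarith

theorem Lin.mono {α c : ℝ} {y : ℝ → ℝ} (hy : Lin α c y) (hc : 0 < c) : ∀ s t, -1 ≤ s → s ≤ t → t ≤ 0 → y s ≤ y t := by
  intro s t _ h1 h2
  rw [hy.hist s (by linarith), hy.hist t h2]
  nlinarith

theorem loop_le2 {α : ℝ} {y : ℝ → ℝ} (hα : 3.69 ≤ α) (hy : Traj α y)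
    (hm : ∀ s t, -1 ≤ s → s ≤ t → t ≤ 0 → y s ≤ y t) : ∃ q L, Loop α y q L ∧ q ≤ 2 := by
  have hM := hy.pos01 (by linarith) one_pos le_rfl
  have h := hy.at2 (by linarith) hm
  refine hy.exists_loop (by linarith) (by norm_num : (1:ℝ) < 2) (h.trans ?_)
  have e := exp_cubic hM.le
  have : 1 + y 1 / 2 ≤ (Real.exp (y 1) - 1) / y 1 := by
    rw [le_div_iff₀ hM]
    have : 0 ≤ y 1 ^ 3 := by positivity
    linarith
  nlinarith

set_option maxHeartbeats 1000000 in
/-- expansion of slopes -/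
theorem lin_expand {α c : ℝ} (hα : 3.69 ≤ α) (hc : 0 < c) (hcα : 1.01 * c ≤ α - 0.12) :
    ∃ y q L, Loop α y q L ∧ (∀ t, -1 ≤ t → t ≤ 0 → y t = c * t) ∧ q ≤ 2 ∧
      ∀ t, -1 ≤ t → t ≤ 0 → y (L + t) ≤ 1.01 * c * t := by
  have hα0 : 0 < α := by linarith
  obtain ⟨y, hy⟩ := Lin.exists (α := α) hc
  have hm := hy.mono hc
  obtain ⟨q, L, T, hq2⟩ := loop_le2 hα hy.toTraj hm
  have hq := T.hq
  refine ⟨y, q, L, T, fun t _ h => hy.hist t h, hq2, ?_⟩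
  have hM := hy.pos01 hα0 one_pos le_rfl
  have hMc : α * c ≤ y 1 * (2 + c) := by
    have h1 := hy.M_lo hα0 hc (fun t _ h => (hy.hist t h).le)
    have h2 : (1 - Real.exp (-c)) / c ≤ 2 / (2 + c) := by
      rw [div_le_div_iff₀ hc (by linarith)]
      linarith [one_sub_exp_le hc.le]
    have h3 : α * ((1 - Real.exp (-c)) / c) * (2 + c) ≤ α * 2 := by
      calc _ ≤ α * (2 / (2 + c)) * (2 + c) := by gcongr
        _ = _ := by field_simp
    nlinarith
  have h2 := T.at2 hα0 hm
  have hml := T.m_lo hα0 hq2 hm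
  have hfp := T.fp_lo hα0 hq2
  have he := exp_cubic hM.le
  have hp : 0 < y (q-1) := T.pos _ (by linarith) (by linarith)
  have hf : 0 < Real.exp (y (q-1)) - 1 := by have := Real.add_one_le_exp (y (q-1)); linarith
  set M := y 1
  set f := Real.exp (y (q-1)) - 1
  set F := (Real.exp M - 1) / M - 1 with hF
  have hFM : M * F = Real.exp M - 1 - M := by rw [hF]; field_simp
  have hF1 : M / 2 + M^2 / 6 ≤ F := by
    refine le_of_mul_le_mul_left (a := M) ?_ hM
    rw [hFM]
    linarith
  have hw : 0 < 2 + c := by linarith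
  have hα2 : 3.69 * α ≤ α^2 := by nlinarith
  have hα3 : 3.69 * α^2 ≤ α^3 := by nlinarith
  have hca : c ≤ α := by linarith
  -- first criterion
  have g3 : α^3 * c ≤ α^2 * M * (2 + c) := by
    have := mul_le_mul_of_nonneg_left hMc (sq_nonneg α)
    linarith
  have k2 : M + 1.01 * c ≤ α * F := by
    have e1 : 1.01 * (2 + c) ≤ α * (α / 2 - 1) + α^2 * M / 6 := by
      refine le_of_mul_le_mul_right (a := 2 + c) ?_ hw
      have e2 := g3
      have e3 : 0 ≤ c * (α - c) := mul_nonneg hc.le (by linarith)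
      have e4 : 0 ≤ (α^2 / 2 - α + α^3 / 6 - 1.01 * (4 + α)) * c := mul_nonneg (by linarith) hc.le
      linarith
    have e5 : 1.01 * c * α ≤ M * (α * (α / 2 - 1) + α^2 * M / 6) := by
      calc _ = 1.01 * (α * c) := by ring
        _ ≤ 1.01 * (M * (2 + c)) := by gcongr
        _ = M * (1.01 * (2 + c)) := by ring
        _ ≤ _ := mul_le_mul_of_nonneg_left e1 hM.le
    have e6 : 1.01 * c ≤ M * ((α / 2 - 1) + α * M / 6) := by
      refine le_of_mul_le_mul_right (a := α) ?_ hα0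
      linarith
    have e7 : α * (M / 2 + M^2 / 6) ≤ α * F := mul_le_mul_of_nonneg_left hF1 hα0.le
    linarith
  -- second criterion
  have k1 : 1.01 * c * (1 - Real.exp (-(1.01 * c))) ≤ M * F := by
    have e0 : (1 - Real.exp (-(1.01 * c))) * (2 + c) ≤ 2 * (1.01 * c) := by
      have a1 := one_sub_exp_le (c := 1.01 * c) (by linarith)
      have a2 : Real.exp (-(1.01 * c)) < 1 := Real.exp_lt_one_iff.2 (by linarith)
      nlinarith
    have e1 : 2.0402 * (2 + c) ≤ α^2 / 2 + α^2 * M / 6 := by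
      refine le_of_mul_le_mul_right (a := 2 + c) ?_ hw
      have e2 := g3
      have e3 : 0 ≤ c * (α - c) := mul_nonneg hc.le (by linarith)
      have e4 : 0 ≤ (α^2 - 8.1608) * (α - c) := mul_nonneg (by linarith) (by linarith)
      have e5 : 0 ≤ ((α^2 - 8.1608) + α * (α^2 / 2 + α^3 / 6 - 2.0402 * (4 + α))) * c := by
        apply mul_nonneg _ hc.le
        have a1 : -0.51 ≤ α^2 / 2 + α^3 / 6 - 2.0402 * (4 + α) := by linarith
        have a2 := mul_le_mul_of_nonneg_left a1 hα0.le
        linarith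
      have e6 : 0 ≤ α * ((α^2 - 8.1608) + c * (α^2 / 2 + α^3 / 6 - 2.0402 * (4 + α))) := by linarith
      have e7 : 0 ≤ (α^2 - 8.1608) + c * (α^2 / 2 + α^3 / 6 - 2.0402 * (4 + α)) := nonneg_of_mul_nonneg_right e6 hα0
      linarith
    have e5 : (α * c) * (α * c) ≤ (M * (2 + c)) * (M * (2 + c)) := mul_self_le_mul_self (by positivity) hMc
    have e6 : α^2 * (1.01 * c * (1 - Real.exp (-(1.01 * c)))) * (2 + c) ≤ α^2 * (M * F) * (2 + c) := by
      calc _ = α^2 * (1.01 * c) * ((1 - Real.exp (-(1.01 * c))) * (2 + c)) := by ring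
        _ ≤ α^2 * (1.01 * c) * (2 * (1.01 * c)) := by gcongr
        _ = 2.0402 * ((α * c) * (α * c)) := by ring
        _ ≤ 2.0402 * ((M * (2 + c)) * (M * (2 + c))) := by gcongr
        _ = M^2 * (2 + c) * (2.0402 * (2 + c)) := by ring
        _ ≤ M^2 * (2 + c) * (α^2 / 2 + α^2 * M / 6) := by gcongr
        _ = α^2 * (M * (M / 2 + M^2 / 6)) * (2 + c) := by ring
        _ ≤ _ := by gcongr
    exact le_of_mul_le_mul_left (le_of_mul_le_mul_right e6 hw) (by positivity)
  refine T.retC hα0 hq2 (by linarith) (gam_ok hα (by linarith) hcα) (by linarith) ?_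
  have e1 : α * (q - 1) * F ≤ -y (q+1) - 1.01 * c := by linarith
  have hF0 : 0 ≤ F := le_trans (by positivity) hF1
  calc _ ≤ M * F := k1
    _ ≤ (α * (q - 1) * f) * F := by gcongr
    _ = (α * (q - 1) * F) * f := by ring
    _ ≤ _ := by gcongr

theorem bar_c1 {α : ℝ} (hα : 3.69 ≤ α) : Barrier α (α - 0.12) := by
  have h1 : Barrier α ((α - 0.12) / 1.01) := Barrier.small (ε := 0.01) (by linarith) (div_pos (by linarith) (by norm_num))
    (by norm_num) (fun c h1 h2 => by
      obtain ⟨y, q, L, a, b, d, e⟩ := lin_expand hα h1 (by rw [le_div_iff₀ (by norm_num)] at h2; linarith)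
      exact ⟨y, q, L, a, b, d, fun t h3 h4 => (e t h3 h4).trans_eq (by norm_num)⟩)
  have hp : 0 < (α - 0.12) / 1.01 := div_pos (by linarith) (by norm_num)
  obtain ⟨y, q, L, a, b, d, e⟩ := lin_expand hα hp (le_of_eq (by ring))
  exact h1.step (by linarith) hp.le a b d (fun t h3 h4 => (e t h3 h4).trans_eq (by ring))

theorem M_big {α : ℝ} (hα : 3.69 ≤ α) {x : ℝ → ℝ} (T : Traj α x) (h : ∀ t, -1 ≤ t → t ≤ 0 → x t ≤ (α - 0.12) * t) :
    α - 1.034 ≤ x 1 := by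
  have hc : 0 < α - 0.12 := by linarith
  have h1 := T.M_lo (by linarith) hc h
  have h2 : α * ((1 - Real.exp (-(α - 0.12))) / (α - 0.12)) ≤ 1.034 := by
    rw [← mul_div_assoc, div_le_iff₀ hc]
    have := Real.exp_pos (-(α - 0.12))
    nlinarith
  linarith

theorem v_small {α : ℝ} (hα : 3.69 ≤ α) : Real.exp (-α) ≤ 0.025 := by
  have := e369 hα
  have := Real.exp_pos (-α)
  nlinarith

theorem upper_big {α : ℝ} (hα : 3.69 ≤ α) : Upper α (α - 0.12)
    (Real.exp α + 0.9445 * Real.exp (α - 1 + Real.exp (-α)) - 2 * α + 1.034) (α - 1 + Real.exp (-α)) := by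
  intro x q L hx hA hq2
  have hα0 : 0 < α := by linarith
  refine ⟨?_, (Upper.crude hα0 x q L hx hA hq2).2⟩
  have hq := hx.hq
  have hL := hx.hL
  have hml := M_big hα hx.toTraj hA.le
  have hg : ∀ t, 0 ≤ t → t ≤ 1 → x t ≤ α * t - Real.exp (α * (t - 1)) + Real.exp (-α) := by
    intro t h0 h1
    have := sub_le_sub_of_deriv (p := 0) (r := t) (w := x) (w' := fun t => -α * (Real.exp (x (t-1)) - 1)) h0
      hx.cont.continuousOn (by fun_prop) (fun u hu _ => hx.der u hu)
      (fun u _ _ => hasDeriv_expLin α 1 0 α u hα0.ne') (fun u h2 h3 => by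
        have h4 := hA.lip (u-1) 0 (by linarith) (by linarith) le_rfl
        rw [hA.zero] at h4
        have := Real.exp_le_exp.2 (show α * (u - 1) + 0 ≤ x (u-1) by linarith)
        nlinarith)
    simp only [hx.zero, mul_zero, add_zero, zero_sub, mul_neg, mul_one] at this
    have e : ∀ z : ℝ, α * (z / α) = z := by intro z; field_simp
    rw [e, e] at this
    linarith
  have hMu : x 1 ≤ α - 1 + Real.exp (-α) := by
    have := hg 1 (by norm_num) le_rfl
    simp at this
    linarith
  -- first unit interval
  have s1 := sub_le_sub_of_deriv (p := 1) (r := 2) (g := x) (g' := fun t => -α * (Real.exp (x (t-1)) - 1))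
    (w := fun u => α * u + Real.exp (α + Real.exp (-α)) * Real.exp (-Real.exp (α * (u - 2))))
    (w' := fun u => α + Real.exp (α + Real.exp (-α)) * (Real.exp (-Real.exp (α * (u - 2))) * -(Real.exp (α * (u-2)) * α)))
    (by norm_num) (by fun_prop) hx.cont.continuousOn (fun u _ _ => by
      have e1 : HasDerivAt (fun t : ℝ => α * (t - 2)) α u := by
        simpa using ((hasDerivAt_id u).sub_const 2).const_mul α
      have e2 : HasDerivAt (fun t : ℝ => α * t) α u := by simpa using (hasDerivAt_id u).const_mul α
      exact e2.add (e1.exp.neg.exp.const_mul _)) (fun u hu _ => hx.der u (by linarith)) (fun u h1 h2 => by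
      have := Real.exp_le_exp.2 (hg (u-1) (by linarith) (by linarith))
      have e : Real.exp (α + Real.exp (-α)) * (Real.exp (-Real.exp (α * (u - 2))) * -(Real.exp (α * (u-2)) * α))
        = -α * Real.exp (α * (u - 1) - Real.exp (α * (u - 1 - 1)) + Real.exp (-α)) := by
        have e3 : Real.exp (α * (u - 1) - Real.exp (α * (u - 1 - 1)) + Real.exp (-α)) =
            Real.exp (α + Real.exp (-α)) * Real.exp (-Real.exp (α * (u - 2))) * Real.exp (α * (u - 2)) := by
          rw [← Real.exp_add (α + Real.exp (-α)), ← Real.exp_add]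
          congr 1
          rw [show u - 1 - 1 = u - 2 by ring]
          ring
        rw [e3]
        ring
      rw [e]
      nlinarith)
  have c1 : Real.exp (α + Real.exp (-α)) * Real.exp (-1) = Real.exp (α - 1 + Real.exp (-α)) := by
    rw [← Real.exp_add]; congr 1; ring
  have c2 : Real.exp (α + Real.exp (-α)) * Real.exp (-Real.exp (-α)) = Real.exp α := by
    rw [← Real.exp_add]; congr 1; ring
  simp only [sub_self, mul_zero, Real.exp_zero] at s1
  rw [c1, show α * (1 - 2) = -α by ring, c2] at s1
  -- Gaussian tail
  have hM0 : 0 < x 1 := by linarith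
  have hpar : ∀ s, 0 ≤ s → s ≤ 1 → x (1 + s) ≤ x 1 - α * x 1 * s^2 / 2 := by
    intro s h0 h1
    have := sub_le_sub_of_deriv (p := 1) (r := 1 + s) (w := x) (w' := fun t => -α * (Real.exp (x (t-1)) - 1))
      (g := fun t => - (α * x 1 / 2) * (t - 1)^2) (g' := fun t => - (α * x 1 / 2) * (2 * (t - 1))) (by linarith)
      hx.cont.continuousOn (by fun_prop) (fun u hu _ => hx.der u (by linarith))
      (fun u _ _ => by
        have e1 : HasDerivAt (fun t : ℝ => (t - 1)^2) (2 * (u - 1)) u := by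
          simpa using ((hasDerivAt_id u).sub_const 1).fun_pow 2
        exact e1.const_mul _) (fun u h2 h3 => by
        have e1 := hx.conc01 hα0 hA.mono (t := u - 1) (by linarith) (by linarith)
        have e2 := Real.add_one_le_exp (x (u-1))
        have e3 : α * (x 1 * (u - 1)) ≤ α * (Real.exp (x (u-1)) - 1) := mul_le_mul_of_nonneg_left (by linarith) hα0.le
        linarith)
    simp only [add_sub_cancel_left, sub_self] at this
    linarith
  have s2 := sub_le_sub_of_deriv (p := 2) (r := q + 1) (g := x) (g' := fun t => -α * (Real.exp (x (t-1)) - 1))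
    (by linarith) (by fun_prop) hx.cont.continuousOn
    (fun u _ _ => hasDeriv_expLin (-(0.85 * α)) 2 (x 1 + 0.5022) α u (neg_ne_zero.2 (by positivity)))
    (fun u hu _ => hx.der u (by linarith)) (fun u h1 h2 => by
      have e1 := hpar (u - 2) (by linarith) (by linarith)
      rw [show 1 + (u - 2) = u - 1 by ring] at e1
      have e2 : x (u-1) ≤ -(0.85 * α) * (u - 2) + (x 1 + 0.5022) := by
        have e3 : α * (u-2)^2 * α ≤ α * (u-2)^2 * (1.39 * x 1) := mul_le_mul_of_nonneg_left (by linarith) (by positivity)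
        have e4 := sq_nonneg (α * (u - 2) - 0.85 * 1.39)
        nlinarith
      have := Real.exp_le_exp.2 e2
      nlinarith)
  have e0 : -(0.85 * α) * (2 - 2) + (x 1 + 0.5022) = x 1 + 0.5022 := by ring
  have e1 : ∀ z : ℝ, α * (z / -(0.85 * α)) = - (z / 0.85) := by intro z; field_simp
  simp only [e0, e1] at s2
  have e2 : 0 ≤ Real.exp (-(0.85 * α) * (q + 1 - 2) + (x 1 + 0.5022)) / 0.85 := by positivity
  have e3 : Real.exp (x 1 + 0.5022) / 0.85 ≤ 1.9445 * Real.exp (α - 1 + Real.exp (-α)) := by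
    rw [div_le_iff₀ (by norm_num), Real.exp_add]
    have a1 := Real.exp_le_exp.2 hMu
    have a2 : Real.exp 0.5022 ≤ 1.6525 := by
      have e2 := Real.exp_bound' (x := 0.5022) (by norm_num) (by norm_num) (n := 6) (by norm_num)
      norm_num [Finset.sum_range_succ, Nat.factorial] at e2
      norm_num
      linarith
    calc _ ≤ Real.exp (α - 1 + Real.exp (-α)) * 1.6525 := by gcongr
      _ ≤ _ := by have := Real.exp_pos (α - 1 + Real.exp (-α)); nlinarith
  have e4 : 0 ≤ α * (q - 1) := mul_nonneg hα0.le (by linarith)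
  linarith

theorem k_big {α : ℝ} (hα : 3.69 ≤ α) :
    (α - 1 + (Real.exp α + 0.9445 * Real.exp (α - 1 + Real.exp (-α)) - 2 * α + 1.034) + Real.exp (α - 1 + Real.exp (-α)) / 2) *
    (α^2 * Real.exp (-(α - 0.12)) * (1 - Real.exp (-(α - 0.12)))^2 / (2 * (α - 0.12) * (α - 0.3))) < 1 := by
  have hv := v_small hα
  have h1 : Real.exp (α - 1 + Real.exp (-α)) ≤ 0.3774 * Real.exp α := by
    rw [show α - 1 + Real.exp (-α) = α + (-1) + Real.exp (-α) by ring, Real.exp_add, Real.exp_add]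
    have a1 : Real.exp (-1) ≤ 0.36788 := Real.exp_neg_one_lt_d9.le.trans (by norm_num)
    have a2 : Real.exp (Real.exp (-α)) ≤ 1.0257 := by
      have b1 := Real.add_one_le_exp (-Real.exp (-α))
      have b2 : Real.exp (Real.exp (-α)) * Real.exp (-Real.exp (-α)) = 1 := by rw [← Real.exp_add]; simp
      have b3 := Real.exp_pos (Real.exp (-α))
      nlinarith
    calc _ ≤ Real.exp α * 0.36788 * 1.0257 := by gcongr
      _ ≤ _ := by have := Real.exp_pos α; nlinarith
  have hE := Real.exp_pos α
  have h2 : α - 1 + (Real.exp α + 0.9445 * Real.exp (α - 1 + Real.exp (-α)) - 2 * α + 1.034) + Real.exp (α - 1 + Real.exp (-α)) / 2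
      ≤ 1.5452 * Real.exp α := by linarith
  have h3 : Real.exp (-(α - 0.12)) * Real.exp α ≤ 1.1276 := by
    rw [← Real.exp_add]
    convert e012 using 2
    ring
  have hc : 0 < α - 0.12 := by linarith
  have hs : 0 < α - 0.3 := by linarith
  have hw0 := Real.exp_pos (-(α - 0.12))
  have hw1 : Real.exp (-(α - 0.12)) < 1 := Real.exp_lt_one_iff.2 (by linarith)
  set w := Real.exp (-(α - 0.12))
  have h4 : (1 - w)^2 ≤ 1 := by nlinarith
  have h5 : (0:ℝ) ≤ α^2 * w * (1 - w)^2 / (2 * (α - 0.12) * (α - 0.3)) := by positivity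
  calc _ ≤ (1.5452 * Real.exp α) * (α^2 * w * (1 - w)^2 / (2 * (α - 0.12) * (α - 0.3))) := mul_le_mul_of_nonneg_right h2 h5
    _ = (1.5452 * (w * Real.exp α)) * α^2 * (1 - w)^2 / (2 * (α - 0.12) * (α - 0.3)) := by ring
    _ ≤ (1.5452 * 1.1276) * α^2 * 1 / (2 * (α - 0.12) * (α - 0.3)) := by gcongr
    _ < 1 := by
      rw [div_lt_one (by positivity)]
      nlinarith

theorem exp15 : 4.48 ≤ Real.exp 1.5 ∧ Real.exp 1.5 ≤ 4.49 := by
  have e : Real.exp 1.5 = Real.exp 0.5 * Real.exp 0.5 * Real.exp 0.5 := by rw [← Real.exp_add, ← Real.exp_add]; norm_num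
  have e1 := Real.sum_le_exp_of_nonneg (show (0:ℝ) ≤ 0.5 by norm_num) 6
  have e2 := Real.exp_bound' (x := 0.5) (by norm_num) (by norm_num) (n := 6) (by norm_num)
  norm_num [Finset.sum_range_succ, Nat.factorial] at e1 e2
  rw [e]
  have h1 : (1.6486:ℝ) ≤ Real.exp 0.5 := by norm_num at e1 ⊢; linarith
  have h2 : Real.exp 0.5 ≤ (1.649:ℝ) := by norm_num at e2 ⊢; linarith
  constructor
  · calc (4.48:ℝ) ≤ 1.6486 * 1.6486 * 1.6486 := by norm_num
      _ ≤ _ := by gcongr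
  · calc _ ≤ (1.649:ℝ) * 1.649 * 1.649 := by gcongr
      _ ≤ _ := by norm_num

theorem exp1428 : Real.exp (-1.428) ≤ 0.241 := by
  have h4 := Real.add_one_le_exp (-0.072)
  have h5 : Real.exp 1.428 = Real.exp 1.5 * Real.exp (-0.072) := by rw [← Real.exp_add]; norm_num
  have h6 : (4.48:ℝ) * (-0.072 + 1) ≤ Real.exp 1.428 := by
    rw [h5]
    have := exp15.1
    gcongr
  have h7 : Real.exp (-1.428) * Real.exp 1.428 = 1 := by rw [← Real.exp_add]; simp
  by_contra hcon
  push Not at hcon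
  have : (0.241:ℝ) * (4.48 * (-0.072 + 1)) ≤ Real.exp (-1.428) * Real.exp 1.428 := by gcongr
  rw [h7] at this
  norm_num at this

set_option maxHeartbeats 4000000 in
/-- large parameters -/
theorem concl_big {α : ℝ} (hα : 3.69 ≤ α) : Concl α := by
  have hα0 : 0 < α := by linarith
  have hc : 0 < α - 0.12 := by linarith
  have hca := c1_ok hα
  have hv := v_small hα
  have hav := e369 hα
  obtain ⟨y, hy⟩ := Lin.exists (α := α) hc
  have hm := hy.mono hc
  obtain ⟨q, L, T, hq2⟩ := loop_le2 hα hy.toTraj hm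
  have hq := T.hq
  have hL := T.hL
  have hMl := M_big hα hy.toTraj (fun t _ h => (hy.hist t h).le)
  have hMu : y 1 ≤ α := by
    have := T.B_mono hα0 (p := 0) (r := 1) le_rfl (by norm_num)
    have := T.zero
    linarith
  have hM0 : 0 < y 1 := by linarith
  have hM26 : 2.656 ≤ y 1 := by linarith
  -- `F ≥ 7/2`
  have hF : 3.5 ≤ (Real.exp (y 1) - 1) / y 1 - 1 := by
    have h1 := Real.add_one_le_exp (y 1 - 3)
    have h2 : Real.exp (y 1) = Real.exp (y 1 - 3) * Real.exp 1.5 * Real.exp 1.5 := by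
      rw [← Real.exp_add, ← Real.exp_add]; congr 1; ring
    have h3 := exp15.1
    have h4 : (y 1 - 3 + 1) * 4.48 * 4.48 ≤ Real.exp (y 1) := by
      rw [h2]
      have : 0 ≤ y 1 - 3 + 1 := by linarith
      gcongr
    rw [le_sub_iff_add_le, le_div_iff₀ hM0]
    linarith
  have h2 : y 2 ≤ -2.5 * α := by
    have := T.at2 hα0 hm
    have := mul_le_mul_of_nonneg_left hF hα0.le
    linarith
  have hm1 : y (q+1) ≤ -2.5 * α := by
    have h3 := T.m_lo hα0 hq2 hm
    have h4 : α * 1 * 3.5 ≤ α * q * ((Real.exp (y 1) - 1) / y 1 - 1) := by gcongr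
    linarith
  -- bound for `q`
  have hq6 : q ≤ 1.6 := by
    by_contra hcon
    push Not at hcon
    have h0 := T.nonneg (t := 1.6) (by norm_num) hcon.le
    have := sub_le_sub_of_deriv (p := 1) (r := 1.6) (w := y) (w' := fun t => -α * (Real.exp (y (t-1)) - 1)) (by norm_num)
      T.cont.continuousOn (by fun_prop) (fun u hu _ => T.der u (by linarith))
      (fun u _ _ => hasDeriv_expLin (y 1) 1 0 α u hM0.ne') (fun u h1 h2 => by
        have := Real.exp_le_exp.2 (T.conc01 hα0 hm (t := u - 1) (by linarith) (by linarith))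
        simp only [add_zero]
        have := mul_le_mul_of_nonneg_left this hα0.le
        linarith)
    simp only [add_zero, sub_self, mul_zero, Real.exp_zero] at this
    have e1 := exp_cubic (M := y 1 * (1.6 - 1)) (by norm_num; linarith)
    set M := y 1
    have e2 : 0.6 + 0.18 * M + 0.036 * M^2 ≤ Real.exp (M * (1.6 - 1)) / M - 1 / M := by
      rw [← sub_div, le_div_iff₀ hM0]
      linarith
    have e3 : α * (0.6 + 0.18 * M + 0.036 * M^2) ≤ α * (Real.exp (M * (1.6 - 1)) / M - 1 / M) := by gcongr
    have e4 : 3.69 * (0.18 * M + 0.036 * M^2) ≤ α * (0.18 * M + 0.036 * M^2) := by gcongr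
    have e5 := mul_le_mul_of_nonneg_left hM26 hM0.le
    linarith
  -- bound for `p`
  have hp0 : 0 < y (q-1) := T.pos _ (by linarith) (by linarith)
  have hfp : 3.48 ≤ Real.exp (y (q-1)) - 1 := by
    have hd := sub_le_sub_of_deriv (p := 0) (r := q - 1) (w := fun t => -0.759 * y (t + 1))
      (w' := fun t => -0.759 * (-α * (Real.exp (y (t + 1 - 1)) - 1)))
      (g := fun t => Real.exp (y t) - y t)
      (g' := fun t => Real.exp (y t) * (-α * (Real.exp (y (t-1)) - 1)) - (-α * (Real.exp (y (t-1)) - 1))) (by linarith)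
      (by have := T.cont; fun_prop) (by have := T.cont; fun_prop)
      (fun u h1 _ => ((T.der (u+1) (by linarith)).comp_add_const u 1).const_mul _)
      (fun u h1 _ => (T.der u h1).exp.sub (T.der u h1)) (fun u h1 h2 => by
        rw [add_sub_cancel_right, hy.hist (u-1) (by linarith)]
        have a1 : Real.exp ((α - 0.12) * (u - 1)) ≤ 0.241 := (Real.exp_le_exp.2 (by linarith [mul_le_mul (show 3.57 ≤ α - 0.12 by linarith) (show 0.4 ≤ 1 - u by linarith) (by norm_num) hc.le])).trans exp1428
        have a2 := Real.add_one_le_exp (y u)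
        have a3 := T.pos u h1 (by linarith)
        have a4 : 0 ≤ α * (Real.exp (y u) - 1) := mul_nonneg hα0.le (by linarith)
        have := mul_le_mul_of_nonneg_left a1 a4
        linarith)
    simp only [sub_add_cancel, zero_add, T.xq, T.zero, Real.exp_zero] at hd
    have h15 : 1.5 ≤ y (q-1) := by
      by_contra hcon
      push Not at hcon
      set p := y (q-1)
      have a1 := Real.add_one_le_exp (1.5 - p)
      have a2 : Real.exp 1.5 = Real.exp p * Real.exp (1.5 - p) := by rw [← Real.exp_add]; congr 1; ring
      have a3 := Real.add_one_le_exp p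
      have a4 := exp15.2
      have a5 : Real.exp p * (1.5 - p + 1) ≤ Real.exp 1.5 := by rw [a2]; gcongr
      have a6 : 1 * (1.5 - p) ≤ Real.exp p * (1.5 - p) := mul_le_mul_of_nonneg_right (by linarith) (by linarith)
      linarith
    have := Real.exp_le_exp.2 h15
    linarith [exp15.1]
  -- the rise
  have hdesc : ∀ v, q ≤ v → v ≤ 2 → y v ≤ -(α * 3.48) * (v - q) := by
    intro v h3 h4
    have := sub_le_of_deriv (w := y) (C := -α * 3.48) h3 T.cont.continuousOn
      (fun u h1 _ => T.der u (by linarith)) (fun u h1 h2 => by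
        have := Real.exp_le_exp.2 (T.mono01 hα0 (a := q-1) (b := u-1) ⟨by linarith, by linarith⟩ ⟨by linarith, by linarith⟩ (by linarith))
        have := mul_le_mul_of_nonneg_left (hfp.trans (sub_le_sub_right this 1)) hα0.le
        linarith)
    rw [T.xq] at this
    linarith
  have r1 := sub_le_sub_of_deriv (p := q+1) (r := 3) (g := y) (g' := fun t => -α * (Real.exp (y (t-1)) - 1))
    (by linarith) (by fun_prop) T.cont.continuousOn
    (fun u _ _ => hasDeriv_expLin (-(α * 3.48)) (q+1) 0 α u (neg_ne_zero.2 (by positivity)))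
    (fun u hu _ => T.der u (by linarith)) (fun u h1 h2 => by
      have e1 := hdesc (u - 1) (by linarith) (by linarith)
      rw [show u - 1 - q = u - (q + 1) by ring] at e1
      have := Real.exp_le_exp.2 e1
      rw [add_zero]
      have := mul_le_mul_of_nonneg_left this hα0.le
      linarith)
  have e1 : ∀ z : ℝ, α * (z / -(α * 3.48)) = - (z / 3.48) := by intro z; field_simp
  simp only [add_zero, sub_self, mul_zero, Real.exp_zero, e1] at r1
  have e2 : 0 ≤ Real.exp (-(α * 3.48) * (3 - (q + 1))) / 3.48 := by positivity
  have e25 : Real.exp (-2.5 * α) ≤ 0.025 * Real.exp (-α) := by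
    have : Real.exp (-2.5 * α) ≤ Real.exp (-α + -α) := Real.exp_le_exp.2 (by linarith)
    rw [Real.exp_add] at this
    have h := Real.exp_pos (-α)
    have h5 := mul_le_mul_of_nonneg_right hα h.le
    have h6 : Real.exp (-α) ≤ 0.025 := by linarith
    exact this.trans (mul_le_mul_of_nonneg_right h6 h.le)
  have r2 := le_sub_of_deriv (w := y) (p := 3) (r := q+2) (C := α * (1 - 0.025 * Real.exp (-α))) (by linarith) T.cont.continuousOn
    (fun u h1 _ => T.der u (by linarith)) (fun u h1 h2' => by
      have := Real.exp_le_exp.2 ((T.anti1 hα0 (a := 2) (b := u-1) ⟨by linarith, by linarith⟩ ⟨by linarith, by linarith⟩ (by linarith)).trans h2)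
      have := mul_le_mul_of_nonneg_left (this.trans e25) hα0.le
      linarith)
  have e3 : 0 ≤ α * Real.exp (-α) := by positivity
  have hA : α - y (q+2) + y (q+1) ≤ 0.3 := by
    have e4 : α * Real.exp (-α) * (q + 2 - 3) ≤ (3.69 * 0.025) * 1 := by gcongr <;> linarith
    generalize Real.exp (-(α * 3.48) * (3 - (q + 1))) = E at r1 e2
    generalize Real.exp (-α) = F at r2 e4
    linarith
  have hy2 : y (q+2) ≤ -1.5 * α := by
    have := T.B_mono hα0 (p := q+1) (r := q+2) (by linarith) (by linarith)
    linarith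
  have hy3 : y (q+3) ≤ -0.5 * α := by
    have := T.B_mono hα0 (p := q+2) (r := q+3) (by linarith) (by linarith)
    linarith
  have l2 : q + 2 < L := T.mark hα0 hL (by linarith) (by linarith)
  have l3 : q + 3 < L := T.mark hα0 l2 (by linarith) (by linarith)
  have r3 := T.speed hα0 (p := q+2) (r := q+3) (C := -α) le_rfl (by linarith) (by linarith)
    (by rw [show q + 3 - 1 = q + 2 by ring]; linarith)
  have hE := Real.add_one_le_exp (α - 0.12)
  exact regionII (c := α - 0.12) (A := 0.3) (K := 0.7) (s1 := α - 0.3) (by linarith) (bar_c1 hα) T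
    (fun t _ h => hy.hist t h) hc (by linarith) hq2 (by linarith) hA l3 (by linarith)
    (T.retB hα0 l3.le hc (gam_ok hα hc le_rfl)) (upper_big hα) (by linarith) (by linarith) (by norm_num)
    (by linarith) (by linarith) (by linarith) (by linarith) (k_big hα)

theorem wright_unique_SOPS_ge :
    ∀ α : ℝ, 1.9 ≤ α →
      (∃ x : ℝ → ℝ, SOPS α x) ∧
      (∀ x y : ℝ → ℝ, SOPS α x → SOPS α y →
        ∃ τ : ℝ, ∀ t : ℝ, y t = x (t + τ)) := by
  intro α hα
  rcases lt_or_ge α 3.6999 with h | h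
  · exact cert_lo hα h
  · exact concl_big (by linarith)
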